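/- Let p, q, p', q' be positive integers with p ≥ q ≥ 2 and q' < min{2q−1, p}, and let f : D^I_{p,q} → D^I_{p',q'} be a proper holomorphic map. Then p' ≥ p and q' ≥ q, and f is of diagonal type: there exist automorphisms ψ of D^I_{p,q} and Φ of D^I_{p',q'} and a holomorphic map h : D^I_{p,q} → D^I_{p'−p,q'−q} such that f(Z) = Φ(G_h(ψ(Z))) for all Z ∈ D^I_{p,q}. -/

import Mathlib

open Matrix
open scoped ComplexOrder

attribute [local instance] Matrix.normedAddCommGroup Matrix.normedSpace

/-- The type-I irreducible bounded symmetric domain `D^I_{m,n}`,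
realized as the set of complex `m × n` matrices `Z` with `I - Zᴴ Z` positive definite. -/
def typeIDomain (m n : ℕ) : Set (Matrix (Fin m) (Fin n) ℂ) :=
  {Z | (1 - Zᴴ * Z).PosDef}

/-- `f` maps `D` into `D'` and the `f`-preimage of every compact subset of `D'`
is a compact subset of `D`. -/
def ProperOn {E F : Type*} [TopologicalSpace E] [TopologicalSpace F]
    (f : E → F) (D : Set E) (D' : Set F) : Prop :=
  Set.MapsTo f D D' ∧ ∀ K : Set F, K ⊆ D' → IsCompact K → IsCompact (D ∩ f ⁻¹' K)

/-- `Φ` is a (biholomorphic) automorphism of the type-I domain `D^I_{m,n}`. -/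
def IsAutOf {m n : ℕ} (Φ : Matrix (Fin m) (Fin n) ℂ → Matrix (Fin m) (Fin n) ℂ) : Prop :=
  Set.MapsTo Φ (typeIDomain m n) (typeIDomain m n) ∧
  DifferentiableOn ℂ Φ (typeIDomain m n) ∧
  ∃ Ψ, Set.MapsTo Ψ (typeIDomain m n) (typeIDomain m n) ∧
    DifferentiableOn ℂ Ψ (typeIDomain m n) ∧
    (∀ Z ∈ typeIDomain m n, Ψ (Φ Z) = Z) ∧
    (∀ Z ∈ typeIDomain m n, Φ (Ψ Z) = Z)

/-- The block-diagonal matrix `[[Z, 0], [0, W]]`, reindexed to size `p' × q'`. -/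
def diagBlock {p q a b p' q' : ℕ} (hp : p + a = p') (hq : q + b = q')
    (Z : Matrix (Fin p) (Fin q) ℂ) (W : Matrix (Fin a) (Fin b) ℂ) :
    Matrix (Fin p') (Fin q') ℂ :=
  Matrix.reindex (finCongr hp) (finCongr hq)
    (Matrix.reindex finSumFinEquiv finSumFinEquiv (Matrix.fromBlocks Z 0 0 W))


open Topology Filter


theorem id_lemma {E F : Type*} [NormedAddCommGroup E] [NormedSpace ℂ E]
    [NormedAddCommGroup F] [NormedSpace ℂ F] [CompleteSpace F] {D : Set E} (hD : IsOpen D)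
    (hc : Convex ℝ D) {g : E → F} (hg : DifferentiableOn ℂ g D) {z0 : E} (h0 : z0 ∈ D)
    (hz : ∀ᶠ z in 𝓝 z0, g z = 0) : ∀ z ∈ D, g z = 0 := by
  intro z hzD
  let L : ℂ → E := fun t => z0 + t • (z - z0)
  have hL : Continuous L := by fun_prop
  have hLd : Differentiable ℂ L := by fun_prop
  have hSo : IsOpen (L ⁻¹' D) := hD.preimage hL
  have hSc : Convex ℝ (L ⁻¹' D) := by
    intro a ha b hb s t hs ht hst
    have := hc ha hb hs ht hst
    have e : L (s • a + t • b) = s • L a + t • L b := by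
      simp only [L, smul_add, add_smul, smul_assoc]
      have : z0 = s • z0 + t • z0 := by rw [← add_smul, hst, one_smul]
      nth_rewrite 1 [this]; abel
    rw [Set.mem_preimage, e]; exact this
  have hd : DifferentiableOn ℂ (g ∘ L) (L ⁻¹' D) := hg.comp hLd.differentiableOn (fun t ht => ht)
  have h0L : L 0 = z0 := by simp [L]
  have ev : (g ∘ L) =ᶠ[𝓝 0] 0 := by
    have : Tendsto L (𝓝 0) (𝓝 z0) := by rw [← h0L]; exact hL.continuousAt
    exact this.eventually hz
  have := (hd.analyticOnNhd hSo).eqOn_zero_of_preconnected_of_eventuallyEq_zero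
    hSc.isPreconnected (show (0:ℂ) ∈ L ⁻¹' D by simp [h0L, h0]) ev
  have h1 : L 1 = z := by simp [L]
  have h2 := this (show (1:ℂ) ∈ L ⁻¹' D by simp [h1, hzD])
  simpa [h1] using h2

theorem id_eq_lemma {E F : Type*} [NormedAddCommGroup E] [NormedSpace ℂ E]
    [NormedAddCommGroup F] [NormedSpace ℂ F] [CompleteSpace F] {D : Set E} (hD : IsOpen D)
    (hc : Convex ℝ D) {g h : E → F} (hg : DifferentiableOn ℂ g D) (hh : DifferentiableOn ℂ h D)
    {z0 : E} (h0 : z0 ∈ D)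
    (hz : ∀ᶠ z in 𝓝 z0, g z = h z) : ∀ z ∈ D, g z = h z := by
  intro z hzD
  have := id_lemma hD hc (hg.sub hh) h0 (by filter_upwards [hz] with z hz; simp [hz]) z hzD
  simpa [sub_eq_zero] using this

theorem hasDerivAt_line {E F : Type*} [NormedAddCommGroup E] [NormedSpace ℂ E]
    [NormedAddCommGroup F] [NormedSpace ℂ F] {f : E → F} {Z X : E} {t : ℂ}
    (h : DifferentiableAt ℂ f (Z + t • X)) :
    HasDerivAt (fun t : ℂ => f (Z + t • X)) (fderiv ℂ f (Z + t • X) X) t := by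
  have h1 : HasDerivAt (fun t : ℂ => Z + t • X) X t := by
    simpa using ((hasDerivAt_id t).smul_const X).const_add Z
  exact h.hasFDerivAt.comp_hasDerivAt t h1

theorem continuousAt_dirDeriv {E F : Type*} [NormedAddCommGroup E] [NormedSpace ℂ E]
    [NormedAddCommGroup F] [NormedSpace ℂ F] [ProperSpace E] {D : Set E} (hD : IsOpen D)
    {f : E → F} (hf : DifferentiableOn ℂ f D) (X : E) {Z : E} (hZ : Z ∈ D) :
    ContinuousAt (fun Z => fderiv ℂ f Z X) Z := by
  obtain ⟨ε, hε, hb⟩ := Metric.isOpen_iff.1 hD Z hZ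
  set ρ := ε / 2 with hρ
  have hρ0 : 0 < ρ := by positivity
  have hcb : Metric.closedBall Z ρ ⊆ D :=
    (Metric.closedBall_subset_ball (by linarith)).trans hb
  have huc : UniformContinuousOn f (Metric.closedBall Z ρ) :=
    (isCompact_closedBall Z ρ).uniformContinuousOn_of_continuous (hf.continuousOn.mono hcb)
  set r := ρ / 2 / (‖X‖ + 1) with hr
  have hX : 0 < ‖X‖ + 1 := by positivity
  have hr0 : 0 < r := by positivity
  have hrX : r * ‖X‖ ≤ ρ / 2 := by
    rw [hr, div_mul_eq_mul_div, div_le_iff₀ hX]; nlinarith [norm_nonneg X]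
  rw [Metric.continuousAt_iff]
  intro e he
  rw [Metric.uniformContinuousOn_iff] at huc
  obtain ⟨δ, hδ, hu⟩ := huc (e * r / 2) (by positivity)
  refine ⟨min δ (ρ / 2), by positivity, fun {Z'} hZ' => ?_⟩
  have hZ1 : dist Z' Z < δ := lt_of_lt_of_le hZ' (min_le_left _ _)
  have hZ2 : dist Z' Z < ρ / 2 := lt_of_lt_of_le hZ' (min_le_right _ _)
  have memb : ∀ Y, dist Y Z < ρ / 2 → ∀ t : ℂ, ‖t‖ ≤ r → Y + t • X ∈ Metric.closedBall Z ρ := by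
    intro Y hY t ht
    rw [Metric.mem_closedBall, dist_eq_norm]
    have : Y + t • X - Z = (Y - Z) + t • X := by abel
    rw [this]
    have h1 : ‖t • X‖ ≤ r * ‖X‖ := by rw [norm_smul]; gcongr
    rw [dist_eq_norm] at hY
    linarith [norm_add_le (Y - Z) (t • X)]
  have hZZ : dist Z Z < ρ / 2 := by simp; linarith
  let g : ℂ → F := fun t => f (Z' + t • X) - f (Z + t • X)
  have hgd : ∀ t : ℂ, ‖t‖ ≤ r → HasDerivAt g (fderiv ℂ f (Z' + t • X) X - fderiv ℂ f (Z + t • X) X) t := by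
    intro t ht
    exact (hasDerivAt_line (hf.differentiableAt (hD.mem_nhds (hcb (memb Z' hZ2 t ht))))).sub
      (hasDerivAt_line (hf.differentiableAt (hD.mem_nhds (hcb (memb Z hZZ t ht)))))
  have hdc : DiffContOnCl ℂ g (Metric.ball 0 r) := by
    apply DifferentiableOn.diffContOnCl
    rw [closure_ball _ hr0.ne']
    intro t ht
    exact (hgd t (by simpa using ht)).differentiableAt.differentiableWithinAt
  have key := Complex.norm_deriv_le_of_forall_mem_sphere_norm_le (C := e * r / 2) hr0 hdc (by
    intro t ht
    have ht' : ‖t‖ ≤ r := by simp at ht; exact ht.le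
    have := hu _ (memb Z' hZ2 t ht') _ (memb Z hZZ t ht') (by simpa using hZ1)
    rw [dist_eq_norm] at this
    exact this.le)
  have h0 := (hgd 0 (by simpa using hr0.le)).deriv
  rw [h0] at key
  simp only [zero_smul, add_zero] at key
  rw [dist_eq_norm]
  refine lt_of_le_of_lt key ?_
  rw [mul_div_assoc, mul_div_assoc]
  rw [show r / 2 / r = 1/2 by field_simp]; linarith

section mats
variable {E : Type*} [NormedAddCommGroup E] [NormedSpace ℂ E] {m n l : ℕ}

theorem mdiff_iff {f : E → Matrix (Fin m) (Fin n) ℂ} {x : E} :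
    DifferentiableAt ℂ f x ↔ ∀ i j, DifferentiableAt ℂ (fun x => f x i j) x := by
  constructor
  · intro h i j
    have h1 := differentiableAt_pi.1 (show DifferentiableAt ℂ (fun x => (f x : Fin m → Fin n → ℂ)) x from h) i
    exact differentiableAt_pi.1 h1 j
  · intro h
    have : DifferentiableAt ℂ (fun x => (f x : Fin m → Fin n → ℂ)) x :=
      differentiableAt_pi.2 (fun i => differentiableAt_pi.2 (fun j => h i j))
    exact this

theorem mdiff_mul {f : E → Matrix (Fin m) (Fin n) ℂ} {g : E → Matrix (Fin n) (Fin l) ℂ} {x : E}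
    (hf : DifferentiableAt ℂ f x) (hg : DifferentiableAt ℂ g x) :
    DifferentiableAt ℂ (fun x => f x * g x) x := by
  rw [mdiff_iff] at *
  intro i j
  simp only [Matrix.mul_apply]
  exact DifferentiableAt.fun_sum (fun k _ => (hf i k).mul (hg k j))

theorem mdiff_mulVec {f : E → Matrix (Fin m) (Fin n) ℂ} {g : E → (Fin n) → ℂ} {x : E}
    (hf : DifferentiableAt ℂ f x) (hg : DifferentiableAt ℂ g x) :
    DifferentiableAt ℂ (fun x => f x *ᵥ g x) x := by
  rw [mdiff_iff] at *
  rw [differentiableAt_pi] at *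
  intro i
  simp only [Matrix.mulVec, dotProduct]
  exact DifferentiableAt.fun_sum (fun k _ => (hf i k).mul (hg k))

theorem mdiff_det {f : E → Matrix (Fin n) (Fin n) ℂ} {x : E}
    (hf : DifferentiableAt ℂ f x) : DifferentiableAt ℂ (fun x => (f x).det) x := by
  rw [mdiff_iff] at hf
  simp only [Matrix.det_apply']
  refine DifferentiableAt.fun_sum (fun k _ => ?_)
  refine DifferentiableAt.const_mul ?_ _
  have : ∀ s : Finset (Fin n), DifferentiableAt ℂ (fun x => ∏ i ∈ s, f x (k i) i) x := by
    intro s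
    induction s using Finset.induction_on with
    | empty => simp
    | insert a s ha ih =>
      simp only [Finset.prod_insert ha]
      exact (hf _ _).mul ih
  exact this _

theorem mdiff_adj {f : E → Matrix (Fin n) (Fin n) ℂ} {x : E}
    (hf : DifferentiableAt ℂ f x) : DifferentiableAt ℂ (fun x => (f x).adjugate) x := by
  rw [mdiff_iff]
  intro i j
  simp only [Matrix.adjugate_apply]
  apply mdiff_det
  rw [mdiff_iff] at *
  intro a b
  simp only [Matrix.updateRow_apply]
  split_ifs
  · exact differentiableAt_const _
  · exact hf a b

theorem mdiff_inv {f : E → Matrix (Fin n) (Fin n) ℂ} {x : E}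
    (hf : DifferentiableAt ℂ f x) (h : (f x).det ≠ 0) :
    DifferentiableAt ℂ (fun x => (f x)⁻¹) x := by
  simp only [Matrix.inv_def, Ring.inverse_eq_inv']
  exact ((mdiff_det hf).inv h).smul (mdiff_adj hf)

theorem mcont_inv {X : Type*} [TopologicalSpace X] {f : X → Matrix (Fin n) (Fin n) ℂ} {x : X}
    (hf : ContinuousAt f x) (h : (f x).det ≠ 0) :
    ContinuousAt (fun x => (f x)⁻¹) x := by
  simp only [Matrix.inv_def, Ring.inverse_eq_inv']
  have h1 : ContinuousAt (fun x => (f x).det) x := (Continuous.matrix_det continuous_id).continuousAt.comp hf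
  have h2 : ContinuousAt (fun x => (f x).adjugate) x := (Continuous.matrix_adjugate continuous_id).continuousAt.comp hf
  exact (h1.inv₀ h).smul h2

end mats


/-- common kernel of a family of rows -/
def rowKer {ι : Type*} {n : ℕ} (ρ : ι → Fin n → ℂ) : Submodule ℂ (Fin n → ℂ) where
  carrier := {k | ∀ i, ρ i ⬝ᵥ k = 0}
  add_mem' := by intro a b ha hb i; simp [dotProduct_add, ha i, hb i]
  zero_mem' := by intro i; simp
  smul_mem' := by intro c a ha i; simp [dotProduct_smul, ha i]

theorem mem_rowKer {ι : Type*} {n : ℕ} {ρ : ι → Fin n → ℂ} {k : Fin n → ℂ} :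
    k ∈ rowKer ρ ↔ ∀ i, ρ i ⬝ᵥ k = 0 := Iff.rfl

theorem rowKer_of {r n : ℕ} (B : Fin r → Fin n → ℂ) :
    rowKer B = LinearMap.ker (Matrix.of B).mulVecLin := by
  ext k
  rw [mem_rowKer, LinearMap.mem_ker, mulVecLin_apply, funext_iff]
  rfl

theorem finrank_ker_right_inv {r n : ℕ} {B : Fin r → Fin n → ℂ}
    (hB : Function.Surjective (Matrix.of B).mulVec) :
    r + Module.finrank ℂ (rowKer B) = n := by
  have h := LinearMap.finrank_range_add_finrank_ker (Matrix.of B).mulVecLin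
  have hr : LinearMap.range (Matrix.of B).mulVecLin = ⊤ := LinearMap.range_eq_top.2 hB
  rw [hr, finrank_top] at h
  rw [rowKer_of]
  simpa using h

theorem ker_rows {ι : Type*} {n : ℕ} (ρ : ι → Fin n → ℂ) :
    ∃ (r : ℕ) (i : Fin r → ι) (R : Matrix (Fin n) (Fin r) ℂ),
      (Matrix.of fun a => ρ (i a)) * R = 1 ∧ rowKer ρ = rowKer (fun a => ρ (i a)) ∧
      r + Module.finrank ℂ (rowKer ρ) = n := by
  obtain ⟨g, hg, hsp, hli⟩ := Submodule.exists_fun_fin_finrank_span_eq ℂ (Set.range ρ)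
  choose i hi using hg
  have hgi : (fun a => ρ (i a)) = g := funext hi
  have hker : rowKer ρ = rowKer (fun a => ρ (i a)) := by
    apply le_antisymm
    · intro k hk a; exact hk _
    · intro k hk j
      have : ρ j ∈ Submodule.span ℂ (Set.range g) := by
        rw [hsp]; exact Submodule.subset_span ⟨j, rfl⟩
      rw [← hgi] at this
      generalize ρ j = y at this
      induction this using Submodule.span_induction with
      | mem x hx => obtain ⟨a, rfl⟩ := hx; exact hk a
      | zero => simp
      | add x y _ _ hx hy => simp [add_dotProduct, hx, hy]
      | smul c x _ hx => simp [smul_dotProduct, hx]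
  have hrank : (Matrix.of fun a => ρ (i a)).rank = Fintype.card (Fin _) :=
    LinearIndependent.rank_matrix (M := Matrix.of fun a => ρ (i a)) (by
      show LinearIndependent ℂ (fun a => ρ (i a)); rw [hgi]; exact hli)
  have hsurj : Function.Surjective (Matrix.of fun a => ρ (i a)).mulVec := by
    have : LinearMap.range (Matrix.of fun a => ρ (i a)).mulVecLin = ⊤ := by
      apply Submodule.eq_top_of_finrank_eq
      rw [Matrix.rank] at hrank
      rw [hrank]; simp
    exact LinearMap.range_eq_top.1 this
  obtain ⟨R, hR⟩ := mulVec_surjective_iff_exists_right_inverse.1 hsurj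
  refine ⟨_, i, R, hR, hker, ?_⟩
  rw [hker]
  exact finrank_ker_right_inv hsurj

theorem surj_of_det {r n : ℕ} {B : Matrix (Fin r) (Fin n) ℂ} {R : Matrix (Fin n) (Fin r) ℂ}
    (h : (B * R).det ≠ 0) : Function.Surjective B.mulVec := by
  apply mulVec_surjective_iff_exists_right_inverse.2
  refine ⟨R * (B * R)⁻¹, ?_⟩
  rw [← Matrix.mul_assoc, Matrix.mul_nonsing_inv _ (Ne.isUnit h)]

section
variable {X ι : Type*} [TopologicalSpace X] {n : ℕ} {ρ : X → ι → Fin n → ℂ} {x0 : X}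

theorem cont_rows {r : ℕ} {i : Fin r → ι} (hc : ∀ i, ContinuousAt (fun x => ρ x i) x0) :
    ContinuousAt (fun x => (Matrix.of fun a => ρ x (i a) : Matrix (Fin r) (Fin n) ℂ)) x0 := by
  have : ContinuousAt (fun x => (fun a => ρ x (i a))) x0 := continuousAt_pi.2 (fun a => hc _)
  exact this

theorem cont_mulM {a b c : ℕ} {f : X → Matrix (Fin a) (Fin b) ℂ} {g : X → Matrix (Fin b) (Fin c) ℂ}
    (hf : ContinuousAt f x0) (hg : ContinuousAt g x0) : ContinuousAt (fun x => f x * g x) x0 :=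
  ContinuousAt.comp₂ (f := fun p : Matrix (Fin a) (Fin b) ℂ × Matrix (Fin b) (Fin c) ℂ => p.1 * p.2)
    (Continuous.matrix_mul continuous_fst continuous_snd).continuousAt hf hg

theorem cont_mulV {a b : ℕ} {f : X → Matrix (Fin a) (Fin b) ℂ} {g : X → Fin b → ℂ}
    (hf : ContinuousAt f x0) (hg : ContinuousAt g x0) : ContinuousAt (fun x => f x *ᵥ g x) x0 :=
  ContinuousAt.comp₂ (f := fun p : Matrix (Fin a) (Fin b) ℂ × (Fin b → ℂ) => p.1 *ᵥ p.2)
    (Continuous.matrix_mulVec continuous_fst continuous_snd).continuousAt hf hg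

theorem cont_vecM {a b : ℕ} {f : X → Matrix (Fin a) (Fin b) ℂ} {g : X → Fin a → ℂ}
    (hf : ContinuousAt f x0) (hg : ContinuousAt g x0) : ContinuousAt (fun x => g x ᵥ* f x) x0 :=
  ContinuousAt.comp₂ (f := fun p : (Fin a → ℂ) × Matrix (Fin a) (Fin b) ℂ => p.1 ᵥ* p.2)
    (Continuous.matrix_vecMul continuous_fst continuous_snd).continuousAt hg hf

theorem ker_basic (hc : ∀ i, ContinuousAt (fun x => ρ x i) x0) :
    ∃ (r : ℕ) (i : Fin r → ι) (R : Matrix (Fin n) (Fin r) ℂ),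
      (Matrix.of fun a => ρ x0 (i a)) * R = 1 ∧ rowKer (ρ x0) = rowKer (fun a => ρ x0 (i a)) ∧
      r + Module.finrank ℂ (rowKer (ρ x0)) = n ∧
      (∀ᶠ x in 𝓝 x0, ((Matrix.of fun a => ρ x (i a)) * R).det ≠ 0) := by
  obtain ⟨r, i, R, h1, h2, h3⟩ := ker_rows (ρ x0)
  refine ⟨r, i, R, h1, h2, h3, ?_⟩
  have : ContinuousAt (fun x => ((Matrix.of fun a => ρ x (i a)) * R).det) x0 :=
    (Continuous.matrix_det continuous_id).continuousAt.comp
      (cont_mulM (cont_rows hc) continuousAt_const)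
  apply this.eventually_ne
  rw [h1]; simp

/-- upper semicontinuity of the dimension of the common kernel -/
theorem ker_usc (hc : ∀ i, ContinuousAt (fun x => ρ x i) x0) :
    ∀ᶠ x in 𝓝 x0, Module.finrank ℂ (rowKer (ρ x)) ≤ Module.finrank ℂ (rowKer (ρ x0)) := by
  obtain ⟨r, i, R, h1, h2, h3, h4⟩ := ker_basic hc
  filter_upwards [h4] with x hx
  have h5 := finrank_ker_right_inv (surj_of_det hx)
  have h6 : rowKer (ρ x) ≤ rowKer (fun a => ρ x (i a)) := fun k hk a => hk _
  have := Submodule.finrank_mono h6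
  omega

/-- with locally minimal dimension, the kernel is the kernel of a fixed choice of rows. -/
theorem ker_min (hc : ∀ i, ContinuousAt (fun x => ρ x i) x0)
    (hmin : ∀ᶠ x in 𝓝 x0, Module.finrank ℂ (rowKer (ρ x0)) ≤ Module.finrank ℂ (rowKer (ρ x))) :
    ∃ (r : ℕ) (i : Fin r → ι) (R : Matrix (Fin n) (Fin r) ℂ),
      (Matrix.of fun a => ρ x0 (i a)) * R = 1 ∧
      (∀ᶠ x in 𝓝 x0, ((Matrix.of fun a => ρ x (i a)) * R).det ≠ 0 ∧
        rowKer (ρ x) = rowKer (fun a => ρ x (i a))) := by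
  obtain ⟨r, i, R, h1, h2, h3, h4⟩ := ker_basic hc
  refine ⟨r, i, R, h1, ?_⟩
  filter_upwards [h4, hmin] with x hx hm
  refine ⟨hx, ?_⟩
  have h5 := finrank_ker_right_inv (surj_of_det hx)
  have h6 : rowKer (ρ x) ≤ rowKer (fun a => ρ x (i a)) := fun k hk a => hk _
  exact Submodule.eq_of_le_of_finrank_le h6 (by omega)

/-- explicit section -/
noncomputable def secF {r : ℕ} (B : Matrix (Fin r) (Fin n) ℂ) (R : Matrix (Fin n) (Fin r) ℂ)
    (k : Fin n → ℂ) : Fin n → ℂ := k - R *ᵥ ((B * R)⁻¹ *ᵥ (B *ᵥ k))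

theorem secF_mem {r : ℕ} {B : Fin r → Fin n → ℂ} {R : Matrix (Fin n) (Fin r) ℂ}
    {k : Fin n → ℂ} (h : (Matrix.of B * R).det ≠ 0) : secF (Matrix.of B) R k ∈ rowKer B := by
  rw [rowKer_of, LinearMap.mem_ker, mulVecLin_apply, secF, mulVec_sub, mulVec_mulVec,
    mulVec_mulVec, Matrix.mul_nonsing_inv _ (Ne.isUnit h)]
  simp

theorem secF_self {r : ℕ} {B : Fin r → Fin n → ℂ} {R : Matrix (Fin n) (Fin r) ℂ}
    {k : Fin n → ℂ} (hk : k ∈ rowKer B) : secF (Matrix.of B) R k = k := by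
  rw [rowKer_of, LinearMap.mem_ker, mulVecLin_apply] at hk
  simp [secF, hk]

theorem ker_sec (hc : ∀ i, ContinuousAt (fun x => ρ x i) x0)
    (hmin : ∀ᶠ x in 𝓝 x0, Module.finrank ℂ (rowKer (ρ x0)) ≤ Module.finrank ℂ (rowKer (ρ x)))
    {k : Fin n → ℂ} (hk : k ∈ rowKer (ρ x0)) :
    ∃ s : X → Fin n → ℂ, ContinuousAt s x0 ∧ s x0 = k ∧ ∀ᶠ x in 𝓝 x0, s x ∈ rowKer (ρ x) := by
  obtain ⟨r, i, R, h1, h2⟩ := ker_min hc hmin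
  refine ⟨fun x => secF (Matrix.of fun a => ρ x (i a)) R k, ?_, ?_, ?_⟩
  · have hB : ContinuousAt (fun x => (Matrix.of fun a => ρ x (i a) : Matrix (Fin r) (Fin n) ℂ)) x0 :=
      cont_rows hc
    unfold secF
    refine continuousAt_const.sub (cont_mulV continuousAt_const (cont_mulV ?_ (cont_mulV hB continuousAt_const)))
    exact mcont_inv (cont_mulM hB continuousAt_const) (by rw [h1]; simp)
  · apply secF_self
    intro a; exact hk _
  · filter_upwards [h2] with x hx
    rw [hx.2]
    exact secF_mem hx.1

end


/-- the parameter space -/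
abbrev Xpt (p q : ℕ) := Matrix (Fin p) (Fin q) ℂ × (Fin q → ℂ) × (Fin p → ℂ)

section defs
variable {p q p' n : ℕ}

def Kvb (D : Set (Matrix (Fin p) (Fin q) ℂ)) (f : Matrix (Fin p) (Fin q) ℂ → Matrix (Fin p') (Fin n) ℂ)
    (Z : Matrix (Fin p) (Fin q) ℂ) (v : Fin q → ℂ) (b : Fin p → ℂ) : Submodule ℂ (Fin n → ℂ) where
  carrier := {k | ∀ Z' ∈ D, Z' *ᵥ v = Z *ᵥ v → b ᵥ* Z' = b ᵥ* Z → f Z' *ᵥ k = f Z *ᵥ k}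
  add_mem' := by
    intro x y hx hy Z' h1 h2 h3
    simp [mulVec_add, hx Z' h1 h2 h3, hy Z' h1 h2 h3]
  zero_mem' := by intro Z' _ _ _; simp
  smul_mem' := by
    intro c x hx Z' h1 h2 h3
    simp [mulVec_smul, hx Z' h1 h2 h3]

def Ninf (D : Set (Matrix (Fin p) (Fin q) ℂ)) (f : Matrix (Fin p) (Fin q) ℂ → Matrix (Fin p') (Fin n) ℂ)
    (Z : Matrix (Fin p) (Fin q) ℂ) (v : Fin q → ℂ) : Submodule ℂ (Fin n → ℂ) where
  carrier := {k | ∀ Z' ∈ D, Z' *ᵥ v = Z *ᵥ v → f Z' *ᵥ k = f Z *ᵥ k}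
  add_mem' := by
    intro x y hx hy Z' h1 h2
    simp [mulVec_add, hx Z' h1 h2, hy Z' h1 h2]
  zero_mem' := by intro Z' _ _; simp
  smul_mem' := by
    intro c x hx Z' h1 h2
    simp [mulVec_smul, hx Z' h1 h2]

def Kz (f : Matrix (Fin p) (Fin q) ℂ → Matrix (Fin p') (Fin n) ℂ)
    (Z : Matrix (Fin p) (Fin q) ℂ) : Submodule ℂ (Fin n → ℂ) where
  carrier := {k | ∀ X, (fderiv ℂ f Z X) *ᵥ k = 0}
  add_mem' := by
    intro x y hx hy Z'
    simp [mulVec_add, hx Z', hy Z']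
  zero_mem' := by intro Z'; simp
  smul_mem' := by
    intro c x hx Z'
    simp [mulVec_smul, hx Z']

def Nd (f : Matrix (Fin p) (Fin q) ℂ → Matrix (Fin p') (Fin n) ℂ)
    (Z : Matrix (Fin p) (Fin q) ℂ) (v : Fin q → ℂ) : Submodule ℂ (Fin n → ℂ) where
  carrier := {k | ∀ X, X *ᵥ v = 0 → (fderiv ℂ f Z X) *ᵥ k = 0}
  add_mem' := by
    intro x y hx hy Z' h
    simp [mulVec_add, hx Z' h, hy Z' h]
  zero_mem' := by intro Z' _; simp
  smul_mem' := by
    intro c x hx Z' h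
    simp [mulVec_smul, hx Z' h]

end defs

noncomputable def Pv {q : ℕ} (η v : Fin q → ℂ) : Matrix (Fin q) (Fin q) ℂ :=
  1 - (η ⬝ᵥ v)⁻¹ • vecMulVec v η

theorem Pv_mulVec {q : ℕ} {η v : Fin q → ℂ} (h : η ⬝ᵥ v ≠ 0) : Pv η v *ᵥ v = 0 := by
  rw [Pv, sub_mulVec, one_mulVec, smul_mulVec, vecMulVec_mulVec]
  ext i
  simp
  field_simp
  simp

theorem vecMul_Pv {q : ℕ} {x b : Fin q → ℂ} (h : b ⬝ᵥ x ≠ 0) : b ᵥ* Pv b x = 0 := by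
  rw [Pv, vecMul_sub, vecMul_one, vecMul_smul, vecMul_vecMulVec]
  ext i
  simp
  field_simp
  simp

theorem mul_Pv {p q : ℕ} {η v : Fin q → ℂ} {W : Matrix (Fin p) (Fin q) ℂ} (h : W *ᵥ v = 0) :
    W * Pv η v = W := by
  rw [Pv, Matrix.mul_sub, Matrix.mul_one, Matrix.mul_smul, Matrix.mul_vecMulVec, h]
  simp

theorem Pv_mul {p q : ℕ} {x b : Fin p → ℂ} {W : Matrix (Fin p) (Fin q) ℂ} (h : b ᵥ* W = 0) :
    Pv b x * W = W := by
  rw [Pv, Matrix.sub_mul, Matrix.one_mul, Matrix.smul_mul, Matrix.vecMulVec_mul, h]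
  ext i j
  simp [vecMulVec_apply]

theorem cont_Pv {X : Type*} [TopologicalSpace X] {x0 : X} {q : ℕ} {η v : X → Fin q → ℂ}
    (h1 : ContinuousAt η x0) (h2 : ContinuousAt v x0) (h : η x0 ⬝ᵥ v x0 ≠ 0) :
    ContinuousAt (fun x => Pv (η x) (v x)) x0 := by
  unfold Pv
  have hd : ContinuousAt (fun x => η x ⬝ᵥ v x) x0 :=
    ContinuousAt.comp₂ (f := fun p : (Fin q → ℂ) × (Fin q → ℂ) => p.1 ⬝ᵥ p.2)
      (Continuous.dotProduct continuous_fst continuous_snd).continuousAt h1 h2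
  have hv : ContinuousAt (fun x => vecMulVec (v x) (η x)) x0 :=
    ContinuousAt.comp₂ (f := fun p : (Fin q → ℂ) × (Fin q → ℂ) => vecMulVec p.1 p.2)
      (Continuous.matrix_vecMulVec continuous_fst continuous_snd).continuousAt h2 h1
  exact continuousAt_const.sub ((hd.inv₀ h).smul hv)

theorem star_dot_ne {q : ℕ} {v : Fin q → ℂ} (h : v ≠ 0) : star v ⬝ᵥ v ≠ 0 := by
  simpa [dotProduct_star_self_eq_zero, dotProduct_comm] using h

section
variable {p q p' n : ℕ} {D : Set (Matrix (Fin p) (Fin q) ℂ)} (hD : IsOpen D) (hc : Convex ℝ D)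
  {f : Matrix (Fin p) (Fin q) ℂ → Matrix (Fin p') (Fin n) ℂ} (hf : DifferentiableOn ℂ f D)

include hD hc hf in
theorem line_const {Z Z' : Matrix (Fin p) (Fin q) ℂ} (hZ : Z ∈ D) (hZ' : Z' ∈ D) {k : Fin n → ℂ}
    (h : ∀ᶠ t in 𝓝 (0:ℂ), f (Z + t • (Z' - Z)) *ᵥ k = f Z *ᵥ k) : f Z' *ᵥ k = f Z *ᵥ k := by
  let L : ℂ → Matrix (Fin p) (Fin q) ℂ := fun t => Z + t • (Z' - Z)
  have hL : Continuous L := by fun_prop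
  have hLd : Differentiable ℂ L := by fun_prop
  have hSo : IsOpen (L ⁻¹' D) := hD.preimage hL
  have hSc : Convex ℝ (L ⁻¹' D) := by
    intro a ha b hb s t hs ht hst
    have := hc ha hb hs ht hst
    have e : L (s • a + t • b) = s • L a + t • L b := by
      simp only [L, smul_add, add_smul, smul_assoc]
      have : Z = s • Z + t • Z := by rw [← add_smul, hst, one_smul]
      nth_rewrite 1 [this]; abel
    rw [Set.mem_preimage, e]; exact this
  have hd : DifferentiableOn ℂ (fun t => f (L t) *ᵥ k) (L ⁻¹' D) := by
    intro t ht
    have h1 : DifferentiableAt ℂ (fun t => f (L t)) t :=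
      DifferentiableAt.comp t (hf.differentiableAt (hD.mem_nhds ht)) (hLd t)
    exact (mdiff_mulVec h1 (differentiableAt_const k)).differentiableWithinAt
  have := id_eq_lemma hSo hSc hd (differentiableOn_const (f Z *ᵥ k)) (z0 := 0)
    (by simp [L, hZ]) h 1 (by simp [L, hZ'])
  simpa [L] using this

include hD hf in
theorem cont_fderiv {Z : Matrix (Fin p) (Fin q) ℂ} (hZ : Z ∈ D) :
    ContinuousAt (fun Z => fderiv ℂ f Z) Z := by
  have : ContinuousOn (fun Z => fderiv ℂ f Z) D := by
    refine continuousOn_clm_apply.2 ?_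
    intro X Z hZ
    exact (continuousAt_dirDeriv hD hf X hZ).continuousWithinAt
  exact this.continuousAt (hD.mem_nhds hZ)

theorem Kz_rows (Z : Matrix (Fin p) (Fin q) ℂ) :
    Kz f Z = rowKer (fun (a : Matrix (Fin p) (Fin q) ℂ × Fin p') => (fderiv ℂ f Z a.1) a.2) := by
  ext k
  rw [mem_rowKer]
  constructor
  · intro h a
    exact congrFun (h a.1) a.2
  · intro h X
    ext i
    exact h (X, i)

theorem Nd_rows {η : Fin q → ℂ} (Z : Matrix (Fin p) (Fin q) ℂ) {v : Fin q → ℂ} (h : η ⬝ᵥ v ≠ 0) :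
    Nd f Z v = rowKer (fun (a : Matrix (Fin p) (Fin q) ℂ × Fin p') =>
      (fderiv ℂ f Z (a.1 * Pv η v)) a.2) := by
  ext k
  rw [mem_rowKer]
  constructor
  · intro hk a
    exact congrFun (hk (a.1 * Pv η v) (by rw [← mulVec_mulVec, Pv_mulVec h]; simp)) a.2
  · intro hk X hX
    ext i
    have := hk (X, i)
    simp only [mul_Pv hX] at this
    exact this

include hD hf in
theorem Kz_cont {Z : Matrix (Fin p) (Fin q) ℂ} (hZ : Z ∈ D) (a : Matrix (Fin p) (Fin q) ℂ × Fin p') :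
    ContinuousAt (fun Z => (fderiv ℂ f Z a.1) a.2) Z := by
  have := continuousAt_dirDeriv hD hf a.1 hZ
  exact continuousAt_pi.1 (show ContinuousAt (fun Z => (fderiv ℂ f Z a.1 : Fin p' → Fin n → ℂ)) Z from this) a.2

include hD hf in
theorem Nd_cont {η : Fin q → ℂ} {x : Matrix (Fin p) (Fin q) ℂ × (Fin q → ℂ)} (hZ : x.1 ∈ D)
    (h : η ⬝ᵥ x.2 ≠ 0) (a : Matrix (Fin p) (Fin q) ℂ × Fin p') :
    ContinuousAt (fun x : Matrix (Fin p) (Fin q) ℂ × (Fin q → ℂ) =>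
      (fderiv ℂ f x.1 (a.1 * Pv η x.2)) a.2) x := by
  have h1 : ContinuousAt (fun x : Matrix (Fin p) (Fin q) ℂ × (Fin q → ℂ) => fderiv ℂ f x.1) x :=
    ContinuousAt.comp (f := Prod.fst) (cont_fderiv hD hf hZ) continuousAt_fst
  have h2 : ContinuousAt (fun x : Matrix (Fin p) (Fin q) ℂ × (Fin q → ℂ) => a.1 * Pv η x.2) x :=
    cont_mulM continuousAt_const (cont_Pv continuousAt_const continuousAt_snd h)
  have := h1.clm_apply h2
  exact continuousAt_pi.1 (show ContinuousAt (fun x : Matrix (Fin p) (Fin q) ℂ × (Fin q → ℂ) =>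
    (fderiv ℂ f x.1 (a.1 * Pv η x.2) : Fin p' → Fin n → ℂ)) x from this) a.2

include hD hc hf in
theorem Kvb_rows {Z0 : Matrix (Fin p) (Fin q) ℂ} {v0 : Fin q → ℂ} {b0 : Fin p → ℂ}
    (hZ0 : Z0 ∈ D) (hv : v0 ≠ 0) (hb : b0 ≠ 0) :
    ∃ (ι : Type) (ρ : Matrix (Fin p) (Fin q) ℂ × (Fin q → ℂ) × (Fin p → ℂ) → ι → Fin n → ℂ),
      (∀ i, ContinuousAt (fun x => ρ x i) (Z0, v0, b0)) ∧
      (∀ᶠ x in 𝓝 (Z0, v0, b0), rowKer (ρ x) = Kvb D f x.1 x.2.1 x.2.2) ∧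
      (∀ᶠ Z in 𝓝 Z0, ∀ i, DifferentiableAt ℂ (fun Z => ρ (Z, v0, b0) i) Z) := by
  let x0 : Xpt p q := (Z0, v0, b0)
  let G : Xpt p q → Matrix (Fin p) (Fin q) ℂ → Matrix (Fin p) (Fin q) ℂ :=
    fun x W => x.1 + Pv x.2.2 (star b0) * W * Pv (star v0) x.2.1
  have hv0 : star v0 ⬝ᵥ v0 ≠ 0 := star_dot_ne hv
  have hb0 : b0 ⬝ᵥ star b0 ≠ 0 := by rw [dotProduct_comm]; exact star_dot_ne hb
  have hPv : ContinuousAt (fun x : Xpt p q => Pv (star v0) x.2.1) x0 :=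
    cont_Pv continuousAt_const (by fun_prop) hv0
  have hPb : ContinuousAt (fun x : Xpt p q => Pv x.2.2 (star b0)) x0 :=
    cont_Pv (by fun_prop) continuousAt_const hb0
  have hGx : ∀ W, ContinuousAt (fun x => G x W) x0 := fun W =>
    ContinuousAt.add (by fun_prop) (cont_mulM (cont_mulM hPb continuousAt_const) hPv)
  have hGj : ContinuousAt (fun y : Xpt p q × Matrix (Fin p) (Fin q) ℂ => G y.1 y.2) (x0, 0) := by
    have e1 : ContinuousAt (Prod.fst : Xpt p q × Matrix (Fin p) (Fin q) ℂ → Xpt p q) (x0, 0) := continuousAt_fst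
    refine ContinuousAt.add (by fun_prop) (cont_mulM (cont_mulM ?_ continuousAt_snd) ?_)
    · exact ContinuousAt.comp (f := (Prod.fst : Xpt p q × Matrix (Fin p) (Fin q) ℂ → Xpt p q)) (x := (x0, 0)) hPb e1
    · exact ContinuousAt.comp (f := (Prod.fst : Xpt p q × Matrix (Fin p) (Fin q) ℂ → Xpt p q)) (x := (x0, 0)) hPv e1
  have hev : ∀ᶠ y in 𝓝 (x0, (0 : Matrix (Fin p) (Fin q) ℂ)), G y.1 y.2 ∈ D :=
    hGj.eventually (hD.mem_nhds (by simp [G, x0, hZ0]))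
  rw [nhds_prod_eq, eventually_prod_iff] at hev
  obtain ⟨pa, hpa, pb, hpb, hG⟩ := hev
  refine ⟨{W : Matrix (Fin p) (Fin q) ℂ // pb W} × Fin p', fun x a => f (G x a.1.1) a.2 - f x.1 a.2,
    ?_, ?_, ?_⟩
  · rintro ⟨⟨W, hW⟩, i⟩
    have hx0 : pa x0 := hpa.self_of_nhds
    have hfc : ∀ Y ∈ D, ContinuousAt (fun Y => f Y i) Y := fun Y hY => by
      have : ContinuousAt f Y := (hf.differentiableAt (hD.mem_nhds hY)).continuousAt
      exact continuousAt_pi.1 (show ContinuousAt (fun Y => (f Y : Fin p' → Fin n → ℂ)) Y from this) i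
    have h1 : ContinuousAt (fun x : Xpt p q => f (G x W) i) x0 :=
      ContinuousAt.comp (f := fun x : Xpt p q => G x W) (x := x0) (hfc _ (hG hx0 hW)) (hGx W)
    have h2 : ContinuousAt (fun x : Xpt p q => f x.1 i) x0 :=
      ContinuousAt.comp (f := fun x : Xpt p q => x.1) (x := x0) (hfc _ hZ0) (by fun_prop)
    exact h1.sub h2
  · have hvn : ∀ᶠ x : Xpt p q in 𝓝 x0, star v0 ⬝ᵥ x.2.1 ≠ 0 := by
      refine ContinuousAt.eventually_ne (g := fun x : Xpt p q => star v0 ⬝ᵥ x.2.1) ?_ hv0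
      exact (Continuous.dotProduct continuous_const (by fun_prop)).continuousAt
    have hbn : ∀ᶠ x : Xpt p q in 𝓝 x0, x.2.2 ⬝ᵥ star b0 ≠ 0 := by
      refine ContinuousAt.eventually_ne (g := fun x : Xpt p q => x.2.2 ⬝ᵥ star b0) ?_ hb0
      exact (Continuous.dotProduct (by fun_prop) continuous_const).continuousAt
    have hZD : ∀ᶠ x : Xpt p q in 𝓝 x0, x.1 ∈ D :=
      (continuousAt_fst (p := x0)).eventually (hD.mem_nhds hZ0)
    filter_upwards [hpa, hvn, hbn, hZD] with x hx hxv hxb hxD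
    ext k
    rw [mem_rowKer]
    constructor
    · intro h Z' hZ' h1 h2
      apply line_const hD hc hf hxD hZ'
      have : Tendsto (fun t : ℂ => t • (Z' - x.1)) (𝓝 0) (𝓝 0) := by
        have : Continuous (fun t : ℂ => t • (Z' - x.1)) := by fun_prop
        simpa using this.tendsto 0
      filter_upwards [this.eventually hpb] with t ht
      have e : G x (t • (Z' - x.1)) = x.1 + t • (Z' - x.1) := by
        simp only [G]
        rw [Pv_mul (by rw [vecMul_smul, vecMul_sub, h2]; simp),
          mul_Pv (by rw [smul_mulVec, sub_mulVec, h1]; simp)]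
      ext i
      have := h (⟨_, ht⟩, i)
      simp only [e, sub_dotProduct, sub_eq_zero] at this
      exact this
    · rintro h ⟨⟨W, hW⟩, i⟩
      have := h (G x W) (hG hx hW) (by
        simp only [G]; rw [add_mulVec, ← mulVec_mulVec, Pv_mulVec hxv]; simp) (by
        simp only [G]; rw [vecMul_add, Matrix.mul_assoc, ← vecMul_vecMul, vecMul_Pv hxb]; simp)
      rw [sub_dotProduct, sub_eq_zero]
      exact congrFun this i
  · have hx0 : ∀ᶠ Z in 𝓝 Z0, pa (Z, v0, b0) := by
      have : ContinuousAt (fun Z : Matrix (Fin p) (Fin q) ℂ => ((Z, v0, b0) : Xpt p q)) Z0 := by fun_prop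
      exact this.eventually hpa
    filter_upwards [hx0, hD.mem_nhds hZ0] with Z hZ hZD
    rintro ⟨⟨W, hW⟩, i⟩
    have h1 : DifferentiableAt ℂ (fun Z => f (G (Z, v0, b0) W)) Z := by
      have h0 : DifferentiableAt ℂ (fun Z => G (Z, v0, b0) W) Z := by
        simp only [G]; fun_prop
      exact DifferentiableAt.comp (g := f) (f := fun Z => G (Z, v0, b0) W) Z
        (hf.differentiableAt (hD.mem_nhds (hG hZ hW))) h0
    have h2 := h1.sub (hf.differentiableAt (hD.mem_nhds hZD))
    exact differentiableAt_pi.1 (show DifferentiableAt ℂ (fun Z => (f (G (Z, v0, b0) W) - f Z : Fin p' → Fin n → ℂ)) Z from h2) i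

end


theorem hasDerivAt_mulVec {a b : ℕ} {A : ℂ → Matrix (Fin a) (Fin b) ℂ} {s : ℂ → Fin b → ℂ}
    {A' : Matrix (Fin a) (Fin b) ℂ} {s' : Fin b → ℂ} {t : ℂ} (hA : HasDerivAt A A' t)
    (hs : HasDerivAt s s' t) :
    HasDerivAt (fun t => A t *ᵥ s t) (A' *ᵥ s t + A t *ᵥ s') t := by
  have hA' : ∀ i j, HasDerivAt (fun t => A t i j) (A' i j) t := fun i j => by
    have h1 := hasDerivAt_pi.1 (show HasDerivAt (fun t => (A t : Fin a → Fin b → ℂ)) A' t from hA) i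
    exact hasDerivAt_pi.1 h1 j
  rw [hasDerivAt_pi] at *
  intro i
  have : (A' *ᵥ s t + A t *ᵥ s') i = ∑ j, (A' i j * s t j + A t i j * s' j) := by
    simp [mulVec, dotProduct, Finset.sum_add_distrib]
  rw [this]
  exact HasDerivAt.fun_sum (u := Finset.univ) (fun j _ => (hA' i j).fun_mul (hs j))

section
variable {p q p' n : ℕ} {D : Set (Matrix (Fin p) (Fin q) ℂ)}
  {f : Matrix (Fin p) (Fin q) ℂ → Matrix (Fin p') (Fin n) ℂ}

def Adm (D : Set (Matrix (Fin p) (Fin q) ℂ)) (x : Xpt p q) : Prop :=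
  x.1 ∈ D ∧ x.2.1 ≠ 0 ∧ x.2.2 ≠ 0

theorem Adm_open (hD : IsOpen D) {x : Xpt p q} (h : Adm D x) : ∀ᶠ y in 𝓝 x, Adm D y := by
  have h1 : ∀ᶠ y in 𝓝 x, y.1 ∈ D := (continuousAt_fst (p := x)).eventually (hD.mem_nhds h.1)
  have h2 : ∀ᶠ y in 𝓝 x, y.2.1 ≠ 0 :=
    ContinuousAt.eventually_ne (g := fun y : Xpt p q => y.2.1) (by fun_prop) h.2.1
  have h3 : ∀ᶠ y in 𝓝 x, y.2.2 ≠ 0 :=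
    ContinuousAt.eventually_ne (g := fun y : Xpt p q => y.2.2) (by fun_prop) h.2.2
  filter_upwards [h1, h2, h3] with y a b c using ⟨a, b, c⟩

/-- dimension of the kernel `Kvb` at a point -/
noncomputable def dK (D : Set (Matrix (Fin p) (Fin q) ℂ))
    (f : Matrix (Fin p) (Fin q) ℂ → Matrix (Fin p') (Fin n) ℂ) (x : Xpt p q) : ℕ :=
  Module.finrank ℂ (Kvb D f x.1 x.2.1 x.2.2)

/-- points where `Kvb` has minimal dimension -/
def Om (D : Set (Matrix (Fin p) (Fin q) ℂ))
    (f : Matrix (Fin p) (Fin q) ℂ → Matrix (Fin p') (Fin n) ℂ) : Set (Xpt p q) :=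
  {x | Adm D x ∧ ∀ y, Adm D y → dK D f x ≤ dK D f y}

theorem Om_nonempty (hne : D.Nonempty) (hp : 0 < p) (hq : 0 < q) : (Om D f).Nonempty := by
  obtain ⟨Z, hZ⟩ := hne
  have hex : ∃ x : Xpt p q, Adm D x :=
    ⟨(Z, fun _ => 1, fun _ => 1), hZ, fun h => by simpa using congrFun h ⟨0, hq⟩,
      fun h => by simpa using congrFun h ⟨0, hp⟩⟩
  have hS : ({x : Xpt p q | Adm D x}).Nonempty := hex
  exact ⟨Function.argminOn (dK D f) _ hS, Function.argminOn_mem (dK D f) _ hS,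
    fun y hy => Function.argminOn_le (dK D f) _ hy⟩

variable (hD : IsOpen D) (hc : Convex ℝ D) (hf : DifferentiableOn ℂ f D)

include hD hc hf in
theorem Om_open {x : Xpt p q} (hx : x ∈ Om D f) : ∀ᶠ y in 𝓝 x, y ∈ Om D f := by
  obtain ⟨ι, ρ, h1, h2, h3⟩ := Kvb_rows hD hc hf hx.1.1 hx.1.2.1 hx.1.2.2
  have h4 := ker_usc h1
  have h5 := h2.self_of_nhds
  filter_upwards [h2, h4, Adm_open hD hx.1] with y hy hy2 hy3
  refine ⟨hy3, fun w hw => le_trans ?_ (hx.2 w hw)⟩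
  rw [hy, h5] at hy2
  exact hy2

include hD hc hf in
theorem Om_sec {x : Xpt p q} (hx : x ∈ Om D f) {k : Fin n → ℂ} (hk : k ∈ Kvb D f x.1 x.2.1 x.2.2) :
    ∃ s : Xpt p q → Fin n → ℂ, ContinuousAt s x ∧ s x = k ∧
      ∀ᶠ y in 𝓝 x, s y ∈ Kvb D f y.1 y.2.1 y.2.2 := by
  obtain ⟨ι, ρ, h1, h2, h3⟩ := Kvb_rows hD hc hf hx.1.1 hx.1.2.1 hx.1.2.2
  have h5 : rowKer (ρ x) = _ := h2.self_of_nhds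
  have hmin : ∀ᶠ y in 𝓝 x, Module.finrank ℂ (rowKer (ρ x)) ≤ Module.finrank ℂ (rowKer (ρ y)) := by
    filter_upwards [h2, Adm_open hD hx.1] with y hy hy3
    rw [hy, h5]
    exact hx.2 y hy3
  obtain ⟨s, hs1, hs2, hs3⟩ := ker_sec h1 hmin (k := k) (by rw [h5]; exact hk)
  refine ⟨s, hs1, hs2, ?_⟩
  filter_upwards [hs3, h2] with y hy hy2
  rw [← hy2]; exact hy

theorem Kvb_slice {Z Z' : Matrix (Fin p) (Fin q) ℂ} {v : Fin q → ℂ} {b : Fin p → ℂ}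
    (hZ' : Z' ∈ D) (h1 : Z' *ᵥ v = Z *ᵥ v) (h2 : b ᵥ* Z' = b ᵥ* Z) {k : Fin n → ℂ}
    (hk : k ∈ Kvb D f Z v b) : k ∈ Kvb D f Z' v b := by
  intro Y hY h3 h4
  rw [hk Y hY (h3.trans h1) (h4.trans h2), hk Z' hZ' h1 h2]

theorem Ninf_slice {Z Z' : Matrix (Fin p) (Fin q) ℂ} {v : Fin q → ℂ}
    (hZ' : Z' ∈ D) (h1 : Z' *ᵥ v = Z *ᵥ v) {k : Fin n → ℂ}
    (hk : k ∈ Ninf D f Z v) : k ∈ Ninf D f Z' v := by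
  intro Y hY h3
  rw [hk Y hY (h3.trans h1), hk Z' hZ' h1]

theorem Ninf_le_Kvb (Z : Matrix (Fin p) (Fin q) ℂ) (v : Fin q → ℂ) (b : Fin p → ℂ) :
    Ninf D f Z v ≤ Kvb D f Z v b := fun _ hk Y hY h3 _ => hk Y hY h3

include hD hc hf in
theorem exists_not_le_Kz
    (hK : ∀ k, (∀ Z ∈ D, ∀ Z' ∈ D, f Z *ᵥ k = f Z' *ᵥ k) → k = 0)
    (hBC : ∀ Z ∈ D, ∀ v b, v ≠ 0 → b ≠ 0 → Kvb D f Z v b ≠ ⊥)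
    (hO : (Om D f).Nonempty) : ∃ x ∈ Om D f, ¬ Kvb D f x.1 x.2.1 x.2.2 ≤ Kz f x.1 := by
  by_contra hcon
  push Not at hcon
  obtain ⟨⟨Z1, v, b⟩, hx⟩ := hO
  obtain ⟨k0, hk0, hk0n⟩ := Submodule.exists_mem_ne_zero_of_ne_bot (hBC Z1 hx.1.1 v b hx.1.2.1 hx.1.2.2)
  obtain ⟨ι, ρ, h1, h2, h3⟩ := Kvb_rows hD hc hf hx.1.1 hx.1.2.1 hx.1.2.2
  have h5 : rowKer (ρ (Z1, v, b)) = _ := h2.self_of_nhds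
  have hmin : ∀ᶠ y in 𝓝 (Z1, v, b), Module.finrank ℂ (rowKer (ρ (Z1, v, b))) ≤ Module.finrank ℂ (rowKer (ρ y)) := by
    filter_upwards [h2, Adm_open hD hx.1] with y hy hy3
    rw [hy, h5]
    exact hx.2 y hy3
  obtain ⟨r, i, R, hR, hB⟩ := ker_min h1 hmin
  have hct : ContinuousAt (fun Z : Matrix (Fin p) (Fin q) ℂ => ((Z, v, b) : Xpt p q)) Z1 := by fun_prop
  have hall : ∀ᶠ Z in 𝓝 Z1, Z ∈ D ∧ (Z, v, b) ∈ Om D f ∧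
      ((Matrix.of fun a => ρ (Z, v, b) (i a)) * R).det ≠ 0 ∧
      Kvb D f Z v b = rowKer (fun a => ρ (Z, v, b) (i a)) ∧
      ∀ i, DifferentiableAt ℂ (fun Z => ρ (Z, v, b) i) Z := by
    filter_upwards [hct.eventually hB, hct.eventually h2, h3, hD.mem_nhds hx.1.1,
      hct.eventually (Om_open hD hc hf hx)] with Z a1 a2 a3 a4 a5
    exact ⟨a4, a5, a1.1, by rw [← a1.2, a2], a3⟩
  obtain ⟨ε, hε, hU⟩ := Metric.eventually_nhds_iff_ball.1 hall
  let B : Matrix (Fin p) (Fin q) ℂ → Matrix (Fin r) (Fin n) ℂ := fun Z => Matrix.of fun a => ρ (Z, v, b) (i a)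
  let u : Matrix (Fin p) (Fin q) ℂ → Fin r → ℂ := fun Z => (B Z * R)⁻¹ *ᵥ (B Z *ᵥ k0)
  let s : Matrix (Fin p) (Fin q) ℂ → Fin n → ℂ := fun Z => secF (B Z) R k0
  have hBd : ∀ Z ∈ Metric.ball Z1 ε, DifferentiableAt ℂ B Z := by
    intro Z hZ
    have : DifferentiableAt ℂ (fun Z => (fun a => ρ (Z, v, b) (i a))) Z :=
      differentiableAt_pi.2 (fun a => (hU Z hZ).2.2.2.2 (i a))
    exact this
  have hud : ∀ Z ∈ Metric.ball Z1 ε, DifferentiableAt ℂ u Z := by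
    intro Z hZ
    exact mdiff_mulVec (mdiff_inv (mdiff_mul (hBd Z hZ) (differentiableAt_const R)) (hU Z hZ).2.2.1)
      (mdiff_mulVec (hBd Z hZ) (differentiableAt_const k0))
  have hsK : ∀ Z ∈ Metric.ball Z1 ε, s Z ∈ Kvb D f Z v b := by
    intro Z hZ
    rw [(hU Z hZ).2.2.2.1]
    exact secF_mem (hU Z hZ).2.2.1
  have hline : ∀ Z ∈ Metric.ball Z1 ε, ∀ X, HasDerivAt (fun t : ℂ => u (Z + t • X)) (fderiv ℂ u Z X) 0 := by
    intro Z hZ X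
    have := hasDerivAt_line (f := u) (Z := Z) (X := X) (t := 0) (by rw [zero_smul, add_zero]; exact hud Z hZ)
    rw [zero_smul, add_zero] at this
    exact this
  have hsline : ∀ Z ∈ Metric.ball Z1 ε, ∀ X, HasDerivAt (fun t : ℂ => s (Z + t • X))
      (-(R *ᵥ (fderiv ℂ u Z X))) 0 := by
    intro Z hZ X
    have h := hasDerivAt_mulVec (hasDerivAt_const (0:ℂ) R) (hline Z hZ X)
    have h' := h.const_sub k0
    simpa [s, secF, u] using h'
  have hfl : ∀ Z ∈ D, ∀ X, HasDerivAt (fun t : ℂ => f (Z + t • X)) (fderiv ℂ f Z X) 0 := by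
    intro Z hZ X
    have := hasDerivAt_line (f := f) (Z := Z) (X := X) (t := 0)
      (by rw [zero_smul, add_zero]; exact hf.differentiableAt (hD.mem_nhds hZ))
    rw [zero_smul, add_zero] at this
    exact this
  have hnear : ∀ Z X : Matrix (Fin p) (Fin q) ℂ, ∀ U : Set (Matrix (Fin p) (Fin q) ℂ), IsOpen U → Z ∈ U →
      ∀ᶠ t in 𝓝 (0:ℂ), Z + t • X ∈ U := by
    intro Z X U hU hZ
    have : Continuous (fun t : ℂ => Z + t • X) := by fun_prop
    exact this.continuousAt.eventually (hU.mem_nhds (by simpa using hZ))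
  -- derivative of s vanishes
  have hder : ∀ Z ∈ Metric.ball Z1 ε, ∀ X, fderiv ℂ u Z X = 0 := by
    intro Z hZ X
    have hmem : -(R *ᵥ (fderiv ℂ u Z X)) ∈ Kvb D f Z v b := by
      intro Z' hZ' e1 e2
      apply line_const hD hc hf (hU Z hZ).1 hZ'
      filter_upwards [hnear Z (Z' - Z) _ Metric.isOpen_ball hZ] with t ht
      set Y := Z + t • (Z' - Z) with hY
      have e1' : ∀ τ : ℂ, (Y + τ • X) *ᵥ v = (Z + τ • X) *ᵥ v := by
        intro τ; simp [hY, add_mulVec, smul_mulVec, sub_mulVec, e1]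
      have e2' : ∀ τ : ℂ, b ᵥ* (Y + τ • X) = b ᵥ* (Z + τ • X) := by
        intro τ; simp [hY, vecMul_add, vecMul_smul, vecMul_sub, e2]
      have ev : (fun τ : ℂ => f (Y + τ • X) *ᵥ s (Z + τ • X)) =ᶠ[𝓝 0]
          (fun τ : ℂ => f (Z + τ • X) *ᵥ s (Z + τ • X)) := by
        filter_upwards [hnear Z X _ Metric.isOpen_ball hZ, hnear Y X _ Metric.isOpen_ball ht] with τ h1 h2
        exact hsK _ h1 _ (hU _ h2).1 (e1' τ) (e2' τ)
      have d1 := hasDerivAt_mulVec (hfl Y (hU _ ht).1 X) (hsline Z hZ X)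
      have d2 := hasDerivAt_mulVec (hfl Z (hU _ hZ).1 X) (hsline Z hZ X)
      have d3 := (d1.congr_of_eventuallyEq ev.symm).unique d2
      simp only [zero_smul, add_zero] at d3
      have k1 : s Z ∈ Kz f Z := hcon _ (hU _ hZ).2.1 (hsK Z hZ)
      have k2 : s Z ∈ Kz f Y := hcon (Y, v, b) (hU _ ht).2.1
        (Kvb_slice (hU _ ht).1 (by simpa using e1' 0) (by simpa using e2' 0) (hsK Z hZ))
      rw [k1 X, k2 X] at d3
      simpa using d3
    rw [(hU Z hZ).2.2.2.1, rowKer_of, LinearMap.mem_ker, mulVecLin_apply, mulVec_neg, mulVec_mulVec,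
      neg_eq_zero] at hmem
    exact Matrix.eq_zero_of_mulVec_eq_zero (hU Z hZ).2.2.1 hmem
  have hu0 : ∀ Z ∈ Metric.ball Z1 ε, u Z = u Z1 := by
    intro Z hZ
    apply (convex_ball Z1 ε).is_const_of_fderivWithin_eq_zero (𝕜 := ℂ)
      (fun Z hZ => (hud Z hZ).differentiableWithinAt) _ hZ (Metric.mem_ball_self hε)
    intro Y hY
    rw [fderivWithin_of_isOpen Metric.isOpen_ball hY]
    ext X : 1
    exact hder Y hY X
  have hsk : ∀ Z ∈ Metric.ball Z1 ε, k0 ∈ Kvb D f Z v b := by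
    intro Z hZ
    have e1 : s Z = s Z1 := by
      have := hu0 Z hZ
      simp only [s, secF]
      simp only [u] at this
      rw [this]
    have e2 : s Z1 = k0 := by
      apply secF_self
      have := (hU Z1 (Metric.mem_ball_self hε)).2.2.2.1
      rw [← this]; exact hk0
    rw [← e2, ← e1]; exact hsK Z hZ
  apply hk0n
  apply hK
  have hfk : ∀ Z ∈ Metric.ball Z1 ε, f Z *ᵥ k0 = f Z1 *ᵥ k0 := by
    intro Z hZ
    have hd : ∀ Y ∈ Metric.ball Z1 ε, DifferentiableAt ℂ (fun Z => f Z *ᵥ k0) Y := fun Y hY =>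
      mdiff_mulVec (hf.differentiableAt (hD.mem_nhds (hU Y hY).1)) (differentiableAt_const k0)
    apply (convex_ball Z1 ε).is_const_of_fderivWithin_eq_zero (𝕜 := ℂ) (f := fun Z => f Z *ᵥ k0)
      (fun Z hZ => (hd Z hZ).differentiableWithinAt) _ hZ (Metric.mem_ball_self hε)
    intro Y hY
    rw [fderivWithin_of_isOpen Metric.isOpen_ball hY]
    ext X : 1
    have a1 := hasDerivAt_line (f := fun Z => f Z *ᵥ k0) (Z := Y) (X := X) (t := 0) (by rw [zero_smul, add_zero]; exact hd Y hY)
    have a2 := hasDerivAt_mulVec (hfl Y (hU Y hY).1 X) (hasDerivAt_const (0:ℂ) k0)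
    have a3 := a1.unique a2
    simp only [zero_smul, add_zero, mulVec_zero] at a3
    rw [a3]
    exact hcon (Y, v, b) (hU Y hY).2.1 (hsk Y hY) X
  have hfin : ∀ Z ∈ D, f Z *ᵥ k0 = f Z1 *ᵥ k0 := by
    apply id_eq_lemma hD hc (g := fun Z => f Z *ᵥ k0) (h := fun Z => f Z1 *ᵥ k0) _ (differentiableOn_const _)
      (z0 := Z1) hx.1.1
    · filter_upwards [Metric.ball_mem_nhds Z1 hε] with Z hZ using hfk Z hZ
    · intro Z hZ
      exact (mdiff_mulVec (hf.differentiableAt (hD.mem_nhds hZ)) (differentiableAt_const k0)).differentiableWithinAt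
  intro Z hZ Z' hZ'
  rw [hfin Z hZ, hfin Z' hZ']

end


theorem left_inv_of_inj {a b : ℕ} {A : Matrix (Fin a) (Fin b) ℂ} (h : Function.Injective A.mulVec) :
    ∃ L : Matrix (Fin b) (Fin a) ℂ, L * A = 1 := by
  obtain ⟨g, hg⟩ := LinearMap.exists_leftInverse_of_injective A.mulVecLin (LinearMap.ker_eq_bot.2 h)
  refine ⟨LinearMap.toMatrix' g, ?_⟩
  have h1 : LinearMap.toMatrix' (g ∘ₗ A.mulVecLin) = LinearMap.toMatrix' g * A := by
    rw [LinearMap.toMatrix'_comp]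
    congr 1
    exact LinearMap.toMatrix'_toLin' A
  rw [← h1, hg, LinearMap.toMatrix'_id]

theorem exists_ker_frame {r p n' : ℕ} (B : Fin r → Fin p → ℂ) (h : r + n' ≤ p) :
    ∃ (Ω : Matrix (Fin p) (Fin n') ℂ) (L : Matrix (Fin n') (Fin p) ℂ), L * Ω = 1 ∧
      ∀ i, B i ᵥ* Ω = 0 := by
  have h1 := LinearMap.finrank_range_add_finrank_ker (Matrix.of B).mulVecLin
  have h2 : Module.finrank ℂ (LinearMap.range (Matrix.of B).mulVecLin) ≤ r := by
    have := Submodule.finrank_le (LinearMap.range (Matrix.of B).mulVecLin)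
    simpa using this
  have h3 : Module.finrank ℂ (Fin p → ℂ) = p := by simp
  have h4 : n' ≤ Module.finrank ℂ (rowKer B) := by rw [rowKer_of]; omega
  let bs := Module.finBasis ℂ (rowKer B)
  let w : Fin n' → Fin p → ℂ := fun a => (bs (Fin.castLE h4 a) : Fin p → ℂ)
  have hw : LinearIndependent ℂ w := by
    have := bs.linearIndependent.comp (Fin.castLE h4) (Fin.castLE_injective h4)
    exact this.map' (rowKer B).subtype (Submodule.ker_subtype _)
  have hinj : Function.Injective ((Matrix.of w)ᵀ).mulVec := by
    rw [Matrix.mulVec_injective_iff]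
    exact hw
  obtain ⟨L, hL⟩ := left_inv_of_inj hinj
  refine ⟨(Matrix.of w)ᵀ, L, hL, fun i => ?_⟩
  ext a
  exact (bs (Fin.castLE h4 a)).2 i

section
variable {p q p' n : ℕ} {D : Set (Matrix (Fin p) (Fin q) ℂ)}
  {f : Matrix (Fin p) (Fin q) ℂ → Matrix (Fin p') (Fin n) ℂ}

def VS (D : Set (Matrix (Fin p) (Fin q) ℂ))
    (f : Matrix (Fin p) (Fin q) ℂ → Matrix (Fin p') (Fin n) ℂ)
    (Z : Matrix (Fin p) (Fin q) ℂ) (v : Fin q → ℂ) : Set (Fin n → ℂ) :=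
  {k | ∃ b, (Z, v, b) ∈ Om D f ∧ k ∈ Kvb D f Z v b}

variable (hD : IsOpen D) (hc : Convex ℝ D) (hf : DifferentiableOn ℂ f D)

include hD hc hf in
theorem span_lemma {Z : Matrix (Fin p) (Fin q) ℂ} {v : Fin q → ℂ} {n' : ℕ}
    (h : Module.finrank ℂ (Submodule.span ℂ (VS D f Z v)) + n' ≤ p) :
    ∃ (Ω0 : Matrix (Fin p) (Fin n') ℂ) (L0 : Matrix (Fin n') (Fin p) ℂ), L0 * Ω0 = 1 ∧
      ∀ᶠ Ω in 𝓝 Ω0, ∀ H : Matrix (Fin n') (Fin q) ℂ, H *ᵥ v = 0 → Z + Ω * H ∈ D →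
        ∀ k ∈ Submodule.span ℂ (VS D f Z v), f (Z + Ω * H) *ᵥ k = f Z *ᵥ k := by
  obtain ⟨g, hg, hsp, hli⟩ := Submodule.exists_fun_fin_finrank_span_eq ℂ (VS D f Z v)
  choose b hb hgb using hg
  obtain ⟨Ω0, L0, hL, hB⟩ := exists_ker_frame b h
  refine ⟨Ω0, L0, hL, ?_⟩
  choose s hs1 hs2 hs3 using fun i => Om_sec hD hc hf (hb i) (hgb i)
  let b' : Matrix (Fin p) (Fin n') ℂ → _ → Fin p → ℂ :=
    fun Ω i => b i - (b i ᵥ* (Ω * (L0 * Ω)⁻¹)) ᵥ* L0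
  have hcd : ContinuousAt (fun Ω : Matrix (Fin p) (Fin n') ℂ => L0 * Ω) Ω0 :=
    cont_mulM continuousAt_const continuousAt_id
  have hdet0 : (L0 * Ω0).det ≠ 0 := by rw [hL]; simp
  have hdet : ∀ᶠ Ω in 𝓝 Ω0, (L0 * Ω).det ≠ 0 :=
    ((Continuous.matrix_det continuous_id).continuousAt.comp hcd).eventually_ne hdet0
  have hb'0 : ∀ i, b' Ω0 i = b i := by
    intro i
    simp only [b', hL, inv_one, Matrix.mul_one, hB i]
    simp
  have hb'c : ∀ i, ContinuousAt (fun Ω => b' Ω i) Ω0 := by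
    intro i
    refine continuousAt_const.sub ?_
    refine cont_vecM continuousAt_const ?_
    refine cont_vecM ?_ continuousAt_const
    exact cont_mulM continuousAt_id (mcont_inv hcd hdet0)
  have hb'm : ∀ i, ∀ Ω, (L0 * Ω).det ≠ 0 → b' Ω i ᵥ* Ω = 0 := by
    intro i Ω hΩ
    simp only [b', sub_vecMul, vecMul_vecMul]
    rw [Matrix.mul_assoc Ω, Matrix.mul_assoc Ω, Matrix.mul_assoc _ L0 Ω, Matrix.nonsing_inv_mul _ (Ne.isUnit hΩ), Matrix.mul_one,
      sub_self]
  have hx : ∀ i, Tendsto (fun Ω => ((Z, v, b' Ω i) : Xpt p q)) (𝓝 Ω0) (𝓝 (Z, v, b i)) := by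
    intro i
    have : ContinuousAt (fun Ω => ((Z, v, b' Ω i) : Xpt p q)) Ω0 :=
      continuousAt_const.prodMk (continuousAt_const.prodMk (hb'c i))
    have h2 := this.tendsto
    rwa [hb'0 i] at h2
  have hli' : ∀ᶠ Ω in 𝓝 Ω0, LinearIndependent ℂ (fun i => s i (Z, v, b' Ω i)) := by
    have ht : Tendsto (fun Ω => (fun i => s i (Z, v, b' Ω i))) (𝓝 Ω0) (𝓝 g) := by
      rw [tendsto_pi_nhds]
      intro i
      have := (hs1 i).tendsto.comp (hx i)
      rw [hs2 i] at this
      exact this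
    exact ht.eventually hli.eventually
  have e1 : ∀ᶠ Ω in 𝓝 Ω0, ∀ i, (Z, v, b' Ω i) ∈ Om D f :=
    eventually_all.2 fun i => (hx i).eventually (Om_open hD hc hf (hb i))
  have e2 : ∀ᶠ Ω in 𝓝 Ω0, ∀ i, s i (Z, v, b' Ω i) ∈ Kvb D f Z v (b' Ω i) :=
    eventually_all.2 fun i => (hx i).eventually (hs3 i)
  filter_upwards [hdet, hli', e1, e2] with Ω h1 h2 h3 h4 H hH hZ k hk
  have hspan : Submodule.span ℂ (Set.range (fun i => s i (Z, v, b' Ω i))) =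
      Submodule.span ℂ (VS D f Z v) := by
    apply Submodule.eq_of_le_of_finrank_le
    · rw [Submodule.span_le]
      rintro _ ⟨i, rfl⟩
      exact Submodule.subset_span ⟨_, h3 i, h4 i⟩
    · rw [finrank_span_eq_card h2]; simp
  rw [← hspan] at hk
  induction hk using Submodule.span_induction with
  | mem x hx =>
    obtain ⟨i, rfl⟩ := hx
    apply h4 i _ hZ
    · rw [add_mulVec, ← mulVec_mulVec, hH]; simp
    · rw [vecMul_add, ← vecMul_vecMul, hb'm i Ω h1]; simp
  | zero => simp
  | add x y _ _ hx hy => rw [mulVec_add, mulVec_add, hx, hy]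
  | smul a x _ hx => rw [mulVec_smul, mulVec_smul, hx]

theorem near_line (hD : IsOpen D) {Z : Matrix (Fin p) (Fin q) ℂ} (hZ : Z ∈ D)
    (X : Matrix (Fin p) (Fin q) ℂ) : ∀ᶠ t in 𝓝 (0:ℂ), Z + t • X ∈ D := by
  have : Continuous (fun t : ℂ => Z + t • X) := by fun_prop
  refine this.continuousAt.eventually (hD.mem_nhds ?_)
  show Z + (0:ℂ) • X ∈ D
  rw [zero_smul, add_zero]; exact hZ

include hD hf in
theorem deriv_line {Z : Matrix (Fin p) (Fin q) ℂ} (hZ : Z ∈ D) (X : Matrix (Fin p) (Fin q) ℂ)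
    (k : Fin n → ℂ) : HasDerivAt (fun t : ℂ => f (Z + t • X) *ᵥ k) (fderiv ℂ f Z X *ᵥ k) 0 := by
  have h1 := hasDerivAt_line (f := f) (Z := Z) (X := X) (t := 0)
      (by rw [zero_smul, add_zero]; exact hf.differentiableAt (hD.mem_nhds hZ))
  rw [zero_smul, add_zero] at h1
  have := hasDerivAt_mulVec h1 (hasDerivAt_const (0:ℂ) k)
  simp only [zero_smul, add_zero, mulVec_zero] at this
  exact this

include hD hf in
/-- if `f k` is constant along a line direction, the derivative kills `k` -/
theorem dirDeriv_zero {Z : Matrix (Fin p) (Fin q) ℂ} (hZ : Z ∈ D) {X : Matrix (Fin p) (Fin q) ℂ}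
    {k : Fin n → ℂ} (h : ∀ᶠ t in 𝓝 (0:ℂ), f (Z + t • X) *ᵥ k = f Z *ᵥ k) :
    fderiv ℂ f Z X *ᵥ k = 0 := by
  have h1 := deriv_line hD hf hZ X k
  have h2 : HasDerivAt (fun t : ℂ => f (Z + t • X) *ᵥ k) 0 0 :=
    (hasDerivAt_const (0:ℂ) (f Z *ᵥ k)).congr_of_eventuallyEq h
  exact h1.unique h2

include hD hf in
theorem Ninf_le_Nd {Z : Matrix (Fin p) (Fin q) ℂ} (hZ : Z ∈ D) (v : Fin q → ℂ) :
    Ninf D f Z v ≤ Nd f Z v := by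
  intro k hk X hX
  apply dirDeriv_zero hD hf hZ
  filter_upwards [near_line hD hZ X] with t ht
  apply hk _ ht
  simp [add_mulVec, smul_mulVec, hX]

include hD hc hf in
/-- Kvb ≤ Nd on Om -/
theorem Kvb_le_Nd (hnp : n < p) {Z : Matrix (Fin p) (Fin q) ℂ} {v : Fin q → ℂ} {b : Fin p → ℂ}
    (hx : (Z, v, b) ∈ Om D f) : Kvb D f Z v b ≤ Nd f Z v := by
  have hr : Module.finrank ℂ (Submodule.span ℂ (VS D f Z v)) ≤ n := by
    have := Submodule.finrank_le (Submodule.span ℂ (VS D f Z v))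
    simpa using this
  obtain ⟨Ω0, L0, hL, hev⟩ := span_lemma hD hc hf (Z := Z) (v := v) (n' := 1) (by omega)
  intro k hk X hX
  have hkS : k ∈ Submodule.span ℂ (VS D f Z v) := Submodule.subset_span ⟨b, hx, hk⟩
  -- for Ω near Ω0 and η with η v = 0
  have hΩ : ∀ᶠ Ω in 𝓝 Ω0, ∀ H : Matrix (Fin 1) (Fin q) ℂ, H *ᵥ v = 0 → fderiv ℂ f Z (Ω * H) *ᵥ k = 0 := by
    filter_upwards [hev] with Ω hΩ H hH
    apply dirDeriv_zero hD hf hx.1.1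
    filter_upwards [near_line hD hx.1.1 (Ω * H)] with t ht
    have := hΩ (t • H) (by simp [smul_mulVec, hH]) (by rw [Matrix.mul_smul]; exact ht) k hkS
    rwa [Matrix.mul_smul] at this
  have hall : ∀ (Ω : Matrix (Fin p) (Fin 1) ℂ) (H : Matrix (Fin 1) (Fin q) ℂ), H *ᵥ v = 0 →
      fderiv ℂ f Z (Ω * H) *ᵥ k = 0 := by
    intro Ω H hH
    have hcon : Continuous (fun t : ℂ => Ω0 + t • Ω) := by fun_prop
    have ht : Tendsto (fun t : ℂ => Ω0 + t • Ω) (𝓝 0) (𝓝 Ω0) := by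
      have := hcon.tendsto 0
      rwa [zero_smul, add_zero] at this
    have h1 := (ht.eventually hΩ)
    have h2 : ∀ᶠ t in 𝓝[≠] (0:ℂ), ∀ H : Matrix (Fin 1) (Fin q) ℂ, H *ᵥ v = 0 →
      fderiv ℂ f Z ((Ω0 + t • Ω) * H) *ᵥ k = 0 := h1.filter_mono nhdsWithin_le_nhds
    obtain ⟨t, ht1, ht2⟩ := (h2.and self_mem_nhdsWithin).exists
    have h3 := ht1 H hH
    have h4 := hΩ.self_of_nhds H hH
    rw [Matrix.add_mul, map_add, add_mulVec, h4, zero_add, Matrix.smul_mul, map_smul, smul_mulVec] at h3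
    exact (smul_eq_zero.1 h3).resolve_left ht2
  have hXs : X = ∑ i, (Matrix.of fun a _ => if a = i then (1:ℂ) else 0 : Matrix (Fin p) (Fin 1) ℂ) *
      (Matrix.of fun _ j => X i j : Matrix (Fin 1) (Fin q) ℂ) := by
    ext a j
    simp [Matrix.sum_apply, Matrix.mul_apply]
  rw [hXs, map_sum, Matrix.sum_mulVec]
  apply Finset.sum_eq_zero
  intro i _
  apply hall
  ext a
  exact congrFun hX i

include hD hc hf in
/-- if span is small, then it lies in Ninf -/
theorem span_le_Ninf {Z : Matrix (Fin p) (Fin q) ℂ} (hZ : Z ∈ D) {v : Fin q → ℂ} (hv : v ≠ 0)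
    (h : Module.finrank ℂ (Submodule.span ℂ (VS D f Z v)) + q ≤ p) :
    Submodule.span ℂ (VS D f Z v) ≤ Ninf D f Z v := by
  obtain ⟨Ω0, L0, hL, hev⟩ := span_lemma hD hc hf h
  intro k hk Z' hZ' hZv
  set H := Pv (star v) v
  have hH : H *ᵥ v = 0 := Pv_mulVec (star_dot_ne hv)
  let S : Set (Matrix (Fin p) (Fin q) ℂ) := {Ω | Z + Ω * H ∈ D}
  have hcS : Continuous (fun Ω : Matrix (Fin p) (Fin q) ℂ => Z + Ω * H) := by fun_prop
  have hSo : IsOpen S := hD.preimage hcS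
  have hSc : Convex ℝ S := by
    intro a ha b hb s t hs ht hst
    have := hc ha hb hs ht hst
    have e : Z + (s • a + t • b) * H = s • (Z + a * H) + t • (Z + b * H) := by
      rw [Matrix.add_mul, Matrix.smul_mul, Matrix.smul_mul, smul_add, smul_add]
      have : Z = s • Z + t • Z := by rw [← add_smul, hst, one_smul]
      nth_rewrite 1 [this]; abel
    show Z + (s • a + t • b) * H ∈ D
    rw [e]; exact this
  -- scaled point
  have hnl := near_line hD hZ (Ω0 * H)
  obtain ⟨t, ht1, ht2⟩ := ((hnl.filter_mono (nhdsWithin_le_nhds (s := {0}ᶜ))).and self_mem_nhdsWithin).exists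
  have ht2 : t ≠ 0 := ht2
  have hmem : t • Ω0 ∈ S := by
    show Z + (t • Ω0) * H ∈ D
    rw [Matrix.smul_mul]; exact ht1
  have hdiff : DifferentiableOn ℂ (fun Ω => f (Z + Ω * H) *ᵥ k) S := by
    intro Ω hΩ
    have hh : DifferentiableAt ℂ (fun Ω : Matrix (Fin p) (Fin q) ℂ => Z + Ω * H) Ω :=
      (differentiableAt_const Z).add (mdiff_mul differentiableAt_id (differentiableAt_const H))
    have h2 : DifferentiableAt ℂ f (Z + Ω * H) := hf.differentiableAt (hD.mem_nhds hΩ)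
    exact (mdiff_mulVec (DifferentiableAt.comp Ω h2 hh) (differentiableAt_const k)).differentiableWithinAt
  have hfin := id_eq_lemma hSo hSc hdiff (differentiableOn_const (f Z *ᵥ k)) hmem (by
    have hcs : Continuous (fun Ω : Matrix (Fin p) (Fin q) ℂ => t⁻¹ • Ω) := by fun_prop
    have hts : Tendsto (fun Ω : Matrix (Fin p) (Fin q) ℂ => t⁻¹ • Ω) (𝓝 (t • Ω0)) (𝓝 Ω0) := by
      have := hcs.tendsto (t • Ω0)
      rwa [smul_smul, inv_mul_cancel₀ ht2, one_smul] at this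
    filter_upwards [hts.eventually hev, hSo.mem_nhds hmem] with Ω h1 h2
    have e : (t⁻¹ • Ω) * (t • H) = Ω * H := by
      rw [Matrix.smul_mul, Matrix.mul_smul, smul_smul, inv_mul_cancel₀ ht2, one_smul]
    have := h1 (t • H) (by simp [smul_mulVec, hH]) (by rw [e]; exact h2) k hk
    rwa [e] at this)
  have e2 : Z + (Z' - Z) * H = Z' := by
    rw [mul_Pv (by rw [sub_mulVec, hZv, sub_self])]; abel
  have := hfin (Z' - Z) (by show _ ∈ D; rw [e2]; exact hZ')
  simp only [e2] at this
  exact this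

end


theorem finrank_map_inf {V W : Type*} [AddCommGroup V] [Module ℂ V] [AddCommGroup W] [Module ℂ W]
    [FiniteDimensional ℂ V] (S : Submodule ℂ V) (L : V →ₗ[ℂ] W) :
    Module.finrank ℂ (S.map L) + Module.finrank ℂ (S ⊓ LinearMap.ker L : Submodule ℂ V) =
      Module.finrank ℂ S := by
  have h := LinearMap.finrank_range_add_finrank_ker (L.domRestrict S)
  rw [LinearMap.range_domRestrict] at h
  rw [← h]
  congr 1
  have : (S ⊓ LinearMap.ker L : Submodule ℂ V) = (LinearMap.ker (L.domRestrict S)).map S.subtype := by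
    ext x
    simp only [Submodule.mem_inf, LinearMap.mem_ker, Submodule.mem_map, Submodule.subtype_apply,
      LinearMap.domRestrict_apply]
    constructor
    · rintro ⟨h1, h2⟩; exact ⟨⟨x, h1⟩, h2, rfl⟩
    · rintro ⟨y, h1, rfl⟩; exact ⟨y.2, h1⟩
  rw [this]
  exact LinearEquiv.finrank_eq (Submodule.equivMapOfInjective _ S.injective_subtype _).symm

section
variable {N : Type*} [AddCommGroup N] [Module ℂ N] {q : ℕ}

def tens (v : Fin q → ℂ) (c : N) : Fin q → N := fun i => v i • c

def evl (η : Fin q → ℂ) : (Fin q → N) →ₗ[ℂ] N :=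
  ∑ i, η i • LinearMap.proj i

theorem evl_apply (η : Fin q → ℂ) (φ : Fin q → N) : evl η φ = ∑ i, η i • φ i := by
  simp [evl]

theorem evl_tens (η v : Fin q → ℂ) (c : N) : evl η (tens v c) = (η ⬝ᵥ v) • c := by
  rw [evl_apply, dotProduct, Finset.sum_smul]
  simp [tens, smul_smul]

def dotL (η : Fin q → ℂ) : (Fin q → ℂ) →ₗ[ℂ] ℂ := evl η

theorem dotL_apply (η v : Fin q → ℂ) : dotL η v = η ⬝ᵥ v := by
  simp [dotL, evl_apply, dotProduct]

theorem finrank_hyper (H : Submodule ℂ (Fin q → ℂ)) {η y : Fin q → ℂ} (hy : y ∈ H) (h : η ⬝ᵥ y ≠ 0) :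
    Module.finrank ℂ (H ⊓ LinearMap.ker (dotL η) : Submodule ℂ (Fin q → ℂ)) + 1 =
      Module.finrank ℂ H := by
  have h1 := finrank_map_inf H (dotL η)
  have h2 : H.map (dotL η) = ⊤ := by
    rw [eq_top_iff]
    intro z _
    refine ⟨(z / (η ⬝ᵥ y)) • y, H.smul_mem _ hy, ?_⟩
    rw [map_smul, dotL_apply]
    simp [h]
  rw [h2, finrank_top, Module.finrank_self] at h1
  omega

theorem tens_add (v w : Fin q → ℂ) (c : N) : tens (v + w) c = tens v c + tens w c := by
  ext i; simp [tens, add_smul]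

theorem tens_smul (a : ℂ) (v : Fin q → ℂ) (c : N) : tens (a • v) c = a • tens v c := by
  ext i; simp [tens, smul_smul]

theorem tens_smul' (a : ℂ) (v : Fin q → ℂ) (c : N) : tens v (a • c) = a • tens v c := by
  ext i; simp [tens, smul_smul, mul_comm]

/-- small perturbation in an open set -/
theorem exists_small {O : Set (Fin q → ℂ)} (hO : IsOpen O) {v : Fin q → ℂ} (hv : v ∈ O)
    (y : Fin q → ℂ) : ∀ᶠ t in 𝓝[≠] (0:ℂ), v + t • y ∈ O := by
  have hcn : Continuous (fun t : ℂ => v + t • y) := by fun_prop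
  have : ∀ᶠ t in 𝓝 (0:ℂ), v + t • y ∈ O := hcn.continuousAt.eventually (hO.mem_nhds (by simpa using hv))
  exact this.filter_mono nhdsWithin_le_nhds

theorem exists_small_ne {O : Set (Fin q → ℂ)} (hO : IsOpen O) {H : Submodule ℂ (Fin q → ℂ)}
    {v y : Fin q → ℂ} (hv : v ∈ O) (hvH : v ∈ H) (hyH : y ∈ H) {η : Fin q → ℂ} (hη : η ⬝ᵥ y ≠ 0) :
    ∃ w ∈ H, w ∈ O ∧ η ⬝ᵥ w ≠ 0 := by
  by_cases h : η ⬝ᵥ v = 0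
  · obtain ⟨t, ht, ht0⟩ := ((exists_small hO hv y).and self_mem_nhdsWithin).exists
    refine ⟨v + t • y, H.add_mem hvH (H.smul_mem _ hyH), ht, ?_⟩
    have ht0 : t ≠ 0 := ht0
    simp [dotProduct_add, h, hη, ht0]
  · exact ⟨v, hvH, hv, h⟩

variable [FiniteDimensional ℂ N]

theorem S_lemma {O : Set (Fin q → ℂ)} (hO : IsOpen O) (hOc : Convex ℝ O) : ∀ (h : ℕ)
    (H : Submodule ℂ (Fin q → ℂ)) (S : Submodule ℂ (Fin q → N)),
    Module.finrank ℂ H = h → 1 ≤ h → Module.finrank ℂ S + 2 ≤ 2 * h → (∃ v ∈ H, v ∈ O) →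
    (∀ v ∈ H, v ∈ O → ∃ c : N, c ≠ 0 ∧ tens v c ∈ S) → ∃ c : N, c ≠ 0 ∧ ∀ v ∈ H, tens v c ∈ S := by
  intro h
  induction h with
  | zero => intro H S _ h1; omega
  | succ h ih =>
    intro H S hH _ hS ⟨v0, hv0H, hv0⟩ hc
    by_cases hcase : ∃ η y : Fin q → ℂ, y ∈ H ∧ η ⬝ᵥ y ≠ 0 ∧ Module.finrank ℂ (S.map (evl η)) ≤ 1
    · obtain ⟨η, y, hy, hηy, hr⟩ := hcase
      obtain ⟨g, hg⟩ := finrank_le_one_iff.1 hr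
      obtain ⟨w, hwH, hwO, hηw⟩ := exists_small_ne hO hv0 hv0H hy hηy
      have key : ∀ v ∈ H, v ∈ O → η ⬝ᵥ v ≠ 0 → (g : N) ≠ 0 ∧ tens v (g : N) ∈ S := by
        intro v hvH hvO hηv
        obtain ⟨c, hc0, hcS⟩ := hc v hvH hvO
        have h1 : (η ⬝ᵥ v) • c ∈ S.map (evl η) := ⟨_, hcS, evl_tens _ _ _⟩
        obtain ⟨a, ha⟩ := hg ⟨_, h1⟩
        have ha' : a • (g : N) = (η ⬝ᵥ v) • c := congrArg Subtype.val ha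
        have hne : a • (g : N) ≠ 0 := by rw [ha']; exact smul_ne_zero hηv hc0
        have ha0 : a ≠ 0 := fun h => hne (by simp [h])
        refine ⟨fun h => hne (by rw [h, smul_zero]), ?_⟩
        have : (g : N) = (a⁻¹ * (η ⬝ᵥ v)) • c := by
          rw [mul_smul, ← ha', smul_smul, inv_mul_cancel₀ ha0, one_smul]
        rw [this, tens_smul']
        exact S.smul_mem _ hcS
      refine ⟨g, (key w hwH hwO hηw).1, fun x hx => ?_⟩
      have hcn : Continuous (fun t : ℂ => η ⬝ᵥ (w + t • x)) := by
        simp only [dotProduct_add, dotProduct_smul]; fun_prop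
      have hne : ∀ᶠ t in 𝓝[≠] (0:ℂ), η ⬝ᵥ (w + t • x) ≠ 0 :=
        (hcn.continuousAt.eventually_ne (by simpa using hηw)).filter_mono nhdsWithin_le_nhds
      obtain ⟨t, ⟨ht, ht1⟩, ht0⟩ := (((exists_small hO hwO x).and hne).and self_mem_nhdsWithin).exists
      have ht0 : t ≠ 0 := ht0
      have h1 := (key _ (H.add_mem hwH (H.smul_mem t hx)) ht ht1).2
      rw [tens_add, tens_smul] at h1
      have h2 := (S.add_mem_iff_right (key w hwH hwO hηw).2).1 h1
      exact (S.smul_mem_iff ht0).1 h2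
    · push Not at hcase
      -- choose v1 nonzero
      have hHne : H ≠ ⊥ := by
        rintro rfl; simp at hH
      obtain ⟨y0, hy0H, hy0⟩ := Submodule.exists_mem_ne_zero_of_ne_bot hHne
      obtain ⟨v1, hv1H, hv1O, hv1⟩ := exists_small_ne hO hv0 hv0H hy0H (star_dot_ne hy0)
      have hv1n : v1 ≠ 0 := fun h => hv1 (by simp [h])
      have hd1 := star_dot_ne hv1n
      have h2 := hcase (star v1) v1 hv1H hd1
      have h2' := finrank_map_inf S (evl (star v1))
      have hh := finrank_hyper H hv1H hd1
      have hne2 : (H ⊓ LinearMap.ker (dotL (star v1)) : Submodule ℂ (Fin q → ℂ)) ≠ ⊥ := by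
        intro hb; rw [hb] at hh; simp at hh; omega
      obtain ⟨y, hyH, hy⟩ := Submodule.exists_mem_ne_zero_of_ne_bot hne2
      have hdy := star_dot_ne hy
      obtain ⟨hyH, hyk⟩ := hyH
      have hyk : star v1 ⬝ᵥ y = 0 := by rw [← dotL_apply]; exact hyk
      have hyk' : star y ⬝ᵥ v1 = 0 := by
        have := congrArg star hyk
        rw [star_dotProduct, star_star] at this
        rw [this, star_zero]
      obtain ⟨t, ht, ht0⟩ := ((exists_small hO hv1O y).and self_mem_nhdsWithin).exists
      have ht0 : t ≠ 0 := ht0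
      set v2 := v1 + t • y with hv2
      have hv2H : v2 ∈ H := H.add_mem hv1H (H.smul_mem _ hyH)
      let η1 : Fin q → ℂ := (t * (star y ⬝ᵥ y))⁻¹ • star y
      let η2 : Fin q → ℂ := (star v1 ⬝ᵥ v1)⁻¹ • star v1 - η1
      have e11 : η1 ⬝ᵥ v1 = 0 := by simp [η1, hyk']
      have e12 : η1 ⬝ᵥ v2 = 1 := by
        simp only [η1, hv2, dotProduct_add, dotProduct_smul, smul_dotProduct, hyk', smul_eq_mul]
        field_simp
        simp
      have e21 : η2 ⬝ᵥ v1 = 1 := by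
        simp only [η2, sub_dotProduct, e11, smul_dotProduct, smul_eq_mul, inv_mul_cancel₀ hd1, sub_zero]
      have e22 : η2 ⬝ᵥ v2 = 0 := by
        rw [sub_dotProduct, e12, smul_dotProduct, hv2, dotProduct_add, dotProduct_smul, hyk,
          smul_zero, add_zero, smul_eq_mul, inv_mul_cancel₀ hd1, sub_self]
      have sub : ∀ η w z : Fin q → ℂ, w ∈ H → η ⬝ᵥ w ≠ 0 → z ∈ H → z ∈ O → η ⬝ᵥ z = 0 →
          Module.finrank ℂ (H ⊓ LinearMap.ker (dotL η) : Submodule ℂ (Fin q → ℂ)) = h ∧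
          ∃ c : N, c ≠ 0 ∧ ∀ v ∈ H, η ⬝ᵥ v = 0 → tens v c ∈ S := by
        intro η w z hw hηw hz hzO hηz
        have a1 := finrank_hyper H hw hηw
        have a2 := hcase η w hw hηw
        have a3 := finrank_map_inf S (evl η)
        refine ⟨by omega, ?_⟩
        have hz' : z ∈ (H ⊓ LinearMap.ker (dotL η) : Submodule ℂ (Fin q → ℂ)) :=
          ⟨hz, LinearMap.mem_ker.2 (by rw [dotL_apply]; exact hηz)⟩
        obtain ⟨c, hc0, hcc⟩ := ih (H ⊓ LinearMap.ker (dotL η)) (S ⊓ LinearMap.ker (evl η)) (by omega)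
          (by omega) (by omega) ⟨z, hz', hzO⟩ (by
            intro v hv hvO
            obtain ⟨c, hc0, hcS⟩ := hc v hv.1 hvO
            refine ⟨c, hc0, hcS, ?_⟩
            have : η ⬝ᵥ v = 0 := by rw [← dotL_apply]; exact hv.2
            exact LinearMap.mem_ker.2 (by rw [evl_tens, this, zero_smul]))
        exact ⟨c, hc0, fun v hv hηv => (hcc v ⟨hv, LinearMap.mem_ker.2 (by rw [dotL_apply]; exact hηv)⟩).1⟩
      obtain ⟨f1, c1, hc1, hS1⟩ := sub η1 v2 v1 hv2H (by rw [e12]; simp) hv1H hv1O e11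
      obtain ⟨f2, c2, hc2, hS2⟩ := sub η2 v1 v2 hv1H (by rw [e21]; simp) hv2H ht e22
      by_cases hli : LinearIndependent ℂ ![c1, c2]
      · exfalso
        rw [LinearIndependent.pair_iff] at hli
        let H1 : Submodule ℂ (Fin q → ℂ) := H ⊓ LinearMap.ker (dotL η1)
        let H2 : Submodule ℂ (Fin q → ℂ) := H ⊓ LinearMap.ker (dotL η2)
        let tl : N → (Fin q → ℂ) →ₗ[ℂ] (Fin q → N) := fun c =>
          { toFun := fun v => tens v c, map_add' := fun a b => tens_add a b c,
            map_smul' := fun a b => tens_smul a b c }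
        let M : (H1 × H2) →ₗ[ℂ] (Fin q → N) :=
          LinearMap.coprod ((tl c1).domRestrict H1) ((tl c2).domRestrict H2)
        have hMa : ∀ x, M x = tens (x.1 : Fin q → ℂ) c1 + tens (x.2 : Fin q → ℂ) c2 := fun x => rfl
        have hMi : Function.Injective M := by
          rw [← LinearMap.ker_eq_bot, LinearMap.ker_eq_bot']
          intro x hx
          rw [hMa] at hx
          have hh : ∀ i, (x.1 : Fin q → ℂ) i = 0 ∧ (x.2 : Fin q → ℂ) i = 0 := fun i =>
            hli _ _ (by simpa [tens] using congrFun hx i)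
          ext i
          · simpa using (hh i).1
          · simpa using (hh i).2
        have hfr := LinearMap.finrank_range_of_inj hMi
        rw [Module.finrank_prod] at hfr
        have hrS : LinearMap.range M = S := by
          apply Submodule.eq_of_le_of_finrank_le
          · rintro _ ⟨x, rfl⟩
            rw [hMa]
            refine S.add_mem (hS1 _ x.1.2.1 ?_) (hS2 _ x.2.2.1 ?_)
            · rw [← dotL_apply]; exact x.1.2.2
            · rw [← dotL_apply]; exact x.2.2.2
          · rw [hfr]
            have : Module.finrank ℂ H1 = h := f1
            have : Module.finrank ℂ H2 = h := f2
            omega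
        set v3 : Fin q → ℂ := (1/2 : ℝ) • v1 + (1/2 : ℝ) • v2 with hv3
        have hv3O : v3 ∈ O := hOc hv1O ht (by norm_num) (by norm_num) (by norm_num)
        have hv3' : v3 = (1/2 : ℂ) • v1 + (1/2 : ℂ) • v2 := by
          ext i; simp [hv3]
        have hv3H : v3 ∈ H := by rw [hv3']; exact H.add_mem (H.smul_mem _ hv1H) (H.smul_mem _ hv2H)
        have e13 : η1 ⬝ᵥ v3 = 1/2 := by rw [hv3', dotProduct_add, dotProduct_smul, dotProduct_smul, e11, e12]; simp
        have e23 : η2 ⬝ᵥ v3 = 1/2 := by rw [hv3', dotProduct_add, dotProduct_smul, dotProduct_smul, e21, e22]; simp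
        obtain ⟨c3, hc3, hc3S⟩ := hc v3 hv3H hv3O
        rw [← hrS] at hc3S
        obtain ⟨x, hx⟩ := hc3S
        rw [hMa] at hx
        have hv3n : v3 ≠ 0 := by rintro h; rw [h] at e13; norm_num at e13
        obtain ⟨i0, hi0⟩ := Function.ne_iff.1 hv3n
        have hi0 : v3 i0 ≠ 0 := hi0
        set α := (x.1 : Fin q → ℂ) i0 / v3 i0
        set β := (x.2 : Fin q → ℂ) i0 / v3 i0
        have hxi : ∀ i, (x.1 : Fin q → ℂ) i • c1 + (x.2 : Fin q → ℂ) i • c2 = v3 i • c3 := fun i => congrFun hx i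
        have hc3e : c3 = α • c1 + β • c2 := by
          have := congrArg (fun z => (v3 i0)⁻¹ • z) (hxi i0)
          simp only [smul_add, smul_smul, inv_mul_cancel₀ hi0, one_smul] at this
          rw [← this]
          simp only [α, β, div_eq_inv_mul]
        have hx12 : ∀ i, (x.1 : Fin q → ℂ) i = α * v3 i ∧ (x.2 : Fin q → ℂ) i = β * v3 i := by
          intro i
          have := hli ((x.1 : Fin q → ℂ) i - α * v3 i) ((x.2 : Fin q → ℂ) i - β * v3 i) (by
            have := hxi i
            rw [hc3e, smul_add, smul_smul, smul_smul] at this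
            rw [sub_smul, sub_smul, sub_add_sub_comm, this, mul_comm α, mul_comm β, sub_self])
          exact ⟨sub_eq_zero.1 this.1, sub_eq_zero.1 this.2⟩
        have hα : α = 0 := by
          have h1 : η1 ⬝ᵥ (x.1 : Fin q → ℂ) = 0 := by rw [← dotL_apply]; exact x.1.2.2
          have h2 : (x.1 : Fin q → ℂ) = α • v3 := by ext i; simp [(hx12 i).1]
          rw [h2, dotProduct_smul, e13] at h1
          simpa using h1
        have hβ : β = 0 := by
          have h1 : η2 ⬝ᵥ (x.2 : Fin q → ℂ) = 0 := by rw [← dotL_apply]; exact x.2.2.2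
          have h2 : (x.2 : Fin q → ℂ) = β • v3 := by ext i; simp [(hx12 i).2]
          rw [h2, dotProduct_smul, e23] at h1
          simpa using h1
        apply hc3
        rw [hc3e, hα, hβ]; simp
      · refine ⟨c1, hc1, fun x hx => ?_⟩
        have hdep : ∃ a : ℂ, c1 = a • c2 := by
          by_contra hcon
          push Not at hcon
          apply hli
          rw [LinearIndependent.pair_iff]
          intro s t hst
          have hs : s = 0 := by
            by_contra hs
            apply hcon (-(s⁻¹ * t))
            have : s⁻¹ • (s • c1 + t • c2) = 0 := by rw [hst, smul_zero]
            rw [smul_add, smul_smul, smul_smul, inv_mul_cancel₀ hs, one_smul] at this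
            rw [neg_smul]; exact eq_neg_of_add_eq_zero_left this
          refine ⟨hs, ?_⟩
          rw [hs, zero_smul, zero_add] at hst
          exact (smul_eq_zero.1 hst).resolve_right hc2
        obtain ⟨a, ha⟩ := hdep
        have hx' : x = (x - (η1 ⬝ᵥ x) • v2) + (η1 ⬝ᵥ x) • v2 := by abel
        rw [hx', tens_add, tens_smul]
        refine S.add_mem (hS1 _ (H.sub_mem hx (H.smul_mem _ hv2H)) ?_) (S.smul_mem _ ?_)
        · rw [dotProduct_sub, dotProduct_smul, e12]; simp
        · rw [ha, tens_smul']
          exact S.smul_mem _ (hS2 _ hv2H e22)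
end


theorem basis_in_open {q : ℕ} {O : Set (Fin q → ℂ)} (hO : IsOpen O) (hne : O.Nonempty) :
    ∃ V Vi : Matrix (Fin q) (Fin q) ℂ, V * Vi = 1 ∧ Vi * V = 1 ∧ ∀ i, (fun a => V a i) ∈ O := by
  have hsp : Submodule.span ℂ O = ⊤ := by
    rw [eq_top_iff]
    intro x _
    obtain ⟨v, hv⟩ := hne
    obtain ⟨t, ht, ht0⟩ := ((exists_small hO hv x).and self_mem_nhdsWithin).exists
    have ht0 : t ≠ 0 := ht0
    have h1 : t • x ∈ Submodule.span ℂ O := by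
      have := (Submodule.span ℂ O).sub_mem (Submodule.subset_span ht) (Submodule.subset_span hv)
      simpa using this
    exact ((Submodule.span ℂ O).smul_mem_iff ht0).1 h1
  obtain ⟨g, hg, hgs, hli⟩ := Submodule.exists_fun_fin_finrank_span_eq ℂ O
  have hr : Module.finrank ℂ (Submodule.span ℂ O) = q := by rw [hsp, finrank_top]; simp
  revert g
  rw [hr]
  intro g hg hgs hli
  have hinj : Function.Injective ((Matrix.of g)ᵀ).mulVec := by
    rw [Matrix.mulVec_injective_iff]
    exact hli
  obtain ⟨L, hL⟩ := left_inv_of_inj hinj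
  exact ⟨(Matrix.of g)ᵀ, L, mul_eq_one_comm.1 hL, hL, fun i => hg i⟩

section
variable {p q p' n : ℕ} {D : Set (Matrix (Fin p) (Fin q) ℂ)}
  {f : Matrix (Fin p) (Fin q) ℂ → Matrix (Fin p') (Fin n) ℂ}

theorem Kz_le_Nd (Z : Matrix (Fin p) (Fin q) ℂ) (v : Fin q → ℂ) : Kz f Z ≤ Nd f Z v :=
  fun _ hk X _ => hk X

theorem Kz_of_Nd {Z : Matrix (Fin p) (Fin q) ℂ} {v η : Fin q → ℂ} (hη : η ⬝ᵥ v = 1) {k : Fin n → ℂ}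
    (hk : k ∈ Nd f Z v) (h : ∀ w, fderiv ℂ f Z (vecMulVec w η) *ᵥ k = 0) : k ∈ Kz f Z := by
  intro X
  have h1 : X = (X - vecMulVec (X *ᵥ v) η) + vecMulVec (X *ᵥ v) η := by abel
  rw [h1, map_add, add_mulVec, h, add_zero]
  apply hk
  rw [sub_mulVec, vecMulVec_mulVec, hη]
  simp

variable (hD : IsOpen D) (hc : Convex ℝ D) (hf : DifferentiableOn ℂ f D)

include hD hf in
theorem Kz_usc {Z : Matrix (Fin p) (Fin q) ℂ} (hZ : Z ∈ D) :
    ∀ᶠ Y in 𝓝 Z, Module.finrank ℂ (Kz f Y) ≤ Module.finrank ℂ (Kz f Z) := by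
  have := ker_usc (ρ := fun Z (a : Matrix (Fin p) (Fin q) ℂ × Fin p') => (fderiv ℂ f Z a.1) a.2)
    (x0 := Z) (fun a => Kz_cont hD hf hZ a)
  filter_upwards [this] with Y hY
  rw [Kz_rows Y, Kz_rows Z]
  exact hY

include hD hf in
theorem Nd_usc {Z : Matrix (Fin p) (Fin q) ℂ} (hZ : Z ∈ D) {v : Fin q → ℂ} (hv : v ≠ 0) :
    ∀ᶠ y in 𝓝 (Z, v), Module.finrank ℂ (Nd f y.1 y.2) ≤ Module.finrank ℂ (Nd f Z v) := by
  have hv' := star_dot_ne hv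
  have h1 := ker_usc (ρ := fun (y : Matrix (Fin p) (Fin q) ℂ × (Fin q → ℂ))
    (a : Matrix (Fin p) (Fin q) ℂ × Fin p') => (fderiv ℂ f y.1 (a.1 * Pv (star v) y.2)) a.2)
    (x0 := (Z, v)) (fun a => Nd_cont (x := (Z, v)) hD hf hZ hv' a)
  have hcn : ContinuousAt (fun y : Matrix (Fin p) (Fin q) ℂ × (Fin q → ℂ) => star v ⬝ᵥ y.2) (Z, v) :=
    (Continuous.dotProduct continuous_const continuous_snd).continuousAt
  have h2 := hcn.eventually_ne hv'
  filter_upwards [h1, h2] with y hy hy2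
  rw [Nd_rows y.1 hy2, Nd_rows Z hv']
  exact hy

include hD hc hf in
theorem stage3 (hO : ∃ x ∈ Om D f, ¬ Kvb D f x.1 x.2.1 x.2.2 ≤ Kz f x.1) :
    ∃ (m : ℕ) (x0 : Xpt p q), ∀ᶠ x in 𝓝 x0, x ∈ Om D f ∧
      ¬ Kvb D f x.1 x.2.1 x.2.2 ≤ Kz f x.1 ∧ Module.finrank ℂ (Kz f x.1) = m := by
  let O' : Set (Xpt p q) := {x | x ∈ Om D f ∧ ¬ Kvb D f x.1 x.2.1 x.2.2 ≤ Kz f x.1}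
  have hne : O'.Nonempty := hO
  let dk : Xpt p q → ℕ := fun x => Module.finrank ℂ (Kz f x.1)
  set x0 := Function.argminOn dk O' hne with hx0
  have hx : x0 ∈ O' := Function.argminOn_mem dk O' hne
  have hmin : ∀ y ∈ O', dk x0 ≤ dk y := fun y hy => Function.argminOn_le dk O' hy
  have hopen : ∀ᶠ x in 𝓝 x0, ¬ Kvb D f x.1 x.2.1 x.2.2 ≤ Kz f x.1 := by
    obtain ⟨k, hk, hkn⟩ := SetLike.not_le_iff_exists.1 hx.2
    have : ∃ X, fderiv ℂ f x0.1 X *ᵥ k ≠ 0 := by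
      by_contra h; push Not at h; exact hkn h
    obtain ⟨X, hX⟩ := this
    obtain ⟨s, hs1, hs2, hs3⟩ := Om_sec hD hc hf hx.1 hk
    have h1 : ContinuousAt (fun x : Xpt p q => fderiv ℂ f x.1 X) x0 :=
      ContinuousAt.comp (f := Prod.fst) (continuousAt_dirDeriv hD hf X hx.1.1.1) continuousAt_fst
    have h2 : ContinuousAt (fun x : Xpt p q => fderiv ℂ f x.1 X *ᵥ s x) x0 := cont_mulV h1 hs1
    have h3 := h2.eventually_ne (by rw [hs2]; exact hX)
    filter_upwards [h3, hs3] with x hx1 hx2 hle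
    exact hx1 (hle hx2 X)
  refine ⟨dk x0, x0, ?_⟩
  have husc : ∀ᶠ x in 𝓝 x0, Module.finrank ℂ (Kz f x.1) ≤ dk x0 :=
    (continuousAt_fst (p := x0)).eventually (Kz_usc hD hf hx.1.1.1)
  filter_upwards [hopen, husc, Om_open hD hc hf hx.1] with x h1 h2 h3
  exact ⟨h3, h1, le_antisymm h2 (hmin x ⟨h3, h1⟩)⟩

/-- structure of the derivative at a point -/
theorem deriv_struct (hn : n + 2 ≤ 2 * q) {Z : Matrix (Fin p) (Fin q) ℂ} {O : Set (Fin q → ℂ)}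
    (hO : IsOpen O) (hOc : Convex ℝ O) (hOne : O.Nonempty) (hO0 : ∀ v ∈ O, v ≠ 0)
    (h : ∀ v ∈ O, ¬ Nd f Z v ≤ Kz f Z) :
    ∃ (κ : Matrix (Fin n) (Fin q) ℂ) (C : Matrix (Fin p') (Fin p) ℂ), C ≠ 0 ∧
      ∀ X, fderiv ℂ f Z X * κ = C * X := by
  let A : (Fin n → ℂ) →ₗ[ℂ] (Fin q → Fin p → Fin p' → ℂ) :=
    { toFun := fun k i j => fderiv ℂ f Z (Matrix.single j i 1) *ᵥ k
      map_add' := fun a b => by ext; simp [mulVec_add]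
      map_smul' := fun a b => by ext; simp [mulVec_smul] }
  have hA : ∀ k i j, A k i j = fderiv ℂ f Z (Matrix.single j i 1) *ᵥ k := fun _ _ _ => rfl
  have hAX : ∀ k (X : Matrix (Fin p) (Fin q) ℂ), fderiv ℂ f Z X *ᵥ k = ∑ j, ∑ i, X j i • A k i j := by
    intro k X
    conv_lhs => rw [Matrix.matrix_eq_sum_single X]
    rw [map_sum, Matrix.sum_mulVec]
    refine Finset.sum_congr rfl fun j _ => ?_
    rw [map_sum, Matrix.sum_mulVec]
    refine Finset.sum_congr rfl fun i _ => ?_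
    rw [hA, ← smul_mulVec, ← map_smul, Matrix.smul_single, smul_eq_mul, mul_one]
  have hfr : Module.finrank ℂ (LinearMap.range A) ≤ n := by
    have := LinearMap.finrank_range_le A
    simpa using this
  obtain ⟨v0, hv0⟩ := hOne
  obtain ⟨c, hc0, hcS⟩ := S_lemma hO hOc q ⊤ (LinearMap.range A) (by simp) (by omega) (by omega)
    ⟨v0, trivial, hv0⟩ (by
      intro v _ hvO
      obtain ⟨k, hk, hkn⟩ := SetLike.not_le_iff_exists.1 (h v hvO)
      have hd := star_dot_ne (hO0 v hvO)
      let η : Fin q → ℂ := (star v ⬝ᵥ v)⁻¹ • star v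
      have hη : η ⬝ᵥ v = 1 := by simp only [η, smul_dotProduct, smul_eq_mul, inv_mul_cancel₀ hd]
      let c : Fin p → Fin p' → ℂ := fun j => fderiv ℂ f Z (vecMulVec (Pi.single j 1) η) *ᵥ k
      have hAk : A k = tens v c := by
        ext i j a
        have : fderiv ℂ f Z (Matrix.single j i 1 - v i • vecMulVec (Pi.single j 1) η) *ᵥ k = 0 := by
          apply hk
          rw [sub_mulVec, smul_mulVec, vecMulVec_mulVec, hη, Matrix.single_mulVec]
          ext b
          by_cases hb : b = j
          · subst hb; simp
          · simp [hb, Function.update]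
        rw [map_sub, map_smul, sub_mulVec, smul_mulVec, sub_eq_zero] at this
        exact congrFun this a
      refine ⟨c, ?_, k, hAk⟩
      rintro hc0
      apply hkn
      intro X
      rw [hAX, hAk, hc0]
      simp [tens])
  choose κ hκ using fun i : Fin q => hcS (Pi.single i 1) trivial
  refine ⟨(Matrix.of κ)ᵀ, (Matrix.of c)ᵀ, ?_, fun X => ?_⟩
  · intro h0; apply hc0
    ext j a
    exact congrFun (congrFun h0 a) j
  · ext a i
    have h1 : (fderiv ℂ f Z X * (Matrix.of κ)ᵀ) a i = (fderiv ℂ f Z X *ᵥ κ i) a := rfl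
    rw [h1, hAX, hκ i]
    simp only [tens, Finset.sum_apply, Pi.smul_apply, smul_eq_mul, Matrix.mul_apply, Matrix.transpose_apply,
      Matrix.of_apply]
    refine Finset.sum_congr rfl fun j _ => ?_
    rw [Finset.sum_eq_single i]
    · simp [mul_comm]
    · intro b _ hb; simp [Pi.single_apply, hb]
    · simp

theorem kappa_inj {κ : Matrix (Fin n) (Fin q) ℂ} {C : Matrix (Fin p') (Fin p) ℂ}
    {Z : Matrix (Fin p) (Fin q) ℂ} (hC : C ≠ 0) (h : ∀ X, fderiv ℂ f Z X * κ = C * X)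
    {v : Fin q → ℂ} (hv : κ *ᵥ v ∈ Kz f Z) : v = 0 := by
  by_contra hv0
  have hd := star_dot_ne hv0
  apply hC
  ext a j
  have h1 := hv (vecMulVec (Pi.single j 1) (star v))
  rw [mulVec_mulVec, h, ← mulVec_mulVec, vecMulVec_mulVec] at h1
  have h2 := congrFun h1 a
  simp only [op_smul_eq_smul, mulVec_smul, mulVec_single_one] at h2
  simpa [hd, hv0] using h2

theorem kappa_dim {κ : Matrix (Fin n) (Fin q) ℂ} {C : Matrix (Fin p') (Fin p) ℂ}
    {Z : Matrix (Fin p) (Fin q) ℂ} (hC : C ≠ 0) (h : ∀ X, fderiv ℂ f Z X * κ = C * X) :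
    Module.finrank ℂ (Kz f Z) + q ≤ n := by
  let M : (Kz f Z × (Fin q → ℂ)) →ₗ[ℂ] (Fin n → ℂ) := LinearMap.coprod (Kz f Z).subtype κ.mulVecLin
  have hM : Function.Injective M := by
    rw [← LinearMap.ker_eq_bot, LinearMap.ker_eq_bot']
    rintro ⟨x, v⟩ hx
    have hx : (x : Fin n → ℂ) + κ *ᵥ v = 0 := hx
    have h1 : κ *ᵥ v ∈ Kz f Z := by
      rw [eq_neg_of_add_eq_zero_right hx]; exact (Kz f Z).neg_mem x.2
    have h2 := kappa_inj hC h h1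
    subst h2
    simp at hx
    ext <;> simp [hx]
  have := LinearMap.finrank_le_finrank_of_injective hM
  rw [Module.finrank_prod] at this
  simpa using this

theorem kappa_Nd {κ : Matrix (Fin n) (Fin q) ℂ} {C : Matrix (Fin p') (Fin p) ℂ}
    {Z : Matrix (Fin p) (Fin q) ℂ} (h : ∀ X, fderiv ℂ f Z X * κ = C * X) (v : Fin q → ℂ) :
    κ *ᵥ v ∈ Nd f Z v := by
  intro X hX
  rw [mulVec_mulVec, h, ← mulVec_mulVec, hX, mulVec_zero]

/-- a direction with small `Nd` exists -/
theorem exists_small_Nd {κ : Matrix (Fin n) (Fin q) ℂ} {C : Matrix (Fin p') (Fin p) ℂ}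
    {Z : Matrix (Fin p) (Fin q) ℂ} (hC : C ≠ 0) (h : ∀ X, fderiv ℂ f Z X * κ = C * X)
    (hn : n + 2 ≤ 2 * q) {O : Set (Fin q → ℂ)}
    (hO : IsOpen O) (hOne : O.Nonempty) (hO0 : ∀ v ∈ O, v ≠ 0) :
    ∃ v ∈ O, ∀ k ∈ Nd f Z v, ∃ a : ℂ, k - a • (κ *ᵥ v) ∈ Kz f Z := by
  by_contra hcon
  push Not at hcon
  obtain ⟨V, Vi, hV1, hV2, hVO⟩ := basis_in_open hO hOne
  choose k hk hka using fun i => hcon _ (hVO i)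
  let v : Fin q → Fin q → ℂ := fun i a => V a i
  let M : (Fin q → ℂ × ℂ) →ₗ[ℂ] (Fin n → ℂ) :=
    { toFun := fun x => ∑ i, ((x i).1 • (κ *ᵥ v i) + (x i).2 • k i)
      map_add' := fun a b => by
        rw [← Finset.sum_add_distrib]
        refine Finset.sum_congr rfl fun i _ => ?_
        simp only [Pi.add_apply, Prod.fst_add, Prod.snd_add, add_smul]; abel
      map_smul' := fun a b => by
        simp only [Pi.smul_apply, Prod.smul_fst, Prod.smul_snd, RingHom.id_apply, Finset.smul_sum, smul_add,
          smul_assoc] }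
  have hMi : Function.Injective M := by
    rw [← LinearMap.ker_eq_bot, LinearMap.ker_eq_bot']
    intro x hx
    have hx : ∑ i, ((x i).1 • (κ *ᵥ v i) + (x i).2 • k i) = 0 := hx
    ext l : 1
    set y : Fin q → Fin n → ℂ := fun i => (x i).1 • (κ *ᵥ v i) + (x i).2 • k i with hy
    have hyN : ∀ i, y i ∈ Nd f Z (v i) := fun i =>
      Submodule.add_mem _ (Submodule.smul_mem _ _ (kappa_Nd h _)) (Submodule.smul_mem _ _ (hk i))
    have hηv : ∀ i, Vi l ⬝ᵥ v i = if l = i then 1 else 0 := by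
      intro i
      have := congrFun (congrFun hV2 l) i
      rw [Matrix.one_apply] at this
      exact this
    have hK : y l ∈ Kz f Z := by
      apply Kz_of_Nd (η := Vi l) (by rw [hηv, if_pos rfl]) (hyN l)
      intro w
      have h1 : fderiv ℂ f Z (vecMulVec w (Vi l)) *ᵥ (∑ i, y i) = 0 := by rw [hx, mulVec_zero]
      rw [mulVec_sum, Finset.sum_eq_single l] at h1
      · exact h1
      · intro i _ hi
        apply hyN i
        rw [vecMulVec_mulVec, hηv, if_neg (Ne.symm hi)]
        simp
      · simp
    have hb : (x l).2 = 0 := by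
      by_contra hb
      apply hka l (-((x l).2⁻¹ * (x l).1))
      have h2 := (Kz f Z).smul_mem ((x l).2⁻¹) hK
      have e : (x l).2⁻¹ • y l = k l - (-((x l).2⁻¹ * (x l).1)) • (κ *ᵥ v l) := by
        simp only [hy, smul_add, smul_smul, inv_mul_cancel₀ hb, one_smul, neg_smul, sub_neg_eq_add]
        abel
      rw [e] at h2
      exact h2
    have ha : (x l).1 = 0 := by
      by_contra ha
      simp only [hy, hb, zero_smul, add_zero] at hK
      exact hO0 _ (hVO l) (kappa_inj hC h (((Kz f Z).smul_mem_iff ha).1 hK))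
    exact Prod.ext ha hb
  have := LinearMap.finrank_le_finrank_of_injective hMi
  rw [Module.finrank_pi_fintype, Module.finrank_fin_fun] at this
  simp only [Module.finrank_prod, Module.finrank_self, Finset.sum_const, Finset.card_univ, Fintype.card_fin,
    smul_eq_mul] at this
  omega

theorem Nd_dim {κ : Matrix (Fin n) (Fin q) ℂ} {C : Matrix (Fin p') (Fin p) ℂ}
    {Z : Matrix (Fin p) (Fin q) ℂ} (hC : C ≠ 0) (h : ∀ X, fderiv ℂ f Z X * κ = C * X)
    {v : Fin q → ℂ} (hv : v ≠ 0) :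
    (∀ k ∈ Nd f Z v, ∃ a : ℂ, k - a • (κ *ᵥ v) ∈ Kz f Z) ↔
      Module.finrank ℂ (Nd f Z v) ≤ Module.finrank ℂ (Kz f Z) + 1 := by
  let B : Submodule ℂ (Fin n → ℂ) := Kz f Z ⊔ Submodule.span ℂ {κ *ᵥ v}
  have hnot : κ *ᵥ v ∉ Kz f Z := fun hk => hv (kappa_inj hC h hk)
  have hne : κ *ᵥ v ≠ 0 := fun h0 => hnot (by rw [h0]; exact Submodule.zero_mem _)
  have hB : Module.finrank ℂ B = Module.finrank ℂ (Kz f Z) + 1 := by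
    have h1 := Submodule.finrank_sup_add_finrank_inf_eq (Kz f Z) (Submodule.span ℂ {κ *ᵥ v})
    have h2 : Kz f Z ⊓ Submodule.span ℂ {κ *ᵥ v} = ⊥ := by
      rw [eq_bot_iff]
      rintro x ⟨hx1, hx2⟩
      obtain ⟨a, rfl⟩ := Submodule.mem_span_singleton.1 hx2
      by_cases ha : a = 0
      · simp [ha]
      · exact absurd (((Kz f Z).smul_mem_iff ha).1 hx1) hnot
    rw [h2, finrank_bot, finrank_span_singleton hne] at h1
    omega
  have hBN : B ≤ Nd f Z v := sup_le (Kz_le_Nd Z v) (by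
    rw [Submodule.span_le, Set.singleton_subset_iff]; exact kappa_Nd h v)
  constructor
  · intro hk
    rw [← hB]
    apply Submodule.finrank_mono
    intro k hkN
    obtain ⟨a, ha⟩ := hk k hkN
    rw [Submodule.mem_sup]
    exact ⟨_, ha, a • (κ *ᵥ v), Submodule.smul_mem _ _ (Submodule.mem_span_singleton_self _), by abel⟩
  · intro hd k hk
    have hBe := Submodule.eq_of_le_of_finrank_le hBN (by rw [hB]; exact hd)
    rw [← hBe, Submodule.mem_sup] at hk
    obtain ⟨y, hy, z, hz, rfl⟩ := hk
    obtain ⟨a, rfl⟩ := Submodule.mem_span_singleton.1 hz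
    exact ⟨a, by simpa using hy⟩

include hD hc hf in
theorem stage5 (hn : n + 2 ≤ 2 * q) (hnp : n < p)
    (hO : ∃ x ∈ Om D f, ¬ Kvb D f x.1 x.2.1 x.2.2 ≤ Kz f x.1) :
    ∃ (m : ℕ) (Z0 : Matrix (Fin p) (Fin q) ℂ) (v0 : Fin q → ℂ) (b0 : Fin p → ℂ) (ε : ℝ)
      (κ : Matrix (Fin p) (Fin q) ℂ → Matrix (Fin n) (Fin q) ℂ)
      (C : Matrix (Fin p) (Fin q) ℂ → Matrix (Fin p') (Fin p) ℂ), 0 < ε ∧ m + q ≤ n ∧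
      (∀ Z ∈ Metric.ball Z0 ε, Z ∈ D ∧ Module.finrank ℂ (Kz f Z) = m ∧ C Z ≠ 0 ∧
        ∀ X, fderiv ℂ f Z X * κ Z = C Z * X) ∧
      (∀ Z ∈ Metric.ball Z0 ε, ∀ v ∈ Metric.ball v0 ε, v ≠ 0 ∧
        (∀ k ∈ Nd f Z v, ∃ a : ℂ, k - a • (κ Z *ᵥ v) ∈ Kz f Z) ∧ ¬ Ninf D f Z v ≤ Kz f Z) ∧
      (∀ Z ∈ Metric.ball Z0 ε, ∀ v ∈ Metric.ball v0 ε, ∀ b ∈ Metric.ball b0 ε,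
        (Z, v, b) ∈ Om D f ∧ Kvb D f Z v b = Ninf D f Z v) := by
  obtain ⟨m, ⟨Z0, v0, b0⟩, hev⟩ := stage3 hD hc hf hO
  obtain ⟨ε, hε, hB⟩ := Metric.eventually_nhds_iff_ball.1 hev
  have hB' : ∀ Z ∈ Metric.ball Z0 ε, ∀ v ∈ Metric.ball v0 ε, ∀ b ∈ Metric.ball b0 ε,
      (Z, v, b) ∈ Om D f ∧ ¬ Kvb D f Z v b ≤ Kz f Z ∧ Module.finrank ℂ (Kz f Z) = m := by
    intro Z hZ v hv b hb
    apply hB (Z, v, b)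
    rw [← ball_prod_same, ← ball_prod_same]
    exact ⟨hZ, hv, hb⟩
  have hZ0 := Metric.mem_ball_self (x := Z0) hε
  have hv0 := Metric.mem_ball_self (x := v0) hε
  have hb0 := Metric.mem_ball_self (x := b0) hε
  have hst : ∀ Z ∈ Metric.ball Z0 ε, ∃ (κ : Matrix (Fin n) (Fin q) ℂ) (C : Matrix (Fin p') (Fin p) ℂ), C ≠ 0 ∧
      ∀ X, fderiv ℂ f Z X * κ = C * X := by
    intro Z hZ
    apply deriv_struct hn Metric.isOpen_ball (convex_ball v0 ε) ⟨v0, hv0⟩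
    · intro v hv
      exact (hB' Z hZ v hv b0 hb0).1.1.2.1
    · intro v hv hle
      have h1 := hB' Z hZ v hv b0 hb0
      exact h1.2.1 ((Kvb_le_Nd hD hc hf hnp h1.1).trans hle)
  choose! κ C hC hκ using hst
  have hv0n : ∀ v ∈ Metric.ball v0 ε, v ≠ 0 := fun v hv => (hB' Z0 hZ0 v hv b0 hb0).1.1.2.1
  obtain ⟨v1, hv1, hN⟩ := exists_small_Nd (hC Z0 hZ0) (hκ Z0 hZ0) hn (Metric.isOpen_ball (x := v0) (ε := ε))
    ⟨v0, hv0⟩ hv0n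
  have hm : m + q ≤ n := by
    have := kappa_dim (hC Z0 hZ0) (hκ Z0 hZ0)
    rw [(hB' Z0 hZ0 v0 hv0 b0 hb0).2.2] at this
    exact this
  have hd := (Nd_dim (hC Z0 hZ0) (hκ Z0 hZ0) (hv0n v1 hv1)).1 hN
  have hus := Nd_usc hD hf (Z := Z0) (hB' Z0 hZ0 v0 hv0 b0 hb0).1.1.1 (hv0n v1 hv1)
  obtain ⟨δ, hδ, hU⟩ := Metric.eventually_nhds_iff_ball.1 hus
  obtain ⟨δ2, hδ2, hball⟩ := Metric.isOpen_iff.1 (Metric.isOpen_ball (x := v0) (ε := ε)) v1 hv1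
  refine ⟨m, Z0, v1, b0, min ε (min δ δ2), κ, C, by positivity, hm, ?_, ?_, ?_⟩
  · intro Z hZ
    have hZ := Metric.ball_subset_ball (min_le_left _ _) hZ
    have := hB' Z hZ v0 hv0 b0 hb0
    exact ⟨this.1.1.1, this.2.2, hC Z hZ, hκ Z hZ⟩
  all_goals
    have hNdd : ∀ Z ∈ Metric.ball Z0 (min ε (min δ δ2)), ∀ v ∈ Metric.ball v1 (min ε (min δ δ2)),
        Z ∈ Metric.ball Z0 ε ∧ v ∈ Metric.ball v0 ε ∧ Module.finrank ℂ (Nd f Z v) ≤ m + 1 := by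
      intro Z hZ v hv
      have hZ1 := Metric.ball_subset_ball (min_le_left _ _) hZ
      have hv1' := hball (Metric.ball_subset_ball ((min_le_right _ _).trans (min_le_right _ _)) hv)
      refine ⟨hZ1, hv1', ?_⟩
      have h1 : Module.finrank ℂ (Nd f Z v) ≤ Module.finrank ℂ (Nd f Z0 v1) := hU (Z, v) (by
        rw [← ball_prod_same]
        exact ⟨Metric.ball_subset_ball ((min_le_right _ _).trans (min_le_left _ _)) hZ,
          Metric.ball_subset_ball ((min_le_right _ _).trans (min_le_left _ _)) hv⟩)
      have h2 := (hB' Z0 hZ0 v0 hv0 b0 hb0).2.2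
      omega
    have hKN : ∀ Z ∈ Metric.ball Z0 (min ε (min δ δ2)), ∀ v ∈ Metric.ball v1 (min ε (min δ δ2)),
        ∀ b ∈ Metric.ball b0 ε, (Z, v, b) ∈ Om D f ∧ Kvb D f Z v b = Ninf D f Z v := by
      intro Z hZ v hv b hb
      obtain ⟨h1, h2, h3⟩ := hNdd Z hZ v hv
      have h4 := hB' Z h1 v h2 b hb
      refine ⟨h4.1, le_antisymm ?_ (Ninf_le_Kvb Z v b)⟩
      have h5 : Submodule.span ℂ (VS D f Z v) ≤ Nd f Z v := by
        rw [Submodule.span_le]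
        rintro k ⟨b', hb', hk⟩
        exact Kvb_le_Nd hD hc hf hnp hb' hk
      have h6 := Submodule.finrank_mono h5
      have h7 := span_le_Ninf hD hc hf (Z := Z) (v := v) h4.1.1.1 h4.1.1.2.1 (by omega)
      intro k hk
      exact h7 (Submodule.subset_span ⟨b, h4.1, hk⟩)
  · intro Z hZ v hv
    obtain ⟨h1, h2, h3⟩ := hNdd Z hZ v hv
    have h4 := hB' Z h1 v h2 b0 hb0
    refine ⟨h4.1.1.2.1, (Nd_dim (hC Z h1) (hκ Z h1) h4.1.1.2.1).2 (by rw [h4.2.2]; exact h3), ?_⟩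
    rw [← (hKN Z hZ v hv b0 hb0).2]
    exact h4.2.1
  · intro Z hZ v hv b hb
    exact hKN Z hZ v hv b (Metric.ball_subset_ball (min_le_left _ _) hb)
end


/-- local data produced by `stage5` -/
structure Loc {p q p' n : ℕ} (D : Set (Matrix (Fin p) (Fin q) ℂ))
    (f : Matrix (Fin p) (Fin q) ℂ → Matrix (Fin p') (Fin n) ℂ)
    (U : Set (Matrix (Fin p) (Fin q) ℂ)) (O : Set (Fin q → ℂ)) (b0 : Fin p → ℂ)
    (κ : Matrix (Fin p) (Fin q) ℂ → Matrix (Fin n) (Fin q) ℂ)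
    (C : Matrix (Fin p) (Fin q) ℂ → Matrix (Fin p') (Fin p) ℂ) : Prop where
  hU : IsOpen U
  hO : IsOpen O
  hUD : U ⊆ D
  hC : ∀ Z ∈ U, C Z ≠ 0
  hκ : ∀ Z ∈ U, ∀ X, fderiv ℂ f Z X * κ Z = C Z * X
  hv0 : ∀ v ∈ O, v ≠ 0
  hNd : ∀ Z ∈ U, ∀ v ∈ O, ∀ k ∈ Nd f Z v, ∃ a : ℂ, k - a • (κ Z *ᵥ v) ∈ Kz f Z
  hNn : ∀ Z ∈ U, ∀ v ∈ O, ¬ Ninf D f Z v ≤ Kz f Z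
  hOm : ∀ Z ∈ U, ∀ v ∈ O, (Z, v, b0) ∈ Om D f
  hKN : ∀ Z ∈ U, ∀ v ∈ O, Kvb D f Z v b0 = Ninf D f Z v

section
variable {p q p' n : ℕ}

def SP (D : Set (Matrix (Fin p) (Fin q) ℂ))
    (f : Matrix (Fin p) (Fin q) ℂ → Matrix (Fin p') (Fin n) ℂ) (O : Set (Fin q → ℂ))
    (Z : Matrix (Fin p) (Fin q) ℂ) (G : Submodule ℂ (Fin q → ℂ)) : Submodule ℂ (Fin n → ℂ) :=
  Submodule.span ℂ {k | ∃ v ∈ G, v ∈ O ∧ k ∈ Ninf D f Z v}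

variable {D : Set (Matrix (Fin p) (Fin q) ℂ)}
  {f : Matrix (Fin p) (Fin q) ℂ → Matrix (Fin p') (Fin n) ℂ}
  {U : Set (Matrix (Fin p) (Fin q) ℂ)} {O : Set (Fin q → ℂ)} {b0 : Fin p → ℂ}
  {κ : Matrix (Fin p) (Fin q) ℂ → Matrix (Fin n) (Fin q) ℂ}
  {C : Matrix (Fin p) (Fin q) ℂ → Matrix (Fin p') (Fin p) ℂ}

theorem SP_mono {Z : Matrix (Fin p) (Fin q) ℂ} {G H : Submodule ℂ (Fin q → ℂ)} (h : G ≤ H) :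
    SP D f O Z G ≤ SP D f O Z H := by
  apply Submodule.span_mono
  rintro k ⟨v, hv, hvO, hk⟩
  exact ⟨v, h hv, hvO, hk⟩

theorem span_inter_open (hO : IsOpen O) {G : Submodule ℂ (Fin q → ℂ)} (hne : ∃ v ∈ G, v ∈ O) :
    Submodule.span ℂ {v | v ∈ G ∧ v ∈ O} = G := by
  apply le_antisymm
  · rw [Submodule.span_le]; exact fun v hv => hv.1
  · intro x hx
    obtain ⟨v, hvG, hv⟩ := hne
    obtain ⟨t, ht, ht0⟩ := ((exists_small hO hv x).and self_mem_nhdsWithin).exists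
    have ht0 : t ≠ 0 := ht0
    have h1 := Submodule.sub_mem _ (Submodule.subset_span (R := ℂ) (s := {v | v ∈ G ∧ v ∈ O})
        (show v + t • x ∈ {v | v ∈ G ∧ v ∈ O} from ⟨G.add_mem hvG (G.smul_mem t hx), ht⟩))
      (Submodule.subset_span (R := ℂ) (s := {v | v ∈ G ∧ v ∈ O}) (show v ∈ _ from ⟨hvG, hv⟩))
    rw [add_sub_cancel_left] at h1
    exact (Submodule.smul_mem_iff _ ht0).1 h1

variable (hD : IsOpen D) (hc : Convex ℝ D) (hf : DifferentiableOn ℂ f D)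
  (hL : Loc D f U O b0 κ C)

include hD hf hL

/-- normalised element of `Ninf` -/
theorem Loc.exists_norm {Z : Matrix (Fin p) (Fin q) ℂ} (hZ : Z ∈ U) {v : Fin q → ℂ} (hv : v ∈ O) :
    ∃ k ∈ Ninf D f Z v, k - κ Z *ᵥ v ∈ Kz f Z := by
  obtain ⟨k, hk, hkn⟩ := SetLike.not_le_iff_exists.1 (hL.hNn Z hZ v hv)
  obtain ⟨a, ha⟩ := hL.hNd Z hZ v hv k (Ninf_le_Nd hD hf (hL.hUD hZ) v hk)
  have ha0 : a ≠ 0 := by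
    rintro rfl
    apply hkn
    simpa using ha
  refine ⟨a⁻¹ • k, Submodule.smul_mem _ _ hk, ?_⟩
  have := (Kz f Z).smul_mem a⁻¹ ha
  rwa [smul_sub, smul_smul, inv_mul_cancel₀ ha0, one_smul] at this

theorem Loc.map_SP {Z : Matrix (Fin p) (Fin q) ℂ} (hZ : Z ∈ U) {G : Submodule ℂ (Fin q → ℂ)}
    (hne : ∃ v ∈ G, v ∈ O) :
    (SP D f O Z G).map (Kz f Z).mkQ = G.map ((Kz f Z).mkQ ∘ₗ (κ Z).mulVecLin) := by
  apply le_antisymm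
  · rw [SP, Submodule.map_span, Submodule.span_le]
    rintro _ ⟨k, ⟨v, hvG, hvO, hk⟩, rfl⟩
    obtain ⟨a, ha⟩ := hL.hNd Z hZ v hvO k (Ninf_le_Nd hD hf (hL.hUD hZ) v hk)
    refine ⟨a • v, G.smul_mem _ hvG, ?_⟩
    show (Kz f Z).mkQ (κ Z *ᵥ (a • v)) = _
    rw [mulVec_smul]
    symm
    rw [← sub_eq_zero, ← map_sub]
    exact (Submodule.Quotient.mk_eq_zero _).2 ha
  · conv_lhs => rw [← span_inter_open hL.hO hne]
    rw [Submodule.map_span, Submodule.span_le]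
    rintro _ ⟨v, ⟨hvG, hvO⟩, rfl⟩
    obtain ⟨k, hk, hkv⟩ := hL.exists_norm hD hf hZ hvO
    refine ⟨k, Submodule.subset_span ⟨v, hvG, hvO, hk⟩, ?_⟩
    show _ = (Kz f Z).mkQ (κ Z *ᵥ v)
    rw [← sub_eq_zero, ← map_sub]
    exact (Submodule.Quotient.mk_eq_zero _).2 hkv

theorem Loc.SP_dim {Z : Matrix (Fin p) (Fin q) ℂ} (hZ : Z ∈ U) {G : Submodule ℂ (Fin q → ℂ)}
    (hne : ∃ v ∈ G, v ∈ O) :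
    Module.finrank ℂ G + Module.finrank ℂ (SP D f O Z G ⊓ Kz f Z : Submodule ℂ (Fin n → ℂ)) =
      Module.finrank ℂ (SP D f O Z G) := by
  have h1 := finrank_map_inf (SP D f O Z G) (Kz f Z).mkQ
  rw [hL.map_SP hD hf hZ hne, Submodule.ker_mkQ] at h1
  have hi : Function.Injective ((Kz f Z).mkQ ∘ₗ (κ Z).mulVecLin) := ?_
  · rw [← h1, LinearEquiv.finrank_eq (Submodule.equivMapOfInjective _ hi G)]
  rw [← LinearMap.ker_eq_bot, LinearMap.ker_eq_bot']
  intro v hv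
  apply kappa_inj (hL.hC Z hZ) (hL.hκ Z hZ)
  exact (Submodule.Quotient.mk_eq_zero _).1 hv

set_option maxHeartbeats 800000 in
include hc in
theorem Loc.SP_lsc {Z1 : Matrix (Fin p) (Fin q) ℂ} (hZ : Z1 ∈ U) {H G : Submodule ℂ (Fin q → ℂ)}
    {η0 x0 : Fin q → ℂ} (hη : η0 ⬝ᵥ x0 ≠ 0) (hH : ∀ v ∈ H, η0 ⬝ᵥ v = 0) (hHG : H ≤ G) (hx0 : x0 ∈ G) :
    ∀ᶠ y in 𝓝 (Z1, η0), Module.finrank ℂ (SP D f O Z1 H) ≤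
      Module.finrank ℂ (SP D f O y.1 (G ⊓ LinearMap.ker (dotL y.2))) := by
  obtain ⟨N, hN, g, hg, hli⟩ : ∃ N, N = Module.finrank ℂ (SP D f O Z1 H) ∧ ∃ g : Fin N → Fin n → ℂ,
      (∀ l, g l ∈ {k | ∃ v ∈ H, v ∈ O ∧ k ∈ Ninf D f Z1 v}) ∧ LinearIndependent ℂ g := by
    obtain ⟨g, hg, hgs, hli⟩ := Submodule.exists_fun_fin_finrank_span_eq ℂ
      {k | ∃ v ∈ H, v ∈ O ∧ k ∈ Ninf D f Z1 v}
    exact ⟨_, rfl, g, hg, hli⟩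
  choose v hvH hvO hgN using hg
  have hsec : ∀ l, ∃ s : Xpt p q → Fin n → ℂ, ContinuousAt s (Z1, v l, b0) ∧ s (Z1, v l, b0) = g l ∧
      ∀ᶠ y in 𝓝 (Z1, v l, b0), s y ∈ Kvb D f y.1 y.2.1 y.2.2 := by
    intro l
    refine Om_sec hD hc hf (x := (Z1, v l, b0)) (hL.hOm Z1 hZ (v l) (hvO l)) ?_
    show g l ∈ Kvb D f Z1 (v l) b0
    rw [hL.hKN Z1 hZ (v l) (hvO l)]
    exact hgN l
  choose s hs1 hs2 hs3 using hsec
  let T : ∀ l, Matrix (Fin p) (Fin q) ℂ × (Fin q → ℂ) → Fin q → ℂ :=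
    fun l y => v l - ((y.2 ⬝ᵥ v l) / (y.2 ⬝ᵥ x0)) • x0
  have hd : ∀ x : Fin q → ℂ, ContinuousAt (fun y : Matrix (Fin p) (Fin q) ℂ × (Fin q → ℂ) => y.2 ⬝ᵥ x) (Z1, η0) :=
    fun x => (Continuous.dotProduct continuous_snd continuous_const).continuousAt
  have hT : ∀ l, ContinuousAt (T l) (Z1, η0) := by
    intro l
    exact continuousAt_const.sub (((hd (v l)).div (hd x0) hη).smul continuousAt_const)
  have hT0 : ∀ l, T l (Z1, η0) = v l := by
    intro l
    show v l - ((η0 ⬝ᵥ v l) / (η0 ⬝ᵥ x0)) • x0 = v l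
    rw [hH (v l) (hvH l)]; simp
  let P : ∀ l, Matrix (Fin p) (Fin q) ℂ × (Fin q → ℂ) → Xpt p q := fun l y => (y.1, T l y, b0)
  have hP : ∀ l, ContinuousAt (P l) (Z1, η0) := fun l => continuousAt_fst.prodMk ((hT l).prodMk continuousAt_const)
  have hP0 : ∀ l, P l (Z1, η0) = (Z1, v l, b0) := by
    intro l; show (Z1, T l (Z1, η0), b0) = _; rw [hT0]
  have hS : ContinuousAt (fun y l => s l (P l y)) (Z1, η0) := by
    rw [continuousAt_pi]
    intro l
    refine ContinuousAt.comp ?_ (hP l)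
    rw [hP0]; exact hs1 l
  have hS0 : (fun l => s l (P l (Z1, η0))) = g := by
    funext l; rw [hP0, hs2]
  have e1 : ∀ᶠ y in 𝓝 (Z1, η0), LinearIndependent ℂ (fun l => s l (P l y)) := by
    have hev : ∀ᶠ g' in 𝓝 g, LinearIndependent ℂ g' := hli.eventually
    have hS' : Tendsto (fun y l => s l (P l y)) (𝓝 (Z1, η0)) (𝓝 g) := by
      rw [← hS0]; exact hS
    exact hS'.eventually hev
  have e2 : ∀ᶠ y in 𝓝 (Z1, η0), ∀ l, s l (P l y) ∈ Kvb D f (P l y).1 (P l y).2.1 (P l y).2.2 := by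
    rw [eventually_all]
    intro l
    have hP' : Tendsto (P l) (𝓝 (Z1, η0)) (𝓝 (Z1, v l, b0)) := by rw [← hP0 l]; exact hP l
    exact hP'.eventually (hs3 l)
  have e3 : ∀ᶠ y in 𝓝 (Z1, η0), ∀ l, T l y ∈ O := by
    rw [eventually_all]
    intro l
    have hT' : Tendsto (T l) (𝓝 (Z1, η0)) (𝓝 (v l)) := by rw [← hT0 l]; exact hT l
    exact hT'.eventually (hL.hO.mem_nhds (hvO l))
  have e4 : ∀ᶠ y in 𝓝 (Z1, η0), y.1 ∈ U :=
    (continuousAt_fst (p := (Z1, η0))).eventually (hL.hU.mem_nhds hZ)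
  have e5 : ∀ᶠ y in 𝓝 (Z1, η0), y.2 ⬝ᵥ x0 ≠ 0 := (hd x0).eventually_ne hη
  filter_upwards [e1, e2, e3, e4, e5] with y h1 h2 h3 h4 h5
  have := finrank_span_eq_card h1
  rw [Fintype.card_fin] at this
  rw [← hN, ← this]
  apply Submodule.finrank_mono
  rw [Submodule.span_le]
  rintro _ ⟨l, rfl⟩
  refine Submodule.subset_span ⟨T l y, ⟨G.sub_mem (hHG (hvH l)) (G.smul_mem _ hx0), ?_⟩, h3 l, ?_⟩
  · refine LinearMap.mem_ker.2 ?_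
    rw [dotL_apply]
    simp only [T, dotProduct_sub, dotProduct_smul, smul_eq_mul]
    field_simp; ring
  · rw [← hL.hKN y.1 h4 _ (h3 l)]
    exact h2 l
end


section
variable {p q p' n : ℕ}
variable {D : Set (Matrix (Fin p) (Fin q) ℂ)}
  {f : Matrix (Fin p) (Fin q) ℂ → Matrix (Fin p') (Fin n) ℂ}
  {U : Set (Matrix (Fin p) (Fin q) ℂ)} {O : Set (Fin q → ℂ)} {b0 : Fin p → ℂ}
  {κ : Matrix (Fin p) (Fin q) ℂ → Matrix (Fin n) (Fin q) ℂ}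
  {C : Matrix (Fin p) (Fin q) ℂ → Matrix (Fin p') (Fin p) ℂ}

theorem SP_ker {Z : Matrix (Fin p) (Fin q) ℂ} {G : Submodule ℂ (Fin q → ℂ)} {η : Fin q → ℂ}
    {w : Fin p → ℂ} (hZ : Z + vecMulVec w η ∈ D) {k : Fin n → ℂ}
    (hk : k ∈ SP D f O Z (G ⊓ LinearMap.ker (dotL η))) :
    f (Z + vecMulVec w η) *ᵥ k = f Z *ᵥ k ∧
      k ∈ SP D f O (Z + vecMulVec w η) (G ⊓ LinearMap.ker (dotL η)) := by
  have key : ∀ v : Fin q → ℂ, v ∈ LinearMap.ker (dotL η) → (Z + vecMulVec w η) *ᵥ v = Z *ᵥ v := by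
    intro v hv
    have hv : η ⬝ᵥ v = 0 := by rw [← dotL_apply]; exact LinearMap.mem_ker.1 hv
    rw [add_mulVec, vecMulVec_mulVec, hv]; simp
  induction hk using Submodule.span_induction with
  | mem k hk =>
    obtain ⟨v, hv, hvO, hk⟩ := hk
    have h1 := hk _ hZ (key v hv.2)
    refine ⟨h1, Submodule.subset_span ⟨v, hv, hvO, ?_⟩⟩
    intro Z' hZ' hv'
    rw [h1]
    exact hk Z' hZ' (hv'.trans (key v hv.2))
  | zero => exact ⟨by simp, Submodule.zero_mem _⟩
  | add a b _ _ ha hb => exact ⟨by rw [mulVec_add, mulVec_add, ha.1, hb.1], Submodule.add_mem _ ha.2 hb.2⟩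
  | smul a b _ hb => exact ⟨by rw [mulVec_smul, mulVec_smul, hb.1], Submodule.smul_mem _ _ hb.2⟩

variable (hD : IsOpen D) (hc : Convex ℝ D) (hf : DifferentiableOn ℂ f D)
  (hL : Loc D f U O b0 κ C)

include hD hf hL

include hc in
theorem Loc.C_ne {Z1 : Matrix (Fin p) (Fin q) ℂ} (hZ : Z1 ∈ U) (hOne : O.Nonempty) {w0 : Fin p → ℂ}
    (hw0 : C Z1 *ᵥ w0 ≠ 0) : ∀ᶠ y in 𝓝 (Z1, w0), C y.1 *ᵥ y.2 ≠ 0 := by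
  obtain ⟨v0, hv0⟩ := hOne
  have hd := star_dot_ne (hL.hv0 v0 hv0)
  obtain ⟨k, hk, hkκ⟩ := hL.exists_norm hD hf hZ hv0
  obtain ⟨s, hs1, hs2, hs3⟩ := Om_sec hD hc hf (x := (Z1, v0, b0)) (hL.hOm Z1 hZ v0 hv0) (k := k)
    (by show k ∈ Kvb D f Z1 v0 b0; rw [hL.hKN Z1 hZ v0 hv0]; exact hk)
  have key : ∀ Z ∈ U, ∀ w k a, k - a • (κ Z *ᵥ v0) ∈ Kz f Z →
      fderiv ℂ f Z (vecMulVec w (star v0)) *ᵥ k = (a * (star v0 ⬝ᵥ v0)) • (C Z *ᵥ w) := by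
    intro Z hZ w k a hk
    have h1 := hk (vecMulVec w (star v0))
    rw [mulVec_sub, sub_eq_zero] at h1
    rw [h1, mulVec_smul, mulVec_mulVec, hL.hκ Z hZ, ← mulVec_mulVec, vecMulVec_mulVec, op_smul_eq_smul,
      mulVec_smul, smul_smul]
  let P : Matrix (Fin p) (Fin q) ℂ × (Fin p → ℂ) → Xpt p q := fun y => (y.1, v0, b0)
  have hP : Tendsto P (𝓝 (Z1, w0)) (𝓝 (Z1, v0, b0)) :=
    (continuousAt_fst.prodMk continuousAt_const : ContinuousAt P (Z1, w0))
  have c1 : ContinuousAt (fun y : Matrix (Fin p) (Fin q) ℂ × (Fin p → ℂ) => fderiv ℂ f y.1) (Z1, w0) :=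
    ContinuousAt.comp (f := Prod.fst) (cont_fderiv hD hf (hL.hUD hZ)) continuousAt_fst
  have c2 : ContinuousAt (fun y : Matrix (Fin p) (Fin q) ℂ × (Fin p → ℂ) => vecMulVec y.2 (star v0)) (Z1, w0) :=
    (Continuous.matrix_vecMulVec continuous_snd continuous_const).continuousAt
  have c3 : ContinuousAt (fun y : Matrix (Fin p) (Fin q) ℂ × (Fin p → ℂ) =>
      fderiv ℂ f y.1 (vecMulVec y.2 (star v0))) (Z1, w0) := c1.clm_apply c2
  have c4 : ContinuousAt (fun y => s (P y)) (Z1, w0) := ContinuousAt.comp hs1 hP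
  have c5 := cont_mulV c3 c4
  have e0 := c5.eventually_ne (y := 0) (by
    show fderiv ℂ f Z1 (vecMulVec w0 (star v0)) *ᵥ s (Z1, v0, b0) ≠ 0
    rw [hs2, key Z1 hZ w0 k 1 (by simpa using hkκ), one_mul]
    exact smul_ne_zero hd hw0)
  have e1 : ∀ᶠ y in 𝓝 (Z1, w0), y.1 ∈ U :=
    (continuousAt_fst (p := (Z1, w0))).eventually (hL.hU.mem_nhds hZ)
  filter_upwards [e0, e1, hP.eventually hs3] with y h0 h1 h2
  have h2 : s (P y) ∈ Kvb D f y.1 v0 b0 := h2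
  rw [hL.hKN y.1 h1 v0 hv0] at h2
  obtain ⟨a, ha⟩ := hL.hNd y.1 h1 v0 hv0 _ (Ninf_le_Nd hD hf (hL.hUD h1) v0 h2)
  intro hcw
  apply h0
  rw [key y.1 h1 _ _ a ha, hcw, smul_zero]

theorem Loc.step {Z : Matrix (Fin p) (Fin q) ℂ} {G : Submodule ℂ (Fin q → ℂ)} {η0 : Fin q → ℂ} {r : ℝ}
    {w : Fin p → ℂ} {e : Fin n → ℂ} {η : Fin q → ℂ} (hG : ∃ v ∈ G, v ∈ O)
    (hη : η ∈ Metric.ball η0 r) (hZ' : Z + vecMulVec w η ∈ U)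
    (hP : ∀ η ∈ Metric.ball η0 r, e ∈ SP D f O Z (G ⊓ LinearMap.ker (dotL η)))
    (hC : C (Z + vecMulVec w η) *ᵥ w ≠ 0) :
    e ∈ SP D f O (Z + vecMulVec w η) G ⊓ Kz f (Z + vecMulVec w η) ∧
      f (Z + vecMulVec w η) *ᵥ e = f Z *ᵥ e := by
  obtain ⟨h1, h2⟩ := SP_ker (hL.hUD hZ') (hP η hη)
  have h3 := SP_mono (inf_le_left (a := G)) h2
  refine ⟨⟨h3, ?_⟩, h1⟩
  have h4 : (Kz f (Z + vecMulVec w η)).mkQ e ∈ (SP D f O (Z + vecMulVec w η) G).map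
    (Kz f (Z + vecMulVec w η)).mkQ := ⟨e, h3, rfl⟩
  rw [hL.map_SP hD hf hZ' hG] at h4
  obtain ⟨x, hx, hxe⟩ := h4
  have hxe' : e - κ (Z + vecMulVec w η) *ᵥ x ∈ Kz f (Z + vecMulVec w η) := by
    refine (Submodule.Quotient.mk_eq_zero _).1 ?_
    have hxe : (Kz f (Z + vecMulVec w η)).mkQ (κ (Z + vecMulVec w η) *ᵥ x) = _ := hxe
    show (Kz f (Z + vecMulVec w η)).mkQ (e - _) = 0
    rw [map_sub, hxe, sub_self]
  have h5 : ∀ η', fderiv ℂ f (Z + vecMulVec w η) (vecMulVec w η') *ᵥ e = 0 := by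
    intro η'
    apply dirDeriv_zero hD hf (hL.hUD hZ')
    have hcn : Continuous (fun t : ℂ => η + t • η') := by fun_prop
    have e1 : ∀ᶠ t in 𝓝 (0:ℂ), η + t • η' ∈ Metric.ball η0 r :=
      hcn.continuousAt.eventually (Metric.isOpen_ball.mem_nhds (by simpa using hη))
    filter_upwards [e1, near_line hD (hL.hUD hZ') (vecMulVec w η')] with t ht1 ht2
    have e2 : Z + vecMulVec w η + t • vecMulVec w η' = Z + vecMulVec w (η + t • η') := by
      rw [vecMulVec_add, vecMulVec_smul, add_assoc]
    rw [e2] at ht2 ⊢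
    rw [(SP_ker ht2 (hP _ ht1)).1, h1]
  have hx0 : x = 0 := by
    by_contra hx0
    have hd := star_dot_ne hx0
    have h6 := hxe' (vecMulVec w (star x))
    rw [mulVec_sub, h5, zero_sub, neg_eq_zero, mulVec_mulVec, hL.hκ _ hZ', ← mulVec_mulVec, vecMulVec_mulVec,
      op_smul_eq_smul, mulVec_smul] at h6
    exact smul_ne_zero hd hC h6
  rw [hx0, mulVec_zero, sub_zero] at hxe'
  exact hxe'

include hc in
theorem Loc.core (hK : ∀ k, (∀ Z ∈ D, ∀ Z' ∈ D, f Z *ᵥ k = f Z' *ᵥ k) → k = 0)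
    {Z1 : Matrix (Fin p) (Fin q) ℂ} (hZ : Z1 ∈ U) {G : Submodule ℂ (Fin q → ℂ)} {η0 : Fin q → ℂ}
    (hG : ∃ v ∈ G, v ∈ O)
    (hP : ∀ᶠ y in 𝓝 (Z1, η0), SP D f O y.1 G ⊓ Kz f y.1 ≤ SP D f O y.1 (G ⊓ LinearMap.ker (dotL y.2))) :
    SP D f O Z1 G ⊓ Kz f Z1 = ⊥ := by
  rw [eq_bot_iff]
  intro e he
  refine (Submodule.mem_bot ℂ).2 (hK e ?_)
  obtain ⟨w0, hw0⟩ : ∃ w0, C Z1 *ᵥ w0 ≠ 0 := by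
    by_contra h; push Not at h
    apply hL.hC Z1 hZ
    ext i j
    have := congrFun (h (Pi.single j 1)) i
    simpa using this
  have hCn := hL.C_ne hD hc hf hZ (by obtain ⟨v, _, hv⟩ := hG; exact ⟨v, hv⟩) hw0
  obtain ⟨r1, hr1, hB1⟩ := Metric.eventually_nhds_iff_ball.1 hP
  obtain ⟨r2, hr2, hB2⟩ := Metric.eventually_nhds_iff_ball.1 hCn
  obtain ⟨r3, hr3, hB3⟩ := Metric.isOpen_iff.1 hL.hU Z1 hZ
  obtain ⟨r, hr, hrr1, hrr2, hrr3⟩ : ∃ r > 0, r ≤ r1 ∧ r ≤ r2 ∧ r ≤ r3 :=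
    ⟨min r1 (min r2 r3), by positivity, min_le_left _ _, (min_le_right _ _).trans (min_le_left _ _),
      (min_le_right _ _).trans (min_le_right _ _)⟩
  have b1 : ∀ Z ∈ Metric.ball Z1 r, ∀ η ∈ Metric.ball η0 r,
      SP D f O Z G ⊓ Kz f Z ≤ SP D f O Z (G ⊓ LinearMap.ker (dotL η)) := by
    intro Z hZ η hη
    refine hB1 (Z, η) ?_
    rw [← ball_prod_same]
    exact ⟨Metric.ball_subset_ball hrr1 hZ, Metric.ball_subset_ball hrr1 hη⟩
  have b2 : ∀ Z ∈ Metric.ball Z1 r, ∀ w ∈ Metric.ball w0 r, C Z *ᵥ w ≠ 0 := by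
    intro Z hZ η hη
    refine hB2 (Z, η) ?_
    rw [← ball_prod_same]
    exact ⟨Metric.ball_subset_ball hrr2 hZ, Metric.ball_subset_ball hrr2 hη⟩
  have b3 : Metric.ball Z1 r ⊆ U := (Metric.ball_subset_ball hrr3).trans hB3
  obtain ⟨V, Vi, hV1, hV2, hVO⟩ := basis_in_open (Metric.isOpen_ball (x := η0) (ε := r))
    ⟨η0, Metric.mem_ball_self hr⟩
  let L : Matrix (Fin p) (Fin q) ℂ → Matrix (Fin p) (Fin q) ℂ := fun M => Z1 + M * Vᵀ
  have hLc : Continuous L := continuous_const.add (Continuous.matrix_mul continuous_id continuous_const)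
  have hL0 : L 0 = Z1 := by simp [L]
  obtain ⟨δ, hδ, hδB⟩ := Metric.isOpen_iff.1 ((Metric.isOpen_ball (x := Z1) (ε := r)).preimage hLc) 0
    (by show L 0 ∈ Metric.ball Z1 r; rw [hL0]; exact Metric.mem_ball_self hr)
  obtain ⟨t0, ht0δ, ht00⟩ : ∃ t0 : ℂ, ‖t0 • w0‖ < δ ∧ t0 ≠ 0 := by
    have hcn : Continuous (fun t : ℂ => ‖t • w0‖) := by fun_prop
    have e1 : ∀ᶠ t in 𝓝[≠] (0:ℂ), ‖t • w0‖ < δ :=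
      (hcn.continuousAt.eventually (gt_mem_nhds (by simpa using hδ))).filter_mono nhdsWithin_le_nhds
    obtain ⟨t, h1, h2⟩ := (e1.and self_mem_nhdsWithin).exists
    exact ⟨t, h1, h2⟩
  let tr : ℕ → Matrix (Fin p) (Fin q) ℂ → Matrix (Fin p) (Fin q) ℂ := fun i M =>
    Matrix.of fun a b => if b.val < i then M a b else 0
  have htr : ∀ i M, ‖M‖ < δ → L (tr i M) ∈ Metric.ball Z1 r := by
    intro i M hM
    apply hδB
    rw [mem_ball_zero_iff]
    refine lt_of_le_of_lt ?_ hM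
    rw [Matrix.norm_le_iff (norm_nonneg _)]
    intro a b
    simp only [tr, Matrix.of_apply]
    split_ifs
    · exact Matrix.norm_entry_le_entrywise_sup_norm M
    · simp
  have hsucc : ∀ i (hi : i < q) M, L (tr (i+1) M) = L (tr i M) + vecMulVec (fun a => M a ⟨i, hi⟩) (fun a => V a ⟨i, hi⟩) := by
    intro i hi M
    simp only [L, add_assoc]
    congr 1
    ext a b
    simp only [Matrix.add_apply, Matrix.mul_apply, vecMulVec_apply, tr, Matrix.of_apply, Matrix.transpose_apply]
    have e1 : ∀ x : Fin q, (if x.val < i + 1 then M a x else 0) * V b x =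
        (if x.val < i then M a x else 0) * V b x + (if x = ⟨i, hi⟩ then M a x * V b x else 0) := by
      intro x
      rcases lt_trichotomy x.val i with h | h | h
      · have : x ≠ ⟨i, hi⟩ := fun h' => by subst h'; simp at h
        simp [h, this, Nat.lt_succ_of_lt h]
      · have : x = ⟨i, hi⟩ := Fin.ext h
        simp [this]
      · have : x ≠ ⟨i, hi⟩ := fun h' => by subst h'; simp at h
        have h1 : ¬ x.val < i := by omega
        have h2 : ¬ x.val < i + 1 := by omega
        simp [h1, h2, this]
    rw [Finset.sum_congr rfl (fun x _ => e1 x), Finset.sum_add_distrib]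
    simp
  have hind : ∀ M, ‖M‖ < δ → (∀ i, (fun a => t0⁻¹ * M a i) ∈ Metric.ball w0 r) → ∀ i, i ≤ q →
      e ∈ SP D f O (L (tr i M)) G ⊓ Kz f (L (tr i M)) ∧ f (L (tr i M)) *ᵥ e = f Z1 *ᵥ e := by
    intro M hM hMw i
    induction i with
    | zero =>
      intro _
      have h0 : tr 0 M = 0 := by ext a b; simp [tr]
      rw [h0, hL0]
      exact ⟨he, rfl⟩
    | succ i ih =>
      intro hi
      obtain ⟨ih1, ih2⟩ := ih (by omega)
      have hb := htr (i+1) M hM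
      rw [hsucc i hi M] at hb ⊢
      obtain ⟨g1, g2⟩ := hL.step hD hf hG (hVO ⟨i, hi⟩) (b3 hb) (fun η hη => b1 _ (htr i M hM) η hη ih1) (by
        have := b2 _ hb _ (hMw ⟨i, hi⟩)
        intro h0
        apply this
        have e1 : (fun a => t0⁻¹ * M a ⟨i, hi⟩) = t0⁻¹ • (fun a => M a ⟨i, hi⟩) := rfl
        rw [e1, mulVec_smul, h0, smul_zero])
      exact ⟨g1, g2.trans ih2⟩
  have hfin : ∀ M, ‖M‖ < δ → (∀ i, (fun a => t0⁻¹ * M a i) ∈ Metric.ball w0 r) →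
      f (L M) *ᵥ e = f Z1 *ᵥ e := by
    intro M hM hMw
    have h1 := (hind M hM hMw q le_rfl).2
    have h0 : tr q M = M := by ext a b; simp [tr]
    rwa [h0] at h1
  -- pass to an open set of Z
  let M0 : Matrix (Fin p) (Fin q) ℂ := Matrix.of fun a _ => t0 * w0 a
  let Li : Matrix (Fin p) (Fin q) ℂ → Matrix (Fin p) (Fin q) ℂ := fun Z => (Z - Z1) * Viᵀ
  have hLic : Continuous Li := Continuous.matrix_mul (continuous_id.sub continuous_const) continuous_const
  have hLLi : ∀ Z, L (Li Z) = Z := by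
    intro Z
    simp only [L, Li, Matrix.mul_assoc, ← Matrix.transpose_mul, hV1]
    simp
  have hLiL : ∀ Z, Li (L Z) = Z := by
    intro Z
    simp only [L, Li, add_sub_cancel_left, Matrix.mul_assoc, ← Matrix.transpose_mul, hV2]
    simp
  have hM0 : ‖M0‖ < δ := by
    refine lt_of_le_of_lt ?_ ht0δ
    rw [Matrix.norm_le_iff (norm_nonneg _)]
    intro a b
    exact norm_le_pi_norm (t0 • w0) a
  have hopen : ∀ᶠ Z in 𝓝 (L M0), f Z *ᵥ e = f Z1 *ᵥ e := by
    have hT : Tendsto Li (𝓝 (L M0)) (𝓝 M0) := by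
      have := hLic.continuousAt (x := L M0)
      rw [ContinuousAt, hLiL] at this
      exact this
    have e1 : ∀ᶠ M in 𝓝 M0, ‖M‖ < δ := continuous_norm.continuousAt.eventually (gt_mem_nhds hM0)
    have e2 : ∀ᶠ M in 𝓝 M0, ∀ i, (fun a => t0⁻¹ * M a i) ∈ Metric.ball w0 r := by
      rw [eventually_all]
      intro i
      have hcn : Continuous (fun M : Matrix (Fin p) (Fin q) ℂ => (fun a => t0⁻¹ * M a i)) := by
        refine continuous_pi fun a => continuous_const.mul ?_
        exact Continuous.matrix_elem continuous_id a i
      refine hcn.continuousAt.eventually (Metric.isOpen_ball.mem_nhds ?_)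
      have : (fun a => t0⁻¹ * M0 a i) = w0 := by
        funext a
        simp only [M0, Matrix.of_apply]
        rw [inv_mul_cancel_left₀ ht00]
      show (fun a => t0⁻¹ * M0 a i) ∈ Metric.ball w0 r
      rw [this]; exact Metric.mem_ball_self hr
    filter_upwards [hT.eventually e1, hT.eventually e2] with Z h1 h2
    have := hfin (Li Z) h1 h2
    rwa [hLLi] at this
  have hLM0 : L M0 ∈ D := by
    apply hL.hUD; apply b3; apply hδB
    rw [mem_ball_zero_iff]; exact hM0
  have hall := id_eq_lemma hD hc (g := fun Z => f Z *ᵥ e) (h := fun _ => f Z1 *ᵥ e)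
    (fun Z hZ => (mdiff_mulVec (hf.differentiableAt (hD.mem_nhds hZ)) (differentiableAt_const e)).differentiableWithinAt)
    (differentiableOn_const _) hLM0 hopen
  intro Z hZ Z' hZ'
  exact (hall Z hZ).trans (hall Z' hZ').symm
end


theorem finrank_sup_one {q : ℕ} {H : Submodule ℂ (Fin q → ℂ)} {x : Fin q → ℂ} (hx : x ∉ H) :
    Module.finrank ℂ (H ⊔ Submodule.span ℂ {x} : Submodule ℂ (Fin q → ℂ)) = Module.finrank ℂ H + 1 := by
  have h1 := Submodule.finrank_sup_add_finrank_inf_eq H (Submodule.span ℂ {x})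
  have h2 : H ⊓ Submodule.span ℂ {x} = ⊥ := by
    rw [eq_bot_iff]
    rintro y ⟨hy1, hy2⟩
    obtain ⟨a, rfl⟩ := Submodule.mem_span_singleton.1 hy2
    by_cases ha : a = 0
    · simp [ha]
    · exact absurd ((H.smul_mem_iff ha).1 hy1) hx
  have hx0 : x ≠ 0 := fun h => hx (by rw [h]; exact H.zero_mem)
  rw [h2, finrank_bot, finrank_span_singleton hx0] at h1
  omega

theorem exists_super {q : ℕ} (S : Submodule ℂ (Fin q → ℂ)) (r : ℕ) (h1 : Module.finrank ℂ S ≤ r) :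
    r ≤ q → ∃ G, S ≤ G ∧ Module.finrank ℂ G = r := by
  induction r, h1 using Nat.le_induction with
  | base => exact fun _ => ⟨S, le_rfl, rfl⟩
  | succ r hr ih =>
    intro hq
    obtain ⟨G, hG, hGr⟩ := ih (by omega)
    have : ∃ x, x ∉ G := by
      by_contra h
      push Not at h
      have : G = ⊤ := by rw [eq_top_iff]; exact fun x _ => h x
      rw [this, finrank_top, Module.finrank_fin_fun] at hGr
      omega
    obtain ⟨x, hx⟩ := this
    exact ⟨G ⊔ Submodule.span ℂ {x}, hG.trans le_sup_left, by rw [finrank_sup_one hx, hGr]⟩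

theorem linball {q n : ℕ} {O : Set (Fin q → ℂ)} (hO : IsOpen O) {v0 : Fin q → ℂ} (hv0 : v0 ∈ O)
    {h : (Fin q → ℂ) → Fin n → ℂ}
    (hl : ∀ v ∈ O, ∀ w ∈ O, ∀ a b : ℂ, a • v + b • w ∈ O → h (a • v + b • w) = a • h v + b • h w)
    {V Vi : Matrix (Fin q) (Fin q) ℂ} (hV : V * Vi = 1) (hVO : ∀ i, (fun a => V a i) ∈ O) :
    ∀ v ∈ O, h v = (Matrix.of (fun a i => h (fun b => V b i) a) * Vi) *ᵥ v := by
  have hev : ∀ x : Fin q → ℂ, ∀ᶠ t in 𝓝 (0:ℂ), v0 + t • x ∈ O := by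
    intro x
    have hcn : Continuous (fun t : ℂ => v0 + t • x) := by fun_prop
    exact hcn.continuousAt.eventually (hO.mem_nhds (by simpa using hv0))
  have hsc : ∀ a : ℂ, Tendsto (fun t : ℂ => t * a) (𝓝 0) (𝓝 0) := by
    intro a
    have : Continuous (fun t : ℂ => t * a) := by fun_prop
    simpa using this.tendsto 0
  let Γ : Submodule ℂ ((Fin q → ℂ) × (Fin n → ℂ)) :=
    { carrier := {x | ∀ᶠ t in 𝓝 (0:ℂ), h (v0 + t • x.1) = h v0 + t • x.2}
      zero_mem' := by simp
      add_mem' := by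
        rintro ⟨x, y⟩ ⟨x', y'⟩ h1 h2
        have h1 : ∀ᶠ t in 𝓝 (0:ℂ), h (v0 + t • x) = h v0 + t • y := h1
        have h2 : ∀ᶠ t in 𝓝 (0:ℂ), h (v0 + t • x') = h v0 + t • y' := h2
        show ∀ᶠ t in 𝓝 (0:ℂ), h (v0 + t • (x + x')) = h v0 + t • (y + y')
        filter_upwards [(hsc 2).eventually h1, (hsc 2).eventually h2, (hsc 2).eventually (hev x),
          (hsc 2).eventually (hev x'), hev (x + x')] with t g1 g2 g3 g4 g5
        have e : v0 + t • (x + x') = (1/2 : ℂ) • (v0 + (t * 2) • x) + (1/2 : ℂ) • (v0 + (t * 2) • x') := by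
          ext i; simp; ring
        rw [e] at g5 ⊢
        rw [hl _ g3 _ g4 _ _ g5, g1, g2]
        ext i; simp; ring
      smul_mem' := by
        rintro a ⟨x, y⟩ h1
        have h1 : ∀ᶠ t in 𝓝 (0:ℂ), h (v0 + t • x) = h v0 + t • y := h1
        show ∀ᶠ t in 𝓝 (0:ℂ), h (v0 + t • (a • x)) = h v0 + t • (a • y)
        filter_upwards [(hsc a).eventually h1] with t g1
        rw [smul_smul, smul_smul, g1] }
  have hmem : ∀ v ∈ O, (v, h v) ∈ Γ := by
    intro v hv
    show ∀ᶠ t in 𝓝 (0:ℂ), h (v0 + t • v) = h v0 + t • h v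
    filter_upwards [hev v] with t ht
    have := hl v0 hv0 v hv 1 t (by simpa using ht)
    simpa using this
  intro v hv
  have h1 : (v, (Matrix.of (fun a i => h (fun b => V b i) a) * Vi) *ᵥ v) ∈ Γ := by
    have h2 : ∑ i, (Vi *ᵥ v) i • ((fun a => V a i), h (fun b => V b i)) ∈ Γ :=
      Submodule.sum_mem _ fun i _ => Submodule.smul_mem _ _ (hmem _ (hVO i))
    convert h2 using 1
    refine Prod.ext ?_ ?_
    · rw [Prod.fst_sum]
      conv_lhs => rw [← one_mulVec v, ← hV, ← mulVec_mulVec]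
      ext a
      simp [mulVec, dotProduct, Finset.sum_apply, mul_comm]
    · rw [Prod.snd_sum, ← mulVec_mulVec]
      ext a
      simp [mulVec, dotProduct, Finset.sum_apply, mul_comm]
  have h3 := Γ.sub_mem (hmem v hv) h1
  have h4 : ∀ᶠ t in 𝓝 (0:ℂ), h (v0 + t • (v - v)) = h v0 + t • (h v - (Matrix.of (fun a i => h (fun b => V b i) a) * Vi) *ᵥ v) := h3
  obtain ⟨t, ht, ht0⟩ := ((h4.filter_mono nhdsWithin_le_nhds).and (self_mem_nhdsWithin (s := {(0:ℂ)}ᶜ))).exists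
  have ht0 : t ≠ 0 := ht0
  rw [sub_self, smul_zero, add_zero, left_eq_add] at ht
  exact sub_eq_zero.1 ((smul_eq_zero.1 ht).resolve_left ht0)

section
variable {p q p' n : ℕ}
variable {D : Set (Matrix (Fin p) (Fin q) ℂ)}
  {f : Matrix (Fin p) (Fin q) ℂ → Matrix (Fin p') (Fin n) ℂ}
  {U : Set (Matrix (Fin p) (Fin q) ℂ)} {O : Set (Fin q → ℂ)} {b0 : Fin p → ℂ}
  {κ : Matrix (Fin p) (Fin q) ℂ → Matrix (Fin n) (Fin q) ℂ}
  {C : Matrix (Fin p) (Fin q) ℂ → Matrix (Fin p') (Fin p) ℂ}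

variable (hD : IsOpen D) (hc : Convex ℝ D) (hf : DifferentiableOn ℂ f D)
  (hL : Loc D f U O b0 κ C)

include hD hf hL

theorem Loc.chain (hn : n + 2 ≤ 2 * q) (hq : 2 ≤ q) (hUne : U.Nonempty) (hOne : O.Nonempty) :
    ∃ (g : ℕ) (Z1 : Matrix (Fin p) (Fin q) ℂ) (H : Submodule ℂ (Fin q → ℂ)), Z1 ∈ U ∧
      Module.finrank ℂ H = g ∧ (∃ v ∈ H, v ∈ O) ∧ 1 ≤ g ∧ g < q ∧
      ∀ Z ∈ U, ∀ G : Submodule ℂ (Fin q → ℂ), Module.finrank ℂ G = g + 1 → (∃ v ∈ G, v ∈ O) →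
        Module.finrank ℂ (SP D f O Z G) ≤ Module.finrank ℂ (SP D f O Z1 H) + 1 := by
  by_contra hcon
  have hind : ∀ g, 1 ≤ g → g ≤ q → ∃ (Z1 : Matrix (Fin p) (Fin q) ℂ) (H : Submodule ℂ (Fin q → ℂ)), Z1 ∈ U ∧
      Module.finrank ℂ H = g ∧ (∃ v ∈ H, v ∈ O) ∧ 2 * g ≤ Module.finrank ℂ (SP D f O Z1 H) + 1 := by
    intro g hg
    induction g, hg using Nat.le_induction with
    | base =>
      intro _
      obtain ⟨Z, hZ⟩ := hUne
      obtain ⟨v, hv⟩ := hOne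
      have h1 : Module.finrank ℂ (Submodule.span ℂ {v}) = 1 := finrank_span_singleton (hL.hv0 v hv)
      have hm : ∃ w ∈ Submodule.span ℂ {v}, w ∈ O := ⟨v, Submodule.mem_span_singleton_self v, hv⟩
      refine ⟨Z, Submodule.span ℂ {v}, hZ, h1, hm, ?_⟩
      have := hL.SP_dim hD hf hZ hm
      omega
    | succ g hg ih =>
      intro hgq
      obtain ⟨Z1, H, hZ1, hH, hm, hd⟩ := ih (by omega)
      by_contra hcon2
      push Not at hcon2
      apply hcon
      refine ⟨g, Z1, H, hZ1, hH, hm, hg, by omega, ?_⟩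
      intro Z hZ G hG hGm
      have := hcon2 Z G hZ hG (by obtain ⟨v, a, b⟩ := hGm; exact ⟨v, a, b⟩)
      omega
  obtain ⟨Z1, H, _, _, _, h⟩ := hind q (by omega) le_rfl
  have := Submodule.finrank_le (SP D f O Z1 H)
  rw [Module.finrank_fin_fun] at this
  omega

include hc in
theorem Loc.step6 (hn : n + 2 ≤ 2 * q) (hq : 2 ≤ q) (hUne : U.Nonempty) (hOne : O.Nonempty)
    (hK : ∀ k, (∀ Z ∈ D, ∀ Z' ∈ D, f Z *ᵥ k = f Z' *ᵥ k) → k = 0) :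
    ∀ Z ∈ U, ∀ G : Submodule ℂ (Fin q → ℂ), (∃ v ∈ G, v ∈ O) → Module.finrank ℂ G ≤ 2 →
      SP D f O Z G ⊓ Kz f Z = ⊥ := by
  obtain ⟨g, Z1, H, hZ1, hHg, hHm, hg1, hgq, hmax⟩ := hL.chain hD hf hn hq hUne hOne
  obtain ⟨η0, hη0, hηH⟩ : ∃ η0 : Fin q → ℂ, η0 ≠ 0 ∧ ∀ v ∈ H, η0 ⬝ᵥ v = 0 := by
    have hlt : H < ⊤ := by
      rw [lt_top_iff_ne_top]
      rintro rfl
      rw [finrank_top, Module.finrank_fin_fun] at hHg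
      omega
    obtain ⟨φ, hφ0, hφ⟩ := Submodule.exists_le_ker_of_lt_top H hlt
    have hφe : ∀ x, φ x = (fun i => φ (Pi.single i 1)) ⬝ᵥ x := by
      intro x
      rw [LinearMap.pi_apply_eq_sum_univ φ x]
      simp only [dotProduct, smul_eq_mul]
      refine Finset.sum_congr rfl fun i _ => ?_
      rw [mul_comm]
      congr 2
      ext j
      simp [Pi.single_apply, eq_comm]
    refine ⟨fun i => φ (Pi.single i 1), ?_, ?_⟩
    · intro h0
      apply hφ0
      ext x
      rw [LinearMap.coe_comp, Function.comp_apply, hφe, h0]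
      simp
    · intro v hv
      rw [← hφe]
      exact hφ hv
  have hx0 : η0 ⬝ᵥ star η0 ≠ 0 := by rw [dotProduct_comm]; exact star_dot_ne hη0
  set x0 := star η0 with hx0def
  have hx0H : x0 ∉ H := fun h => hx0 (hηH x0 h)
  set G0 := H ⊔ Submodule.span ℂ {x0} with hG0
  have hG0g : Module.finrank ℂ G0 = g + 1 := by rw [hG0, finrank_sup_one hx0H, hHg]
  have hx0G : x0 ∈ G0 := (le_sup_right : _ ≤ G0) (Submodule.mem_span_singleton_self x0)
  have hHG : H ≤ G0 := le_sup_left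
  have hG0m : ∃ v ∈ G0, v ∈ O := by obtain ⟨v, a, b⟩ := hHm; exact ⟨v, hHG a, b⟩
  have hd1 := hL.SP_dim hD hf hZ1 hHm
  have hcore : SP D f O Z1 G0 ⊓ Kz f Z1 = ⊥ := by
    refine hL.core hD hc hf hK hZ1 (η0 := η0) hG0m ?_
    have e1 := hL.SP_lsc hD hc hf hZ1 hx0 hηH hHG hx0G
    have e2 : ∀ᶠ y in 𝓝 (Z1, η0), y.1 ∈ U :=
      (continuousAt_fst (p := (Z1, η0))).eventually (hL.hU.mem_nhds hZ1)
    have e3 : ∀ᶠ y in 𝓝 (Z1, η0), y.2 ⬝ᵥ x0 ≠ 0 :=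
      ContinuousAt.eventually_ne (g := fun y : Matrix (Fin p) (Fin q) ℂ × (Fin q → ℂ) => y.2 ⬝ᵥ x0)
        (Continuous.dotProduct continuous_snd continuous_const).continuousAt hx0
    filter_upwards [e1, e2, e3] with y h1 h2 h3
    have h4 := finrank_hyper G0 hx0G h3
    have hm : ∃ v ∈ G0 ⊓ LinearMap.ker (dotL y.2), v ∈ O := by
      by_contra hcon
      have : SP D f O y.1 (G0 ⊓ LinearMap.ker (dotL y.2)) = ⊥ := by
        rw [eq_bot_iff, SP, Submodule.span_le]
        rintro k ⟨v, hv, hvO, _⟩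
        exact absurd ⟨v, hv, hvO⟩ hcon
      rw [this, finrank_bot] at h1
      omega
    have h5 := hL.SP_dim hD hf h2 hm
    have h6 := hL.SP_dim hD hf h2 hG0m
    have h7 := hmax y.1 h2 G0 hG0g hG0m
    have h8 : SP D f O y.1 (G0 ⊓ LinearMap.ker (dotL y.2)) ⊓ Kz f y.1 ≤ SP D f O y.1 G0 ⊓ Kz f y.1 :=
      inf_le_inf_right _ (SP_mono inf_le_left)
    have h9 := Submodule.eq_of_le_of_finrank_le h8 (by omega)
    rw [← h9]
    exact inf_le_left
  have hH0 : Module.finrank ℂ (SP D f O Z1 H ⊓ Kz f Z1 : Submodule ℂ (Fin n → ℂ)) = 0 := by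
    have : SP D f O Z1 H ⊓ Kz f Z1 = ⊥ := by
      rw [eq_bot_iff, ← hcore]
      exact inf_le_inf_right _ (SP_mono hHG)
    rw [this, finrank_bot]
  intro Z hZ G hGm hG2
  obtain ⟨G', hGG', hG'⟩ := exists_super G (g + 1) (by omega) (by omega)
  have hG'm : ∃ v ∈ G', v ∈ O := by obtain ⟨v, a, b⟩ := hGm; exact ⟨v, hGG' a, b⟩
  have h1 := hmax Z hZ G' hG' hG'm
  have h2 := hL.SP_dim hD hf hZ hG'm
  have h3 : SP D f O Z G' ⊓ Kz f Z = ⊥ := by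
    apply Submodule.finrank_eq_zero.1
    omega
  rw [eq_bot_iff, ← h3]
  exact inf_le_inf_right _ (SP_mono hGG')
end


section
variable {p q p' n : ℕ} {D : Set (Matrix (Fin p) (Fin q) ℂ)}
  {f : Matrix (Fin p) (Fin q) ℂ → Matrix (Fin p') (Fin n) ℂ}

theorem local_thm (hD : IsOpen D) (hc : Convex ℝ D) (hf : DifferentiableOn ℂ f D)
    (hne : D.Nonempty) (hp : 0 < p) (hq : 2 ≤ q) (hn : n + 2 ≤ 2 * q) (hnp : n < p)
    (hK : ∀ k, (∀ Z ∈ D, ∀ Z' ∈ D, f Z *ᵥ k = f Z' *ᵥ k) → k = 0)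
    (hBC : ∀ Z ∈ D, ∀ v b, v ≠ 0 → b ≠ 0 → Kvb D f Z v b ≠ ⊥) :
    ∃ (Z0 : Matrix (Fin p) (Fin q) ℂ) (v0 : Fin q → ℂ) (b0 : Fin p → ℂ)
      (κ : Matrix (Fin p) (Fin q) ℂ → Matrix (Fin n) (Fin q) ℂ) (ε : ℝ), 0 < ε ∧
      ContinuousAt κ Z0 ∧ ∀ Z ∈ Metric.ball Z0 ε, ∀ v ∈ Metric.ball v0 ε, ∀ b ∈ Metric.ball b0 ε,
        Z ∈ D ∧ v ≠ 0 ∧ b ≠ 0 ∧ κ Z *ᵥ v ≠ 0 ∧ κ Z *ᵥ v ∈ Ninf D f Z v ∧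
        ∀ k ∈ Kvb D f Z v b, ∃ a : ℂ, k = a • (κ Z *ᵥ v) := by
  obtain ⟨m, Z0, v0, b0, ε, κ, C, hε, -, h1, h2, h3⟩ := stage5 hD hc hf hn hnp
    (exists_not_le_Kz hD hc hf hK hBC (Om_nonempty hne hp (by omega)))
  have hL : Loc D f (Metric.ball Z0 ε) (Metric.ball v0 ε) b0 κ C :=
    { hU := Metric.isOpen_ball
      hO := Metric.isOpen_ball
      hUD := fun Z hZ => (h1 Z hZ).1
      hC := fun Z hZ => (h1 Z hZ).2.2.1
      hκ := fun Z hZ => (h1 Z hZ).2.2.2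
      hv0 := fun v hv => (h2 Z0 (Metric.mem_ball_self hε) v hv).1
      hNd := fun Z hZ v hv => (h2 Z hZ v hv).2.1
      hNn := fun Z hZ v hv => (h2 Z hZ v hv).2.2
      hOm := fun Z hZ v hv => (h3 Z hZ v hv b0 (Metric.mem_ball_self hε)).1
      hKN := fun Z hZ v hv => (h3 Z hZ v hv b0 (Metric.mem_ball_self hε)).2 }
  have h6 := hL.step6 hD hc hf hn hq ⟨Z0, Metric.mem_ball_self hε⟩ ⟨v0, Metric.mem_ball_self hε⟩ hK
  set U := Metric.ball Z0 ε with hU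
  set O := Metric.ball v0 ε with hO
  have hZ0 : Z0 ∈ U := Metric.mem_ball_self hε
  have hv0 : v0 ∈ O := Metric.mem_ball_self hε
  have hch : ∀ Z v, ∃ k, Z ∈ U → v ∈ O → k ∈ Ninf D f Z v ∧ k - κ Z *ᵥ v ∈ Kz f Z := by
    intro Z v
    by_cases h : Z ∈ U ∧ v ∈ O
    · obtain ⟨k, hk⟩ := hL.exists_norm hD hf h.1 h.2
      exact ⟨k, fun _ _ => hk⟩
    · exact ⟨0, fun a b => absurd ⟨a, b⟩ h⟩
  choose h hh using hch
  -- elements of `SP ⊓ Kz` vanish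
  have hz : ∀ Z ∈ U, ∀ v ∈ O, ∀ w ∈ O, ∀ k, k ∈ SP D f O Z (Submodule.span ℂ {v, w}) →
      k ∈ Kz f Z → k = 0 := by
    intro Z hZ v hv w hw k hk hk2
    have hfr : Module.finrank ℂ (Submodule.span ℂ ({v, w} : Set (Fin q → ℂ))) ≤ 2 := by
      classical
      have h := finrank_span_finset_le_card (R := ℂ) ({v, w} : Finset (Fin q → ℂ))
      have h' := Finset.card_le_two (a := v) (b := w)
      have e : ((({v, w} : Finset (Fin q → ℂ)) : Set (Fin q → ℂ))) = {v, w} := by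
        ext x; simp
      rw [e] at h
      exact h.trans h'
    have := h6 Z hZ (Submodule.span ℂ {v, w}) ⟨v, Submodule.subset_span (by simp), hv⟩ hfr
    have hm : k ∈ SP D f O Z (Submodule.span ℂ {v, w}) ⊓ Kz f Z := ⟨hk, hk2⟩
    rw [this] at hm
    exact hm
  have hlin : ∀ Z ∈ U, ∀ v ∈ O, ∀ w ∈ O, ∀ a b : ℂ, a • v + b • w ∈ O →
      h Z (a • v + b • w) = a • h Z v + b • h Z w := by
    intro Z hZ v hv w hw a b hab
    rw [← sub_eq_zero]
    apply hz Z hZ v hv w hw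
    · have hG : ∀ x ∈ O, x ∈ Submodule.span ℂ ({v, w} : Set (Fin q → ℂ)) →
          h Z x ∈ SP D f O Z (Submodule.span ℂ {v, w}) := fun x hx hxG =>
        Submodule.subset_span ⟨x, hxG, hx, (hh Z x hZ hx).1⟩
      have e1 : v ∈ Submodule.span ℂ ({v, w} : Set (Fin q → ℂ)) := Submodule.subset_span (by simp)
      have e2 : w ∈ Submodule.span ℂ ({v, w} : Set (Fin q → ℂ)) := Submodule.subset_span (by simp)
      exact Submodule.sub_mem _ (hG _ hab (Submodule.add_mem _ (Submodule.smul_mem _ _ e1)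
        (Submodule.smul_mem _ _ e2))) (Submodule.add_mem _ (Submodule.smul_mem _ _ (hG v hv e1))
        (Submodule.smul_mem _ _ (hG w hw e2)))
    · have := Submodule.sub_mem _ (hh Z _ hZ hab).2 (Submodule.add_mem _
        (Submodule.smul_mem _ a (hh Z v hZ hv).2) (Submodule.smul_mem _ b (hh Z w hZ hw).2))
      convert this using 1
      rw [mulVec_add, mulVec_smul, mulVec_smul, smul_sub, smul_sub]
      abel
  have huni : ∀ Z ∈ U, ∀ v ∈ O, ∀ k ∈ Ninf D f Z v, ∃ a : ℂ, k = a • h Z v := by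
    intro Z hZ v hv k hk
    obtain ⟨a, ha⟩ := hL.hNd Z hZ v hv k (Ninf_le_Nd hD hf (hL.hUD hZ) v hk)
    refine ⟨a, ?_⟩
    rw [← sub_eq_zero]
    apply hz Z hZ v hv v hv
    · exact Submodule.subset_span ⟨v, Submodule.subset_span (by simp), hv,
        Submodule.sub_mem _ hk (Submodule.smul_mem _ _ (hh Z v hZ hv).1)⟩
    · have := Submodule.sub_mem _ ha (Submodule.smul_mem _ a (hh Z v hZ hv).2)
      convert this using 1
      rw [smul_sub]; abel
  obtain ⟨V, Vi, hV, hVi, hVO⟩ := basis_in_open hL.hO ⟨v0, hv0⟩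
  set vv : Fin q → Fin q → ℂ := fun i a => V a i with hvv
  have hVO : ∀ i, vv i ∈ O := hVO
  set K : Matrix (Fin p) (Fin q) ℂ → Matrix (Fin n) (Fin q) ℂ :=
    fun Z => Matrix.of (fun a i => h Z (vv i) a) * Vi with hKdef
  have hKv : ∀ Z ∈ U, ∀ v ∈ O, h Z v = K Z *ᵥ v := fun Z hZ =>
    linball hL.hO hv0 (hlin Z hZ) hV hVO
  obtain ⟨w0, i0, hw0⟩ : ∃ (w0 : Fin p → ℂ) (i0 : Fin p'), (C Z0 *ᵥ w0) i0 ≠ 0 := by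
    by_contra hcon
    push Not at hcon
    apply hL.hC Z0 hZ0
    ext i j
    have := hcon (Pi.single j 1) i
    simpa using this
  set θ0 : Fin q → ℂ := fun a => ∑ i, Vi i a with hθ
  have hθv : ∀ j, θ0 ⬝ᵥ vv j = 1 := by
    intro j
    have : θ0 ⬝ᵥ vv j = ∑ i, (Vi * V) i j := by
      simp only [dotProduct, hθ, hvv, Matrix.mul_apply, Finset.sum_mul]
      exact Finset.sum_comm
    rw [this, hVi]
    simp [Matrix.one_apply]
  set τ : Matrix (Fin p) (Fin q) ℂ → (Fin n → ℂ) → ℂ :=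
    fun Z k => (fderiv ℂ f Z (vecMulVec w0 θ0) *ᵥ k) i0 with hτ
  have hτh : ∀ Z ∈ U, ∀ i, τ Z (h Z (vv i)) = (C Z *ᵥ w0) i0 := by
    intro Z hZ i
    have e := (hh Z (vv i) hZ (hVO i)).2 (vecMulVec w0 θ0)
    rw [mulVec_sub, sub_eq_zero] at e
    simp only [hτ]
    rw [e, mulVec_mulVec, hL.hκ Z hZ, ← mulVec_mulVec, vecMulVec_mulVec, hθv]
    simp
  have hsec : ∀ i, ∃ s : Matrix (Fin p) (Fin q) ℂ → Fin n → ℂ, ContinuousAt s Z0 ∧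
      s Z0 = h Z0 (vv i) ∧ ∀ᶠ Z in 𝓝 Z0, s Z ∈ Kvb D f Z (vv i) b0 := by
    intro i
    obtain ⟨s, s1, s2, s3⟩ := Om_sec hD hc hf (hL.hOm Z0 hZ0 (vv i) (hVO i))
      (Ninf_le_Kvb _ _ _ (hh Z0 (vv i) hZ0 (hVO i)).1)
    have hcn : ContinuousAt (fun Z : Matrix (Fin p) (Fin q) ℂ => ((Z, vv i, b0) : Xpt p q)) Z0 := by
      fun_prop
    exact ⟨fun Z => s (Z, vv i, b0), ContinuousAt.comp (f := fun Z : Matrix (Fin p) (Fin q) ℂ =>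
      ((Z, vv i, b0) : Xpt p q)) s1 hcn, s2, hcn.eventually s3⟩
  choose s s1 s2 s3 using hsec
  have hτc : ∀ i, ContinuousAt (fun Z => τ Z (s i Z)) Z0 := by
    intro i
    have e1 : ContinuousAt (fun Z => fderiv ℂ f Z (vecMulVec w0 θ0)) Z0 :=
      continuousAt_dirDeriv hD hf _ (hL.hUD hZ0)
    exact continuousAt_pi.1 (cont_mulV e1 (s1 i)) i0
  have hτne : ∀ i, ∀ᶠ Z in 𝓝 Z0, τ Z (s i Z) ≠ 0 := by
    intro i
    refine (hτc i).eventually_ne ?_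
    rw [s2, hτh Z0 hZ0]
    exact hw0
  set κ' : Matrix (Fin p) (Fin q) ℂ → Matrix (Fin n) (Fin q) ℂ :=
    fun Z => ((C Z *ᵥ w0) i0)⁻¹ • K Z with hκ'
  have hUe : ∀ᶠ Z in 𝓝 Z0, Z ∈ U := hL.hU.mem_nhds hZ0
  have hmu : ∀ᶠ Z in 𝓝 Z0, ∀ i, Z ∈ U ∧ (C Z *ᵥ w0) i0 ≠ 0 ∧
      (τ Z (s i Z))⁻¹ • s i Z = ((C Z *ᵥ w0) i0)⁻¹ • h Z (vv i) := by
    rw [eventually_all]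
    intro i
    filter_upwards [hUe, hτne i, s3 i] with Z hZ hne hs
    rw [hL.hKN Z hZ (vv i) (hVO i)] at hs
    obtain ⟨a, ha⟩ := huni Z hZ (vv i) (hVO i) _ hs
    have e : τ Z (s i Z) = a * (C Z *ᵥ w0) i0 := by
      rw [← hτh Z hZ i, ha]
      simp only [hτ, mulVec_smul, Pi.smul_apply, smul_eq_mul]
    rw [e] at hne ⊢
    have ha0 : a ≠ 0 := left_ne_zero_of_mul hne
    refine ⟨hZ, right_ne_zero_of_mul hne, ?_⟩
    rw [ha, smul_smul, mul_inv, mul_comm a⁻¹, mul_assoc, inv_mul_cancel₀ ha0, mul_one]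
  have hκc : ContinuousAt κ' Z0 := by
    have hq0 : (Finset.univ : Finset (Fin q)).Nonempty := ⟨⟨0, by omega⟩, Finset.mem_univ _⟩
    have e1 : ContinuousAt (fun Z => (Matrix.of (fun a i => ((τ Z (s i Z))⁻¹ • s i Z) a) : Matrix (Fin n) (Fin q) ℂ) * Vi) Z0 := by
      refine cont_mulM ?_ continuousAt_const
      have : ContinuousAt (fun Z => (fun a i => ((τ Z (s i Z))⁻¹ • s i Z) a : Fin n → Fin q → ℂ)) Z0 := by
        refine continuousAt_pi.2 (fun a => continuousAt_pi.2 (fun i => ?_))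
        refine ContinuousAt.mul ((hτc i).inv₀ ?_) (continuousAt_pi.1 (s1 i) a)
        exact (hτne i).self_of_nhds
      exact this
    refine e1.congr ?_
    filter_upwards [hmu] with Z hZ
    simp only [hκ', hKdef]
    rw [← Matrix.smul_mul]
    congr 1
    ext a i
    rw [Matrix.smul_apply, of_apply, of_apply, (hZ i).2.2]
    rfl
  obtain ⟨δ, hδ, hδB⟩ := Metric.eventually_nhds_iff_ball.1 hmu
  refine ⟨Z0, v0, b0, κ', min δ ε, lt_min hδ hε, hκc, ?_⟩
  intro Z hZ v hv b hb
  have hZU : Z ∈ U := Metric.ball_subset_ball (min_le_right _ _) hZ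
  have hvO : v ∈ O := Metric.ball_subset_ball (min_le_right _ _) hv
  have hbO : b ∈ Metric.ball b0 ε := Metric.ball_subset_ball (min_le_right _ _) hb
  have hγ := (hδB Z (Metric.ball_subset_ball (min_le_left _ _) hZ) ⟨0, by omega⟩).2.1
  have e3 := h3 Z hZU v hvO b hbO
  have hkv : κ' Z *ᵥ v = ((C Z *ᵥ w0) i0)⁻¹ • h Z v := by
    rw [hKv Z hZU v hvO]
    simp only [hκ', smul_mulVec]
  refine ⟨hL.hUD hZU, hL.hv0 v hvO, e3.1.1.2.2, ?_, ?_, ?_⟩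
  · rw [hkv]
    refine smul_ne_zero (inv_ne_zero hγ) ?_
    intro h0
    apply hL.hNn Z hZU v hvO
    intro k hk
    obtain ⟨a, ha⟩ := huni Z hZU v hvO k hk
    rw [ha, h0, smul_zero]
    exact Submodule.zero_mem _
  · rw [hkv]
    exact Submodule.smul_mem _ _ (hh Z v hZU hvO).1
  · intro k hk
    rw [e3.2] at hk
    obtain ⟨a, ha⟩ := huni Z hZU v hvO k hk
    refine ⟨a * (C Z *ᵥ w0) i0, ?_⟩
    rw [hkv, smul_smul, mul_assoc, mul_inv_cancel₀ hγ, mul_one, ha]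
end


/-- squared euclidean norm -/
noncomputable def nsq {n : ℕ} (x : Fin n → ℂ) : ℝ := ∑ i, ‖x i‖ ^ 2

section
variable {m n : ℕ}

theorem nsq_nonneg (x : Fin n → ℂ) : 0 ≤ nsq x := Finset.sum_nonneg (fun _ _ => by positivity)

theorem nsq_coe (x : Fin n → ℂ) : star x ⬝ᵥ x = (nsq x : ℂ) := by
  simp only [nsq, dotProduct, Complex.ofReal_sum, Pi.star_apply, Complex.ofReal_pow]
  refine Finset.sum_congr rfl (fun i _ => ?_)
  exact Complex.conj_mul' (x i)

theorem nsq_eq_zero {x : Fin n → ℂ} : nsq x = 0 ↔ x = 0 := by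
  constructor
  · intro h
    have := (Finset.sum_eq_zero_iff_of_nonneg (fun i _ => by positivity)).1 h
    funext i
    simpa using this i (Finset.mem_univ i)
  · rintro rfl; simp [nsq]

@[simp] theorem nsq_zero : nsq (0 : Fin n → ℂ) = 0 := nsq_eq_zero.2 rfl

theorem nsq_pos {x : Fin n → ℂ} (h : x ≠ 0) : 0 < nsq x :=
  lt_of_le_of_ne (nsq_nonneg x) (fun e => h (nsq_eq_zero.1 e.symm))

theorem nsq_smul (a : ℂ) (x : Fin n → ℂ) : nsq (a • x) = ‖a‖ ^ 2 * nsq x := by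
  simp [nsq, mul_pow, Finset.mul_sum]

theorem nsq_neg (x : Fin n → ℂ) : nsq (-x) = nsq x := by simp [nsq]

theorem nsq_star (x : Fin n → ℂ) : nsq (star x) = nsq x := by simp [nsq]

theorem star_dot_comm (x y : Fin n → ℂ) : star y ⬝ᵥ x = star (star x ⬝ᵥ y) := by
  rw [star_dotProduct]

theorem nsq_add (x y : Fin n → ℂ) : nsq (x + y) = nsq x + nsq y + 2 * (star x ⬝ᵥ y).re := by
  have h : ((nsq (x + y) : ℝ) : ℂ) = nsq x + nsq y + (star x ⬝ᵥ y + star (star x ⬝ᵥ y)) := by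
    rw [← nsq_coe, ← nsq_coe, ← nsq_coe, star_add, add_dotProduct, dotProduct_add, dotProduct_add,
      star_dot_comm x y]
    ring
  have := congrArg Complex.re h
  simp at this
  linarith

theorem nsq_sub (x y : Fin n → ℂ) : nsq (x - y) = nsq x + nsq y - 2 * (star x ⬝ᵥ y).re := by
  rw [sub_eq_add_neg, nsq_add, nsq_neg, dotProduct_neg]
  simp; ring

theorem nsq_eq_norm (x : Fin n → ℂ) : nsq x = ‖(WithLp.toLp 2 x : EuclideanSpace ℂ (Fin n))‖ ^ 2 := by
  rw [EuclideanSpace.norm_sq_eq]; rfl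

theorem nsq_cs (x y : Fin n → ℂ) : ‖star x ⬝ᵥ y‖ ^ 2 ≤ nsq x * nsq y := by
  have := norm_inner_le_norm (𝕜 := ℂ) (WithLp.toLp 2 x : EuclideanSpace ℂ (Fin n))
    (WithLp.toLp 2 y : EuclideanSpace ℂ (Fin n))
  rw [EuclideanSpace.inner_toLp_toLp] at this
  rw [nsq_eq_norm, nsq_eq_norm, ← mul_pow, dotProduct_comm]
  gcongr

theorem nsq_cont : Continuous (nsq : (Fin n → ℂ) → ℝ) := by
  unfold nsq; fun_prop

theorem nsq_orth {x y : Fin n → ℂ} (h : star x ⬝ᵥ y = 0) : nsq (x + y) = nsq x + nsq y := by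
  rw [nsq_add, h]; simp

theorem star_mulVec_dot (A : Matrix (Fin m) (Fin n) ℂ) (x : Fin n → ℂ) (y : Fin m → ℂ) :
    star (A *ᵥ x) ⬝ᵥ y = star x ⬝ᵥ (Aᴴ *ᵥ y) := by
  rw [star_mulVec, dotProduct_mulVec]

theorem mem_dom {Z : Matrix (Fin m) (Fin n) ℂ} :
    Z ∈ typeIDomain m n ↔ ∀ x, x ≠ 0 → nsq (Z *ᵥ x) < nsq x := by
  have key : ∀ x : Fin n → ℂ, star x ⬝ᵥ ((1 - Zᴴ * Z) *ᵥ x) = ((nsq x - nsq (Z *ᵥ x) : ℝ) : ℂ) := by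
    intro x
    rw [sub_mulVec, one_mulVec, dotProduct_sub, ← mulVec_mulVec, ← star_mulVec_dot, nsq_coe, nsq_coe]
    simp
  constructor
  · intro h x hx
    have := (Matrix.posDef_iff_dotProduct_mulVec.1 h).2 hx
    rw [key, Complex.zero_lt_real] at this
    linarith
  · intro h
    refine Matrix.posDef_iff_dotProduct_mulVec.2 ⟨?_, ?_⟩
    · exact Matrix.isHermitian_one.sub (Matrix.isHermitian_conjTranspose_mul_self Z)
    · intro x hx
      rw [key, Complex.zero_lt_real]
      linarith [h x hx]

theorem dom_le {Z : Matrix (Fin m) (Fin n) ℂ} (h : Z ∈ typeIDomain m n) (x : Fin n → ℂ) :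
    nsq (Z *ᵥ x) ≤ nsq x := by
  by_cases hx : x = 0
  · subst hx; simp
  · exact (mem_dom.1 h x hx).le

theorem zero_mem_dom : (0 : Matrix (Fin m) (Fin n) ℂ) ∈ typeIDomain m n := by
  rw [mem_dom]; intro x hx; simpa using nsq_pos hx

theorem dom_balanced {Z : Matrix (Fin m) (Fin n) ℂ} (h : Z ∈ typeIDomain m n) {t : ℂ} (ht : ‖t‖ ≤ 1) :
    t • Z ∈ typeIDomain m n := by
  rw [mem_dom] at *
  intro x hx
  rw [smul_mulVec, nsq_smul]
  have := h x hx
  have h1 : ‖t‖ ^ 2 ≤ 1 := pow_le_one₀ (norm_nonneg _) ht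
  nlinarith [nsq_nonneg (Z *ᵥ x)]

theorem nsq_convex (x y : Fin n → ℂ) {a b : ℝ} (ha : 0 ≤ a) (hb : 0 ≤ b) (hab : a + b = 1) :
    nsq ((a : ℂ) • x + (b : ℂ) • y) ≤ a * nsq x + b * nsq y := by
  have h1 := nsq_nonneg (x - y)
  rw [nsq_sub] at h1
  have h2 : (star ((a : ℂ) • x) ⬝ᵥ ((b : ℂ) • y)).re = a * b * (star x ⬝ᵥ y).re := by
    rw [star_smul, smul_dotProduct, dotProduct_smul]
    simp; ring
  rw [nsq_add, nsq_smul, nsq_smul, h2]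
  simp only [Complex.norm_real, Real.norm_eq_abs, sq_abs]
  have : b = 1 - a := by linarith
  subst this
  nlinarith [mul_nonneg ha hb]

theorem dom_convex : Convex ℝ (typeIDomain m n) := by
  intro A hA B hB a b ha hb hab
  rw [mem_dom] at *
  intro x hx
  have e : (a • A + b • B) *ᵥ x = (a : ℂ) • (A *ᵥ x) + (b : ℂ) • (B *ᵥ x) := by
    rw [add_mulVec, smul_mulVec, smul_mulVec]; rfl
  rw [e]
  have h1 := nsq_convex (A *ᵥ x) (B *ᵥ x) ha hb hab
  have h2 := hA x hx
  have h3 := hB x hx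
  rcases ha.eq_or_lt with h | h
  · subst h; simp at hab; subst hab; simp at h1 ⊢; exact h3
  · have e : a * nsq x + b * nsq x = nsq x := by rw [← add_mul, hab, one_mul]
    nlinarith [mul_lt_mul_of_pos_left h2 h, mul_le_mul_of_nonneg_left h3.le hb]

theorem sphere_compact : IsCompact {x : Fin n → ℂ | nsq x = 1} := by
  refine Metric.isCompact_of_isClosed_isBounded (isClosed_eq nsq_cont continuous_const) ?_
  refine (Metric.isBounded_closedBall (x := (0 : Fin n → ℂ)) (r := 1)).subset ?_
  intro x hx
  rw [mem_closedBall_zero_iff, pi_norm_le_iff_of_nonneg zero_le_one]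
  intro i
  have : ‖x i‖ ^ 2 ≤ nsq x := Finset.single_le_sum (f := fun i => ‖x i‖ ^ 2) (fun _ _ => by positivity) (Finset.mem_univ i)
  rw [show nsq x = 1 from hx] at this
  nlinarith [norm_nonneg (x i)]

theorem exists_unit {x : Fin n → ℂ} (hx : x ≠ 0) : ∃ (c : ℝ), 0 < c ∧ c ^ 2 = nsq x ∧ nsq (((c⁻¹ : ℝ) : ℂ) • x) = 1 := by
  have h := nsq_pos hx
  refine ⟨Real.sqrt (nsq x), Real.sqrt_pos.2 h, Real.sq_sqrt h.le, ?_⟩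
  rw [nsq_smul, Complex.norm_real, Real.norm_eq_abs, sq_abs, inv_pow, Real.sq_sqrt h.le, inv_mul_cancel₀ h.ne']

theorem mem_dom_unit {Z : Matrix (Fin m) (Fin n) ℂ} :
    Z ∈ typeIDomain m n ↔ ∀ x, nsq x = 1 → nsq (Z *ᵥ x) < 1 := by
  rw [mem_dom]
  constructor
  · intro h x hx
    rw [← hx]; apply h; rintro rfl; simp at hx
  · intro h x hx
    obtain ⟨c, hc, hc2, h1⟩ := exists_unit hx
    have := h _ h1
    rw [mulVec_smul, nsq_smul, Complex.norm_real, Real.norm_eq_abs, sq_abs, inv_pow, hc2] at this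
    have h2 := nsq_pos hx
    rw [inv_mul_lt_iff₀ h2] at this
    linarith

theorem mulVec_contAt_pair : Continuous (fun z : Matrix (Fin m) (Fin n) ℂ × (Fin n → ℂ) => z.1 *ᵥ z.2) :=
  Continuous.matrix_mulVec continuous_fst continuous_snd

theorem dom_open : IsOpen (typeIDomain m n) := by
  rw [isOpen_iff_mem_nhds]
  intro Z hZ
  have hZ' := mem_dom_unit.1 hZ
  have := sphere_compact.eventually_forall_of_forall_eventually (x₀ := Z)
    (P := fun (Z : Matrix (Fin m) (Fin n) ℂ) x => nsq (Z *ᵥ x) < 1) (fun x hx => by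
      have hc : ContinuousAt (fun z : Matrix (Fin m) (Fin n) ℂ × (Fin n → ℂ) => nsq (z.1 *ᵥ z.2)) (Z, x) :=
        (nsq_cont.comp mulVec_contAt_pair).continuousAt
      exact hc.eventually (isOpen_Iio.mem_nhds (hZ' x hx)))
  filter_upwards [this] with Y hY
  exact mem_dom_unit.2 hY

theorem norm_le_of_contr {Z : Matrix (Fin m) (Fin n) ℂ} (h : ∀ x, nsq (Z *ᵥ x) ≤ nsq x) : ‖Z‖ ≤ 1 := by
  rw [Matrix.norm_le_iff zero_le_one]
  intro i j
  have h1 := h (Pi.single j 1)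
  have h2 : nsq (Pi.single j 1 : Fin n → ℂ) = 1 := by
    have : ((nsq (Pi.single j 1 : Fin n → ℂ) : ℝ) : ℂ) = 1 := by rw [← nsq_coe]; simp
    exact_mod_cast this
  have h3 : ‖(Z *ᵥ Pi.single j 1) i‖ ^ 2 ≤ nsq (Z *ᵥ Pi.single j 1) :=
    Finset.single_le_sum (f := fun i => ‖(Z *ᵥ Pi.single j 1) i‖ ^ 2) (fun _ _ => by positivity) (Finset.mem_univ i)
  rw [h2] at h1
  have h4 : (Z *ᵥ Pi.single j 1) i = Z i j := by simp
  rw [h4] at h3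
  nlinarith [norm_nonneg (Z i j)]

/-- exhausting compact sets -/
def KK (m n : ℕ) (c : ℝ) : Set (Matrix (Fin m) (Fin n) ℂ) := {Z | ∀ x, nsq (Z *ᵥ x) ≤ c * nsq x}

theorem KK_compact {c : ℝ} (hc : c ≤ 1) : IsCompact (KK m n c) := by
  refine Metric.isCompact_of_isClosed_isBounded ?_ ?_
  · have : KK m n c = ⋂ x, {Z | nsq (Z *ᵥ x) ≤ c * nsq x} := by ext; simp [KK]
    rw [this]
    refine isClosed_iInter (fun x => isClosed_le ?_ continuous_const)
    exact nsq_cont.comp (Continuous.matrix_mulVec continuous_id continuous_const)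
  · refine (Metric.isBounded_closedBall (x := (0 : Matrix (Fin m) (Fin n) ℂ)) (r := 1)).subset ?_
    intro Z hZ
    rw [mem_closedBall_zero_iff]
    exact norm_le_of_contr (fun x => (hZ x).trans (by nlinarith [nsq_nonneg x]))

theorem KK_sub {c : ℝ} (hc : c < 1) : KK m n c ⊆ typeIDomain m n := by
  intro Z hZ
  rw [mem_dom]
  intro x hx
  have := nsq_pos hx
  exact (hZ x).trans_lt (by nlinarith)

theorem conj_contr {Z : Matrix (Fin m) (Fin n) ℂ} (h : ∀ x, nsq (Z *ᵥ x) ≤ nsq x) (y : Fin m → ℂ) :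
    nsq (Zᴴ *ᵥ y) ≤ nsq y := by
  have h1 : star (Zᴴ *ᵥ y) ⬝ᵥ (Zᴴ *ᵥ y) = star y ⬝ᵥ (Z *ᵥ (Zᴴ *ᵥ y)) := by
    rw [star_mulVec_dot, conjTranspose_conjTranspose]
  have h2 := nsq_cs y (Z *ᵥ (Zᴴ *ᵥ y))
  rw [← h1, nsq_coe, Complex.norm_real, Real.norm_eq_abs, sq_abs] at h2
  have h3 := h (Zᴴ *ᵥ y)
  have h4 := nsq_nonneg (Zᴴ *ᵥ y)
  have h5 := nsq_nonneg y
  by_contra hcon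
  push Not at hcon
  nlinarith [mul_le_mul_of_nonneg_left h3 h5]

theorem dom_conj {Z : Matrix (Fin m) (Fin n) ℂ} (h : Z ∈ typeIDomain m n) :
    Zᴴ ∈ typeIDomain n m := by
  rw [mem_dom]
  intro y hy
  have h1 : star (Zᴴ *ᵥ y) ⬝ᵥ (Zᴴ *ᵥ y) = star y ⬝ᵥ (Z *ᵥ (Zᴴ *ᵥ y)) := by
    rw [star_mulVec_dot, conjTranspose_conjTranspose]
  have h2 := nsq_cs y (Z *ᵥ (Zᴴ *ᵥ y))
  rw [← h1, nsq_coe, Complex.norm_real, Real.norm_eq_abs, sq_abs] at h2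
  by_cases h0 : Zᴴ *ᵥ y = 0
  · rw [h0]; simpa using nsq_pos hy
  have h3 := mem_dom.1 h _ h0
  have h4 := nsq_pos h0
  have h5 := nsq_pos hy
  by_contra hcon
  push Not at hcon
  nlinarith [mul_lt_mul_of_pos_left h3 h5]

theorem vecMul_contr {Z : Matrix (Fin m) (Fin n) ℂ} (h : ∀ x, nsq (Z *ᵥ x) ≤ nsq x) (y : Fin m → ℂ) :
    nsq (y ᵥ* Z) ≤ nsq y := by
  have := conj_contr h (star y)
  rw [← nsq_star, star_vecMul]
  rwa [nsq_star] at this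

/-- rank one matrices -/
noncomputable def rk {p q : ℕ} (u : Fin p → ℂ) (v : Fin q → ℂ) (z : ℂ) : Matrix (Fin p) (Fin q) ℂ :=
  z • vecMulVec u (star v)

theorem rk_mulVec {p q : ℕ} (u : Fin p → ℂ) (v : Fin q → ℂ) (z : ℂ) (x : Fin q → ℂ) :
    rk u v z *ᵥ x = (z * (star v ⬝ᵥ x)) • u := by
  rw [rk, smul_mulVec, vecMulVec_mulVec, op_smul_eq_smul, smul_smul]

theorem rk_add_mem {p q : ℕ} {u : Fin p → ℂ} {v : Fin q → ℂ} (hu : nsq u = 1) (hv : nsq v = 1)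
    {z : ℂ} (hz : ‖z‖ < 1) {W : Matrix (Fin p) (Fin q) ℂ} (hW : W ∈ typeIDomain p q)
    (h1 : W *ᵥ v = 0) (h2 : star u ᵥ* W = 0) : rk u v z + W ∈ typeIDomain p q := by
  rw [mem_dom] at *
  intro x hx
  set a := star v ⬝ᵥ x with ha
  set x' := x - a • v with hx'
  have hxe : x = a • v + x' := by rw [hx']; abel
  have horth : star (a • v) ⬝ᵥ x' = 0 := by
    rw [star_smul, smul_dotProduct, hx', dotProduct_sub, dotProduct_smul, nsq_coe, hv, ← ha]
    simp
  have e1 : (rk u v z + W) *ᵥ x = (z * a) • u + W *ᵥ x' := by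
    rw [add_mulVec, rk_mulVec, hx', mulVec_sub, mulVec_smul, h1]; simp [ha]
  have o2 : star ((z * a) • u) ⬝ᵥ (W *ᵥ x') = 0 := by
    rw [star_smul, smul_dotProduct, dotProduct_mulVec, h2]; simp
  rw [e1, nsq_orth o2, nsq_smul, hu, norm_mul]
  have e3 : nsq x = ‖a‖ ^ 2 + nsq x' := by
    conv_lhs => rw [hxe]
    rw [nsq_orth horth, nsq_smul, hv, mul_one]
  rw [e3]
  have hz2 : ‖z‖ ^ 2 < 1 := by nlinarith [norm_nonneg z]
  by_cases hx0 : x' = 0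
  · rw [hx0]; simp only [mulVec_zero, nsq_zero]
    have ha0 : a ≠ 0 := by
      intro h0; apply hx; rw [hxe, hx0, h0]; simp
    have : 0 < ‖a‖ ^ 2 := by positivity
    nlinarith
  · have := hW x' hx0
    nlinarith [sq_nonneg ‖a‖]

theorem rk_mem {p q : ℕ} {u : Fin p → ℂ} {v : Fin q → ℂ} (hu : nsq u = 1) (hv : nsq v = 1)
    {z : ℂ} (hz : ‖z‖ < 1) : rk u v z ∈ typeIDomain p q := by
  have := rk_add_mem hu hv hz zero_mem_dom (by simp) (by simp)
  simpa using this

end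


theorem disc0 {g : ℂ → ℂ} (hg : DifferentiableOn ℂ g (Metric.ball 0 1))
    (hb : ∀ z : ℕ → ℂ, (∀ n, ‖z n‖ < 1) → Tendsto (fun n => ‖z n‖) atTop (𝓝 1) →
      ∃ φ : ℕ → ℕ, StrictMono φ ∧ Tendsto (fun n => g (z (φ n))) atTop (𝓝 0)) :
    ∀ z, ‖z‖ < 1 → g z = 0 := by
  intro z0 hz0
  by_contra h0
  have hpos : 0 < ‖g z0‖ := norm_pos_iff.2 h0
  have hex : ∃ r, ‖z0‖ < r ∧ r < 1 ∧ ∀ z, ‖z‖ = r → ‖g z‖ ≤ ‖g z0‖ / 2 := by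
    by_contra hcon
    push Not at hcon
    have hr : ∀ n : ℕ, ‖z0‖ < 1 - (1 - ‖z0‖) * (1 / ((n : ℝ) + 2)) ∧ 1 - (1 - ‖z0‖) * (1 / ((n : ℝ) + 2)) < 1 := by
      intro n
      have h1 : 0 < 1 / ((n : ℝ) + 2) := by positivity
      have h2 : 1 / ((n : ℝ) + 2) < 1 := by
        rw [div_lt_one (by positivity)]; linarith [Nat.cast_nonneg (α := ℝ) n]
      constructor <;> nlinarith
    choose z hz1 hz2 using fun n => hcon _ (hr n).1 (hr n).2
    obtain ⟨φ, hφ, ht⟩ := hb z (fun n => by rw [hz1]; exact (hr n).2) (by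
      simp_rw [hz1]
      have h1 : Tendsto (fun n : ℕ => 1 / ((n : ℝ) + 2)) atTop (𝓝 0) := by
        have := (tendsto_one_div_add_atTop_nhds_zero_nat (𝕜 := ℝ)).comp (tendsto_add_atTop_nat 1)
        refine this.congr (fun n => ?_)
        simp; ring
      have := (h1.const_mul (1 - ‖z0‖)).const_sub 1
      simpa using this)
    have h1 := ht.norm
    rw [norm_zero] at h1
    have h2 := h1.eventually (gt_mem_nhds (half_pos hpos))
    obtain ⟨n, hn⟩ := h2.exists
    exact absurd hn (not_lt.2 (hz2 (φ n)).le)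
  obtain ⟨r, hr0, hr1, hr⟩ := hex
  have hrp : 0 < r := (norm_nonneg _).trans_lt hr0
  have hsub : Metric.closedBall (0 : ℂ) r ⊆ Metric.ball 0 1 := Metric.closedBall_subset_ball hr1
  have := Complex.norm_le_of_forall_mem_frontier_norm_le (f := g) (U := Metric.ball 0 r)
    Metric.isBounded_ball
    (DifferentiableOn.diffContOnCl (by rw [closure_ball _ hrp.ne']; exact hg.mono hsub))
    (C := ‖g z0‖ / 2) (by
      intro z hz
      rw [frontier_ball _ hrp.ne'] at hz
      exact hr z (by simpa using hz))
    (z := z0) (subset_closure (by simpa using hr0))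
  linarith

section
variable {m n : ℕ}

theorem tendsto_of_nsq {a : ℕ → Fin n → ℂ} (h : Tendsto (fun k => nsq (a k)) atTop (𝓝 0)) :
    Tendsto a atTop (𝓝 0) := by
  rw [tendsto_pi_nhds]
  intro i
  rw [Pi.zero_apply, tendsto_zero_iff_norm_tendsto_zero]
  have h1 : Tendsto (fun k => ‖a k i‖ ^ 2) atTop (𝓝 0) := by
    refine squeeze_zero (fun _ => by positivity) (fun k => ?_) h
    exact Finset.single_le_sum (f := fun i => ‖a k i‖ ^ 2) (fun _ _ => by positivity) (Finset.mem_univ i)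
  have h2 := (Real.continuous_sqrt.tendsto 0).comp h1
  rw [Real.sqrt_zero] at h2
  refine h2.congr (fun k => ?_)
  simp [Real.sqrt_sq]

theorem nsq_diff_le {g : ℂ → Fin m → ℂ} {R : ℝ} (hR : 1 < R) (hg : DifferentiableOn ℂ g (Metric.ball 0 R))
    (h1 : ∀ t, ‖t‖ < R → nsq (g t) ≤ 1) (h0 : nsq (g 0) < 1) :
    nsq (g 1 - g 0) ≤ (1 - nsq (g 0)) * (1 + 2 / (R - 1)) := by
  set y := g 0 with hy
  set h : ℂ → ℂ := fun t => star y ⬝ᵥ g t - (nsq y : ℂ) with hh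
  have hd : DifferentiableOn ℂ h (Metric.ball 0 R) := by
    intro t ht
    have := differentiableWithinAt_pi.1 (hg t ht)
    refine DifferentiableWithinAt.sub ?_ (differentiableWithinAt_const _)
    simp only [dotProduct]
    exact DifferentiableWithinAt.fun_sum (fun i _ => (this i).const_mul _)
  have hre : ∀ t, (h t).re = (star y ⬝ᵥ g t).re - nsq y := by intro t; simp [hh]
  have hM : 0 < (1 - nsq y) / 2 := by linarith
  have := Complex.borelCaratheodory_zero (f := h) (z := 1) hM hd (by
    intro t ht
    show (h t).re ≤ _
    rw [hre]
    have e := nsq_nonneg (y - g t)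
    rw [nsq_sub] at e
    have e2 := h1 t (by simpa using ht)
    linarith) (by linarith) (by simpa using hR) (by simp [hh, nsq_coe, ← hy])
  have h3 : |(h 1).re| ≤ ‖h 1‖ := Complex.abs_re_le_norm _
  rw [hre] at h3
  have h4 := (abs_le.1 (h3.trans this)).1
  have e : nsq (g 1 - y) = nsq y + nsq (g 1) - 2 * (star y ⬝ᵥ g 1).re := by
    rw [← nsq_neg, neg_sub, nsq_sub]
  rw [e]
  have e2 := h1 1 (by simpa using hR)
  simp only [norm_one, mul_one] at h4
  have e3 : (1 - nsq y) * (1 + 2 / (R - 1)) = (1 - nsq y) + 2 * (2 * ((1 - nsq y) / 2) / (R - 1)) := by ring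
  rw [e3]
  linarith

variable {p q p' q' : ℕ} {f : Matrix (Fin p) (Fin q) ℂ → Matrix (Fin p') (Fin q') ℂ}

theorem escape (hP : ProperOn f (typeIDomain p q) (typeIDomain p' q'))
    {v : Fin q → ℂ} (hv : nsq v = 1) {Y : ℕ → Matrix (Fin p) (Fin q) ℂ}
    (hY : ∀ n, Y n ∈ typeIDomain p q) (ht : Tendsto (fun n => nsq (Y n *ᵥ v)) atTop (𝓝 1))
    {c : ℝ} (hc : c < 1) : ∀ᶠ n in atTop, f (Y n) ∉ KK p' q' c := by
  have hK := hP.2 (KK p' q' c) (KK_sub hc) (KK_compact hc.le)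
  set S := typeIDomain p q ∩ f ⁻¹' (KK p' q' c) with hS
  by_cases hne : S.Nonempty
  · have hcn : Continuous (fun Z : Matrix (Fin p) (Fin q) ℂ => nsq (Z *ᵥ v)) :=
      nsq_cont.comp (Continuous.matrix_mulVec continuous_id continuous_const)
    obtain ⟨Z, hZ, hmax⟩ := hK.exists_isMaxOn hne hcn.continuousOn
    have h1 : nsq (Z *ᵥ v) < 1 := mem_dom_unit.1 hZ.1 v hv
    filter_upwards [ht.eventually (lt_mem_nhds h1)] with n hn hmem
    exact absurd (hmax (show Y n ∈ S from ⟨hY n, hmem⟩)) (not_le.2 hn)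
  · filter_upwards with n hmem
    exact hne ⟨Y n, hY n, hmem⟩

theorem escape_seq (hP : ProperOn f (typeIDomain p q) (typeIDomain p' q'))
    {v : Fin q → ℂ} (hv : nsq v = 1) {Y : ℕ → Matrix (Fin p) (Fin q) ℂ}
    (hY : ∀ n, Y n ∈ typeIDomain p q) (ht : Tendsto (fun n => nsq (Y n *ᵥ v)) atTop (𝓝 1)) :
    ∃ (φ : ℕ → ℕ) (x : Fin q' → ℂ), StrictMono φ ∧ nsq x = 1 ∧
      Tendsto (fun n => nsq (f (Y (φ n)) *ᵥ x)) atTop (𝓝 1) := by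
  have hnonempty : {x : Fin q' → ℂ | nsq x = 1}.Nonempty := by
    obtain ⟨n, hn⟩ := (escape hP hv hY ht (c := 0) one_pos).exists
    simp only [KK, Set.mem_ofPred_eq, not_forall] at hn
    obtain ⟨x, hx⟩ := hn
    have hx0 : x ≠ 0 := by rintro rfl; simp at hx
    obtain ⟨c, -, -, h⟩ := exists_unit hx0
    exact ⟨_, h⟩
  have hex : ∀ n, ∃ x : Fin q' → ℂ, nsq x = 1 ∧ ∀ y, nsq y = 1 → nsq (f (Y n) *ᵥ y) ≤ nsq (f (Y n) *ᵥ x) := by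
    intro n
    have hcn : Continuous (fun x : Fin q' → ℂ => nsq (f (Y n) *ᵥ x)) :=
      nsq_cont.comp (Continuous.matrix_mulVec continuous_const continuous_id)
    obtain ⟨x, hx, hmax⟩ := sphere_compact.exists_isMaxOn hnonempty hcn.continuousOn
    exact ⟨x, hx, fun y hy => hmax hy⟩
  choose x hx hxm using hex
  have hlow : ∀ c < 1, ∀ᶠ n in atTop, c < nsq (f (Y n) *ᵥ x n) := by
    intro c hc
    filter_upwards [escape hP hv hY ht hc] with n hn
    simp only [KK, Set.mem_ofPred_eq, not_forall, not_le] at hn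
    obtain ⟨y, hy⟩ := hn
    have hy0 : y ≠ 0 := by rintro rfl; simp at hy
    obtain ⟨s, hs, hs2, h⟩ := exists_unit hy0
    have := hxm n _ h
    rw [mulVec_smul, nsq_smul, Complex.norm_real, Real.norm_eq_abs, sq_abs, inv_pow, hs2] at this
    refine lt_of_lt_of_le ?_ this
    rw [lt_inv_mul_iff₀ (nsq_pos hy0)]
    linarith
  obtain ⟨x0, hx0, φ, hφ, hlim⟩ := sphere_compact.tendsto_subseq hx
  refine ⟨φ, x0, hφ, hx0, ?_⟩
  -- compare
  have hd : Tendsto (fun n => nsq (x (φ n) - x0)) atTop (𝓝 0) := by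
    have h1 : Tendsto (fun n => x (φ n) - x0) atTop (𝓝 0) := by
      simpa using hlim.sub_const x0
    have := (nsq_cont.tendsto (0 : Fin q' → ℂ)).comp h1
    rw [nsq_zero] at this
    exact this
  have hsq : Tendsto (fun n => Real.sqrt (nsq (x (φ n) - x0))) atTop (𝓝 0) := by
    have := (Real.continuous_sqrt.tendsto 0).comp hd
    rw [Real.sqrt_zero] at this
    exact this
  have hl : ∀ n, nsq (f (Y (φ n)) *ᵥ x (φ n)) - 2 * Real.sqrt (nsq (x (φ n) - x0)) ≤ nsq (f (Y (φ n)) *ᵥ x0) := by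
    intro n
    have hfd := hP.1 (hY (φ n))
    set A := f (Y (φ n))
    set a := A *ᵥ x (φ n) with ha
    have e : A *ᵥ x0 = a - A *ᵥ (x (φ n) - x0) := by rw [mulVec_sub]; abel
    rw [e, nsq_sub a]
    have h1 : (star a ⬝ᵥ (A *ᵥ (x (φ n) - x0))).re ≤ Real.sqrt (nsq (x (φ n) - x0)) := by
      refine (Complex.re_le_norm _).trans ?_
      apply Real.le_sqrt_of_sq_le
      refine (nsq_cs _ _).trans ?_
      have i1 : nsq a ≤ 1 := by rw [← hx (φ n)]; exact dom_le hfd _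
      have i2 := dom_le hfd (x (φ n) - x0)
      nlinarith [nsq_nonneg a, nsq_nonneg (A *ᵥ (x (φ n) - x0))]
    linarith [nsq_nonneg (A *ᵥ (x (φ n) - x0))]
  rw [tendsto_order]
  constructor
  · intro c hc
    have h1 := hφ.tendsto_atTop.eventually (hlow ((c + 1) / 2) (by linarith))
    have h2 := hsq.eventually (gt_mem_nhds (show 0 < (1 - c) / 4 by linarith))
    filter_upwards [h1, h2] with n a1 a2
    linarith [hl n]
  · intro c hc
    filter_upwards with n
    have := dom_le (hP.1 (hY (φ n))) x0
    rw [show nsq x0 = 1 from hx0] at this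
    linarith

theorem cluster (hf : DifferentiableOn ℂ f (typeIDomain p q))
    (hP : ProperOn f (typeIDomain p q) (typeIDomain p' q'))
    {u : Fin p → ℂ} {v : Fin q → ℂ} (hu : nsq u = 1) (hv : nsq v = 1) {z : ℕ → ℂ}
    (hz : ∀ n, ‖z n‖ < 1) (ht : Tendsto (fun n => ‖z n‖) atTop (𝓝 1)) :
    ∃ (φ : ℕ → ℕ) (x : Fin q' → ℂ), StrictMono φ ∧ nsq x = 1 ∧
      Tendsto (fun n => nsq (f (rk u v (z (φ n))) *ᵥ x)) atTop (𝓝 1) ∧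
      ∀ W ∈ typeIDomain p q, W *ᵥ v = 0 → star u ᵥ* W = 0 →
        Tendsto (fun n => f (rk u v (z (φ n)) + W) *ᵥ x - f (rk u v (z (φ n))) *ᵥ x) atTop (𝓝 0) := by
  obtain ⟨φ, x, hφ, hx, hlim⟩ := escape_seq hP hv (Y := fun n => rk u v (z n))
    (fun n => rk_mem hu hv (hz n)) (by
      have : ∀ n, nsq (rk u v (z n) *ᵥ v) = ‖z n‖ ^ 2 := by
        intro n; rw [rk_mulVec, nsq_smul, nsq_coe, hv, hu]; simp
      simp_rw [this]
      simpa using ht.pow 2)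
  refine ⟨φ, x, hφ, hx, hlim, ?_⟩
  intro W hW hW1 hW2
  obtain ⟨R, hR, hRW⟩ : ∃ R : ℝ, 1 < R ∧ (R : ℂ) • W ∈ typeIDomain p q := by
    have hcn : Continuous (fun R : ℝ => (R : ℂ) • W) := by fun_prop
    have : ∀ᶠ R : ℝ in 𝓝[>] (1:ℝ), (R : ℂ) • W ∈ typeIDomain p q := by
      have h1 : Tendsto (fun R : ℝ => (R : ℂ) • W) (𝓝 1) (𝓝 W) := by
        have := hcn.tendsto 1
        simpa using this
      exact (h1.eventually (dom_open.mem_nhds hW)).filter_mono nhdsWithin_le_nhds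
    obtain ⟨R, h1, h2⟩ := (this.and self_mem_nhdsWithin).exists
    exact ⟨R, h2, h1⟩
  have hmem : ∀ t : ℂ, ‖t‖ < R → t • W ∈ typeIDomain p q := by
    intro t ht
    have hR0 : (R : ℂ) ≠ 0 := by exact_mod_cast (by linarith : R ≠ 0)
    have := dom_balanced hRW (t := t / R) (by
      rw [norm_div, Complex.norm_real, Real.norm_eq_abs, abs_of_pos (by linarith), div_le_one (by linarith)]
      exact ht.le)
    rwa [smul_smul, div_mul_cancel₀ _ hR0] at this
  have hmem2 : ∀ n, ∀ t : ℂ, ‖t‖ < R → rk u v (z n) + t • W ∈ typeIDomain p q := fun n t ht =>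
    rk_add_mem hu hv (hz n) (hmem t ht) (by rw [smul_mulVec, hW1, smul_zero])
      (by rw [vecMul_smul, hW2, smul_zero])
  apply tendsto_of_nsq
  have hb : ∀ n, nsq (f (rk u v (z (φ n)) + W) *ᵥ x - f (rk u v (z (φ n))) *ᵥ x) ≤
      (1 - nsq (f (rk u v (z (φ n))) *ᵥ x)) * (1 + 2 / (R - 1)) := by
    intro n
    have := nsq_diff_le (g := fun t => f (rk u v (z (φ n)) + t • W) *ᵥ x) hR (by
      intro t ht
      have hm := hmem2 (φ n) t (by simpa using ht)
      have h1 : DifferentiableAt ℂ f (rk u v (z (φ n)) + t • W) := hf.differentiableAt (dom_open.mem_nhds hm)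
      have h2 : DifferentiableAt ℂ (fun t : ℂ => rk u v (z (φ n)) + t • W) t := by fun_prop
      have h3 : DifferentiableAt ℂ (fun t : ℂ => f (rk u v (z (φ n)) + t • W)) t := h1.comp t h2
      exact (mdiff_mulVec h3 (differentiableAt_const _)).differentiableWithinAt) (by
      intro t ht
      rw [← hx]
      exact dom_le (hP.1 (hmem2 (φ n) t ht)) _) (by
      simp only [zero_smul, add_zero]
      exact mem_dom_unit.1 (hP.1 (rk_mem hu hv (hz _))) x hx)
    simpa using this
  refine squeeze_zero (fun _ => nsq_nonneg _) hb ?_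
  have := (hlim.const_sub 1).mul_const (1 + 2 / (R - 1))
  simpa using this

end


/-- pseudo-unitary block matrices -/
structure JU {p q : ℕ} (a : Matrix (Fin p) (Fin p) ℂ) (b : Matrix (Fin p) (Fin q) ℂ)
    (c : Matrix (Fin q) (Fin p) ℂ) (d : Matrix (Fin q) (Fin q) ℂ) : Prop where
  h1 : aᴴ * a = 1 + cᴴ * c
  h2 : dᴴ * d = 1 + bᴴ * b
  h3 : aᴴ * b = cᴴ * d
  g1 : a * aᴴ = 1 + b * bᴴ
  g2 : d * dᴴ = 1 + c * cᴴ
  g3 : a * cᴴ = b * dᴴ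

noncomputable def mob {p q : ℕ} (a : Matrix (Fin p) (Fin p) ℂ) (b : Matrix (Fin p) (Fin q) ℂ)
    (c : Matrix (Fin q) (Fin p) ℂ) (d : Matrix (Fin q) (Fin q) ℂ) (Z : Matrix (Fin p) (Fin q) ℂ) :
    Matrix (Fin p) (Fin q) ℂ := (a * Z + b) * (c * Z + d)⁻¹

section
variable {p q : ℕ} {a : Matrix (Fin p) (Fin p) ℂ} {b : Matrix (Fin p) (Fin q) ℂ}
    {c : Matrix (Fin q) (Fin p) ℂ} {d : Matrix (Fin q) (Fin q) ℂ}

theorem JU.of_three (h1 : aᴴ * a = 1 + cᴴ * c) (h2 : dᴴ * d = 1 + bᴴ * b) (h3 : aᴴ * b = cᴴ * d) :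
    JU a b c d := by
  have h3' : bᴴ * a = dᴴ * c := by
    have := congrArg conjTranspose h3
    simpa [conjTranspose_mul] using this
  have e : fromBlocks aᴴ (-cᴴ) (-bᴴ) dᴴ * fromBlocks a b c d = 1 := by
    rw [fromBlocks_multiply, ← fromBlocks_one]
    congr 1
    · rw [Matrix.neg_mul, h1]; abel
    · rw [Matrix.neg_mul, h3]; abel
    · rw [Matrix.neg_mul, h3']; abel
    · rw [Matrix.neg_mul, h2]; abel
  rw [mul_eq_one_comm, fromBlocks_multiply, ← fromBlocks_one, fromBlocks_inj] at e
  obtain ⟨e1, e2, e3, e4⟩ := e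
  refine ⟨h1, h2, h3, ?_, ?_, ?_⟩
  · rw [← e1, Matrix.mul_neg]; abel
  · rw [← e4, Matrix.mul_neg]; abel
  · rw [Matrix.mul_neg, neg_add_eq_zero] at e2; exact e2

theorem JU.inv (h : JU a b c d) : JU aᴴ (-cᴴ) (-bᴴ) dᴴ := by
  apply JU.of_three
  · simpa using h.g1
  · simpa using h.g2
  · simpa using h.g3

variable (h : JU a b c d)
include h

theorem JU.h3' : bᴴ * a = dᴴ * c := by
  have := congrArg conjTranspose h.h3
  simpa [conjTranspose_mul] using this

theorem JU.e1 (Z : Matrix (Fin p) (Fin q) ℂ) : aᴴ * (a * Z + b) = Z + cᴴ * (c * Z + d) := by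
  rw [Matrix.mul_add, Matrix.mul_add, ← Matrix.mul_assoc, h.h1, h.h3, Matrix.add_mul, Matrix.one_mul,
    Matrix.mul_assoc, add_assoc]

theorem JU.e2 (Z : Matrix (Fin p) (Fin q) ℂ) : dᴴ * (c * Z + d) = 1 + bᴴ * (a * Z + b) := by
  rw [Matrix.mul_add, Matrix.mul_add, ← Matrix.mul_assoc, ← h.h3', h.h2, Matrix.mul_assoc]
  abel

theorem JU.nsq (Z : Matrix (Fin p) (Fin q) ℂ) (x : Fin q → ℂ) :
    nsq ((c * Z + d) *ᵥ x) - nsq ((a * Z + b) *ᵥ x) = nsq x - nsq (Z *ᵥ x) := by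
  have key : star ((c * Z + d) *ᵥ x) ⬝ᵥ ((c * Z + d) *ᵥ x) - star ((a * Z + b) *ᵥ x) ⬝ᵥ ((a * Z + b) *ᵥ x)
      = star x ⬝ᵥ x - star (Z *ᵥ x) ⬝ᵥ (Z *ᵥ x) := by
    rw [star_mulVec_dot, star_mulVec_dot, star_mulVec_dot, ← dotProduct_sub, ← dotProduct_sub]
    congr 1
    rw [mulVec_mulVec, mulVec_mulVec, mulVec_mulVec, ← sub_mulVec]
    have : (c * Z + d)ᴴ * (c * Z + d) - (a * Z + b)ᴴ * (a * Z + b) = 1 - Zᴴ * Z := by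
      simp only [conjTranspose_add, conjTranspose_mul, Matrix.add_mul, Matrix.mul_assoc]
      rw [h.e2, h.e1]
      simp only [Matrix.mul_add]
      abel
    rw [this, sub_mulVec, one_mulVec]
  rw [nsq_coe, nsq_coe, nsq_coe, nsq_coe] at key
  exact_mod_cast key

variable {Z Z' : Matrix (Fin p) (Fin q) ℂ}

theorem JU.det (hZ : Z ∈ typeIDomain p q) : (c * Z + d).det ≠ 0 := by
  intro h0
  obtain ⟨x, hx, hx0⟩ := Matrix.exists_mulVec_eq_zero_iff.2 h0
  have := h.nsq Z x
  rw [hx0] at this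
  have h1 := mem_dom.1 hZ x hx
  have h2 := nsq_nonneg ((a * Z + b) *ᵥ x)
  simp at this
  linarith

theorem JU.mul_den (hZ : Z ∈ typeIDomain p q) : mob a b c d Z * (c * Z + d) = a * Z + b := by
  rw [mob, Matrix.mul_assoc, Matrix.nonsing_inv_mul _ (isUnit_iff_ne_zero.2 (h.det hZ)), Matrix.mul_one]

theorem JU.mem (hZ : Z ∈ typeIDomain p q) : mob a b c d Z ∈ typeIDomain p q := by
  rw [mem_dom]
  intro y hy
  have hu := isUnit_iff_ne_zero.2 (h.det hZ)
  set x := (c * Z + d)⁻¹ *ᵥ y with hx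
  have hy2 : (c * Z + d) *ᵥ x = y := by rw [hx, mulVec_mulVec, Matrix.mul_nonsing_inv _ hu, one_mulVec]
  have hx0 : x ≠ 0 := by
    intro h0; apply hy; rw [← hy2, h0, mulVec_zero]
  have e : mob a b c d Z *ᵥ y = (a * Z + b) *ᵥ x := by
    rw [← hy2, mulVec_mulVec, h.mul_den hZ]
  have h1 := h.nsq Z x
  have h2 := mem_dom.1 hZ x hx0
  rw [e]
  rw [hy2] at h1
  linarith

theorem JU.left_inv (hZ : Z ∈ typeIDomain p q) :
    mob aᴴ (-cᴴ) (-bᴴ) dᴴ (mob a b c d Z) = Z := by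
  have hu := isUnit_iff_ne_zero.2 (h.det hZ)
  set M := mob a b c d Z with hM
  have hMd := h.mul_den hZ
  rw [← hM] at hMd
  have e2 : (-bᴴ * M + dᴴ) * (c * Z + d) = 1 := by
    rw [Matrix.add_mul, Matrix.mul_assoc, hMd, h.e2, Matrix.neg_mul]; abel
  have e1 : (aᴴ * M + -cᴴ) * (c * Z + d) = Z := by
    rw [Matrix.add_mul, Matrix.mul_assoc, hMd, h.e1, Matrix.neg_mul]; abel
  have e3 : (-bᴴ * M + dᴴ)⁻¹ = c * Z + d := Matrix.inv_eq_right_inv e2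
  rw [mob, e3, e1]

theorem JU.diff (hZ : Z ∈ typeIDomain p q) : DifferentiableAt ℂ (mob a b c d) Z := by
  have hd : DifferentiableAt ℂ (fun Z : Matrix (Fin p) (Fin q) ℂ => c * Z + d) Z :=
    (mdiff_mul (differentiableAt_const c) differentiableAt_id).add_const d
  have hn : DifferentiableAt ℂ (fun Z : Matrix (Fin p) (Fin q) ℂ => a * Z + b) Z :=
    (mdiff_mul (differentiableAt_const a) differentiableAt_id).add_const b
  exact mdiff_mul hn (mdiff_inv hd (h.det hZ))

theorem JU.aut : IsAutOf (mob a b c d) := by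
  refine ⟨fun Z hZ => h.mem hZ, fun Z hZ => (h.diff hZ).differentiableWithinAt,
    mob aᴴ (-cᴴ) (-bᴴ) dᴴ, fun Z hZ => h.inv.mem hZ, fun Z hZ => (h.inv.diff hZ).differentiableWithinAt,
    fun Z hZ => h.left_inv hZ, ?_⟩
  intro Z hZ
  have := h.inv.left_inv hZ
  simpa using this

theorem JU.diff_eq (hZ' : Z' ∈ typeIDomain p q) :
    (mob a b c d Z' * (c * Z + d)) - (a * Z + b) = (a - mob a b c d Z' * c) * (Z' - Z) := by
  have := h.mul_den hZ'
  have e : mob a b c d Z' * (c * Z + d) = mob a b c d Z' * (c * Z' + d) - mob a b c d Z' * c * (Z' - Z) := by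
    rw [Matrix.mul_assoc, ← Matrix.mul_sub, Matrix.mul_sub c]; congr 1; abel
  rw [e, this, Matrix.sub_mul, Matrix.mul_sub a]
  abel

theorem JU.num_inv (hZ : Z ∈ typeIDomain p q) : (aᴴ + Z * bᴴ) * (a - mob a b c d Z * c) = 1 := by
  have hu := isUnit_iff_ne_zero.2 (h.det hZ)
  have e1 : (aᴴ + Z * bᴴ) * (a * Z + b) = (cᴴ + Z * dᴴ) * (c * Z + d) := by
    rw [Matrix.add_mul, Matrix.add_mul, Matrix.mul_assoc, Matrix.mul_assoc, h.e1, h.e2, Matrix.mul_add Z,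
      Matrix.mul_one]
    abel
  have e2 : (aᴴ + Z * bᴴ) * mob a b c d Z = cᴴ + Z * dᴴ := by
    rw [mob, ← Matrix.mul_assoc, e1, Matrix.mul_assoc, Matrix.mul_nonsing_inv _ hu, Matrix.mul_one]
  rw [Matrix.mul_sub, ← Matrix.mul_assoc, e2, Matrix.add_mul, Matrix.add_mul, Matrix.mul_assoc, Matrix.mul_assoc,
    h.h1, h.h3']
  abel

theorem JU.eq_iff (hZ : Z ∈ typeIDomain p q) (hZ' : Z' ∈ typeIDomain p q) (v : Fin q → ℂ) :
    mob a b c d Z' *ᵥ ((c * Z + d) *ᵥ v) = mob a b c d Z *ᵥ ((c * Z + d) *ᵥ v) ↔ Z' *ᵥ v = Z *ᵥ v := by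
  rw [mulVec_mulVec, mulVec_mulVec, h.mul_den hZ, ← sub_eq_zero, ← sub_mulVec, h.diff_eq hZ',
    ← mulVec_mulVec, ← sub_eq_zero (a := Z' *ᵥ v), ← sub_mulVec]
  constructor
  · intro e
    have := congrArg (fun y => (aᴴ + Z' * bᴴ) *ᵥ y) e
    simpa only [mulVec_mulVec, ← Matrix.mul_assoc, h.num_inv hZ', Matrix.one_mul, mulVec_zero] using this
  · intro e; rw [e, mulVec_zero]

theorem JU.eq_iff_row (hZ : Z ∈ typeIDomain p q) (hZ' : Z' ∈ typeIDomain p q) (w : Fin p → ℂ) :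
    (w ᵥ* (aᴴ + Z * bᴴ)) ᵥ* mob a b c d Z' = (w ᵥ* (aᴴ + Z * bᴴ)) ᵥ* mob a b c d Z ↔ w ᵥ* Z' = w ᵥ* Z := by
  have hu := isUnit_iff_ne_zero.2 (h.det hZ')
  have e1 : (aᴴ + Z * bᴴ) * (mob a b c d Z * (c * Z' + d) - mob a b c d Z' * (c * Z' + d)) = Z - Z' := by
    rw [h.mul_den hZ', h.diff_eq hZ, ← Matrix.mul_assoc, h.num_inv hZ, Matrix.one_mul]
  have e2 : ((w ᵥ* (aᴴ + Z * bᴴ)) ᵥ* mob a b c d Z - (w ᵥ* (aᴴ + Z * bᴴ)) ᵥ* mob a b c d Z') ᵥ* (c * Z' + d)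
      = w ᵥ* Z - w ᵥ* Z' := by
    rw [← vecMul_sub Z Z' w, ← e1]
    simp only [sub_vecMul, vecMul_vecMul, Matrix.mul_sub, vecMul_sub, Matrix.mul_assoc]
  constructor
  · intro e
    rw [e, sub_self, zero_vecMul] at e2
    exact (sub_eq_zero.1 e2.symm).symm
  · intro e
    rw [e, sub_self] at e2
    have := congrArg (fun y => y ᵥ* (c * Z' + d)⁻¹) e2
    simp only [vecMul_vecMul, Matrix.mul_nonsing_inv _ hu, vecMul_one, zero_vecMul] at this
    rw [vecMul_vecMul, vecMul_vecMul]
    exact (sub_eq_zero.1 this).symm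

end

section
variable {p q : ℕ}
theorem exists_sq_inv {M : Matrix (Fin q) (Fin q) ℂ} (hM : M.PosDef) :
    ∃ B : Matrix (Fin q) (Fin q) ℂ, B.det ≠ 0 ∧ Bᴴ * M * B = 1 := by
  set U : Matrix (Fin q) (Fin q) ℂ := hM.1.eigenvectorUnitary.1 with hU
  have hUU : Uᴴ * U = 1 := by
    have := Unitary.star_mul_self_of_mem hM.1.eigenvectorUnitary.2
    exact this
  have hs : M = U * diagonal (fun i => (hM.1.eigenvalues i : ℂ)) * Uᴴ := by
    have := hM.1.spectral_theorem
    rw [Unitary.conjStarAlgAut_apply] at this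
    exact this
  set D : Matrix (Fin q) (Fin q) ℂ := diagonal (fun i => (((Real.sqrt (hM.1.eigenvalues i))⁻¹ : ℝ) : ℂ)) with hD
  have hpos := hM.eigenvalues_pos
  have e : (U * D)ᴴ * M * (U * D) = 1 := by
    have e1 : (U * D)ᴴ * M * (U * D) = Dᴴ * ((Uᴴ * U) * diagonal (fun i => (hM.1.eigenvalues i : ℂ)) * (Uᴴ * U)) * D := by
      conv_lhs => rw [hs]
      rw [conjTranspose_mul]
      simp only [Matrix.mul_assoc]
    rw [e1, hUU, Matrix.one_mul, Matrix.mul_one, hD, diagonal_conjTranspose, diagonal_mul_diagonal,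
      diagonal_mul_diagonal, ← diagonal_one]
    congr 1
    funext i
    have hp := Real.sqrt_pos.2 (hpos i)
    have h2 := Real.sq_sqrt (hpos i).le
    simp only [Pi.star_apply, RCLike.star_def, Complex.conj_ofReal]
    rw [← Complex.ofReal_mul, ← Complex.ofReal_mul, ← Complex.ofReal_one, Complex.ofReal_inj]
    field_simp
    rw [h2]
  refine ⟨U * D, ?_, e⟩
  intro h0
  have := congrArg Matrix.det e
  rw [Matrix.det_mul, h0, mul_zero, det_one] at this
  exact zero_ne_one this

theorem JU.exists_of_mem {A : Matrix (Fin p) (Fin q) ℂ} (hA : A ∈ typeIDomain p q) :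
    ∃ a b c d, JU (p := p) (q := q) a b c d ∧ mob a b c d 0 = A := by
  have key : ∀ {r s : ℕ} {A : Matrix (Fin r) (Fin s) ℂ}, A ∈ typeIDomain r s →
      ∃ d : Matrix (Fin s) (Fin s) ℂ, dᴴ * d = 1 + (A * d)ᴴ * (A * d) ∧ d.det ≠ 0 := by
    intro r s A hA
    have hA' : (1 - Aᴴ * A).PosDef := hA
    obtain ⟨B, hBd, hBe⟩ := exists_sq_inv hA'
    refine ⟨B, ?_, hBd⟩
    rw [Matrix.mul_sub, Matrix.sub_mul, Matrix.mul_one, sub_eq_iff_eq_add] at hBe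
    rw [hBe, conjTranspose_mul]
    simp only [Matrix.mul_assoc]
  obtain ⟨d, hd, hdd⟩ := key hA
  obtain ⟨a, ha, -⟩ := key (dom_conj hA)
  refine ⟨a, A * d, Aᴴ * a, d, JU.of_three ha hd ?_, ?_⟩
  · rw [conjTranspose_mul, conjTranspose_conjTranspose, Matrix.mul_assoc]
  · rw [mob]
    simp only [Matrix.mul_zero, zero_add]
    rw [Matrix.mul_assoc, Matrix.mul_nonsing_inv _ (isUnit_iff_ne_zero.2 hdd), Matrix.mul_one]

end


section
variable {p q : ℕ}

theorem IsAutOf.symm' {Φ : Matrix (Fin p) (Fin q) ℂ → Matrix (Fin p) (Fin q) ℂ} (h : IsAutOf Φ) :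
    ∃ Ψ, IsAutOf Ψ ∧ (∀ Z ∈ typeIDomain p q, Ψ (Φ Z) = Z) ∧ (∀ Z ∈ typeIDomain p q, Φ (Ψ Z) = Z) := by
  obtain ⟨h1, h2, Ψ, h3, h4, h5, h6⟩ := h
  exact ⟨Ψ, ⟨h3, h4, Φ, h1, h2, h6, h5⟩, h5, h6⟩

theorem IsAutOf.comp {Φ Φ' : Matrix (Fin p) (Fin q) ℂ → Matrix (Fin p) (Fin q) ℂ} (h : IsAutOf Φ)
    (h' : IsAutOf Φ') : IsAutOf (Φ ∘ Φ') := by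
  obtain ⟨h1, h2, Ψ, h3, h4, h5, h6⟩ := h
  obtain ⟨h1', h2', Ψ', h3', h4', h5', h6'⟩ := h'
  refine ⟨h1.comp h1', h2.comp h2' h1', Ψ' ∘ Ψ, h3'.comp h3, h4'.comp h4 h3, ?_, ?_⟩
  · intro Z hZ
    show Ψ' (Ψ (Φ (Φ' Z))) = Z
    rw [h5 _ (h1' hZ), h5' _ hZ]
  · intro Z hZ
    show Φ (Φ' (Ψ' (Ψ Z))) = Z
    rw [h6' _ (h3 hZ), h6 _ hZ]

variable {p' n : ℕ} {f : Matrix (Fin p) (Fin q) ℂ → Matrix (Fin p') (Fin n) ℂ}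

theorem proper_left {Φ : Matrix (Fin p') (Fin n) ℂ → Matrix (Fin p') (Fin n) ℂ} (hΦ : IsAutOf Φ)
    (hf : ProperOn f (typeIDomain p q) (typeIDomain p' n)) :
    ProperOn (Φ ∘ f) (typeIDomain p q) (typeIDomain p' n) := by
  obtain ⟨h1, h2, Ψ, h3, h4, h5, h6⟩ := hΦ
  refine ⟨h1.comp hf.1, fun K hK hKc => ?_⟩
  have e : typeIDomain p q ∩ (Φ ∘ f) ⁻¹' K = typeIDomain p q ∩ f ⁻¹' (Ψ '' K) := by
    ext Z
    constructor
    · rintro ⟨hZ, hZ2⟩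
      exact ⟨hZ, Φ (f Z), hZ2, h5 _ (hf.1 hZ)⟩
    · rintro ⟨hZ, Y, hY, hY2⟩
      refine ⟨hZ, ?_⟩
      show Φ (f Z) ∈ K
      rw [← hY2, h6 _ (hK hY)]; exact hY
  rw [e]
  refine hf.2 _ ?_ (hKc.image_of_continuousOn (h4.continuousOn.mono hK))
  rintro _ ⟨Y, hY, rfl⟩
  exact h3 (hK hY)

theorem proper_right {ψ : Matrix (Fin p) (Fin q) ℂ → Matrix (Fin p) (Fin q) ℂ} (hψ : IsAutOf ψ)
    (hf : ProperOn f (typeIDomain p q) (typeIDomain p' n)) :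
    ProperOn (f ∘ ψ) (typeIDomain p q) (typeIDomain p' n) := by
  obtain ⟨h1, h2, Ψ, h3, h4, h5, h6⟩ := hψ
  refine ⟨hf.1.comp h1, fun K hK hKc => ?_⟩
  have e : typeIDomain p q ∩ (f ∘ ψ) ⁻¹' K = Ψ '' (typeIDomain p q ∩ f ⁻¹' K) := by
    ext Z
    constructor
    · rintro ⟨hZ, hZ2⟩
      exact ⟨ψ Z, ⟨h1 hZ, hZ2⟩, h5 _ hZ⟩
    · rintro ⟨Y, ⟨hY, hY2⟩, rfl⟩
      refine ⟨h3 hY, ?_⟩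
      show f (ψ (Ψ Y)) ∈ K
      rw [h6 _ hY]; exact hY2
  rw [e]
  exact (hf.2 _ hK hKc).image_of_continuousOn (h4.continuousOn.mono Set.inter_subset_left)

variable {a : Matrix (Fin p) (Fin p) ℂ} {b : Matrix (Fin p) (Fin q) ℂ}
    {c : Matrix (Fin q) (Fin p) ℂ} {d : Matrix (Fin q) (Fin q) ℂ}

theorem JU.right_inv (h : JU a b c d) {Z : Matrix (Fin p) (Fin q) ℂ} (hZ : Z ∈ typeIDomain p q) :
    mob a b c d (mob aᴴ (-cᴴ) (-bᴴ) dᴴ Z) = Z := by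
  have := h.inv.left_inv hZ
  simpa using this

theorem mob_kvb (h : JU a b c d) {Z : Matrix (Fin p) (Fin q) ℂ} (hZ : Z ∈ typeIDomain p q)
    (v : Fin q → ℂ) (w : Fin p → ℂ) :
    Kvb (typeIDomain p q) (f ∘ mob a b c d) Z v w
      = Kvb (typeIDomain p q) f (mob a b c d Z) ((c * Z + d) *ᵥ v) (w ᵥ* (aᴴ + Z * bᴴ)) := by
  ext k
  constructor
  · intro hk Y hY h1 h2
    rw [← h.right_inv hY] at h1 h2 ⊢
    have hY' := h.inv.mem hY
    exact hk _ hY' ((h.eq_iff hZ hY' v).1 h1) ((h.eq_iff_row hZ hY' w).1 h2)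
  · intro hk Y hY h1 h2
    exact hk _ (h.mem hY) ((h.eq_iff hZ hY v).2 h1) ((h.eq_iff_row hZ hY w).2 h2)

theorem mob_ninf (h : JU a b c d) {Z : Matrix (Fin p) (Fin q) ℂ} (hZ : Z ∈ typeIDomain p q)
    (v : Fin q → ℂ) :
    Ninf (typeIDomain p q) (f ∘ mob a b c d) Z v
      = Ninf (typeIDomain p q) f (mob a b c d Z) ((c * Z + d) *ᵥ v) := by
  ext k
  constructor
  · intro hk Y hY h1
    rw [← h.right_inv hY] at h1 ⊢
    have hY' := h.inv.mem hY
    exact hk _ hY' ((h.eq_iff hZ hY' v).1 h1)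
  · intro hk Y hY h1
    exact hk _ (h.mem hY) ((h.eq_iff hZ hY v).2 h1)

variable {A : Matrix (Fin p') (Fin p') ℂ} {B : Matrix (Fin p') (Fin n) ℂ}
    {C : Matrix (Fin n) (Fin p') ℂ} {E : Matrix (Fin n) (Fin n) ℂ}

theorem mob_kvb_t (h : JU A B C E) (hf : Set.MapsTo f (typeIDomain p q) (typeIDomain p' n))
    {Z : Matrix (Fin p) (Fin q) ℂ} (hZ : Z ∈ typeIDomain p q)
    (v : Fin q → ℂ) (w : Fin p → ℂ) (k : Fin n → ℂ) :
    (C * f Z + E) *ᵥ k ∈ Kvb (typeIDomain p q) (mob A B C E ∘ f) Z v w ↔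
      k ∈ Kvb (typeIDomain p q) f Z v w := by
  constructor
  · intro hk Y hY h1 h2
    exact (h.eq_iff (hf hZ) (hf hY) k).1 (hk Y hY h1 h2)
  · intro hk Y hY h1 h2
    exact (h.eq_iff (hf hZ) (hf hY) k).2 (hk Y hY h1 h2)

theorem mob_ninf_t (h : JU A B C E) (hf : Set.MapsTo f (typeIDomain p q) (typeIDomain p' n))
    {Z : Matrix (Fin p) (Fin q) ℂ} (hZ : Z ∈ typeIDomain p q)
    (v : Fin q → ℂ) (k : Fin n → ℂ) :
    (C * f Z + E) *ᵥ k ∈ Ninf (typeIDomain p q) (mob A B C E ∘ f) Z v ↔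
      k ∈ Ninf (typeIDomain p q) f Z v := by
  constructor
  · intro hk Y hY h1
    exact (h.eq_iff (hf hZ) (hf hY) k).1 (hk Y hY h1)
  · intro hk Y hY h1
    exact (h.eq_iff (hf hZ) (hf hY) k).2 (hk Y hY h1)

theorem mob_hK_t (h : JU A B C E) (hf : Set.MapsTo f (typeIDomain p q) (typeIDomain p' n))
    (hK : ∀ k, (∀ Z ∈ typeIDomain p q, ∀ Z' ∈ typeIDomain p q, f Z *ᵥ k = f Z' *ᵥ k) → k = 0) (k : Fin n → ℂ)
    (hk : ∀ Z ∈ typeIDomain p q, ∀ Z' ∈ typeIDomain p q,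
      (mob A B C E ∘ f) Z *ᵥ k = (mob A B C E ∘ f) Z' *ᵥ k) : k = 0 := by
  have h0 : (0 : Matrix (Fin p) (Fin q) ℂ) ∈ typeIDomain p q := zero_mem_dom
  have hu := isUnit_iff_ne_zero.2 (h.det (hf h0))
  have e : k = (C * f 0 + E) *ᵥ ((C * f 0 + E)⁻¹ *ᵥ k) := by
    rw [mulVec_mulVec, Matrix.mul_nonsing_inv _ hu, one_mulVec]
  have key : ∀ Z ∈ typeIDomain p q, f Z *ᵥ ((C * f 0 + E)⁻¹ *ᵥ k) = f 0 *ᵥ ((C * f 0 + E)⁻¹ *ᵥ k) := by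
    intro Z hZ
    refine (h.eq_iff (hf h0) (hf hZ) _).1 ?_
    rw [← e]
    exact hk Z hZ 0 h0
  have := hK ((C * f 0 + E)⁻¹ *ᵥ k) (fun Z hZ Z' hZ' => by rw [key Z hZ, key Z' hZ'])
  rw [e, this, mulVec_zero]

theorem mob_hK {ψ : Matrix (Fin p) (Fin q) ℂ → Matrix (Fin p) (Fin q) ℂ} (hψ : IsAutOf ψ)
    (hK : ∀ k, (∀ Z ∈ typeIDomain p q, ∀ Z' ∈ typeIDomain p q, f Z *ᵥ k = f Z' *ᵥ k) → k = 0) (k : Fin n → ℂ)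
    (hk : ∀ Z ∈ typeIDomain p q, ∀ Z' ∈ typeIDomain p q, (f ∘ ψ) Z *ᵥ k = (f ∘ ψ) Z' *ᵥ k) : k = 0 := by
  obtain ⟨h1, h2, Ψ, h3, h4, h5, h6⟩ := hψ
  refine hK k fun Z hZ Z' hZ' => ?_
  have := hk _ (h3 hZ) _ (h3 hZ')
  simp only [Function.comp] at this
  rwa [h6 _ hZ, h6 _ hZ'] at this

theorem BC0 (hf : DifferentiableOn ℂ f (typeIDomain p q))
    (hP : ProperOn f (typeIDomain p q) (typeIDomain p' n)) {v : Fin q → ℂ} {w : Fin p → ℂ}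
    (hv : v ≠ 0) (hw : w ≠ 0) : Kvb (typeIDomain p q) f 0 v w ≠ ⊥ := by
  intro hbot
  obtain ⟨cv, hcv, -, hv1⟩ := exists_unit hv
  obtain ⟨cw, hcw, -, hw1⟩ := exists_unit (x := star w) (by simpa using hw)
  set v1 := ((cv⁻¹ : ℝ) : ℂ) • v with hv1d
  set u := ((cw⁻¹ : ℝ) : ℂ) • star w with hud
  have hsu : star u = ((cw⁻¹ : ℝ) : ℂ) • w := by rw [hud, star_smul, star_star]; simp
  let ι := {W : Matrix (Fin p) (Fin q) ℂ // W ∈ typeIDomain p q ∧ W *ᵥ v1 = 0 ∧ star u ᵥ* W = 0} × Fin p'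
  let ρ : ℂ → ι → Fin n → ℂ := fun z i => (f (rk u v1 z + i.1.1) - f (rk u v1 z)) i.2
  have hrk : ∀ W : Matrix (Fin p) (Fin q) ℂ, ∀ z, DifferentiableAt ℂ (fun z => rk u v1 z + W) z := by
    intro W z
    unfold rk
    exact ((differentiableAt_id.smul_const _).add_const _)
  have hd : ∀ i z, ‖z‖ < 1 → DifferentiableAt ℂ (fun z => ρ z i) z := by
    intro i z hz
    have h1 : DifferentiableAt ℂ (fun z => f (rk u v1 z + i.1.1)) z := by
      refine DifferentiableAt.comp z (f := fun z => rk u v1 z + i.1.1) ?_ (hrk _ _)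
      exact hf.differentiableAt (dom_open.mem_nhds (rk_add_mem hw1 hv1 hz i.1.2.1 i.1.2.2.1 i.1.2.2.2))
    have h2 : DifferentiableAt ℂ (fun z => f (rk u v1 z)) z := by
      refine DifferentiableAt.comp z (f := fun z => rk u v1 z) ?_ (by unfold rk; exact differentiableAt_id.smul_const _)
      exact hf.differentiableAt (dom_open.mem_nhds (rk_mem hw1 hv1 hz))
    have h3 := h1.sub h2
    exact (differentiableAt_pi.1 h3) i.2
  obtain ⟨r, i, R, hR1, hR2, hR3, -⟩ := ker_basic (ρ := ρ) (x0 := (0 : ℂ)) (fun i => (hd i 0 (by simp)).continuousAt)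
  have hker : rowKer (ρ 0) = ⊥ := by
    rw [eq_bot_iff, ← hbot]
    intro k hk Z' hZ' h1 h2
    have hW1 : Z' *ᵥ v1 = 0 := by rw [hv1d, mulVec_smul, h1]; simp
    have hW2 : star u ᵥ* Z' = 0 := by rw [hsu, smul_vecMul, h2]; simp
    rw [← sub_eq_zero, ← sub_mulVec]
    funext j
    have := hk (⟨Z', hZ', hW1, hW2⟩, j)
    have e0 : rk u v1 0 = 0 := by simp [rk]
    simp only [ρ, e0, zero_add] at this
    exact this
  rw [hker] at hR3
  simp only [finrank_bot, add_zero] at hR3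
  subst hR3
  have hdet0 : (Matrix.of fun a => ρ 0 (i a)).det ≠ 0 := by
    intro h0
    have := congrArg Matrix.det hR1
    rw [Matrix.det_mul, h0, zero_mul, det_one] at this
    exact zero_ne_one this
  apply hdet0
  refine disc0 (g := fun z => (Matrix.of fun a => ρ z (i a)).det) ?_ ?_ 0 (by simp)
  · intro z hz
    refine (mdiff_det (mdiff_iff.2 fun s t => ?_)).differentiableWithinAt
    exact differentiableAt_pi.1 (hd (i s) z (by simpa using hz)) t
  · intro z hz hzt
    obtain ⟨φ, x, hφ, hx1, -, hxW⟩ := cluster hf hP hw1 hv1 hz hzt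
    have hbd : ∀ m, (Matrix.of fun a => ρ (z (φ m)) (i a)) ∈ Metric.closedBall (0 : Matrix (Fin r) (Fin r) ℂ) 2 := by
      intro m
      rw [mem_closedBall_zero_iff, Matrix.norm_le_iff (by norm_num)]
      intro s t
      have hA := norm_le_of_contr (dom_le (hP.1 (rk_mem hw1 hv1 (hz (φ m)))))
      have hB := norm_le_of_contr (dom_le (hP.1 (rk_add_mem hw1 hv1 (hz (φ m)) (i s).1.2.1 (i s).1.2.2.1 (i s).1.2.2.2)))
      have hA' := (Matrix.norm_le_iff zero_le_one).1 hA (i s).2 t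
      have hB' := (Matrix.norm_le_iff zero_le_one).1 hB (i s).2 t
      simp only [ρ, of_apply, Matrix.sub_apply]
      refine (norm_sub_le _ _).trans ?_
      linarith
    obtain ⟨M, -, φ', hφ', hM⟩ := (isCompact_closedBall (0 : Matrix (Fin r) (Fin r) ℂ) 2).tendsto_subseq hbd
    refine ⟨φ ∘ φ', hφ.comp hφ', ?_⟩
    have hMx : M *ᵥ x = 0 := by
      have h1 : Tendsto (fun m => (Matrix.of fun a => ρ (z (φ (φ' m))) (i a)) *ᵥ x) atTop (𝓝 (M *ᵥ x)) := by
        have hc : Continuous fun N : Matrix (Fin r) (Fin r) ℂ => N *ᵥ x :=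
          Continuous.matrix_mulVec continuous_id continuous_const
        exact (hc.tendsto M).comp hM
      have h2 : Tendsto (fun m => (Matrix.of fun a => ρ (z (φ (φ' m))) (i a)) *ᵥ x) atTop (𝓝 0) := by
        refine tendsto_pi_nhds.2 fun s => ?_
        have := (tendsto_pi_nhds.1 (hxW _ (i s).1.2.1 (i s).1.2.2.1 (i s).1.2.2.2)) (i s).2
        refine (this.comp hφ'.tendsto_atTop).congr fun m => ?_
        simp only [Function.comp, ← sub_mulVec]
        rfl
      exact tendsto_nhds_unique h1 h2
    have hM0 : M.det = 0 := by
      refine Matrix.exists_mulVec_eq_zero_iff.1 ⟨x, ?_, hMx⟩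
      intro h0
      rw [h0, nsq_zero] at hx1
      exact zero_ne_one hx1
    have hc : Continuous fun N : Matrix (Fin r) (Fin r) ℂ => N.det := Continuous.matrix_det continuous_id
    have := (hc.tendsto M).comp hM
    rw [hM0] at this
    exact this

theorem BC (hf : DifferentiableOn ℂ f (typeIDomain p q))
    (hP : ProperOn f (typeIDomain p q) (typeIDomain p' n)) {Z : Matrix (Fin p) (Fin q) ℂ}
    (hZ : Z ∈ typeIDomain p q) {v : Fin q → ℂ} {w : Fin p → ℂ}
    (hv : v ≠ 0) (hw : w ≠ 0) : Kvb (typeIDomain p q) f Z v w ≠ ⊥ := by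
  obtain ⟨a, b, c, d, h, hm⟩ := JU.exists_of_mem hZ
  have h0 : (0 : Matrix (Fin p) (Fin q) ℂ) ∈ typeIDomain p q := zero_mem_dom
  have h1 := isUnit_iff_ne_zero.2 (h.det h0)
  have h2 := h.num_inv h0
  have h2' := mul_eq_one_comm.1 h2
  have key := BC0 (f := f ∘ mob a b c d) (hf.comp h.aut.2.1 h.aut.1) (proper_right h.aut hP)
    (v := (c * (0 : Matrix (Fin p) (Fin q) ℂ) + d)⁻¹ *ᵥ v) (w := w ᵥ* (a - mob a b c d 0 * c)) ?_ ?_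
  · rw [mob_kvb h h0, hm, mulVec_mulVec, Matrix.mul_nonsing_inv _ h1, one_mulVec] at key
    rw [hm] at h2'
    rw [vecMul_vecMul, h2', vecMul_one] at key
    exact key
  · intro e
    apply hv
    have := congrArg (fun y => (c * (0 : Matrix (Fin p) (Fin q) ℂ) + d) *ᵥ y) e
    simpa only [mulVec_mulVec, Matrix.mul_nonsing_inv _ h1, one_mulVec, mulVec_zero] using this
  · intro e
    apply hw
    have := congrArg (fun y => y ᵥ* (aᴴ + (0 : Matrix (Fin p) (Fin q) ℂ) * bᴴ)) e
    simpa only [vecMul_vecMul, h2', vecMul_one, zero_vecMul] using this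

end


section
variable {m : ℕ}

/-- put a row on top of a matrix -/
def consM (θ : Fin (m + 1) → ℂ) (r : Matrix (Fin m) (Fin (m + 1)) ℂ) : Matrix (Fin (m + 1)) (Fin (m + 1)) ℂ :=
  Matrix.of (Fin.cons θ r : Fin (m + 1) → Fin (m + 1) → ℂ)

/-- generalised cross product -/
noncomputable def crossM (r : Matrix (Fin m) (Fin (m + 1)) ℂ) : Fin (m + 1) → ℂ :=
  fun j => (consM 0 r).adjugate j 0

theorem crossM_eq (θ : Fin (m + 1) → ℂ) (r : Matrix (Fin m) (Fin (m + 1)) ℂ) (j : Fin (m + 1)) :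
    crossM r j = (consM θ r).adjugate j 0 := by
  rw [crossM, adjugate_apply, adjugate_apply]
  congr 1
  ext a b
  refine Fin.cases ?_ (fun a => ?_) a
  · simp [consM, updateRow_apply]
  · simp [consM, updateRow_apply]
    rfl

theorem crossM_dot (θ : Fin (m + 1) → ℂ) (r : Matrix (Fin m) (Fin (m + 1)) ℂ) :
    θ ⬝ᵥ crossM r = (consM θ r).det := by
  have := congrArg (fun A => A 0 0) (Matrix.mul_adjugate (consM θ r))
  simp only [Matrix.mul_apply, Matrix.smul_apply, one_apply_eq, smul_eq_mul, mul_one] at this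
  rw [← this]
  simp only [dotProduct]
  refine Finset.sum_congr rfl fun j _ => ?_
  rw [crossM_eq θ]
  rfl

theorem consM_mulVec_zero (θ : Fin (m + 1) → ℂ) (r : Matrix (Fin m) (Fin (m + 1)) ℂ) (x : Fin (m + 1) → ℂ) :
    (consM θ r *ᵥ x) 0 = θ ⬝ᵥ x := rfl

theorem consM_mulVec_succ (θ : Fin (m + 1) → ℂ) (r : Matrix (Fin m) (Fin (m + 1)) ℂ) (x : Fin (m + 1) → ℂ)
    (a : Fin m) : (consM θ r *ᵥ x) a.succ = (r *ᵥ x) a := rfl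

theorem crossM_kernel {r : Matrix (Fin m) (Fin (m + 1)) ℂ} {x : Fin (m + 1) → ℂ} (hx : r *ᵥ x = 0)
    (θ : Fin (m + 1) → ℂ) : (θ ⬝ᵥ crossM r) • x = (θ ⬝ᵥ x) • crossM r := by
  have h1 : consM θ r *ᵥ x = Pi.single 0 (θ ⬝ᵥ x) := by
    funext a
    refine Fin.cases ?_ (fun a => ?_) a
    · rw [consM_mulVec_zero]; simp
    · rw [consM_mulVec_succ, hx]; simp
  have h2 : (consM θ r).adjugate *ᵥ (consM θ r *ᵥ x) = (θ ⬝ᵥ crossM r) • x := by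
    rw [mulVec_mulVec, Matrix.adjugate_mul, crossM_dot, smul_mulVec, one_mulVec]
  rw [← h2, h1]
  funext j
  rw [Matrix.mulVec_single]
  simp only [MulOpposite.smul_eq_mul_unop, Pi.smul_apply, smul_eq_mul]
  rw [crossM_eq θ]
  simp [Matrix.col_apply, mul_comm]

theorem crossM_ne {r : Matrix (Fin m) (Fin (m + 1)) ℂ} {e : Fin (m + 1) → ℂ} (he : e ≠ 0)
    (hr : ∀ x, r *ᵥ x = 0 → ∃ a : ℂ, x = a • e) : crossM r ≠ 0 := by
  intro h0
  have h1 : (consM (star e) r).det = 0 := by rw [← crossM_dot, h0, dotProduct_zero]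
  obtain ⟨x, hx, hx0⟩ := Matrix.exists_mulVec_eq_zero_iff.2 h1
  obtain ⟨a, rfl⟩ := hr x (by
    funext i
    have := congrFun hx0 i.succ
    rwa [consM_mulVec_succ] at this)
  have h2 := congrFun hx0 0
  rw [consM_mulVec_zero, dotProduct_smul] at h2
  simp only [smul_eq_mul, Pi.zero_apply, mul_eq_zero, star_dot_ne he, or_false] at h2
  rw [h2, zero_smul] at hx
  exact hx rfl

theorem crossM_unit {r : Matrix (Fin m) (Fin (m + 1)) ℂ} {x : Fin (m + 1) → ℂ} (hx : r *ᵥ x = 0)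
    (h1 : nsq x = 1) : crossM r = (star x ⬝ᵥ crossM r) • x := by
  have := crossM_kernel hx (star x)
  rw [nsq_coe, h1] at this
  rw [this]; simp

theorem crossM_mult {r : Matrix (Fin m) (Fin (m + 1)) ℂ} {x : Fin (m + 1) → ℂ} (hx : r *ᵥ x = 0)
    (h1 : crossM r ≠ 0) : ∃ a : ℂ, x = a • crossM r := by
  have := crossM_kernel hx (star (crossM r))
  refine ⟨(star (crossM r) ⬝ᵥ crossM r)⁻¹ * (star (crossM r) ⬝ᵥ x), ?_⟩
  rw [mul_smul, ← this, smul_smul, inv_mul_cancel₀ (star_dot_ne h1), one_smul]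

theorem crossM_cont : Continuous (crossM : Matrix (Fin m) (Fin (m + 1)) ℂ → Fin (m + 1) → ℂ) := by
  have h : Continuous (fun r : Matrix (Fin m) (Fin (m + 1)) ℂ => (consM 0 r).adjugate) := by
    refine Continuous.matrix_adjugate ?_
    refine continuous_matrix fun a b => ?_
    refine Fin.cases ?_ (fun a => ?_) a
    · exact continuous_const
    · exact continuous_id.matrix_elem a b
  exact continuous_pi fun j => h.matrix_elem j 0

theorem crossM_diff {r : ℂ → Matrix (Fin m) (Fin (m + 1)) ℂ} {z : ℂ} (h : DifferentiableAt ℂ r z) :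
    DifferentiableAt ℂ (fun z => crossM (r z)) z := by
  have h1 : DifferentiableAt ℂ (fun z => consM 0 (r z)) z := by
    refine mdiff_iff.2 fun a b => ?_
    refine Fin.cases ?_ (fun a => ?_) a
    · exact differentiableAt_const _
    · exact mdiff_iff.1 h a b
  exact differentiableAt_pi.2 fun j => mdiff_iff.1 (mdiff_adj h1) j 0

end

section
variable {p q p' n : ℕ} {f : Matrix (Fin p) (Fin q) ℂ → Matrix (Fin p') (Fin n) ℂ}

theorem rk_vecMul (u : Fin p → ℂ) (v : Fin q → ℂ) (z : ℂ) (x : Fin p → ℂ) :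
    x ᵥ* rk u v z = (z * (x ⬝ᵥ u)) • star v := by
  rw [rk, vecMul_smul, vecMul_vecMulVec, smul_smul]

theorem rk_sub_mem {u : Fin p → ℂ} {v : Fin q → ℂ}
    {z : ℂ} {Z : Matrix (Fin p) (Fin q) ℂ} (hZ : Z ∈ typeIDomain p q)
    (h2 : star u ᵥ* Z = star u ᵥ* rk u v z) : Z - rk u v z ∈ typeIDomain p q := by
  rw [mem_dom] at *
  intro x hx
  refine lt_of_le_of_lt ?_ (hZ x hx)
  have e : Z *ᵥ x = (z * (star v ⬝ᵥ x)) • u + (Z - rk u v z) *ᵥ x := by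
    rw [← rk_mulVec, ← add_mulVec]; congr 1; abel
  have ho : star ((z * (star v ⬝ᵥ x)) • u) ⬝ᵥ ((Z - rk u v z) *ᵥ x) = 0 := by
    rw [star_smul, smul_dotProduct, dotProduct_mulVec, vecMul_sub, h2, sub_self, zero_dotProduct, smul_zero]
  rw [e, nsq_orth ho]
  linarith [nsq_nonneg ((z * (star v ⬝ᵥ x)) • u)]

theorem rk_diff (u : Fin p → ℂ) (v : Fin q → ℂ) (W : Matrix (Fin p) (Fin q) ℂ) (z : ℂ) :
    DifferentiableAt ℂ (fun z => rk u v z + W) z := by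
  unfold rk
  exact ((differentiableAt_id.smul_const _).add_const _)

theorem rk_diff' (u : Fin p → ℂ) (v : Fin q → ℂ) (z : ℂ) :
    DifferentiableAt ℂ (fun z => rk u v z) z := by
  unfold rk
  exact (differentiableAt_id.smul_const _)

theorem frk_diff (hf : DifferentiableOn ℂ f (typeIDomain p q)) {u : Fin p → ℂ} {v : Fin q → ℂ} (hu : nsq u = 1)
    (hv : nsq v = 1) {z : ℂ} (hz : ‖z‖ < 1) : DifferentiableAt ℂ (fun z => f (rk u v z)) z := by
  refine DifferentiableAt.comp z (f := fun z => rk u v z) ?_ (rk_diff' u v z)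
  exact hf.differentiableAt (dom_open.mem_nhds (rk_mem hu hv hz))

theorem frk_diff2 (hf : DifferentiableOn ℂ f (typeIDomain p q)) {u : Fin p → ℂ} {v : Fin q → ℂ} (hu : nsq u = 1)
    (hv : nsq v = 1) {z : ℂ} (hz : ‖z‖ < 1) {W : Matrix (Fin p) (Fin q) ℂ} (hW : W ∈ typeIDomain p q)
    (h1 : W *ᵥ v = 0) (h2 : star u ᵥ* W = 0) :
    DifferentiableAt ℂ (fun z => f (rk u v z + W)) z := by
  refine DifferentiableAt.comp z (f := fun z => rk u v z + W) ?_ (rk_diff u v W z)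
  exact hf.differentiableAt (dom_open.mem_nhds (rk_add_mem hu hv hz hW h1 h2))

theorem kcurve (hf : DifferentiableOn ℂ f (typeIDomain p q))
    (hP : ProperOn f (typeIDomain p q) (typeIDomain p' n)) {u : Fin p → ℂ} {v : Fin q → ℂ}
    (hu : nsq u = 1) (hv : nsq v = 1) {z1 : ℂ} (hz1 : ‖z1‖ < 1) {e : Fin n → ℂ} (he : e ≠ 0)
    (he2 : e ∈ Kvb (typeIDomain p q) f (rk u v z1) v (star u))
    (he3 : ∀ k ∈ Kvb (typeIDomain p q) f (rk u v z1) v (star u), ∃ a : ℂ, k = a • e) :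
    ∃ k : ℂ → Fin n → ℂ, (∀ z, ‖z‖ < 1 → DifferentiableAt ℂ k z) ∧ k z1 ≠ 0 ∧
      (∀ z, ‖z‖ < 1 → k z ≠ 0 → ∀ x ∈ Kvb (typeIDomain p q) f (rk u v z) v (star u), ∃ a : ℂ, x = a • k z) ∧
      (∀ z : ℕ → ℂ, (∀ m, ‖z m‖ < 1) → Tendsto (fun m => ‖z m‖) atTop (𝓝 1) →
        ∃ (φ : ℕ → ℕ) (x : Fin n → ℂ) (M : Matrix (Fin p') (Fin n) ℂ) (k1 : Fin n → ℂ),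
          StrictMono φ ∧ nsq x = 1 ∧ Tendsto (fun m => f (rk u v (z (φ m)))) atTop (𝓝 M) ∧
          Tendsto (fun m => k (z (φ m))) atTop (𝓝 k1) ∧ nsq (M *ᵥ x) = 1 ∧ k1 = (star x ⬝ᵥ k1) • x) := by
  let ι := {W : Matrix (Fin p) (Fin q) ℂ // W ∈ typeIDomain p q ∧ W *ᵥ v = 0 ∧ star u ᵥ* W = 0} × Fin p'
  let ρ : ℂ → ι → Fin n → ℂ := fun z i => (f (rk u v z + i.1.1) - f (rk u v z)) i.2
  have hd : ∀ i z, ‖z‖ < 1 → DifferentiableAt ℂ (fun z => ρ z i) z := by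
    intro i z hz
    have h3 := (frk_diff2 hf hu hv hz i.1.2.1 i.1.2.2.1 i.1.2.2.2).sub (frk_diff hf hu hv hz)
    exact (differentiableAt_pi.1 h3) i.2
  obtain ⟨r, i, R, hR1, hR2, hR3, -⟩ := ker_basic (ρ := ρ) (x0 := z1) (fun i => (hd i z1 hz1).continuousAt)
  have hker : rowKer (ρ z1) = Submodule.span ℂ {e} := by
    have hle : rowKer (ρ z1) ≤ Kvb (typeIDomain p q) f (rk u v z1) v (star u) := by
      intro k hk Z' hZ' h1 h2
      have hW := rk_sub_mem (v := v) (z := z1) hZ' h2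
      have hW1 : (Z' - rk u v z1) *ᵥ v = 0 := by rw [sub_mulVec, h1, sub_self]
      have hW2 : star u ᵥ* (Z' - rk u v z1) = 0 := by rw [vecMul_sub, h2, sub_self]
      rw [← sub_eq_zero, ← sub_mulVec]
      funext j
      have := hk (⟨Z' - rk u v z1, hW, hW1, hW2⟩, j)
      simp only [ρ, add_sub_cancel] at this
      exact this
    apply le_antisymm
    · intro k hk
      obtain ⟨a, ha⟩ := he3 k (hle hk)
      exact Submodule.mem_span_singleton.2 ⟨a, ha.symm⟩
    · rw [Submodule.span_singleton_le_iff_mem]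
      intro w
      have := he2 (rk u v z1 + w.1.1) (rk_add_mem hu hv hz1 w.1.2.1 w.1.2.2.1 w.1.2.2.2)
        (by rw [add_mulVec, w.1.2.2.1, add_zero]) (by rw [vecMul_add, w.1.2.2.2, add_zero])
      rw [← sub_eq_zero, ← sub_mulVec] at this
      exact congrFun this w.2
  have hKle : ∀ z, ‖z‖ < 1 → ∀ x ∈ Kvb (typeIDomain p q) f (rk u v z) v (star u),
      (Matrix.of fun a => ρ z (i a)) *ᵥ x = 0 := by
    intro z hz x hx
    funext s
    have := hx (rk u v z + (i s).1.1) (rk_add_mem hu hv hz (i s).1.2.1 (i s).1.2.2.1 (i s).1.2.2.2)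
        (by rw [add_mulVec, (i s).1.2.2.1, add_zero]) (by rw [vecMul_add, (i s).1.2.2.2, add_zero])
    rw [← sub_eq_zero, ← sub_mulVec] at this
    exact congrFun this (i s).2
  have hR2' : ∀ x, (Matrix.of fun a => ρ z1 (i a)) *ᵥ x = 0 → ∃ a : ℂ, x = a • e := by
    intro x hx
    have : x ∈ rowKer (fun a => ρ z1 (i a)) := fun s => congrFun hx s
    rw [← hR2, hker] at this
    obtain ⟨a, ha⟩ := Submodule.mem_span_singleton.1 this
    exact ⟨a, ha.symm⟩
  rw [hker, finrank_span_singleton he] at hR3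
  subst hR3
  have hrd : ∀ z, ‖z‖ < 1 → DifferentiableAt ℂ (fun z => (Matrix.of fun a => ρ z (i a) : Matrix (Fin r) (Fin (r+1)) ℂ)) z := by
    intro z hz
    exact mdiff_iff.2 fun s t => differentiableAt_pi.1 (hd (i s) z hz) t
  refine ⟨fun z => crossM (Matrix.of fun a => ρ z (i a)), fun z hz => crossM_diff (hrd z hz), crossM_ne he hR2', ?_, ?_⟩
  · intro z hz hk x hx
    exact crossM_mult (hKle z hz x hx) hk
  · intro z hz hzt
    obtain ⟨φ, x, hφ, hx1, hx2, hxW⟩ := cluster hf hP hu hv hz hzt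
    have hbd : ∀ m, (Matrix.of fun a => ρ (z (φ m)) (i a)) ∈ Metric.closedBall (0 : Matrix (Fin r) (Fin (r+1)) ℂ) 2 := by
      intro m
      rw [mem_closedBall_zero_iff, Matrix.norm_le_iff (by norm_num)]
      intro s t
      have hA := norm_le_of_contr (dom_le (hP.1 (rk_mem hu hv (hz (φ m)))))
      have hB := norm_le_of_contr (dom_le (hP.1 (rk_add_mem hu hv (hz (φ m)) (i s).1.2.1 (i s).1.2.2.1 (i s).1.2.2.2)))
      have hA' := (Matrix.norm_le_iff zero_le_one).1 hA (i s).2 t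
      have hB' := (Matrix.norm_le_iff zero_le_one).1 hB (i s).2 t
      simp only [ρ, of_apply, Matrix.sub_apply]
      refine (norm_sub_le _ _).trans ?_
      linarith
    obtain ⟨N, -, φ1, hφ1, hN⟩ := (isCompact_closedBall (0 : Matrix (Fin r) (Fin (r+1)) ℂ) 2).tendsto_subseq hbd
    have hbd2 : ∀ m, f (rk u v (z (φ (φ1 m)))) ∈ Metric.closedBall (0 : Matrix (Fin p') (Fin (r+1)) ℂ) 1 := by
      intro m
      rw [mem_closedBall_zero_iff]
      exact norm_le_of_contr (dom_le (hP.1 (rk_mem hu hv (hz _))))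
    obtain ⟨M, -, φ2, hφ2, hM⟩ := (isCompact_closedBall (0 : Matrix (Fin p') (Fin (r+1)) ℂ) 1).tendsto_subseq hbd2
    have hM' : Tendsto (fun m => f (rk u v (z (φ (φ1 (φ2 m)))))) atTop (𝓝 M) := hM
    refine ⟨φ ∘ φ1 ∘ φ2, x, M, crossM N, hφ.comp (hφ1.comp hφ2), hx1, hM', ?_, ?_, ?_⟩
    · exact ((crossM_cont.tendsto N).comp hN).comp hφ2.tendsto_atTop
    · have hc : Continuous fun N : Matrix (Fin p') (Fin (r+1)) ℂ => nsq (N *ᵥ x) :=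
        nsq_cont.comp (Continuous.matrix_mulVec continuous_id continuous_const)
      have h1 := (hc.tendsto M).comp hM'
      have h2 := hx2.comp (hφ1.comp hφ2).tendsto_atTop
      exact tendsto_nhds_unique h1 h2
    · refine crossM_unit ?_ hx1
      have h1 : Tendsto (fun m => (Matrix.of fun a => ρ (z (φ (φ1 m))) (i a)) *ᵥ x) atTop (𝓝 (N *ᵥ x)) := by
        have hc : Continuous fun N : Matrix (Fin r) (Fin (r+1)) ℂ => N *ᵥ x :=
          Continuous.matrix_mulVec continuous_id continuous_const
        exact (hc.tendsto N).comp hN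
      have h2 : Tendsto (fun m => (Matrix.of fun a => ρ (z (φ (φ1 m))) (i a)) *ᵥ x) atTop (𝓝 0) := by
        refine tendsto_pi_nhds.2 fun s => ?_
        have := (tendsto_pi_nhds.1 (hxW _ (i s).1.2.1 (i s).1.2.2.1 (i s).1.2.2.2)) (i s).2
        refine (this.comp hφ1.tendsto_atTop).congr fun m => ?_
        simp only [Function.comp, ← sub_mulVec]
        rfl
      exact tendsto_nhds_unique h1 h2

end


theorem exists_perp {q : ℕ} (hq : 2 ≤ q) {v : Fin q → ℂ} (hv : v ≠ 0) : ∃ s : Fin q → ℂ, s ≠ 0 ∧ v ⬝ᵥ s = 0 := by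
  have h : v ⬝ᵥ star v ≠ 0 := by rw [dotProduct_comm]; exact star_dot_ne hv
  have h1 := finrank_hyper (⊤ : Submodule ℂ (Fin q → ℂ)) (Submodule.mem_top (x := star v)) h
  have hne : (⊤ ⊓ LinearMap.ker (dotL v) : Submodule ℂ (Fin q → ℂ)) ≠ ⊥ := by
    intro hb; rw [hb] at h1; simp at h1; omega
  obtain ⟨s, hs, hs0⟩ := Submodule.exists_mem_ne_zero_of_ne_bot hne
  refine ⟨s, hs0, ?_⟩
  have := LinearMap.mem_ker.1 hs.2
  rwa [dotL_apply] at this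

theorem eig_lemma {q : ℕ} {M : Matrix (Fin q) (Fin q) ℂ} {v0 : Fin q → ℂ}
    (h : ∀ᶠ v in 𝓝 v0, ∃ a : ℂ, M *ᵥ v = a • v) : ∃ a : ℂ, M = a • (1 : Matrix (Fin q) (Fin q) ℂ) := by
  have key : ∀ i j (v : Fin q → ℂ), (M *ᵥ v) i * v j - (M *ᵥ v) j * v i = 0 := by
    intro i j v
    have hd : ∀ i, Differentiable ℂ (fun v : Fin q → ℂ => (M *ᵥ v) i) := by
      intro i
      simp only [mulVec, dotProduct]
      fun_prop
    refine id_lemma (D := Set.univ) isOpen_univ convex_univ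
      (g := fun v : Fin q → ℂ => (M *ᵥ v) i * v j - (M *ᵥ v) j * v i) ?_ (Set.mem_univ v0) ?_ v (Set.mem_univ v)
    · apply Differentiable.differentiableOn
      exact ((hd i).mul (differentiable_pi.1 differentiable_id j)).sub
        ((hd j).mul (differentiable_pi.1 differentiable_id i))
    · filter_upwards [h] with v hv
      obtain ⟨a, ha⟩ := hv
      simp only [ha, Pi.smul_apply, smul_eq_mul]
      ring
  have hoff : ∀ i k, i ≠ k → M i k = 0 := by
    intro i k hik
    have := key i k (Pi.single k 1)
    simpa [hik] using this
  have hdiag : ∀ i k, M i i = M k k := by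
    intro i k
    by_cases hik : i = k
    · rw [hik]
    have := key i k (Pi.single k 1 + Pi.single i 1)
    simp [mulVec_add, hik, Ne.symm hik, hoff i k hik, hoff k i (Ne.symm hik), sub_eq_zero] at this
    exact this
  by_cases hq : Nonempty (Fin q)
  · obtain ⟨i0⟩ := hq
    refine ⟨M i0 i0, ?_⟩
    ext i j
    by_cases hij : i = j
    · subst hij; simp [hdiag i i0]
    · simp [hij, hoff i j hij]
  · refine ⟨0, ?_⟩
    ext i; exact absurd ⟨i⟩ hq

section
variable {p q p' n : ℕ} {F : Matrix (Fin p) (Fin q) ℂ → Matrix (Fin p') (Fin n) ℂ}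

theorem vmv_add_right (u : Fin p → ℂ) (a b : Fin q → ℂ) : vecMulVec u (a + b) = vecMulVec u a + vecMulVec u b := by
  ext i j; simp [vecMulVec_apply, mul_add]

theorem vmv_smul_right (u : Fin p → ℂ) (c : ℂ) (b : Fin q → ℂ) : vecMulVec u (c • b) = c • vecMulVec u b := by
  ext i j; simp [vecMulVec_apply]; ring

theorem S1 (hF : DifferentiableOn ℂ F (typeIDomain p q)) (h0 : F 0 = 0) (hq : 2 ≤ q) {K : Matrix (Fin n) (Fin q) ℂ}
    {v0 : Fin q → ℂ} (hv0 : v0 ≠ 0)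
    (h : ∀ᶠ y in 𝓝 v0, ∀ Z ∈ typeIDomain p q, Z *ᵥ y = 0 → F Z *ᵥ (K *ᵥ y) = 0)
    (u : Fin p → ℂ) (η y : Fin q → ℂ) (hη : vecMulVec u η ∈ typeIDomain p q) (hy : η ⬝ᵥ y = 0) :
    F (vecMulVec u η) *ᵥ (K *ᵥ y) = 0 := by
  obtain ⟨O, hO, hOo, hv0O⟩ := eventually_nhds_iff.1 h
  have hcn : Continuous (fun η : Fin q → ℂ => vecMulVec u η) := by
    refine continuous_matrix fun i j => ?_
    simp only [vecMulVec_apply]; fun_prop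
  set S : Set (Fin q → ℂ) := {η | vecMulVec u η ∈ typeIDomain p q} with hS
  have hSo : IsOpen S := dom_open.preimage hcn
  have hSc : Convex ℝ S := by
    intro a ha b hb s t hs ht hst
    have := dom_convex (m := p) (n := q) ha hb hs ht hst
    show vecMulVec u _ ∈ typeIDomain p q
    convert this using 1
    ext i j; simp [vecMulVec_apply]; ring
  -- starting point
  obtain ⟨η2, hη2, hη2v⟩ := exists_perp hq hv0
  have hev : ∀ᶠ t in 𝓝[≠] (0:ℂ), t • η2 ∈ S := by
    have hcc : Continuous (fun t : ℂ => t • η2) := by fun_prop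
    have : ∀ᶠ t in 𝓝 (0:ℂ), t • η2 ∈ S := hcc.continuousAt.eventually (hSo.mem_nhds (by
      show vecMulVec u ((0:ℂ) • η2) ∈ typeIDomain p q
      rw [vmv_smul_right, zero_smul]; exact zero_mem_dom))
    exact this.filter_mono nhdsWithin_le_nhds
  obtain ⟨t, ht, ht0⟩ := (hev.and self_mem_nhdsWithin).exists
  have ht0 : t ≠ 0 := ht0
  set η1 := t • η2 with hη1
  have hη1v : η1 ⬝ᵥ v0 = 0 := by rw [hη1, smul_dotProduct, dotProduct_comm, hη2v, smul_zero]
  have hη10 : η1 ≠ 0 := smul_ne_zero ht0 hη2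
  have hww : η1 ⬝ᵥ star η1 ≠ 0 := by rw [dotProduct_comm]; exact star_dot_ne hη10
  have hdc : ∀ x : Fin q → ℂ, Continuous (fun η : Fin q → ℂ => η ⬝ᵥ x) := by
    intro x; simp only [dotProduct]; fun_prop
  have hnear : ∀ᶠ η in 𝓝 η1, η ∈ S ∧ ∀ y, η ⬝ᵥ y = 0 → F (vecMulVec u η) *ᵥ (K *ᵥ y) = 0 := by
    have hc1 : ContinuousAt (fun η : Fin q → ℂ => v0 - ((η ⬝ᵥ v0) / (η ⬝ᵥ star η1)) • star η1) η1 := by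
      refine continuousAt_const.sub (ContinuousAt.fun_smul ?_ continuousAt_const)
      exact (hdc v0).continuousAt.div (hdc _).continuousAt hww
    have hc2 := hc1.eventually (hOo.mem_nhds (by simpa [hη1v] using hv0O))
    have hc3 := (hdc (star η1)).continuousAt.eventually_ne hww
    filter_upwards [hc2, hc3, hSo.mem_nhds ht] with η ha hb hc
    refine ⟨hc, ?_⟩
    have hsp := span_inter_open hOo (G := LinearMap.ker (dotL η)) ⟨_, by
      rw [LinearMap.mem_ker, dotL_apply, dotProduct_sub, dotProduct_smul, smul_eq_mul, div_mul_cancel₀ _ hb, sub_self], ha⟩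
    intro y hy
    have hy' : y ∈ Submodule.span ℂ {v | v ∈ LinearMap.ker (dotL η) ∧ v ∈ O} := by
      rw [hsp, LinearMap.mem_ker, dotL_apply, hy]
    refine Submodule.span_induction (p := fun y _ => F (vecMulVec u η) *ᵥ (K *ᵥ y) = 0) ?_ ?_ ?_ ?_ hy'
    · intro x hx
      refine hO x hx.2 _ hc ?_
      have := LinearMap.mem_ker.1 hx.1
      rw [dotL_apply] at this
      rw [vecMulVec_mulVec, this]; simp
    · simp
    · intro a b _ _ ha hb; rw [mulVec_add, mulVec_add, ha, hb, add_zero]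
    · intro c a _ ha; rw [mulVec_smul, mulVec_smul, ha, smul_zero]
  have hG : ∀ y1 y2 : Fin q → ℂ, ∀ η ∈ S,
      F (vecMulVec u η) *ᵥ (K *ᵥ ((η ⬝ᵥ y1) • y2 - (η ⬝ᵥ y2) • y1)) = 0 := by
    intro y1 y2
    refine id_lemma hSo hSc (g := fun η => F (vecMulVec u η) *ᵥ (K *ᵥ ((η ⬝ᵥ y1) • y2 - (η ⬝ᵥ y2) • y1))) ?_ ht ?_
    · intro η hηS
      apply DifferentiableAt.differentiableWithinAt
      have hd : ∀ x : Fin q → ℂ, DifferentiableAt ℂ (fun η : Fin q → ℂ => η ⬝ᵥ x) η := by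
        intro x; simp only [dotProduct]; fun_prop
      refine mdiff_mulVec ?_ (mdiff_mulVec (differentiableAt_const K) ?_)
      · refine DifferentiableAt.comp η (f := fun η => vecMulVec u η) (hF.differentiableAt (dom_open.mem_nhds hηS)) ?_
        refine mdiff_iff.2 ?_
        intro i j
        simp only [vecMulVec_apply]; fun_prop
      · exact ((hd y1).smul_const _).sub ((hd y2).smul_const _)
    · filter_upwards [hnear] with η hη
      apply hη.2
      rw [dotProduct_sub, dotProduct_smul, dotProduct_smul]; simp; ring
  by_cases hηz : η = 0
  · subst hηz
    have : vecMulVec u (0 : Fin q → ℂ) = 0 := by ext i j; simp [vecMulVec_apply]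
    rw [this, h0, zero_mulVec]
  · have hne : η ⬝ᵥ star η ≠ 0 := by rw [dotProduct_comm]; exact star_dot_ne hηz
    have := hG (star η) y η hη
    rw [hy, zero_smul, sub_zero, mulVec_smul, mulVec_smul] at this
    exact (smul_eq_zero.1 this).resolve_left hne

theorem contr_iso {M : Matrix (Fin p') (Fin n) ℂ} (hM : ∀ x, nsq (M *ᵥ x) ≤ nsq x) {x : Fin n → ℂ}
    (hx : nsq (M *ᵥ x) = nsq x) (y : Fin n → ℂ) : star y ⬝ᵥ x = star (M *ᵥ y) ⬝ᵥ (M *ᵥ x) := by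
  rw [star_mulVec_dot]
  have h : nsq (Mᴴ *ᵥ (M *ᵥ x) - x) ≤ 0 := by
    rw [nsq_sub]
    have h1 := conj_contr hM (M *ᵥ x)
    have h2 : star (Mᴴ *ᵥ (M *ᵥ x)) ⬝ᵥ x = (nsq (M *ᵥ x) : ℂ) := by
      rw [star_mulVec_dot, conjTranspose_conjTranspose, nsq_coe]
    rw [h2, Complex.ofReal_re]
    linarith
  have h2 := nsq_eq_zero.1 (le_antisymm h (nsq_nonneg _))
  rw [sub_eq_zero.1 h2]

theorem contr_lim {A : ℕ → Matrix (Fin p') (Fin n) ℂ} {M : Matrix (Fin p') (Fin n) ℂ}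
    (hA : ∀ m, A m ∈ typeIDomain p' n) (hl : Tendsto A atTop (𝓝 M)) (x : Fin n → ℂ) : nsq (M *ᵥ x) ≤ nsq x := by
  have hcn : Continuous (fun Z : Matrix (Fin p') (Fin n) ℂ => nsq (Z *ᵥ x)) :=
    nsq_cont.comp (Continuous.matrix_mulVec continuous_id continuous_const)
  exact le_of_tendsto ((hcn.tendsto M).comp hl) (Eventually.of_forall fun m => dom_le (hA m) x)

/-- boundary behaviour of the curve `k` -/
def Bdry (F : Matrix (Fin p) (Fin q) ℂ → Matrix (Fin p') (Fin n) ℂ) (u : Fin p → ℂ) (v : Fin q → ℂ)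
    (k : ℂ → Fin n → ℂ) : Prop :=
  ∀ z : ℕ → ℂ, (∀ m, ‖z m‖ < 1) → Tendsto (fun m => ‖z m‖) atTop (𝓝 1) →
        ∃ (φ : ℕ → ℕ) (x : Fin n → ℂ) (M : Matrix (Fin p') (Fin n) ℂ) (k1 : Fin n → ℂ),
          StrictMono φ ∧ nsq x = 1 ∧ Tendsto (fun m => F (rk u v (z (φ m)))) atTop (𝓝 M) ∧
          Tendsto (fun m => k (z (φ m))) atTop (𝓝 k1) ∧ nsq (M *ᵥ x) = 1 ∧ k1 = (star x ⬝ᵥ k1) • x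

theorem bdry_orth (hm : Set.MapsTo F (typeIDomain p q) (typeIDomain p' n)) {u : Fin p → ℂ} {v : Fin q → ℂ}
    (hu : nsq u = 1) (hv : nsq v = 1) {k : ℂ → Fin n → ℂ} (hk : ∀ z, ‖z‖ < 1 → DifferentiableAt ℂ k z)
    (hB : Bdry F u v k) {g : Fin n → ℂ} (hg : ∀ z, ‖z‖ < 1 → F (rk u v z) *ᵥ g = 0) :
    ∀ z, ‖z‖ < 1 → star g ⬝ᵥ k z = 0 := by
  refine disc0 (g := fun z => star g ⬝ᵥ k z) ?_ ?_
  · intro z hz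
    rw [mem_ball_zero_iff] at hz
    have := differentiableAt_pi.1 (hk z hz)
    apply DifferentiableAt.differentiableWithinAt
    simp only [dotProduct]
    exact DifferentiableAt.fun_sum fun i _ => (this i).const_mul _
  · intro z hz ht
    obtain ⟨φ, x, M, k1, hφ, hx, hM, hk1, hMx, hkx⟩ := hB z hz ht
    refine ⟨φ, hφ, ?_⟩
    have hc := contr_lim (fun m => hm (rk_mem hu hv (hz (φ m)))) hM
    have hMg : M *ᵥ g = 0 := by
      have h1 : Tendsto (fun m => F (rk u v (z (φ m))) *ᵥ g) atTop (𝓝 (M *ᵥ g)) :=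
        ((Continuous.matrix_mulVec continuous_id continuous_const).tendsto M).comp hM
      have h2 : (fun m => F (rk u v (z (φ m))) *ᵥ g) = fun _ => 0 := by
        ext1 m; exact hg _ (hz _)
      rw [h2] at h1
      exact tendsto_nhds_unique h1 tendsto_const_nhds
    have h0 : star g ⬝ᵥ k1 = 0 := by
      have := contr_iso hc (hMx.trans hx.symm) g
      rw [hMg] at this
      rw [hkx, dotProduct_smul, this]; simp
    have hcn : Continuous (fun y : Fin n → ℂ => star g ⬝ᵥ y) := by simp only [dotProduct]; fun_prop
    have := (hcn.tendsto k1).comp hk1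
    rw [h0] at this
    exact this

theorem kvb_smul (D : Set (Matrix (Fin p) (Fin q) ℂ)) (Z : Matrix (Fin p) (Fin q) ℂ) {t s : ℂ} (ht : t ≠ 0) (hs : s ≠ 0)
    (v : Fin q → ℂ) (b : Fin p → ℂ) : Kvb D F Z (t • v) (s • b) = Kvb D F Z v b := by
  ext k
  constructor
  · intro h Z' hZ' h1 h2
    exact h Z' hZ' (by rw [mulVec_smul, mulVec_smul, h1]) (by rw [smul_vecMul, smul_vecMul, h2])
  · intro h Z' hZ' h1 h2
    rw [mulVec_smul, mulVec_smul] at h1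
    rw [smul_vecMul, smul_vecMul] at h2
    exact h Z' hZ' (smul_right_injective _ ht h1) (smul_right_injective _ hs h2)

end

theorem add_affine {n : ℕ} {T : ℂ → Fin n → ℂ} (hd : DifferentiableAt ℂ T 0) {r : ℝ} (hr : 0 < r)
    (h : ∀ w w', ‖w‖ < r → ‖w'‖ < r → T (w + w') = T w + T w' - T 0) :
    ∃ β, ∀ w, ‖w‖ < r → T w = T 0 + w • β := by
  refine ⟨deriv T 0, ?_⟩
  have hder : ∀ w, ‖w‖ < r → HasDerivAt T (deriv T 0) w := by
    intro w hw
    have h1 : HasDerivAt (fun x => T (x - w)) (deriv T 0) w := by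
      have := hd.hasDerivAt
      exact HasDerivAt.comp_sub_const w w (by rwa [sub_self])
    have h2 : HasDerivAt (fun x => T w + T (x - w) - T 0) (deriv T 0) w := (h1.const_add _).sub_const _
    refine h2.congr_of_eventuallyEq ?_
    have : ∀ᶠ x in 𝓝 w, ‖x - w‖ < r := by
      have := Metric.ball_mem_nhds w hr
      filter_upwards [this] with x hx
      rwa [Metric.mem_ball, dist_eq_norm] at hx
    filter_upwards [this] with x hx
    rw [← h w (x - w) hw hx]; simp
  intro w hw
  have hS : ∀ x ∈ Metric.ball (0:ℂ) r, HasDerivAt (fun x => T x - x • deriv T 0) 0 x := by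
    intro x hx
    rw [mem_ball_zero_iff] at hx
    have h1 := (hder x hx).sub ((hasDerivAt_id x).smul_const (deriv T 0))
    rw [one_smul, sub_self] at h1
    exact h1
  have := (convex_ball (0:ℂ) r).is_const_of_fderivWithin_eq_zero (𝕜 := ℂ) (f := fun x => T x - x • deriv T 0)
    (fun x hx => (hS x hx).differentiableAt.differentiableWithinAt) (fun x hx => by
      rw [fderivWithin_of_isOpen Metric.isOpen_ball hx]
      have := (hS x hx).hasFDerivAt.fderiv
      rw [this]; ext; simp) (mem_ball_zero_iff.2 hw) (Metric.mem_ball_self hr)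
  simp only [zero_smul, sub_zero] at this
  rw [← this]; simp

theorem affine_lemma {p q n : ℕ} (hq : 2 ≤ q) {U : Set (Matrix (Fin p) (Fin q) ℂ)} (hU : IsOpen U)
    {V : Set (Fin q → ℂ)} (hV : IsOpen V) {N : Matrix (Fin p) (Fin q) ℂ → Matrix (Fin n) (Fin q) ℂ}
    (hN : ∀ Z ∈ U, ∀ Z' ∈ U, ∀ y ∈ V, Z *ᵥ y = Z' *ᵥ y → N Z *ᵥ y = N Z' *ᵥ y)
    {Z1 : Matrix (Fin p) (Fin q) ℂ} (hZ1 : Z1 ∈ U) {v : Fin q → ℂ} (hv : v ∈ V) (hv0 : v ≠ 0) (u : Fin p → ℂ)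
    (c : ℂ) (hd : DifferentiableAt ℂ (fun w : ℂ => N (Z1 + w • vecMulVec u (c • star v)) *ᵥ v) 0) :
    ∃ β, ∀ᶠ w in 𝓝 (0:ℂ), N (Z1 + w • vecMulVec u (c • star v)) *ᵥ v = N Z1 *ᵥ v + w • β := by
  obtain ⟨s0, hs0, hs0v⟩ := exists_perp hq (v := star v) (by simpa using hv0)
  obtain ⟨t, ⟨ht1, ht2⟩, ht0⟩ := (((exists_small hV hv s0).and (exists_small hV hv (-s0))).and self_mem_nhdsWithin).exists
  have ht0 : t ≠ 0 := ht0
  set s := t • s0 with hs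
  have hsn : s ≠ 0 := smul_ne_zero ht0 hs0
  have hs1 : v + s ∈ V := ht1
  have hs2 : v - s ∈ V := by rw [sub_eq_add_neg, hs, ← smul_neg]; exact ht2
  have hvs : star v ⬝ᵥ s = 0 := by rw [hs, dotProduct_smul, hs0v, smul_zero]
  have hsv : star s ⬝ᵥ v = 0 := by rw [star_dot_comm, hvs, star_zero]
  set η := c • star v with hη
  set θ := ((η ⬝ᵥ v) / (star s ⬝ᵥ s)) • star s with hθ
  have a1 : η ⬝ᵥ s = 0 := by rw [hη, smul_dotProduct, hvs, smul_zero]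
  have a2 : θ ⬝ᵥ v = 0 := by rw [hθ, smul_dotProduct, hsv, smul_zero]
  have a3 : θ ⬝ᵥ s = η ⬝ᵥ v := by rw [hθ, smul_dotProduct, smul_eq_mul, div_mul_cancel₀ _ (star_dot_ne hsn)]
  let P : ℂ → ℂ → Matrix (Fin p) (Fin q) ℂ := fun w w' => Z1 + w • vecMulVec u (η + θ) + w' • vecMulVec u (η - θ)
  have hPv : ∀ w w', P w w' *ᵥ v = (Z1 + (w + w') • vecMulVec u η) *ᵥ v := by
    intro w w'
    simp only [P, add_mulVec, smul_mulVec, vecMulVec_mulVec, add_dotProduct, sub_dotProduct, a2]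
    ext i; simp; ring
  have hP1 : ∀ w w' w'', P w w' *ᵥ (v + s) = P w w'' *ᵥ (v + s) := by
    intro w w' w''
    simp only [P, add_mulVec, smul_mulVec, vecMulVec_mulVec, add_dotProduct, sub_dotProduct, dotProduct_add, a1, a2, a3]
    simp
  have hP2 : ∀ w w' w'', P w w' *ᵥ (v - s) = P w'' w' *ᵥ (v - s) := by
    intro w w' w''
    simp only [P, add_mulVec, smul_mulVec, vecMulVec_mulVec, add_dotProduct, sub_dotProduct, dotProduct_sub, a1, a2, a3]
    simp
  have hcP : Continuous (fun z : ℂ × ℂ => P z.1 z.2) := by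
    simp only [P]; fun_prop
  have hc0 : Continuous (fun w : ℂ => Z1 + w • vecMulVec u η) := by fun_prop
  have e1 : ∀ᶠ z in 𝓝 ((0:ℂ),(0:ℂ)), P z.1 z.2 ∈ U ∧ Z1 + (z.1 + z.2) • vecMulVec u η ∈ U := by
    have b1 := (hcP.continuousAt (x := ((0:ℂ),(0:ℂ)))).eventually (hU.mem_nhds (by simpa [P] using hZ1))
    have b2 := ((hc0.comp (continuous_fst.add continuous_snd)).continuousAt (x := ((0:ℂ),(0:ℂ)))).eventually
      (hU.mem_nhds (by simpa using hZ1))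
    exact b1.and b2
  obtain ⟨r, hr, hrr⟩ := Metric.eventually_nhds_iff.1 e1
  have hrr' : ∀ w w' : ℂ, ‖w‖ < r → ‖w'‖ < r → P w w' ∈ U ∧ Z1 + (w + w') • vecMulVec u η ∈ U := by
    intro w w' h1 h2
    exact hrr (y := (w, w')) (by rw [Prod.dist_eq]; simp [h1, h2])
  set T : ℂ → Fin n → ℂ := fun w => N (Z1 + w • vecMulVec u η) *ᵥ v with hT
  have hsum : ∀ w w' : ℂ, ‖w‖ < r → ‖w'‖ < r →
      (2:ℂ) • T (w + w') = N (P w 0) *ᵥ (v + s) + N (P 0 w') *ᵥ (v - s) := by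
    intro w w' h1 h2
    obtain ⟨c1, c2⟩ := hrr' w w' h1 h2
    have d1 : T (w + w') = N (P w w') *ᵥ v := hN _ c2 _ c1 v hv (hPv w w').symm
    have d2 := hN _ c1 _ (hrr' w 0 h1 (by simpa using hr)).1 (v + s) hs1 (hP1 w w' 0)
    have d3 := hN _ c1 _ (hrr' 0 w' (by simpa using hr) h2).1 (v - s) hs2 (hP2 w w' 0)
    rw [d1, ← d2, ← d3, ← mulVec_smul, ← mulVec_add]
    congr 1
    rw [two_smul]; abel
  have hadd : ∀ w w', ‖w‖ < r → ‖w'‖ < r → T (w + w') = T w + T w' - T 0 := by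
    intro w w' h1 h2
    have h00 : ‖(0:ℂ)‖ < r := by simpa using hr
    have e1 := hsum w w' h1 h2
    have e2 := hsum w 0 h1 h00
    have e3 := hsum 0 w' h00 h2
    have e4 := hsum 0 0 h00 h00
    rw [add_zero] at e2 e4
    rw [zero_add] at e3
    apply smul_right_injective _ (two_ne_zero : (2:ℂ) ≠ 0)
    show (2:ℂ) • T (w + w') = (2:ℂ) • (T w + T w' - T 0)
    rw [smul_sub, smul_add, e1, e2, e3, e4]
    abel
  obtain ⟨β, hβ⟩ := add_affine hd hr hadd
  refine ⟨β, ?_⟩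
  filter_upwards [Metric.ball_mem_nhds (0:ℂ) hr] with w hw
  have := hβ w (by simpa using hw)
  simpa [hT] using this


theorem dot_diff {n : ℕ} {g : ℂ → Fin n → ℂ} {z : ℂ} (x : Fin n → ℂ) (hg : DifferentiableAt ℂ g z) :
    DifferentiableAt ℂ (fun z => x ⬝ᵥ g z) z := by
  have := differentiableAt_pi.1 hg
  simp only [dotProduct]
  exact DifferentiableAt.fun_sum fun i _ => (this i).const_mul _

theorem perp_mult {n : ℕ} {v x : Fin n → ℂ} (hv : nsq v = 1)
    (h : ∀ y, star v ⬝ᵥ y = 0 → star y ⬝ᵥ x = 0) : x = (star v ⬝ᵥ x) • v := by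
  have hvv : star v ⬝ᵥ v = 1 := by rw [nsq_coe, hv]; simp
  have h1 : star v ⬝ᵥ (x - (star v ⬝ᵥ x) • v) = 0 := by
    rw [dotProduct_sub, dotProduct_smul, hvv]; simp
  have h2 := h _ h1
  have h3 : star (x - (star v ⬝ᵥ x) • v) ⬝ᵥ v = 0 := by rw [star_dot_comm, h1, star_zero]
  have h4 : star (x - (star v ⬝ᵥ x) • v) ⬝ᵥ (x - (star v ⬝ᵥ x) • v) = 0 := by
    rw [dotProduct_sub, dotProduct_smul, h2, h3]; simp
  by_contra hne
  exact star_dot_ne (sub_ne_zero.2 hne) h4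

theorem rk_eq {p q : ℕ} (u : Fin p → ℂ) (v : Fin q → ℂ) (z : ℂ) : rk u v z = vecMulVec u (z • star v) := by
  rw [rk, vmv_smul_right]

section
variable {p q p' n : ℕ} {F : Matrix (Fin p) (Fin q) ℂ → Matrix (Fin p') (Fin n) ℂ}

theorem kcurve2 (hF : DifferentiableOn ℂ F (typeIDomain p q))
    (hP : ProperOn F (typeIDomain p q) (typeIDomain p' n)) {K : Matrix (Fin n) (Fin q) ℂ}
    (hS : ∀ (u : Fin p → ℂ) (η y : Fin q → ℂ), vecMulVec u η ∈ typeIDomain p q → η ⬝ᵥ y = 0 →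
      F (vecMulVec u η) *ᵥ (K *ᵥ y) = 0)
    {u : Fin p → ℂ} {v : Fin q → ℂ}
    (hu : nsq u = 1) (hv : nsq v = 1) {z1 : ℂ} (hz1 : ‖z1‖ < 1) {e : Fin n → ℂ} (he : e ≠ 0)
    (he2 : e ∈ Kvb (typeIDomain p q) F (rk u v z1) v (star u))
    (he3 : ∀ k ∈ Kvb (typeIDomain p q) F (rk u v z1) v (star u), ∃ a : ℂ, k = a • e) :
    ∃ k : ℂ → Fin n → ℂ, (∀ z, ‖z‖ < 1 → DifferentiableAt ℂ k z) ∧ k z1 ≠ 0 ∧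
      (∀ z, ‖z‖ < 1 → k z ≠ 0 → ∀ x ∈ Kvb (typeIDomain p q) F (rk u v z) v (star u), ∃ a : ℂ, x = a • k z) ∧
      Bdry F u v k ∧ (∀ z, ‖z‖ < 1 → Kᴴ *ᵥ k z = (star v ⬝ᵥ (Kᴴ *ᵥ k z)) • v) := by
  obtain ⟨k, h1, h2, h3, h4⟩ := kcurve hF hP hu hv hz1 he he2 he3
  refine ⟨k, h1, h2, h3, h4, ?_⟩
  intro z hz
  apply perp_mult hv
  intro y hy
  rw [← star_mulVec_dot]
  refine bdry_orth hP.1 hu hv h1 h4 ?_ z hz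
  intro z' hz'
  have := hS u (z' • star v) y (by rw [← rk_eq]; exact rk_mem hu hv hz') (by rw [smul_dotProduct, hy, smul_zero])
  rwa [← rk_eq] at this

theorem eig_point (hF : DifferentiableOn ℂ F (typeIDomain p q))
    (hP : ProperOn F (typeIDomain p q) (typeIDomain p' n)) {K : Matrix (Fin n) (Fin q) ℂ}
    (hS : ∀ (u : Fin p → ℂ) (η y : Fin q → ℂ), vecMulVec u η ∈ typeIDomain p q → η ⬝ᵥ y = 0 →
      F (vecMulVec u η) *ᵥ (K *ᵥ y) = 0)
    {u : Fin p → ℂ} {v : Fin q → ℂ}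
    (hu : nsq u = 1) (hv : nsq v = 1) {z1 : ℂ} (hz1 : ‖z1‖ < 1) {e : Fin n → ℂ} (he : e ≠ 0)
    (he2 : e ∈ Kvb (typeIDomain p q) F (rk u v z1) v (star u))
    (he3 : ∀ k ∈ Kvb (typeIDomain p q) F (rk u v z1) v (star u), ∃ a : ℂ, k = a • e) :
    ∃ a : ℂ, Kᴴ *ᵥ e = a • v := by
  obtain ⟨k, h1, h2, h3, h4, h5⟩ := kcurve2 hF hP hS hu hv hz1 he he2 he3
  obtain ⟨a, ha⟩ := h3 z1 hz1 h2 e he2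
  refine ⟨a * (star v ⬝ᵥ (Kᴴ *ᵥ k z1)), ?_⟩
  rw [ha, mulVec_smul, mul_smul, ← h5 z1 hz1]

theorem eq_of_affine {m : ℕ} {a b c d : Fin m → ℂ} {z1 : ℂ} (h : ∀ᶠ z in 𝓝 z1, a + z • b = c + z • d) :
    a = c ∧ b = d := by
  have := id_eq_lemma (D := Set.univ) isOpen_univ convex_univ (g := fun z : ℂ => a + z • b)
    (h := fun z : ℂ => c + z • d) (by fun_prop) (by fun_prop) (Set.mem_univ z1) h
  have h0 := this 0 (Set.mem_univ _)
  have h1 := this 1 (Set.mem_univ _)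
  simp only [zero_smul, add_zero] at h0
  simp only [one_smul, h0] at h1
  exact ⟨h0, add_left_cancel h1⟩

theorem schwarz_dir (hF : DifferentiableOn ℂ F (typeIDomain p q))
    (hP : ProperOn F (typeIDomain p q) (typeIDomain p' n)) (h0 : F 0 = 0) {u : Fin p → ℂ} {v : Fin q → ℂ}
    (hu : nsq u = 1) (hv : nsq v = 1) {α β : Fin n → ℂ} {δ : Fin p' → ℂ}
    (h : ∀ z, ‖z‖ < 1 → F (rk u v z) *ᵥ (α + z • β) = z • δ) : nsq δ ≤ nsq α := by
  have hr0 : rk u v 0 = 0 := by simp [rk]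
  have hA : ∀ (x : Fin n → ℂ) z, ‖z‖ < 1 → DifferentiableAt ℂ (fun z => star δ ⬝ᵥ (F (rk u v z) *ᵥ x)) z := by
    intro x z hz
    exact dot_diff _ (mdiff_mulVec (frk_diff hF hu hv hz) (differentiableAt_const _))
  have hder : HasDerivAt (fun z => star δ ⬝ᵥ (F (rk u v z) *ᵥ α)) (nsq δ : ℂ) 0 := by
    have h1 : HasDerivAt (fun z : ℂ => z * ((nsq δ : ℂ) - star δ ⬝ᵥ (F (rk u v z) *ᵥ β))) (nsq δ : ℂ) 0 := by
      have := (hasDerivAt_id (0:ℂ)).mul (((hA β 0 (by simp)).hasDerivAt).const_sub (nsq δ : ℂ))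
      have e : (1:ℂ) * ((nsq δ : ℂ) - star δ ⬝ᵥ (F (rk u v 0) *ᵥ β)) + id (0:ℂ) *
          -deriv (fun z => star δ ⬝ᵥ (F (rk u v z) *ᵥ β)) 0 = nsq δ := by
        rw [hr0, h0]; simp
      rw [e] at this
      exact this
    refine h1.congr_of_eventuallyEq ?_
    filter_upwards [Metric.ball_mem_nhds (0:ℂ) one_pos] with z hz
    have := h z (by simpa using hz)
    rw [mulVec_add, mulVec_smul, ← eq_sub_iff_add_eq, ← smul_sub] at this
    rw [this, dotProduct_smul, dotProduct_sub, nsq_coe]; rfl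
  have hle := Complex.norm_deriv_le_div_of_mapsTo_ball (f := fun z => star δ ⬝ᵥ (F (rk u v z) *ᵥ α)) (c := 0)
    (R₁ := 1) (R₂ := Real.sqrt (nsq δ * nsq α)) (fun z hz => (hA α z (by simpa using hz)).differentiableWithinAt) (by
      intro z hz
      rw [mem_closedBall_iff_norm, hr0, h0, zero_mulVec, dotProduct_zero, sub_zero]
      apply Real.le_sqrt_of_sq_le
      refine (nsq_cs _ _).trans ?_
      exact mul_le_mul_of_nonneg_left (dom_le (hP.1 (rk_mem hu hv (by simpa using hz))) α) (nsq_nonneg _)) one_pos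
  rw [hder.deriv, div_one, Complex.norm_real, Real.norm_eq_abs, abs_of_nonneg (nsq_nonneg _)] at hle
  by_cases hd : nsq δ = 0
  · rw [hd]; exact nsq_nonneg _
  have hpos : 0 < nsq δ := lt_of_le_of_ne (nsq_nonneg _) (Ne.symm hd)
  have h2 : nsq δ ^ 2 ≤ nsq δ * nsq α := (Real.le_sqrt hpos.le (mul_nonneg hpos.le (nsq_nonneg _))).1 hle
  rw [sq] at h2
  exact le_of_mul_le_mul_left h2 hpos

theorem bdry_norm (hP : ProperOn F (typeIDomain p q) (typeIDomain p' n)) {u : Fin p → ℂ} {v : Fin q → ℂ}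
    (hu : nsq u = 1) (hv : nsq v = 1) {k : ℂ → Fin n → ℂ} (hB : Bdry F u v k)
    {d : ℂ → ℂ} (hd : ∀ z, ‖z‖ < 1 → DifferentiableAt ℂ d z) {z1 : ℂ} (hz1 : ‖z1‖ < 1) (hd1 : d z1 ≠ 0)
    {α β : Fin n → ℂ} {δ : Fin p' → ℂ} (hab : star α ⬝ᵥ β = 0)
    (hk : ∀ z, ‖z‖ < 1 → k z = d z • (α + z • β))
    (h : ∀ z, ‖z‖ < 1 → F (rk u v z) *ᵥ (α + z • β) = z • δ) : nsq δ = nsq α + nsq β := by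
  by_contra hne
  refine hd1 (disc0 (g := d) (fun z hz => (hd z (by simpa using hz)).differentiableWithinAt) ?_ z1 hz1)
  intro z hz ht
  obtain ⟨φ, x, M, k1, hφ, hx, hM, hk1, hMx, hkx⟩ := hB z hz ht
  refine ⟨φ, hφ, ?_⟩
  have hnk : ∀ w, ‖w‖ < 1 → nsq (k w) - nsq (F (rk u v w) *ᵥ k w) =
      ‖d w‖ ^ 2 * (nsq α + ‖w‖ ^ 2 * (nsq β - nsq δ)) := by
    intro w hw
    rw [hk w hw, mulVec_smul, h w hw, nsq_smul, nsq_smul, nsq_orth (by rw [dotProduct_smul, hab, smul_zero]),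
      nsq_smul, nsq_smul]
    ring
  have l1 : Tendsto (fun m => nsq (k (z (φ m)))) atTop (𝓝 (nsq k1)) := (nsq_cont.tendsto k1).comp hk1
  have l2 : Tendsto (fun m => nsq (F (rk u v (z (φ m))) *ᵥ k (z (φ m)))) atTop (𝓝 (nsq (M *ᵥ k1))) := by
    have := ((nsq_cont.comp mulVec_contAt_pair).tendsto (M, k1)).comp (hM.prodMk_nhds hk1)
    exact this
  have l3 : nsq (M *ᵥ k1) = nsq k1 := by
    rw [hkx, mulVec_smul, nsq_smul, nsq_smul, hMx, hx]
  have l4 := l1.sub l2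
  rw [l3, sub_self] at l4
  have l5 : Tendsto (fun m => nsq α + ‖z (φ m)‖ ^ 2 * (nsq β - nsq δ)) atTop (𝓝 (nsq α + 1 ^ 2 * (nsq β - nsq δ))) :=
    (((ht.comp hφ.tendsto_atTop).pow 2).mul_const _).const_add _
  have hC : nsq α + 1 ^ 2 * (nsq β - nsq δ) ≠ 0 := by
    intro h'; apply hne; linarith
  have l6 := l4.div l5 hC
  rw [zero_div] at l6
  have l7 : Tendsto (fun m => ‖d (z (φ m))‖ ^ 2) atTop (𝓝 0) := by
    refine l6.congr' ?_
    filter_upwards [l5.eventually_ne hC] with m hm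
    simp only [Pi.div_apply]
    rw [hnk _ (hz _), mul_div_assoc, div_self hm, mul_one]
  have l8 := l7.sqrt
  simp only [Real.sqrt_zero, Real.sqrt_sq (norm_nonneg _)] at l8
  exact tendsto_zero_iff_norm_tendsto_zero.2 l8

theorem core (hF : DifferentiableOn ℂ F (typeIDomain p q))
    (hP : ProperOn F (typeIDomain p q) (typeIDomain p' n)) (h0 : F 0 = 0) {K : Matrix (Fin n) (Fin q) ℂ}
    {ρ : ℝ} (hρ : 0 < ρ) (hK : ∀ y, Kᴴ *ᵥ (K *ᵥ y) = (ρ : ℂ) • y)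
    (hS : ∀ (u : Fin p → ℂ) (η y : Fin q → ℂ), vecMulVec u η ∈ typeIDomain p q → η ⬝ᵥ y = 0 →
      F (vecMulVec u η) *ᵥ (K *ᵥ y) = 0)
    {u : Fin p → ℂ} {v : Fin q → ℂ}
    (hu : nsq u = 1) (hv : nsq v = 1) {z1 : ℂ} (hz1 : ‖z1‖ < 1) {T : ℂ → Fin n → ℂ}
    (hT : ∀ᶠ z in 𝓝 z1, Kᴴ *ᵥ T z = (ρ : ℂ) • v ∧ T z ∈ Kvb (typeIDomain p q) F (rk u v z) v (star u))
    (he3 : ∀ k ∈ Kvb (typeIDomain p q) F (rk u v z1) v (star u), ∃ a : ℂ, k = a • T z1)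
    (hk0 : ∀ k ∈ Kvb (typeIDomain p q) F 0 v (star u), ∃ a : ℂ, k = a • (K *ᵥ v))
    (haff : DifferentiableAt ℂ T z1 → ∃ β, ∀ᶠ z in 𝓝 z1, T z = T z1 + (z - z1) • β)
    (haff2 : DifferentiableAt ℂ (fun z => F (rk u v z) *ᵥ T z) z1 →
      ∃ β, ∀ᶠ z in 𝓝 z1, F (rk u v z) *ᵥ T z = F (rk u v z1) *ᵥ T z1 + (z - z1) • β) :
    T z1 = K *ᵥ v ∧ ∃ δ, nsq δ = ρ ∧ ∀ z, ‖z‖ < 1 → F (rk u v z) *ᵥ (K *ᵥ v) = z • δ := by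
  have hv0 : v ≠ 0 := by rintro rfl; simp at hv
  have hρ' : (ρ : ℂ) ≠ 0 := by exact_mod_cast hρ.ne'
  have hr0 : rk u v 0 = 0 := by simp [rk]
  have hvv : star v ⬝ᵥ v = 1 := by rw [nsq_coe, hv]; simp
  have hBo : ∀ᶠ z in 𝓝 z1, ‖z‖ < 1 := by
    filter_upwards [Metric.isOpen_ball.mem_nhds (mem_ball_zero_iff.2 hz1)] with z hz
    simpa using hz
  have hz1b : z1 ∈ Metric.ball (0:ℂ) 1 := mem_ball_zero_iff.2 hz1
  have h0b : (0:ℂ) ∈ Metric.ball (0:ℂ) 1 := Metric.mem_ball_self one_pos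
  have hT1 := hT.self_of_nhds
  have hT0 : T z1 ≠ 0 := by
    intro h
    have := hT1.1
    rw [h, mulVec_zero] at this
    exact smul_ne_zero hρ' hv0 this.symm
  obtain ⟨k, h1, h2, h3, h4, h5⟩ := kcurve2 hF hP hS hu hv hz1 hT0 hT1.2 he3
  set d : ℂ → ℂ := fun z => star v ⬝ᵥ (Kᴴ *ᵥ k z) with hd
  have hdd : ∀ z, ‖z‖ < 1 → DifferentiableAt ℂ d z := fun z hz =>
    dot_diff _ (mdiff_mulVec (differentiableAt_const _) (h1 z hz))
  have hkne := (h1 z1 hz1).continuousAt.eventually_ne h2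
  -- T in terms of k
  have hTk : ∀ᶠ z in 𝓝 z1, d z ≠ 0 ∧ d z • T z = (ρ : ℂ) • k z := by
    filter_upwards [hT, hkne, hBo] with z ha hb hc
    obtain ⟨a, hak⟩ := h3 z hc hb _ ha.2
    have e1 : (a * d z) • v = (ρ : ℂ) • v := by
      rw [← ha.1, hak, mulVec_smul, mul_smul, ← h5 z hc]
    have e2 : a * d z = ρ := smul_left_injective _ hv0 e1
    have e3 : d z ≠ 0 := by
      intro h; rw [h, mul_zero] at e2; exact hρ' e2.symm
    refine ⟨e3, ?_⟩
    rw [hak, smul_smul, ← e2, mul_comm]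
  have hTd : DifferentiableAt ℂ T z1 := by
    have : DifferentiableAt ℂ (fun z => ((d z)⁻¹ * ρ) • k z) z1 :=
      DifferentiableAt.fun_smul (((hdd z1 hz1).inv hTk.self_of_nhds.1).mul_const _) (h1 z1 hz1)
    refine this.congr_of_eventuallyEq ?_
    filter_upwards [hTk] with z hz
    rw [mul_smul, ← hz.2, smul_smul, inv_mul_cancel₀ hz.1, one_smul]
  obtain ⟨β, hβ⟩ := haff hTd
  obtain ⟨δ, hδ⟩ := haff2 (mdiff_mulVec (frk_diff hF hu hv hz1) hTd)
  set α := T z1 - z1 • β with hα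
  have hTa : ∀ᶠ z in 𝓝 z1, T z = α + z • β := by
    filter_upwards [hβ] with z hz
    rw [hz, hα, sub_smul]; abel
  set γ := F (rk u v z1) *ᵥ T z1 - z1 • δ with hγ
  have hFa : ∀ z, ‖z‖ < 1 → F (rk u v z) *ᵥ (α + z • β) = γ + z • δ := by
    intro z hz
    refine id_eq_lemma (D := Metric.ball (0:ℂ) 1) Metric.isOpen_ball (convex_ball _ _)
      (g := fun z => F (rk u v z) *ᵥ (α + z • β)) (h := fun z => γ + z • δ) ?_ (by fun_prop) hz1b ?_ z
      (mem_ball_zero_iff.2 hz)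
    · intro z hz
      exact (mdiff_mulVec (frk_diff hF hu hv (by simpa using hz)) (by fun_prop)).differentiableWithinAt
    · filter_upwards [hTa, hδ] with z ha hb
      rw [← ha, hb, hγ, sub_smul]; abel
  have hγ0 : γ = 0 := by
    have := hFa 0 (by simp)
    rw [hr0, h0, zero_mulVec, zero_smul, add_zero] at this
    exact this.symm
  simp only [hγ0, zero_add] at hFa
  have hka : ∀ z, ‖z‖ < 1 → k z = ((ρ:ℂ)⁻¹ * d z) • (α + z • β) := by
    intro z hz
    refine id_eq_lemma (D := Metric.ball (0:ℂ) 1) Metric.isOpen_ball (convex_ball _ _)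
      (g := fun z => k z) (h := fun z => ((ρ:ℂ)⁻¹ * d z) • (α + z • β)) ?_ ?_ hz1b ?_ z
      (mem_ball_zero_iff.2 hz)
    · intro z hz
      exact (h1 z (by simpa using hz)).differentiableWithinAt
    · intro z hz
      refine DifferentiableAt.differentiableWithinAt ?_
      exact DifferentiableAt.fun_smul ((hdd z (by simpa using hz)).const_mul _) (by fun_prop)
    · filter_upwards [hTa, hTk] with z ha hb
      rw [← ha, mul_smul, hb.2, smul_smul, inv_mul_cancel₀ hρ', one_smul]
  have hKab : Kᴴ *ᵥ α = (ρ:ℂ) • v ∧ Kᴴ *ᵥ β = 0 := by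
    refine eq_of_affine (z1 := z1) ?_
    filter_upwards [hTa, hT] with z ha hb
    rw [smul_zero, add_zero, ← hb.1, ha, mulVec_add, mulVec_smul]
  have hαK : α ∈ Kvb (typeIDomain p q) F 0 v (star u) := by
    intro W hW hWv hWu
    rw [zero_mulVec] at hWv
    rw [vecMul_zero] at hWu
    have := id_eq_lemma (D := Metric.ball (0:ℂ) 1) Metric.isOpen_ball (convex_ball _ _)
      (g := fun z => F (rk u v z + W) *ᵥ (α + z • β)) (h := fun z => F (rk u v z) *ᵥ (α + z • β)) ?_ ?_ hz1b ?_ 0 h0b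
    · simpa [hr0] using this
    · intro z hz
      exact (mdiff_mulVec (frk_diff2 hF hu hv (by simpa using hz) hW hWv hWu) (by fun_prop)).differentiableWithinAt
    · intro z hz
      exact (mdiff_mulVec (frk_diff hF hu hv (by simpa using hz)) (by fun_prop)).differentiableWithinAt
    · filter_upwards [hTa, hT, hBo] with z ha hb hc
      rw [← ha]
      exact hb.2 _ (rk_add_mem hu hv hc hW hWv hWu) (by rw [add_mulVec, hWv, add_zero])
        (by rw [vecMul_add, hWu, add_zero])
  obtain ⟨a, ha⟩ := hk0 α hαK
  have ha1 : a = 1 := by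
    have e := hKab.1
    rw [ha, mulVec_smul, hK, smul_smul] at e
    have := smul_left_injective _ hv0 e
    exact mul_right_cancel₀ hρ' (this.trans (one_mul _).symm)
  rw [ha1, one_smul] at ha
  have hab : star α ⬝ᵥ β = 0 := by rw [ha, star_mulVec_dot, hKab.2, dotProduct_zero]
  have hn1 := bdry_norm hP hu hv h4 (d := fun z => (ρ:ℂ)⁻¹ * d z) (fun z hz => (hdd z hz).const_mul _) hz1
    (mul_ne_zero (inv_ne_zero hρ') hTk.self_of_nhds.1) hab hka hFa
  have hn2 := schwarz_dir hF hP h0 hu hv hFa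
  have hβ0 : β = 0 := nsq_eq_zero.1 (le_antisymm (by linarith) (nsq_nonneg _))
  have hnα : nsq α = ρ := by
    have : (nsq α : ℂ) = ρ := by
      rw [← nsq_coe]
      conv_lhs => rw [ha]
      rw [star_mulVec_dot, hK, dotProduct_smul, hvv]; simp
    exact_mod_cast this
  refine ⟨?_, δ, ?_, ?_⟩
  · rw [← ha, hα, hβ0]; simp
  · rw [hn1, hβ0, hnα]; simp [nsq_zero]
  · intro z hz
    have := hFa z hz
    rwa [hβ0, smul_zero, add_zero, ha] at this

end


theorem polar {n : ℕ} {x : Fin n → ℂ} (hx : x ≠ 0) : ∃ (c : ℝ) (y : Fin n → ℂ), 0 < c ∧ c ^ 2 = nsq x ∧ nsq y = 1 ∧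
    x = (c : ℂ) • y := by
  obtain ⟨c, hc, hc2, h1⟩ := exists_unit hx
  refine ⟨c, _, hc, hc2, h1, ?_⟩
  rw [smul_smul]
  have : (c:ℂ) * ((c⁻¹ : ℝ) : ℂ) = 1 := by
    rw [← Complex.ofReal_mul, mul_inv_cancel₀ hc.ne']; simp
  rw [this, one_smul]

section
variable {p q p' n : ℕ} {F : Matrix (Fin p) (Fin q) ℂ → Matrix (Fin p') (Fin n) ℂ}

theorem aff_conv (hq : 2 ≤ q) {U : Set (Matrix (Fin p) (Fin q) ℂ)} (hU : IsOpen U)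
    {V : Set (Fin q → ℂ)} (hV : IsOpen V) {N : Matrix (Fin p) (Fin q) ℂ → Matrix (Fin n) (Fin q) ℂ}
    (hN : ∀ Z ∈ U, ∀ Z' ∈ U, ∀ y ∈ V, Z *ᵥ y = Z' *ᵥ y → N Z *ᵥ y = N Z' *ᵥ y)
    {Z : Matrix (Fin p) (Fin q) ℂ} (hZ : Z ∈ U) {v : Fin q → ℂ} {c : ℂ} (hc : c ≠ 0) (hv : c • v ∈ V) (hv0 : v ≠ 0)
    (u : Fin p → ℂ) (z1 : ℂ)
    (hd : DifferentiableAt ℂ (fun z : ℂ => N (Z + (z - z1) • vecMulVec u (star v)) *ᵥ v) z1) :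
    ∃ β, ∀ᶠ z in 𝓝 z1, N (Z + (z - z1) • vecMulVec u (star v)) *ᵥ v =
      N (Z + (z1 - z1) • vecMulVec u (star v)) *ᵥ v + (z - z1) • β := by
  have hcn : Continuous (fun y : Fin q → ℂ => c • y) := by fun_prop
  obtain ⟨β, hβ⟩ := affine_lemma hq hU (V := {y | c • y ∈ V}) (hV.preimage hcn) (N := N) (by
    intro Y hY Y' hY' y hy hyy
    have := hN Y hY Y' hY' (c • y) hy (by rw [mulVec_smul, mulVec_smul, hyy])
    rw [mulVec_smul, mulVec_smul] at this
    exact smul_right_injective _ hc this) hZ hv hv0 u 1 (by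
    rw [one_smul]
    have h2 : DifferentiableAt ℂ (fun w : ℂ => z1 + w) 0 := by fun_prop
    have h3 := DifferentiableAt.comp (0:ℂ) (f := fun w : ℂ => z1 + w) (by rw [add_zero]; exact hd) h2
    have h4 : (fun w : ℂ => N (Z + w • vecMulVec u (star v)) *ᵥ v) =
        (fun z : ℂ => N (Z + (z - z1) • vecMulVec u (star v)) *ᵥ v) ∘ (fun w : ℂ => z1 + w) := by
      ext1 w; simp
    rw [h4]; exact h3)
  refine ⟨β, ?_⟩
  have hcc : ContinuousAt (fun z : ℂ => z - z1) z1 := by fun_prop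
  have hcc' : Tendsto (fun z : ℂ => z - z1) (𝓝 z1) (𝓝 0) := by
    have h5 := hcc.tendsto
    rwa [sub_self] at h5
  have := hcc'.eventually hβ
  filter_upwards [this] with z hz
  rw [one_smul] at hz
  rw [hz]; simp

/-- data near the base point -/
def EData (F : Matrix (Fin p) (Fin q) ℂ → Matrix (Fin p') (Fin n) ℂ)
    (κ : Matrix (Fin p) (Fin q) ℂ → Matrix (Fin n) (Fin q) ℂ) (v0 : Fin q → ℂ) (b0 : Fin p → ℂ) (ε : ℝ) : Prop :=
  ∀ Z ∈ Metric.ball (0 : Matrix (Fin p) (Fin q) ℂ) ε, ∀ v ∈ Metric.ball v0 ε, ∀ b ∈ Metric.ball b0 ε,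
    Z ∈ typeIDomain p q ∧ v ≠ 0 ∧ b ≠ 0 ∧ κ Z *ᵥ v ≠ 0 ∧ κ Z *ᵥ v ∈ Ninf (typeIDomain p q) F Z v ∧
    ∀ k ∈ Kvb (typeIDomain p q) F Z v b, ∃ a : ℂ, k = a • (κ Z *ᵥ v)

theorem EData.S {κ : Matrix (Fin p) (Fin q) ℂ → Matrix (Fin n) (Fin q) ℂ} {v0 : Fin q → ℂ} {b0 : Fin p → ℂ} {ε : ℝ}
    (h : EData F κ v0 b0 ε) (hε : 0 < ε) (hF : DifferentiableOn ℂ F (typeIDomain p q)) (h0 : F 0 = 0) (hq : 2 ≤ q) :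
    ∀ (u : Fin p → ℂ) (η y : Fin q → ℂ), vecMulVec u η ∈ typeIDomain p q → η ⬝ᵥ y = 0 →
      F (vecMulVec u η) *ᵥ (κ 0 *ᵥ y) = 0 := by
  intro u η y
  have hb := Metric.mem_ball_self (x := b0) hε
  have hz := Metric.mem_ball_self (x := (0 : Matrix (Fin p) (Fin q) ℂ)) hε
  refine S1 hF h0 hq (h 0 hz v0 (Metric.mem_ball_self hε) b0 hb).2.1 ?_ u η y
  filter_upwards [Metric.ball_mem_nhds v0 hε] with v hv Z hZ hZv
  have := (h 0 hz v hv b0 hb).2.2.2.2.1 Z hZ (by rw [hZv, zero_mulVec])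
  rw [this, h0, zero_mulVec]

theorem EData.step1 {κ : Matrix (Fin p) (Fin q) ℂ → Matrix (Fin n) (Fin q) ℂ} {v0 : Fin q → ℂ} {b0 : Fin p → ℂ} {ε : ℝ}
    (h : EData F κ v0 b0 ε) (hε : 0 < ε) (hF : DifferentiableOn ℂ F (typeIDomain p q))
    (hP : ProperOn F (typeIDomain p q) (typeIDomain p' n)) (h0 : F 0 = 0) (hq : 2 ≤ q) :
    ∃ ρ : ℝ, 0 < ρ ∧ ∀ y, (κ 0)ᴴ *ᵥ (κ 0 *ᵥ y) = (ρ : ℂ) • y := by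
  have hb := Metric.mem_ball_self (x := b0) hε
  have hv := Metric.mem_ball_self (x := v0) hε
  have hz := Metric.mem_ball_self (x := (0 : Matrix (Fin p) (Fin q) ℂ)) hε
  have hb0 : b0 ≠ 0 := (h 0 hz v0 hv b0 hb).2.2.1
  have hv0 : v0 ≠ 0 := (h 0 hz v0 hv b0 hb).2.1
  obtain ⟨cb, u, hcb, -, hu, hbu⟩ := polar (x := star b0) (by simpa using hb0)
  have hb' : b0 = (cb : ℂ) • star u := by
    rw [← star_star b0, hbu]; ext i; simp
  have hcb' : (cb : ℂ) ≠ 0 := by exact_mod_cast hcb.ne'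
  have hS := h.S hε hF h0 hq
  have hr0 : ∀ v : Fin q → ℂ, rk u v 0 = 0 := fun v => by simp [rk]
  obtain ⟨a, ha⟩ := eig_lemma (M := (κ 0)ᴴ * κ 0) (v0 := v0) (by
    filter_upwards [Metric.ball_mem_nhds v0 hε] with v hv
    obtain ⟨-, hvn, -, hκ, hN, hk⟩ := h 0 hz v hv b0 hb
    obtain ⟨cv, w, hcv, -, hw, hvw⟩ := polar hvn
    have hcv' : (cv : ℂ) ≠ 0 := by exact_mod_cast hcv.ne'
    have hKe : Kvb (typeIDomain p q) F 0 v b0 = Kvb (typeIDomain p q) F (rk u w 0) w (star u) := by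
      rw [hr0, hb', hvw, kvb_smul _ _ hcv' hcb']
    obtain ⟨a, ha⟩ := eig_point hF hP hS hu hw (z1 := 0) (by simp) hκ
      (by rw [← hKe]; exact Ninf_le_Kvb _ _ _ hN) (by rw [← hKe]; exact hk)
    refine ⟨a * (cv:ℂ)⁻¹, ?_⟩
    rw [← mulVec_mulVec, ha, mul_smul]
    congr 1
    rw [hvw, smul_smul, inv_mul_cancel₀ hcv', one_smul])
  have hay : ∀ y, (κ 0)ᴴ *ᵥ (κ 0 *ᵥ y) = a • y := by
    intro y; rw [mulVec_mulVec, ha, smul_mulVec, one_mulVec]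
  have h1 : (nsq (κ 0 *ᵥ v0) : ℂ) = a * nsq v0 := by
    rw [← nsq_coe, star_mulVec_dot, hay, dotProduct_smul, nsq_coe]; rfl
  have hp1 := nsq_pos (h 0 hz v0 hv b0 hb).2.2.2.1
  have hp2 := nsq_pos hv0
  have h2 : a = ((nsq (κ 0 *ᵥ v0) / nsq v0 : ℝ) : ℂ) := by
    rw [Complex.ofReal_div, h1, mul_div_cancel_right₀]
    exact_mod_cast hp2.ne'
  refine ⟨nsq (κ 0 *ᵥ v0) / nsq v0, by positivity, ?_⟩
  rw [← h2]; exact hay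

/-- the rank one representative -/
noncomputable def Zq (Z : Matrix (Fin p) (Fin q) ℂ) (v : Fin q → ℂ) : Matrix (Fin p) (Fin q) ℂ :=
  vecMulVec (Z *ᵥ v) (((nsq v : ℝ) : ℂ)⁻¹ • star v)

theorem Zq_mulVec (Z : Matrix (Fin p) (Fin q) ℂ) {v : Fin q → ℂ} (hv : v ≠ 0) : Zq Z v *ᵥ v = Z *ᵥ v := by
  have : ((nsq v : ℝ) : ℂ) ≠ 0 := by exact_mod_cast (nsq_pos hv).ne'
  rw [Zq, vecMulVec_mulVec, smul_dotProduct, nsq_coe, smul_eq_mul, inv_mul_cancel₀ this]; simp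

theorem Zq_eq {Z : Matrix (Fin p) (Fin q) ℂ} {v w : Fin q → ℂ} {u : Fin p → ℂ} {c : ℝ} (hc : 0 < c) {z : ℂ}
    (hw : nsq w = 1)
    (h1 : v = (c : ℂ) • w) (h2 : Z *ᵥ v = (z * c) • u) : Zq Z v = rk u w z := by
  have hc' : (c : ℂ) ≠ 0 := by exact_mod_cast hc.ne'
  rw [Zq, h2, h1, nsq_smul, hw, rk]
  ext i j
  simp [vecMulVec_apply]
  field_simp

theorem ninf_congr {D : Set (Matrix (Fin p) (Fin q) ℂ)} {Z Z' : Matrix (Fin p) (Fin q) ℂ} {v : Fin q → ℂ}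
    (hZ' : Z' ∈ D) (h : Z' *ᵥ v = Z *ᵥ v) {k : Fin n → ℂ} (hk : k ∈ Ninf D F Z v) :
    k ∈ Ninf D F Z' v := by
  intro Y hY hYv
  rw [hk Y hY (hYv.trans h), hk Z' hZ' h]


def SData (F : Matrix (Fin p) (Fin q) ℂ → Matrix (Fin p') (Fin n) ℂ) (K : Matrix (Fin n) (Fin q) ℂ) (ρ : ℝ)
    (N : Matrix (Fin p) (Fin q) ℂ → Matrix (Fin n) (Fin q) ℂ) (U : Set (Matrix (Fin p) (Fin q) ℂ))
    (V : Set (Fin q → ℂ)) : Prop :=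
  ∀ Z ∈ U, ∀ v ∈ V, Z ∈ typeIDomain p q ∧ v ≠ 0 ∧ Z *ᵥ v ≠ 0 ∧ Kᴴ *ᵥ (N Z *ᵥ v) = (ρ : ℂ) • v ∧
    N Z *ᵥ v ∈ Ninf (typeIDomain p q) F Z v ∧
    (∀ k ∈ Kvb (typeIDomain p q) F (Zq Z v) v (star (Z *ᵥ v)), ∃ a : ℂ, k = a • (N Z *ᵥ v)) ∧
    (∀ k ∈ Kvb (typeIDomain p q) F 0 v (star (Z *ᵥ v)), ∃ a : ℂ, k = a • (K *ᵥ v)) ∧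
    K *ᵥ v ∈ Ninf (typeIDomain p q) F 0 v

theorem polar_pair {Z : Matrix (Fin p) (Fin q) ℂ} {v : Fin q → ℂ} (hZ : Z ∈ typeIDomain p q) (hv : v ≠ 0)
    (hZv : Z *ᵥ v ≠ 0) : ∃ (u : Fin p → ℂ) (w : Fin q → ℂ) (c r : ℝ), nsq u = 1 ∧ nsq w = 1 ∧ 0 < c ∧ 0 < r ∧
      r < 1 ∧ v = (c : ℂ) • w ∧ Z *ᵥ v = ((r : ℂ) * c) • u ∧ nsq (Z *ᵥ v) = r ^ 2 * nsq v := by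
  obtain ⟨cv, w, hcv, hcv2, hw, hvw⟩ := polar hv
  obtain ⟨cx, u, hcx, hcx2, hu, hxu⟩ := polar hZv
  have hlt := mem_dom.1 hZ v hv
  refine ⟨u, w, cv, cx / cv, hu, hw, hcv, by positivity, ?_, hvw, ?_, ?_⟩
  · rw [div_lt_one hcv]
    rw [← hcv2, ← hcx2] at hlt
    exact lt_of_pow_lt_pow_left₀ 2 hcv.le hlt
  · rw [hxu]
    congr 1
    have hc' : (cv : ℂ) ≠ 0 := by exact_mod_cast hcv.ne'
    push_cast
    field_simp
  · rw [← hcx2, ← hcv2]; field_simp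

theorem EData.step2 {κ : Matrix (Fin p) (Fin q) ℂ → Matrix (Fin n) (Fin q) ℂ} {v0 : Fin q → ℂ} {b0 : Fin p → ℂ} {ε : ℝ}
    (h : EData F κ v0 b0 ε) (hε : 0 < ε) (hκ : ContinuousAt κ 0) (hF : DifferentiableOn ℂ F (typeIDomain p q))
    (hP : ProperOn F (typeIDomain p q) (typeIDomain p' n)) (h0 : F 0 = 0) (hq : 2 ≤ q) {ρ : ℝ} (hρ : 0 < ρ)
    (hK : ∀ y, (κ 0)ᴴ *ᵥ (κ 0 *ᵥ y) = (ρ : ℂ) • y) :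
    ∃ U V N, IsOpen U ∧ IsOpen V ∧ U.Nonempty ∧ v0 ∈ V ∧ SData F (κ 0) ρ N U V := by
  have hb := Metric.mem_ball_self (x := b0) hε
  have hv := Metric.mem_ball_self (x := v0) hε
  have hz := Metric.mem_ball_self (x := (0 : Matrix (Fin p) (Fin q) ℂ)) hε
  have hb0 : b0 ≠ 0 := (h 0 hz v0 hv b0 hb).2.2.1
  have hv0 : v0 ≠ 0 := (h 0 hz v0 hv b0 hb).2.1
  have hS := h.S hε hF h0 hq
  let i0 : Fin q := ⟨0, by omega⟩
  let lam : Matrix (Fin p) (Fin q) ℂ → ℂ := fun Z => ((κ 0)ᴴ *ᵥ (κ Z *ᵥ Pi.single i0 1)) i0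
  have hlam0 : lam 0 ≠ 0 := by
    simp only [lam, hK]
    simpa using hρ.ne'
  have hlamc : ContinuousAt lam 0 := by
    have h1 := cont_mulV (g := fun _ => (Pi.single i0 1 : Fin q → ℂ)) hκ continuousAt_const
    have h2 := cont_mulV (f := fun _ => (κ 0)ᴴ) continuousAt_const h1
    exact continuousAt_pi.1 h2 i0
  obtain ⟨O, hO, hOo, h0O⟩ := eventually_nhds_iff.1 (hlamc.eventually_ne hlam0)
  -- choice of the base point
  let Y0 : Matrix (Fin p) (Fin q) ℂ := vecMulVec (star b0) (((nsq v0 : ℝ) : ℂ)⁻¹ • star v0)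
  have hY0 : Y0 *ᵥ v0 = star b0 := by
    have : ((nsq v0 : ℝ) : ℂ) ≠ 0 := by exact_mod_cast (nsq_pos hv0).ne'
    simp only [Y0]
    rw [vecMulVec_mulVec, smul_dotProduct, nsq_coe, smul_eq_mul, inv_mul_cancel₀ this]; simp
  have hev : ∀ᶠ s in 𝓝[≠] (0:ℂ), s • Y0 ∈ O ∩ Metric.ball 0 ε := by
    have hcc : Continuous (fun s : ℂ => s • Y0) := by fun_prop
    have : ∀ᶠ s in 𝓝 (0:ℂ), s • Y0 ∈ O ∩ Metric.ball 0 ε := hcc.continuousAt.eventually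
      ((hOo.inter Metric.isOpen_ball).mem_nhds (by simpa using ⟨h0O, hε⟩))
    exact this.filter_mono nhdsWithin_le_nhds
  obtain ⟨s, hs, hs0⟩ := (hev.and self_mem_nhdsWithin).exists
  have hs0 : s ≠ 0 := hs0
  have hss : star s ≠ 0 := by simpa using hs0
  set Zo := s • Y0 with hZo
  have hZov : Zo *ᵥ v0 = s • star b0 := by rw [hZo, smul_mulVec, hY0]
  have hZqo : Zq Zo v0 = Zo := by
    rw [Zq, hZov, hZo]; ext i j; simp [Y0, vecMulVec_apply]; ring
  have hmv : Continuous (fun x : Matrix (Fin p) (Fin q) ℂ × (Fin q → ℂ) => x.1 *ᵥ x.2) := mulVec_contAt_pair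
  have hnv : ((nsq v0 : ℝ) : ℂ) ≠ 0 := by exact_mod_cast (nsq_pos hv0).ne'
  have hcq : ContinuousAt (fun x : Matrix (Fin p) (Fin q) ℂ × (Fin q → ℂ) => Zq x.1 x.2) (Zo, v0) := by
    refine continuousAt_pi.2 fun i => continuousAt_pi.2 fun j => ?_
    simp only [Zq, vecMulVec_apply, Pi.smul_apply, smul_eq_mul, Pi.star_apply]
    refine ContinuousAt.mul (((continuous_apply i).comp hmv).continuousAt) (ContinuousAt.mul ?_ ?_)
    · refine ContinuousAt.inv₀ ?_ hnv
      exact (Complex.continuous_ofReal.comp (nsq_cont.comp continuous_snd)).continuousAt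
    · exact (continuous_star.comp ((continuous_apply j).comp continuous_snd)).continuousAt
  have E1 : ∀ᶠ x in 𝓝 ((Zo, v0) : Matrix (Fin p) (Fin q) ℂ × (Fin q → ℂ)),
      (x.1 ∈ O ∩ Metric.ball 0 ε ∧ x.2 ∈ Metric.ball v0 ε) ∧ x.1 *ᵥ x.2 ≠ 0 ∧ Zq x.1 x.2 ∈ Metric.ball 0 ε ∧
        (star s)⁻¹ • star (x.1 *ᵥ x.2) ∈ Metric.ball b0 ε := by
    refine Eventually.and ?_ (Eventually.and ?_ (Eventually.and ?_ ?_))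
    · exact ((hOo.inter Metric.isOpen_ball).prod Metric.isOpen_ball).mem_nhds ⟨hs, hv⟩
    · refine hmv.continuousAt.eventually_ne ?_
      show Zo *ᵥ v0 ≠ 0
      rw [hZov]; exact smul_ne_zero hs0 (by simpa using hb0)
    · refine hcq.eventually (Metric.isOpen_ball.mem_nhds ?_)
      show Zq Zo v0 ∈ Metric.ball 0 ε
      rw [hZqo]; exact hs.2
    · have hcb : Continuous (fun x : Matrix (Fin p) (Fin q) ℂ × (Fin q → ℂ) => (star s)⁻¹ • star (x.1 *ᵥ x.2)) :=
        (continuous_star.comp hmv).fun_const_smul _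
      refine hcb.continuousAt.eventually (Metric.isOpen_ball.mem_nhds ?_)
      show (star s)⁻¹ • star (Zo *ᵥ v0) ∈ Metric.ball b0 ε
      rw [hZov, star_smul, smul_smul, inv_mul_cancel₀ hss, one_smul, star_star]; exact hb
  obtain ⟨U, hUo, V, hVo, hUV⟩ : ∃ U : Set (Matrix (Fin p) (Fin q) ℂ), (IsOpen U ∧ Zo ∈ U) ∧ ∃ V : Set (Fin q → ℂ),
      (IsOpen V ∧ v0 ∈ V) ∧ ∀ Z ∈ U, ∀ v ∈ V, ((Z ∈ O ∩ Metric.ball 0 ε ∧ v ∈ Metric.ball v0 ε) ∧ Z *ᵥ v ≠ 0 ∧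
        Zq Z v ∈ Metric.ball 0 ε ∧ (star s)⁻¹ • star (Z *ᵥ v) ∈ Metric.ball b0 ε) := by
    rw [nhds_prod_eq] at E1
    obtain ⟨pa, hpa, pb, hpb, hpp⟩ := eventually_prod_iff.1 E1
    obtain ⟨U, hU1, hU2, hU3⟩ := eventually_nhds_iff.1 hpa
    obtain ⟨V, hV1, hV2, hV3⟩ := eventually_nhds_iff.1 hpb
    exact ⟨U, ⟨hU2, hU3⟩, V, ⟨hV2, hV3⟩, fun Z hZ v hv => hpp (hU1 Z hZ) (hV1 v hv)⟩
  have hkey : ∀ Z ∈ U, ∀ v ∈ V, κ Z *ᵥ v ∈ Kvb (typeIDomain p q) F (Zq Z v) v (star (Z *ᵥ v)) ∧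
      ∀ k ∈ Kvb (typeIDomain p q) F (Zq Z v) v (star (Z *ᵥ v)), ∃ a : ℂ, k = a • (κ Z *ᵥ v) := by
    intro Z hZ v hv
    obtain ⟨⟨⟨c1, c2⟩, c3⟩, c4, c5, c6⟩ := hUV Z hZ v hv
    obtain ⟨d1, d2, d3, d4, d5, d6⟩ := h _ c5 v c3 _ c6
    obtain ⟨e1, e2, e3, e4, e5, e6⟩ := h _ c2 v c3 _ c6
    have hsc : Kvb (typeIDomain p q) F (Zq Z v) v ((star s)⁻¹ • star (Z *ᵥ v)) =
        Kvb (typeIDomain p q) F (Zq Z v) v (star (Z *ᵥ v)) := by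
      have := kvb_smul (F := F) (typeIDomain p q) (Zq Z v) one_ne_zero (inv_ne_zero hss) v (star (Z *ᵥ v))
      rwa [one_smul] at this
    rw [hsc] at d6
    have hmem : κ Z *ᵥ v ∈ Kvb (typeIDomain p q) F (Zq Z v) v (star (Z *ᵥ v)) :=
      Ninf_le_Kvb _ _ _ (ninf_congr d1 (Zq_mulVec Z d2) e5)
    refine ⟨hmem, ?_⟩
    obtain ⟨a0, ha0⟩ := d6 _ hmem
    have ha0' : a0 ≠ 0 := by rintro rfl; rw [zero_smul] at ha0; exact e4 ha0
    intro k hk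
    obtain ⟨a, ha⟩ := d6 k hk
    refine ⟨a * a0⁻¹, ?_⟩
    rw [ha0, smul_smul, mul_assoc, inv_mul_cancel₀ ha0', mul_one, ha]
  have heig : ∀ Z ∈ U, ∀ y, (κ 0)ᴴ *ᵥ (κ Z *ᵥ y) = lam Z • y := by
    intro Z hZ
    obtain ⟨a, ha⟩ := eig_lemma (M := (κ 0)ᴴ * κ Z) (v0 := v0) (by
      filter_upwards [hVo.1.mem_nhds hVo.2] with v hv
      obtain ⟨⟨⟨c1, c2⟩, c3⟩, c4, c5, c6⟩ := hUV Z hZ v hv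
      obtain ⟨e1, e2, e3, e4, e5, e6⟩ := h _ c2 v c3 _ c6
      obtain ⟨u, w, c, r, hu, hw, hc, hr, hr1, hvw, hZu, -⟩ := polar_pair e1 e2 c4
      have hc' : (c : ℂ) ≠ 0 := by exact_mod_cast hc.ne'
      have hr' : (r : ℂ) ≠ 0 := by exact_mod_cast hr.ne'
      have hKe : Kvb (typeIDomain p q) F (Zq Z v) v (star (Z *ᵥ v)) =
          Kvb (typeIDomain p q) F (rk u w r) w (star u) := by
        rw [Zq_eq hc hw hvw hZu, hZu, star_smul]
        conv_lhs => rw [hvw]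
        exact kvb_smul _ _ hc' (by simpa using ⟨hr.ne', hc.ne'⟩) _ _
      obtain ⟨k1, k2⟩ := hkey Z hZ v hv
      rw [hKe] at k1 k2
      obtain ⟨a, ha⟩ := eig_point hF hP hS hu hw (z1 := (r:ℂ))
        (by rw [Complex.norm_real, Real.norm_eq_abs, abs_of_pos hr]; exact hr1) e4 k1 k2
      refine ⟨a * (c:ℂ)⁻¹, ?_⟩
      rw [← mulVec_mulVec, ha, mul_smul]
      congr 1
      rw [hvw, smul_smul, inv_mul_cancel₀ hc', one_smul])
    have hay : ∀ y, (κ 0)ᴴ *ᵥ (κ Z *ᵥ y) = a • y := by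
      intro y; rw [mulVec_mulVec, ha, smul_mulVec, one_mulVec]
    have : lam Z = a := by simp only [lam, hay]; simp
    rw [this]; exact hay
  refine ⟨U, V, fun Z => (ρ / lam Z : ℂ) • κ Z, hUo.1, hVo.1, ⟨Zo, hUo.2⟩, hVo.2, ?_⟩
  intro Z hZ v hv
  obtain ⟨⟨⟨c1, c2⟩, c3⟩, c4, c5, c6⟩ := hUV Z hZ v hv
  obtain ⟨e1, e2, e3, e4, e5, e6⟩ := h _ c2 v c3 _ c6
  obtain ⟨f1, f2, f3, f4, f5, f6⟩ := h _ hz v c3 _ c6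
  have hl : lam Z ≠ 0 := hO Z c1
  have hρ' : (ρ : ℂ) ≠ 0 := by exact_mod_cast hρ.ne'
  refine ⟨e1, e2, c4, ?_, ?_, ?_, ?_, f5⟩
  · rw [smul_mulVec, mulVec_smul, heig Z hZ, smul_smul, div_mul_cancel₀ _ hl]
  · rw [smul_mulVec]; exact Submodule.smul_mem _ _ e5
  · intro k hk
    obtain ⟨a, ha⟩ := (hkey Z hZ v hv).2 k hk
    refine ⟨a * (ρ / lam Z)⁻¹, ?_⟩
    rw [smul_mulVec, smul_smul, mul_assoc, inv_mul_cancel₀ (div_ne_zero hρ' hl), mul_one, ha]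
  · intro k hk
    have hsc : Kvb (typeIDomain p q) F 0 v ((star s)⁻¹ • star (Z *ᵥ v)) =
        Kvb (typeIDomain p q) F 0 v (star (Z *ᵥ v)) := by
      have := kvb_smul (F := F) (typeIDomain p q) 0 one_ne_zero (inv_ne_zero hss) v (star (Z *ᵥ v))
      rwa [one_smul] at this
    rw [← hsc] at hk
    exact f6 k hk

end


theorem SData.step3 {p q p' n : ℕ} {F : Matrix (Fin p) (Fin q) ℂ → Matrix (Fin p') (Fin n) ℂ}
    {K : Matrix (Fin n) (Fin q) ℂ} {ρ : ℝ} {N : Matrix (Fin p) (Fin q) ℂ → Matrix (Fin n) (Fin q) ℂ}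
    {U : Set (Matrix (Fin p) (Fin q) ℂ)} {V : Set (Fin q → ℂ)} (h : SData F K ρ N U V)
    (hU : IsOpen U) (hV : IsOpen V) (hF : DifferentiableOn ℂ F (typeIDomain p q))
    (hP : ProperOn F (typeIDomain p q) (typeIDomain p' n)) (h0 : F 0 = 0) (hq : 2 ≤ q) (hρ : 0 < ρ)
    (hK : ∀ y, Kᴴ *ᵥ (K *ᵥ y) = (ρ : ℂ) • y)
    (hS : ∀ (u : Fin p → ℂ) (η y : Fin q → ℂ), vecMulVec u η ∈ typeIDomain p q → η ⬝ᵥ y = 0 →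
      F (vecMulVec u η) *ᵥ (K *ᵥ y) = 0) :
    ∀ Z ∈ U, ∀ v ∈ V, ∃ (u : Fin p → ℂ) (w : Fin q → ℂ) (c r : ℝ) (δ : Fin p' → ℂ), nsq u = 1 ∧ nsq w = 1 ∧ nsq δ = ρ ∧
      0 < c ∧ 0 < r ∧ v = (c : ℂ) • w ∧ Z *ᵥ v = ((r : ℂ) * c) • u ∧ nsq (Z *ᵥ v) = r ^ 2 * nsq v ∧
      (∀ z, ‖z‖ < 1 → F (rk u w z) *ᵥ (K *ᵥ w) = z • δ) ∧ F Z *ᵥ (K *ᵥ v) = ((r : ℂ) * c) • δ := by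
  intro Z hZ v hv
  obtain ⟨hZD, hv0, hZv, -, hNi, -, -, -⟩ := h Z hZ v hv
  obtain ⟨u, w, c, r, hu, hw, hc, hr, hr1, hvw, hZvu, hns⟩ := polar_pair hZD hv0 hZv
  have hρ' : (ρ : ℂ) ≠ 0 := by exact_mod_cast hρ.ne'
  have hc' : (c : ℂ) ≠ 0 := by exact_mod_cast hc.ne'
  have hr' : (r : ℂ) ≠ 0 := by exact_mod_cast hr.ne'
  have hw0 : w ≠ 0 := by rintro rfl; simp [nsq_zero] at hw
  have hww : star w ⬝ᵥ w = 1 := by rw [nsq_coe, hw]; simp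
  have hrn : ‖(r : ℂ)‖ < 1 := by simpa [abs_of_pos hr] using hr1
  -- consistency
  have hN : ∀ Z ∈ U, ∀ Z' ∈ U, ∀ y ∈ V, Z *ᵥ y = Z' *ᵥ y → N Z *ᵥ y = N Z' *ᵥ y := by
    intro Z hZ Z' hZ' y hy hyy
    obtain ⟨hZD, hy0, hZy, hKN, hNi, hk, -, -⟩ := h Z hZ y hy
    obtain ⟨hZD', -, hZy', hKN', hNi', -, -, -⟩ := h Z' hZ' y hy
    obtain ⟨u, w, c, r, hu, hw, hc, hr, hr1, hvw, hZvu, hns⟩ := polar_pair hZD hy0 hZy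
    have hrn : ‖(r : ℂ)‖ < 1 := by simpa [abs_of_pos hr] using hr1
    have hq1 : Zq Z y ∈ typeIDomain p q := by
      rw [Zq_eq hc hw hvw hZvu]; exact rk_mem hu hw hrn
    obtain ⟨a, ha⟩ := hk _ (Ninf_le_Kvb _ _ _ (ninf_congr hq1 ((Zq_mulVec Z hy0).trans hyy) hNi'))
    have h1 := congrArg (fun x => Kᴴ *ᵥ x) ha
    simp only [hKN', mulVec_smul, hKN] at h1
    have h2 : (ρ : ℂ) • (1 - a) • y = 0 := by
      rw [sub_smul, one_smul, smul_sub, h1, smul_comm, sub_self]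
    have h3 := ((smul_eq_zero.1 h2).resolve_left hρ')
    have h4 := (smul_eq_zero.1 h3).resolve_right hy0
    rw [ha, ← sub_eq_zero.1 h4, one_smul]
  have hN2 : ∀ Z ∈ U, ∀ Z' ∈ U, ∀ y ∈ V, Z *ᵥ y = Z' *ᵥ y →
      (fun Z => F Z * N Z) Z *ᵥ y = (fun Z => F Z * N Z) Z' *ᵥ y := by
    intro Z hZ Z' hZ' y hy hyy
    show (F Z * N Z) *ᵥ y = (F Z' * N Z') *ᵥ y
    rw [← mulVec_mulVec, ← mulVec_mulVec, hN Z hZ Z' hZ' y hy hyy]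
    exact (h Z' hZ' y hy).2.2.2.2.1 Z (h Z hZ y hy).1 hyy
  -- the curve
  let Y : ℂ → Matrix (Fin p) (Fin q) ℂ := fun z => Z + (z - r) • vecMulVec u (star w)
  have hYr : Y r = Z := by simp [Y]
  have hYc : Continuous Y := by
    show Continuous (fun z : ℂ => Z + (z - r) • vecMulVec u (star w))
    fun_prop
  have hYv : ∀ z, Y z *ᵥ v = (z * c) • u := by
    intro z
    show (Z + (z - r) • vecMulVec u (star w)) *ᵥ v = _
    rw [add_mulVec, hZvu, smul_mulVec, vecMulVec_mulVec, hvw, dotProduct_smul, hww]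
    ext i; simp; ring
  have hev : ∀ᶠ z in 𝓝 (r : ℂ), Y z ∈ U ∧ ‖z‖ < 1 ∧ z ≠ 0 := by
    have h1 : ∀ᶠ z in 𝓝 (r : ℂ), Y z ∈ U :=
      hYc.continuousAt.eventually (hU.mem_nhds (by rw [hYr]; exact hZ))
    have h2 : ∀ᶠ z in 𝓝 (r : ℂ), ‖z‖ < 1 :=
      (continuous_norm.continuousAt (x := (r:ℂ))).eventually (isOpen_Iio.mem_nhds hrn)
    have h3 : ∀ᶠ z in 𝓝 (r : ℂ), z ≠ 0 := isOpen_ne.mem_nhds hr'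
    filter_upwards [h1, h2, h3] with z a b c using ⟨a, b, c⟩
  have hNv : ∀ z, N (Y z) *ᵥ v = (c : ℂ) • (N (Y z) *ᵥ w) := by intro z; rw [hvw, mulVec_smul]
  have hrkv : ∀ z, rk u w z *ᵥ v = Y z *ᵥ v := by
    intro z
    rw [hYv, rk, smul_mulVec, vecMulVec_mulVec, hvw, dotProduct_smul, hww]
    ext i; simp; ring
  have hFN : ∀ z, Y z ∈ U → ‖z‖ < 1 → F (rk u w z) *ᵥ (N (Y z) *ᵥ w) = (F (Y z) * N (Y z)) *ᵥ w := by
    intro z hz hz1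
    have := (h _ hz v hv).2.2.2.2.1 (rk u w z) (rk_mem hu hw hz1) (hrkv z)
    rw [hNv, mulVec_smul, mulVec_smul] at this
    rw [← mulVec_mulVec]
    exact smul_right_injective _ hc' this
  have hstar : ∀ z : ℂ, star ((z * c) • u) = (star z * c) • star u := by
    intro z; ext i; simp
  have hcore := core hF hP h0 hρ hK hS hu hw hrn (T := fun z => N (Y z) *ᵥ w) (by
      filter_upwards [hev] with z ⟨hzU, hz1, hz0⟩
      obtain ⟨-, -, -, h4, h5, -, -, -⟩ := h _ hzU v hv
      constructor
      · rw [hNv, mulVec_smul, hvw, smul_comm] at h4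
        exact smul_right_injective _ hc' h4
      · have h6 := Ninf_le_Kvb _ _ (star u) (ninf_congr (rk_mem hu hw hz1) (hrkv z) h5)
        rw [hNv, hvw, ← one_smul ℂ (star u), kvb_smul _ _ hc' one_ne_zero] at h6
        exact (Submodule.smul_mem_iff _ hc').1 h6) (by
      intro k hk
      obtain ⟨-, -, -, -, -, h6, -, -⟩ := h _ hZ v hv
      rw [Zq_eq hc hw hvw hZvu, hZvu, hstar, hvw, kvb_smul _ _ hc' (by simp [hr', hc'])] at h6
      obtain ⟨a, ha⟩ := h6 k hk
      refine ⟨a * c, ?_⟩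
      show k = (a * c) • N (Y r) *ᵥ w
      rw [ha, hYr, mulVec_smul, smul_smul]) (by
      intro k hk
      obtain ⟨-, -, -, -, -, -, h7, -⟩ := h _ hZ v hv
      rw [hZvu, hstar, hvw, kvb_smul _ _ hc' (by simp [hr', hc'])] at h7
      obtain ⟨a, ha⟩ := h7 k hk
      exact ⟨a * c, by rw [ha, mulVec_smul, smul_smul]⟩)
    (fun hd => aff_conv hq hU hV hN hZ hc' (by rw [← hvw]; exact hv) hw0 u r hd)
    (by
      intro hd
      have hE : (fun z : ℂ => F (rk u w z) *ᵥ (N (Y z) *ᵥ w)) =ᶠ[𝓝 (r:ℂ)]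
          (fun z : ℂ => (F (Y z) * N (Y z)) *ᵥ w) := by
        filter_upwards [hev] with z ⟨hzU, hz1, hz0⟩
        exact hFN z hzU hz1
      obtain ⟨β, hβ⟩ := aff_conv hq hU hV (N := fun Z => F Z * N Z) hN2 hZ hc' (by rw [← hvw]; exact hv) hw0 u (r:ℂ)
        (hE.differentiableAt_iff.1 hd)
      refine ⟨β, ?_⟩
      filter_upwards [hβ, hE] with z h1 h2
      rw [hE.eq_of_nhds, h2]
      exact h1)
  obtain ⟨hT, δ, hδ, hδz⟩ := hcore
  have hT' : N Z *ᵥ w = K *ᵥ w := by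
    have : N (Y r) *ᵥ w = K *ᵥ w := hT
    rwa [hYr] at this
  refine ⟨u, w, c, r, δ, hu, hw, hδ, hc, hr, hvw, hZvu, hns, hδz, ?_⟩
  have h8 := hNi (rk u w r) (rk_mem hu hw hrn) (by rw [hrkv, hYr])
  have h9 : N Z *ᵥ v = K *ᵥ v := by rw [hvw, mulVec_smul, mulVec_smul, hT']
  rw [h9] at h8
  rw [← h8, hvw, mulVec_smul, mulVec_smul, hδz r hrn, smul_smul, mul_comm]


section P21
variable {p q p' n : ℕ} {F : Matrix (Fin p) (Fin q) ℂ → Matrix (Fin p') (Fin n) ℂ}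

theorem fderiv_dir (hF : DifferentiableAt ℂ F 0) {X : Matrix (Fin p) (Fin q) ℂ} {x : Fin n → ℂ} {y : Fin p' → ℂ}
    (h : ∀ᶠ t : ℂ in 𝓝 0, F (t • X) *ᵥ x = t • y) : fderiv ℂ F 0 X *ᵥ x = y := by
  have h1 := hasDerivAt_line (f := F) (Z := 0) (X := X) (t := 0) (by rw [zero_smul, zero_add]; exact hF)
  rw [show (0 : Matrix (Fin p) (Fin q) ℂ) + (0:ℂ) • X = 0 by simp] at h1
  let Λ : Matrix (Fin p') (Fin n) ℂ →L[ℂ] (Fin p' → ℂ) := LinearMap.toContinuousLinearMap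
    { toFun := fun M => M *ᵥ x
      map_add' := fun A B => add_mulVec A B x
      map_smul' := fun c A => smul_mulVec c A x }
  have h2 := Λ.hasFDerivAt.comp_hasDerivAt (0:ℂ) h1
  have h3 : HasDerivAt (fun t : ℂ => t • y) y 0 := by
    simpa using (hasDerivAt_id (0:ℂ)).smul_const y
  have h4 : (Λ ∘ fun t : ℂ => F (0 + t • X)) =ᶠ[𝓝 0] fun t : ℂ => t • y := by
    filter_upwards [h] with t ht
    show F (0 + t • X) *ᵥ x = t • y
    rw [zero_add, ht]
  exact h2.unique (h3.congr_of_eventuallyEq h4)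

theorem small_mem (X : Matrix (Fin p) (Fin q) ℂ) : ∀ᶠ t : ℂ in 𝓝 0, t • X ∈ typeIDomain p q := by
  have hc : Continuous (fun t : ℂ => t • X) := by fun_prop
  refine hc.continuousAt.eventually (dom_open.mem_nhds ?_)
  show (0:ℂ) • X ∈ _
  rw [zero_smul]; exact zero_mem_dom

theorem bil_form {L : Matrix (Fin p) (Fin q) ℂ →ₗ[ℂ] Matrix (Fin p') (Fin n) ℂ} {K : Matrix (Fin n) (Fin q) ℂ}
    (hq : 0 < q)
    (h : ∀ (u : Fin p → ℂ) (η y : Fin q → ℂ), η ⬝ᵥ y = 0 → L (vecMulVec u η) *ᵥ (K *ᵥ y) = 0) :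
    ∃ c : Matrix (Fin p') (Fin p) ℂ, ∀ X, L X * K = c * X := by
  let j0 : Fin q := ⟨0, hq⟩
  have hjk : ∀ (a : Fin p) (j k : Fin q), j ≠ k →
      L (single a j 1) *ᵥ (K *ᵥ Pi.single k 1) = 0 := by
    intro a j k hne
    rw [single_eq_single_vecMulVec_single]
    exact h _ _ _ (by simp [hne.symm])
  have hjj : ∀ (a : Fin p) (j k : Fin q),
      L (single a j 1) *ᵥ (K *ᵥ Pi.single j 1) = L (single a k 1) *ᵥ (K *ᵥ Pi.single k 1) := by
    intro a j k
    by_cases hne : j = k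
    · rw [hne]
    have := h (Pi.single a 1) (Pi.single j 1 + Pi.single k 1) (Pi.single j 1 - Pi.single k 1) (by
      simp [dotProduct_sub, hne, Ne.symm hne])
    rw [vecMulVec_add, ← single_eq_single_vecMulVec_single, ← single_eq_single_vecMulVec_single, map_add,
      mulVec_sub, add_mulVec, mulVec_sub, mulVec_sub, hjk a j k hne, hjk a k j (Ne.symm hne)] at this
    simpa [sub_eq_zero, ← sub_eq_add_neg] using this
  refine ⟨Matrix.of fun i a => (L (single a j0 1) *ᵥ (K *ᵥ Pi.single j0 1)) i, fun X => ?_⟩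
  ext i k
  have e1 : (L X * K) i k = (L X *ᵥ (K *ᵥ Pi.single k 1)) i := by
    rw [mulVec_mulVec]; simp
  have e2 : X = ∑ a, ∑ j, X a j • single a j (1:ℂ) := by
    conv_lhs => rw [matrix_eq_sum_single X]
    simp
  rw [e1]
  conv_lhs => rw [e2]
  rw [map_sum, sum_mulVec, Finset.sum_apply, mul_apply]
  refine Finset.sum_congr rfl fun a _ => ?_
  rw [map_sum, sum_mulVec, Finset.sum_apply, Finset.sum_eq_single k]
  · rw [map_smul, smul_mulVec, hjj a k j0]
    simp [mul_comm]
  · intro j _ hj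
    rw [map_smul, smul_mulVec, hjk a j k hj]; simp
  · simp

theorem iso_of_local {c : Matrix (Fin p') (Fin p) ℂ} {ρ : ℝ} {x0 : Fin p → ℂ}
    (h : ∀ y, ∀ᶠ t : ℂ in 𝓝 0, nsq (c *ᵥ (x0 + t • y)) = ρ * nsq (x0 + t • y)) :
    ∀ y, nsq (c *ᵥ y) = ρ * nsq y := by
  intro y
  have h1 := h y
  have h2 := h (-y)
  have h0 := (h y).self_of_nhds
  have h3 : ∀ᶠ t : ℂ in 𝓝[≠] 0, nsq (c *ᵥ y) = ρ * nsq y := by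
    filter_upwards [nhdsWithin_le_nhds h1, nhdsWithin_le_nhds h2, self_mem_nhdsWithin] with t h1 h2 ht
    rw [zero_smul, add_zero] at h0
    rw [smul_neg, ← sub_eq_add_neg, mulVec_sub, nsq_sub, nsq_sub, mulVec_smul, nsq_smul, nsq_smul] at h2
    rw [mulVec_add, nsq_add, nsq_add, mulVec_smul, nsq_smul, nsq_smul] at h1
    have ht' : ‖t‖ ^ 2 ≠ 0 := by
      have : t ≠ 0 := ht
      positivity
    apply mul_left_cancel₀ ht'
    linarith
  exact h3.exists.choose_spec

theorem iso_matrix {c : Matrix (Fin p') (Fin p) ℂ} (h : ∀ y, nsq (c *ᵥ y) = nsq y) : cᴴ * c = 1 := by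
  have h1 : ∀ x y, star y ⬝ᵥ x = star y ⬝ᵥ ((cᴴ * c) *ᵥ x) := by
    intro x y
    rw [contr_iso (fun x => (h x).le) (h x) y, star_mulVec_dot, mulVec_mulVec]
  ext i j
  have := h1 (Pi.single j 1) (Pi.single i 1)
  rw [← Pi.single_star] at this
  simp at this
  rw [← this]
  simp [one_apply, Pi.single_apply, eq_comm]

theorem endgame {κ : Matrix (Fin p) (Fin q) ℂ → Matrix (Fin n) (Fin q) ℂ} {v0 : Fin q → ℂ} {b0 : Fin p → ℂ} {ε : ℝ}
    (h : EData F κ v0 b0 ε) (hε : 0 < ε) (hκ : ContinuousAt κ 0) (hF : DifferentiableOn ℂ F (typeIDomain p q))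
    (hP : ProperOn F (typeIDomain p q) (typeIDomain p' n)) (h0 : F 0 = 0) (hq : 2 ≤ q) :
    ∃ (κ1 : Matrix (Fin n) (Fin q) ℂ) (c1 : Matrix (Fin p') (Fin p) ℂ), κ1ᴴ * κ1 = 1 ∧ c1ᴴ * c1 = 1 ∧
      ∀ Z ∈ typeIDomain p q, F Z * κ1 = c1 * Z := by
  obtain ⟨ρ, hρ, hK⟩ := h.step1 hε hF hP h0 hq
  have hS := h.S hε hF h0 hq
  obtain ⟨U, V, N, hU, hV, ⟨Z0, hZ0⟩, hv0, hSD⟩ := h.step2 hε hκ hF hP h0 hq hρ hK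
  have h3 := hSD.step3 hU hV hF hP h0 hq hρ hK hS
  generalize κ 0 = K at *
  have hF0 : DifferentiableAt ℂ F 0 := hF.differentiableAt (dom_open.mem_nhds zero_mem_dom)
  set L := fderiv ℂ F 0 with hLdef
  have hL4 : ∀ Z ∈ U, ∀ v ∈ V, F Z *ᵥ (K *ᵥ v) = L Z *ᵥ (K *ᵥ v) ∧ nsq (F Z *ᵥ (K *ᵥ v)) = ρ * nsq (Z *ᵥ v) := by
    intro Z hZ v hv
    obtain ⟨u, w, c, r, δ, hu, hw, hδ, hc, hr, hvw, hZvu, hns, hδz, hFZ⟩ := h3 Z hZ v hv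
    have hKN := (hSD Z hZ v hv).2.2.2.2.2.2.2
    have hww : star w ⬝ᵥ w = 1 := by rw [nsq_coe, hw]; simp
    constructor
    · have e1 : L (vecMulVec u (star w)) *ᵥ (K *ᵥ w) = δ := by
        apply fderiv_dir hF0
        filter_upwards [Metric.ball_mem_nhds (0:ℂ) one_pos] with t ht
        exact hδz t (by simpa using ht)
      have e2 : L (Z - (r:ℂ) • vecMulVec u (star w)) *ᵥ (K *ᵥ v) = 0 := by
        apply fderiv_dir hF0
        filter_upwards [small_mem (Z - (r:ℂ) • vecMulVec u (star w))] with t ht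
        rw [hKN _ ht, h0, zero_mulVec, smul_zero]
        rw [smul_mulVec, sub_mulVec, hZvu, smul_mulVec, vecMulVec_mulVec, hvw, dotProduct_smul, hww]
        ext i; simp; right; ring
      rw [map_sub, map_smul, sub_mulVec, sub_eq_zero] at e2
      rw [hFZ, e2, smul_mulVec, hvw, mulVec_smul, mulVec_smul, e1, smul_smul]
    · rw [hFZ, hns, nsq_smul, hδ, hvw, nsq_smul, hw]
      simp only [norm_mul, Complex.norm_real, Real.norm_eq_abs, abs_of_pos hr, abs_of_pos hc]
      ring
  have hFL : ∀ Z ∈ U, F Z * K = L Z * K := by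
    intro Z hZ
    obtain ⟨W, Wi, hW, -, hWc⟩ := basis_in_open hV ⟨v0, hv0⟩
    have e : (F Z * K) * W = (L Z * K) * W := by
      ext i j
      have := congrFun (hL4 Z hZ _ (hWc j)).1 i
      rw [mulVec_mulVec, mulVec_mulVec] at this
      exact this
    have := congrArg (fun M => M * Wi) e
    simpa [Matrix.mul_assoc, hW] using this
  have hFL2 : ∀ Z ∈ typeIDomain p q, F Z * K = L Z * K := by
    refine id_eq_lemma dom_open dom_convex (z0 := Z0) ?_ ?_ (hSD Z0 hZ0 v0 hv0).1 ?_
    · intro Z hZ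
      exact (mdiff_mul (hF.differentiableAt (dom_open.mem_nhds hZ)) (differentiableAt_const K)).differentiableWithinAt
    · intro Z hZ
      exact (mdiff_mul L.differentiableAt (differentiableAt_const K)).differentiableWithinAt
    · filter_upwards [hU.mem_nhds hZ0] with Z hZ using hFL Z hZ
  obtain ⟨c, hc⟩ := bil_form (L := (L : Matrix (Fin p) (Fin q) ℂ →ₗ[ℂ] Matrix (Fin p') (Fin n) ℂ)) (K := K) (by omega) (by
    intro u η y hy
    apply fderiv_dir hF0
    filter_upwards [small_mem (vecMulVec u η)] with t ht
    rw [← smul_vecMulVec] at ht ⊢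
    rw [hS _ _ _ ht hy, smul_zero])
  have hc' : ∀ X, L X * K = c * X := hc
  have hv0' : v0 ≠ 0 := (hSD Z0 hZ0 v0 hv0).2.1
  have hcn : ∀ y, nsq (c *ᵥ y) = ρ * nsq y := by
    apply iso_of_local (x0 := Z0 *ᵥ v0)
    intro y
    let X : Matrix (Fin p) (Fin q) ℂ := vecMulVec y (((nsq v0 : ℝ) : ℂ)⁻¹ • star v0)
    have hX : X *ᵥ v0 = y := by
      have : ((nsq v0 : ℝ) : ℂ) ≠ 0 := by exact_mod_cast (nsq_pos hv0').ne'
      show vecMulVec y (((nsq v0 : ℝ) : ℂ)⁻¹ • star v0) *ᵥ v0 = y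
      rw [vecMulVec_mulVec, smul_dotProduct, nsq_coe, smul_eq_mul, inv_mul_cancel₀ this]; simp
    have hcc : Continuous (fun t : ℂ => Z0 + t • X) := by fun_prop
    have hm : ∀ᶠ t : ℂ in 𝓝 0, Z0 + t • X ∈ U :=
      hcc.continuousAt.eventually (hU.mem_nhds (by show Z0 + (0:ℂ) • X ∈ U; rw [zero_smul, add_zero]; exact hZ0))
    filter_upwards [hm] with t ht
    have e := (hL4 _ ht v0 hv0).2
    rw [mulVec_mulVec, hFL _ ht, hc', ← mulVec_mulVec, add_mulVec, smul_mulVec, hX] at e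
    exact e
  have hKn : ∀ y, nsq (K *ᵥ y) = ρ * nsq y := by
    intro y
    have : ((nsq (K *ᵥ y) : ℝ) : ℂ) = ((ρ * nsq y : ℝ) : ℂ) := by
      rw [← nsq_coe, star_mulVec_dot, hK, dotProduct_smul, nsq_coe]; simp
    exact_mod_cast this
  have hs : ‖(((Real.sqrt ρ)⁻¹ : ℝ) : ℂ)‖ ^ 2 * ρ = 1 := by
    rw [Complex.norm_real, Real.norm_eq_abs, sq_abs, inv_pow, Real.sq_sqrt hρ.le, inv_mul_cancel₀ hρ.ne']
  refine ⟨(((Real.sqrt ρ)⁻¹ : ℝ) : ℂ) • K, (((Real.sqrt ρ)⁻¹ : ℝ) : ℂ) • c, iso_matrix ?_, iso_matrix ?_, ?_⟩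
  · intro y
    rw [smul_mulVec, nsq_smul, hKn, ← mul_assoc, hs, one_mul]
  · intro y
    rw [smul_mulVec, nsq_smul, hcn, ← mul_assoc, hs, one_mul]
  · intro Z hZ
    rw [Matrix.mul_smul, hFL2 Z hZ, hc', Matrix.smul_mul]

end P21


section P22
variable {p q p' n : ℕ}

theorem norm_thm {f : Matrix (Fin p) (Fin q) ℂ → Matrix (Fin p') (Fin n) ℂ}
    (hf : DifferentiableOn ℂ f (typeIDomain p q)) (hP : ProperOn f (typeIDomain p q) (typeIDomain p' n))
    (hp : 0 < p) (hq : 2 ≤ q) (hn : n + 2 ≤ 2 * q) (hnp : n < p)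
    (hK : ∀ k, (∀ Z ∈ typeIDomain p q, ∀ Z' ∈ typeIDomain p q, f Z *ᵥ k = f Z' *ᵥ k) → k = 0) :
    ∃ (a : Matrix (Fin p) (Fin p) ℂ) (b : Matrix (Fin p) (Fin q) ℂ) (c : Matrix (Fin q) (Fin p) ℂ)
      (d : Matrix (Fin q) (Fin q) ℂ) (A : Matrix (Fin p') (Fin p') ℂ) (B : Matrix (Fin p') (Fin n) ℂ)
      (C : Matrix (Fin n) (Fin p') ℂ) (E : Matrix (Fin n) (Fin n) ℂ)
      (κ1 : Matrix (Fin n) (Fin q) ℂ) (c1 : Matrix (Fin p') (Fin p) ℂ),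
      JU a b c d ∧ JU A B C E ∧ κ1ᴴ * κ1 = 1 ∧ c1ᴴ * c1 = 1 ∧
      ∀ Z ∈ typeIDomain p q, mob A B C E (f (mob a b c d Z)) * κ1 = c1 * Z := by
  have h0D : (0 : Matrix (Fin p) (Fin q) ℂ) ∈ typeIDomain p q := zero_mem_dom
  obtain ⟨Z0, v0, b0, κ, ε, hε, hκ, hloc⟩ := local_thm dom_open dom_convex hf ⟨0, h0D⟩ hp hq hn hnp hK
    (fun Z hZ v b hv hb => BC hf hP hZ hv hb)
  have hZ0 : Z0 ∈ typeIDomain p q :=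
    (hloc Z0 (Metric.mem_ball_self hε) v0 (Metric.mem_ball_self hε) b0 (Metric.mem_ball_self hε)).1
  obtain ⟨a, b, c, d, h, hm⟩ := JU.exists_of_mem hZ0
  obtain ⟨A', B', C', E', h', hm'⟩ := JU.exists_of_mem (hP.1 hZ0)
  obtain ⟨A, B, C, E, hT, hT0⟩ : ∃ A B C E, JU (p := p') (q := n) A B C E ∧ mob A B C E (f Z0) = 0 := by
    refine ⟨_, _, _, _, h'.inv, ?_⟩
    rw [← hm']
    exact h'.left_inv zero_mem_dom
  have hg : DifferentiableOn ℂ (f ∘ mob a b c d) (typeIDomain p q) :=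
    hf.comp h.aut.2.1 h.aut.1
  have hgP := proper_right h.aut hP
  have hF : DifferentiableOn ℂ (mob A B C E ∘ (f ∘ mob a b c d)) (typeIDomain p q) :=
    hT.aut.2.1.comp hg hgP.1
  have hFP := proper_left hT.aut hgP
  have hF0 : (mob A B C E ∘ (f ∘ mob a b c d)) 0 = 0 := by
    show mob A B C E (f (mob a b c d 0)) = 0
    rw [hm, hT0]
  -- base points
  have hd := isUnit_iff_ne_zero.2 (h.det h0D)
  obtain ⟨v1, hv1⟩ : ∃ v1, (c * (0 : Matrix (Fin p) (Fin q) ℂ) + d) *ᵥ v1 = v0 :=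
    ⟨(c * (0 : Matrix (Fin p) (Fin q) ℂ) + d)⁻¹ *ᵥ v0, by
      rw [mulVec_mulVec, Matrix.mul_nonsing_inv _ hd, one_mulVec]⟩
  obtain ⟨b1, hb1⟩ : ∃ b1, b1 ᵥ* (aᴴ + (0 : Matrix (Fin p) (Fin q) ℂ) * bᴴ) = b0 := by
    refine ⟨b0 ᵥ* (a - mob a b c d 0 * c), ?_⟩
    rw [vecMul_vecMul, mul_eq_one_comm.1 (h.num_inv h0D), vecMul_one]
  let κ' : Matrix (Fin p) (Fin q) ℂ → Matrix (Fin n) (Fin q) ℂ :=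
    fun Z => ((C * f (mob a b c d Z) + E) * κ (mob a b c d Z)) * (c * Z + d)
  have hmc : ContinuousAt (mob a b c d) 0 := (h.diff h0D).continuousAt
  have hdc : ContinuousAt (fun Z : Matrix (Fin p) (Fin q) ℂ => c * Z + d) 0 :=
    (cont_mulM continuousAt_const continuousAt_id).add continuousAt_const
  have hac : ContinuousAt (fun Z : Matrix (Fin p) (Fin q) ℂ => aᴴ + Z * bᴴ) 0 :=
    continuousAt_const.add (cont_mulM continuousAt_id continuousAt_const)
  have hκ' : ContinuousAt κ' 0 := by
    have e1 : ContinuousAt (fun Z => κ (mob a b c d Z)) 0 :=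
      ContinuousAt.comp (f := mob a b c d) (by rw [hm]; exact hκ) hmc
    have e2 : ContinuousAt (fun Z => f (mob a b c d Z)) 0 :=
      (hg.differentiableAt (dom_open.mem_nhds h0D)).continuousAt
    exact cont_mulM (cont_mulM ((cont_mulM continuousAt_const e2).add continuousAt_const) e1) hdc
  have hev : ∀ᶠ x : Matrix (Fin p) (Fin q) ℂ × (Fin q → ℂ) × (Fin p → ℂ) in 𝓝 (0, v1, b1),
      x.1 ∈ typeIDomain p q ∧ mob a b c d x.1 ∈ Metric.ball Z0 ε ∧ (c * x.1 + d) *ᵥ x.2.1 ∈ Metric.ball v0 ε ∧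
        x.2.2 ᵥ* (aᴴ + x.1 * bᴴ) ∈ Metric.ball b0 ε := by
    have f1 : ContinuousAt (fun x : Matrix (Fin p) (Fin q) ℂ × (Fin q → ℂ) × (Fin p → ℂ) => x.1) (0, v1, b1) :=
      continuousAt_fst
    have f2 : ContinuousAt (fun x : Matrix (Fin p) (Fin q) ℂ × (Fin q → ℂ) × (Fin p → ℂ) => x.2.1) (0, v1, b1) := by
      fun_prop
    have f3 : ContinuousAt (fun x : Matrix (Fin p) (Fin q) ℂ × (Fin q → ℂ) × (Fin p → ℂ) => x.2.2) (0, v1, b1) := by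
      fun_prop
    have g1 : ContinuousAt (fun x : Matrix (Fin p) (Fin q) ℂ × (Fin q → ℂ) × (Fin p → ℂ) => mob a b c d x.1)
        (0, v1, b1) := ContinuousAt.comp (g := mob a b c d) hmc f1
    have g2 : ContinuousAt (fun x : Matrix (Fin p) (Fin q) ℂ × (Fin q → ℂ) × (Fin p → ℂ) => c * x.1 + d)
        (0, v1, b1) := (cont_mulM continuousAt_const f1).add continuousAt_const
    have g3 : ContinuousAt (fun x : Matrix (Fin p) (Fin q) ℂ × (Fin q → ℂ) × (Fin p → ℂ) => aᴴ + x.1 * bᴴ)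
        (0, v1, b1) := continuousAt_const.add (cont_mulM f1 continuousAt_const)
    have h1 := f1.eventually (dom_open.mem_nhds h0D)
    have h2 := g1.eventually (Metric.isOpen_ball.mem_nhds (show mob a b c d 0 ∈ Metric.ball Z0 ε by
      rw [hm]; exact Metric.mem_ball_self hε))
    have h3 := (cont_mulV g2 f2).eventually (Metric.isOpen_ball.mem_nhds
      (show (c * (0 : Matrix (Fin p) (Fin q) ℂ) + d) *ᵥ v1 ∈ Metric.ball v0 ε by
      rw [hv1]; exact Metric.mem_ball_self hε))
    have h4 := (cont_vecM g3 f3).eventually (Metric.isOpen_ball.mem_nhds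
      (show b1 ᵥ* (aᴴ + (0 : Matrix (Fin p) (Fin q) ℂ) * bᴴ) ∈ Metric.ball b0 ε by
      rw [hb1]; exact Metric.mem_ball_self hε))
    filter_upwards [h1, h2, h3, h4] with x e1 e2 e3 e4 using ⟨e1, e2, e3, e4⟩
  obtain ⟨ε', hε', hball⟩ := Metric.eventually_nhds_iff_ball.1 hev
  have hE : EData (mob A B C E ∘ (f ∘ mob a b c d)) κ' v1 b1 ε' := by
    intro Z hZ v hv w hw
    obtain ⟨e1, e2, e3, e4⟩ := hball (Z, v, w) (by
      rw [Metric.mem_ball, Prod.dist_eq, Prod.dist_eq]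
      exact max_lt hZ (max_lt hv hw))
    obtain ⟨k1, k2, k3, k4, k5, k6⟩ := hloc _ e2 _ e3 _ e4
    have hu := isUnit_iff_ne_zero.2 (hT.det (hgP.1 e1))
    have hκe : κ' Z *ᵥ v = (C * (f ∘ mob a b c d) Z + E) *ᵥ (κ (mob a b c d Z) *ᵥ ((c * Z + d) *ᵥ v)) := by
      rw [mulVec_mulVec, mulVec_mulVec]; rfl
    have hinv : ∀ k, k = (C * (f ∘ mob a b c d) Z + E) *ᵥ ((C * (f ∘ mob a b c d) Z + E)⁻¹ *ᵥ k) := by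
      intro k
      rw [mulVec_mulVec, Matrix.mul_nonsing_inv _ hu, one_mulVec]
    refine ⟨e1, ?_, ?_, ?_, ?_, ?_⟩
    · rintro rfl; exact k2 (mulVec_zero _)
    · rintro rfl; exact k3 (zero_vecMul _)
    · rw [hκe]
      intro h0
      have := congrArg (fun x => (C * (f ∘ mob a b c d) Z + E)⁻¹ *ᵥ x) h0
      simp only [mulVec_zero] at this
      rw [mulVec_mulVec, Matrix.nonsing_inv_mul _ hu, one_mulVec] at this
      exact k4 this
    · rw [hκe, mob_ninf_t hT hgP.1 e1, mob_ninf h e1]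
      exact k5
    · intro k hk
      rw [hinv k, mob_kvb_t hT hgP.1 e1, mob_kvb h e1] at hk
      obtain ⟨s, hs⟩ := k6 _ hk
      refine ⟨s, ?_⟩
      rw [hinv k, hs, mulVec_smul, hκe]
  obtain ⟨κ1, c1, hk1, hc1, hfin⟩ := endgame hE hε' hκ' hF hFP hF0 hq
  exact ⟨a, b, c, d, A, B, C, E, κ1, c1, h, hT, hk1, hc1, hfin⟩

end P22


section P23

theorem exists_ker_iso {m : ℕ} (S : Submodule ℂ (Fin m → ℂ)) :
    ∃ (n : ℕ) (J : Matrix (Fin m) (Fin n) ℂ), Jᴴ * J = 1 ∧ ∀ x, x ∈ S ↔ Jᴴ *ᵥ x = 0 := by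
  let S' : Submodule ℂ (EuclideanSpace ℂ (Fin m)) := S.comap (WithLp.linearEquiv 2 ℂ (Fin m → ℂ)).toLinearMap
  let b := stdOrthonormalBasis ℂ S'ᗮ
  let J : Matrix (Fin m) (Fin (Module.finrank ℂ S'ᗮ)) ℂ := Matrix.of fun i j => (b j : EuclideanSpace ℂ (Fin m)) i
  have hJ : ∀ x : Fin m → ℂ, ∀ j, (Jᴴ *ᵥ x) j = inner ℂ (b j : EuclideanSpace ℂ (Fin m)) (WithLp.toLp 2 x) := by
    intro x j
    rw [PiLp.inner_apply]
    simp [J, mulVec, dotProduct, mul_comm]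
  refine ⟨_, J, ?_, fun x => ?_⟩
  · ext i j
    have h1 : (Jᴴ * J) i j = (Jᴴ *ᵥ (fun k => (b j : EuclideanSpace ℂ (Fin m)) k)) i := by
      simp [J, mul_apply, mulVec, dotProduct]
    rw [h1, hJ]
    have h2 := orthonormal_iff_ite.1 b.orthonormal i j
    rw [Submodule.coe_inner] at h2
    rw [one_apply, ← h2]
  · have e1 : x ∈ S ↔ WithLp.toLp 2 x ∈ S'ᗮᗮ := by
      rw [Submodule.orthogonal_orthogonal]
      rfl
    rw [e1]
    constructor
    · intro h
      ext j
      rw [hJ]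
      exact h _ (b j).2
    · intro h w hw
      have h3 : ∀ j, inner ℂ (b j : EuclideanSpace ℂ (Fin m)) (WithLp.toLp 2 x) = 0 := by
        intro j; rw [← hJ, h]; rfl
      have h4 := b.sum_repr ⟨w, hw⟩
      have h5 := congrArg (fun y : S'ᗮ => (y : EuclideanSpace ℂ (Fin m))) h4
      simp only [Submodule.coe_sum, Submodule.coe_smul] at h5
      rw [← h5, sum_inner]
      refine Finset.sum_eq_zero fun j _ => ?_
      rw [inner_smul_left, h3, mul_zero]

theorem iso_compl {m k : ℕ} {c : Matrix (Fin m) (Fin k) ℂ} (hc : cᴴ * c = 1) :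
    ∃ n, k + n = m ∧ ∃ c2 : Matrix (Fin m) (Fin n) ℂ, c2ᴴ * c2 = 1 ∧ cᴴ * c2 = 0 ∧ c2ᴴ * c = 0 ∧
      c * cᴴ + c2 * c2ᴴ = 1 := by
  obtain ⟨n, J, hJ, hS⟩ := exists_ker_iso (LinearMap.range c.mulVecLin)
  have h1 : Jᴴ * c = 0 := by
    ext i j
    have := congrFun ((hS (c *ᵥ Pi.single j 1)).1 ⟨Pi.single j 1, rfl⟩) i
    rw [mulVec_mulVec] at this
    simpa using this
  have h2 : cᴴ * J = 0 := by
    have := congrArg conjTranspose h1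
    simpa [conjTranspose_mul] using this
  have h3 : c * cᴴ + J * Jᴴ = 1 := by
    apply Matrix.toLin'.injective
    apply LinearMap.ext
    intro x
    rw [toLin'_apply, toLin'_apply, one_mulVec, add_mulVec]
    obtain ⟨y, hy⟩ := (hS (x - (J * Jᴴ) *ᵥ x)).2 (by
      rw [mulVec_sub, mulVec_mulVec, ← Matrix.mul_assoc, hJ, Matrix.one_mul, sub_self])
    have hy' : c *ᵥ y = x - (J * Jᴴ) *ᵥ x := hy
    have h4 := congrArg (fun z => cᴴ *ᵥ z) hy'
    simp only [mulVec_mulVec, mulVec_sub] at h4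
    rw [hc, one_mulVec, ← Matrix.mul_assoc, h2, Matrix.zero_mul, zero_mulVec, sub_zero] at h4
    rw [← mulVec_mulVec, ← h4, hy']; abel
  refine ⟨n, ?_, J, hJ, h2, h1, h3⟩
  have h5 := congrArg Matrix.trace h3
  rw [trace_add, trace_mul_comm, hc, trace_mul_comm, hJ, trace_one, trace_one, trace_one] at h5
  simp only [Fintype.card_fin] at h5
  exact_mod_cast h5

theorem iso_nsq {m k : ℕ} {c : Matrix (Fin m) (Fin k) ℂ} (hc : cᴴ * c = 1) (x : Fin k → ℂ) :
    nsq (c *ᵥ x) = nsq x := by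
  have : ((nsq (c *ᵥ x) : ℝ) : ℂ) = nsq x := by
    rw [← nsq_coe, star_mulVec_dot, mulVec_mulVec, hc, one_mulVec, nsq_coe]
  exact_mod_cast this

theorem iso_nsq' {m k : ℕ} {c : Matrix (Fin m) (Fin k) ℂ} (hc : cᴴ * c = 1) (x : Fin m → ℂ) :
    nsq (cᴴ *ᵥ x) ≤ nsq x := conj_contr (fun y => (iso_nsq hc y).le) x

theorem mul_iso_mem {p' q' n : ℕ} {J : Matrix (Fin q') (Fin n) ℂ} (hJ : Jᴴ * J = 1)
    {W : Matrix (Fin p') (Fin q') ℂ} (hW : W ∈ typeIDomain p' q') : W * J ∈ typeIDomain p' n := by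
  rw [mem_dom] at *
  intro x hx
  have h1 := iso_nsq hJ x
  rw [← mulVec_mulVec, ← h1]
  apply hW
  intro h0
  rw [h0, nsq_zero] at h1
  exact hx (nsq_eq_zero.1 h1.symm)

theorem mul_isoH_mem {p' q' n : ℕ} {J : Matrix (Fin q') (Fin n) ℂ} (hJ : Jᴴ * J = 1)
    {W : Matrix (Fin p') (Fin n) ℂ} (hW : W ∈ typeIDomain p' n) : W * Jᴴ ∈ typeIDomain p' q' := by
  rw [mem_dom] at *
  intro x hx
  rw [← mulVec_mulVec]
  by_cases h0 : Jᴴ *ᵥ x = 0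
  · rw [h0, mulVec_zero, nsq_zero]; exact nsq_pos hx
  · exact (hW _ h0).trans_le (iso_nsq' hJ x)

theorem isoH_mul_mem {p' q' n : ℕ} {J : Matrix (Fin p') (Fin n) ℂ} (hJ : Jᴴ * J = 1)
    {W : Matrix (Fin p') (Fin q') ℂ} (hW : W ∈ typeIDomain p' q') : Jᴴ * W ∈ typeIDomain n q' := by
  rw [mem_dom] at *
  intro x hx
  rw [← mulVec_mulVec]
  exact (iso_nsq' hJ _).trans_lt (hW x hx)

theorem proper_red {p q p' q' n : ℕ} {f : Matrix (Fin p) (Fin q) ℂ → Matrix (Fin p') (Fin q') ℂ}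
    (hP : ProperOn f (typeIDomain p q) (typeIDomain p' q')) {J : Matrix (Fin q') (Fin n) ℂ} (hJ : Jᴴ * J = 1)
    (hfJ : ∀ Z ∈ typeIDomain p q, f Z = f Z * J * Jᴴ) :
    ProperOn (fun Z => f Z * J) (typeIDomain p q) (typeIDomain p' n) := by
  refine ⟨fun Z hZ => mul_iso_mem hJ (hP.1 hZ), fun K hK hKc => ?_⟩
  have hc : Continuous (fun W : Matrix (Fin p') (Fin n) ℂ => W * Jᴴ) := by
    exact continuous_id.matrix_mul continuous_const
  have h1 := hP.2 ((fun W : Matrix (Fin p') (Fin n) ℂ => W * Jᴴ) '' K) (by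
    rintro _ ⟨W, hW, rfl⟩
    exact mul_isoH_mem hJ (hK hW)) (hKc.image hc)
  have e : typeIDomain p q ∩ (fun Z => f Z * J) ⁻¹' K =
      typeIDomain p q ∩ f ⁻¹' ((fun W : Matrix (Fin p') (Fin n) ℂ => W * Jᴴ) '' K) := by
    ext Z
    constructor
    · rintro ⟨hZ, hk⟩
      exact ⟨hZ, f Z * J, hk, (hfJ Z hZ).symm⟩
    · rintro ⟨hZ, W, hW, hWe⟩
      refine ⟨hZ, ?_⟩
      show f Z * J ∈ K
      have hWe' : W * Jᴴ = f Z := hWe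
      rw [← hWe', Matrix.mul_assoc, hJ, Matrix.mul_one]
      exact hW
  rw [e]; exact h1

theorem JU.ext {p' q' n : ℕ} {a : Matrix (Fin p') (Fin p') ℂ} {b : Matrix (Fin p') (Fin n) ℂ}
    {c : Matrix (Fin n) (Fin p') ℂ} {d : Matrix (Fin n) (Fin n) ℂ} (h : JU a b c d)
    {J : Matrix (Fin q') (Fin n) ℂ} (hJ : Jᴴ * J = 1) :
    ∃ b' c' d', JU (p := p') (q := q') a b' c' d' ∧
      ∀ W ∈ typeIDomain p' n, mob a b' c' d' (W * Jᴴ) = mob a b c d W * Jᴴ := by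
  set P : Matrix (Fin q') (Fin q') ℂ := 1 - J * Jᴴ with hPdef
  have hPJ : P * J = 0 := by rw [hPdef, Matrix.sub_mul, Matrix.mul_assoc, hJ]; simp
  have hJP : Jᴴ * P = 0 := by rw [hPdef, Matrix.mul_sub, ← Matrix.mul_assoc, hJ]; simp
  have hPP : P * P = P := by
    have e : P * P = (1 - J * Jᴴ) * P := by rw [← hPdef]
    rw [e, Matrix.sub_mul, Matrix.mul_assoc, hJP, Matrix.mul_zero, Matrix.one_mul, sub_zero]
  have hPH : Pᴴ = P := by simp [hPdef, conjTranspose_sub, conjTranspose_mul]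
  have hju : JU a (b * Jᴴ) (J * c) (J * d * Jᴴ + P) := by
    apply JU.of_three
    · rw [conjTranspose_mul, Matrix.mul_assoc, ← Matrix.mul_assoc Jᴴ, hJ, Matrix.one_mul, h.h1]
    · have e1 : (J * d * Jᴴ + P)ᴴ = J * dᴴ * Jᴴ + P := by
        rw [conjTranspose_add, hPH, conjTranspose_mul, conjTranspose_mul, conjTranspose_conjTranspose, Matrix.mul_assoc]
      have e2 : (J * dᴴ * Jᴴ + P) * (J * d * Jᴴ + P) = J * (dᴴ * d) * Jᴴ + P := by
        rw [Matrix.add_mul, Matrix.mul_add, Matrix.mul_add, hPP]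
        have t1 : J * dᴴ * Jᴴ * P = 0 := by rw [Matrix.mul_assoc, hJP, Matrix.mul_zero]
        have t2 : P * (J * d * Jᴴ) = 0 := by
          rw [Matrix.mul_assoc, ← Matrix.mul_assoc, hPJ, Matrix.zero_mul]
        have t3 : J * dᴴ * Jᴴ * (J * d * Jᴴ) = J * (dᴴ * d) * Jᴴ := by
          calc J * dᴴ * Jᴴ * (J * d * Jᴴ) = J * dᴴ * (Jᴴ * J) * d * Jᴴ := by simp only [Matrix.mul_assoc]
            _ = _ := by rw [hJ]; simp only [Matrix.mul_assoc, Matrix.one_mul]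
        rw [t1, t2, t3]; abel
      rw [e1, e2, h.h2, hPdef]
      rw [conjTranspose_mul, conjTranspose_conjTranspose, Matrix.mul_add, Matrix.add_mul, Matrix.mul_one]
      simp only [Matrix.mul_assoc]
      abel
    · rw [Matrix.mul_add, conjTranspose_mul, ← Matrix.mul_assoc, h.h3]
      have t1 : cᴴ * Jᴴ * P = 0 := by rw [Matrix.mul_assoc, hJP, Matrix.mul_zero]
      rw [t1, add_zero]
      calc cᴴ * d * Jᴴ = cᴴ * (1 : Matrix (Fin n) (Fin n) ℂ) * d * Jᴴ := by rw [Matrix.mul_one]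
        _ = _ := by rw [← hJ]; simp only [Matrix.mul_assoc]
  refine ⟨_, _, _, hju, fun W hW => ?_⟩
  have hu := isUnit_iff_ne_zero.2 (hju.det (mul_isoH_mem hJ hW))
  rw [mob]
  have e : a * (W * Jᴴ) + b * Jᴴ = mob a b c d W * Jᴴ * (J * c * (W * Jᴴ) + (J * d * Jᴴ + P)) := by
    have t1 : mob a b c d W * Jᴴ * P = 0 := by rw [Matrix.mul_assoc, hJP, Matrix.mul_zero]
    have t2 : J * c * (W * Jᴴ) + J * d * Jᴴ = J * ((c * W + d) * Jᴴ) := by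
      rw [Matrix.add_mul, Matrix.mul_add]; simp only [Matrix.mul_assoc]
    rw [← add_assoc, Matrix.mul_add, t1, add_zero, t2]
    calc a * (W * Jᴴ) + b * Jᴴ = (a * W + b) * Jᴴ := by rw [Matrix.add_mul, Matrix.mul_assoc]
      _ = mob a b c d W * (Jᴴ * J) * (c * W + d) * Jᴴ := by rw [hJ, Matrix.mul_one, h.mul_den hW]
      _ = _ := by simp only [Matrix.mul_assoc]
  rw [e, Matrix.mul_assoc, Matrix.mul_nonsing_inv _ hu, Matrix.mul_one]

end P23


section P24
variable {p q n : ℕ} {β : Matrix (Fin p) (Fin q) ℂ → Matrix (Fin p) (Fin n) ℂ}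

theorem nsq_coord (x : Fin n → ℂ) (j : Fin n) : ‖x j‖ ^ 2 ≤ nsq x :=
  Finset.single_le_sum (f := fun i => ‖x i‖ ^ 2) (fun _ _ => by positivity) (Finset.mem_univ j)

theorem star_vecMul_eq {m : ℕ} (A : Matrix (Fin m) (Fin n) ℂ) (u : Fin m → ℂ) : star u ᵥ* A = star (Aᴴ *ᵥ u) := by
  rw [star_mulVec, conjTranspose_conjTranspose]

theorem beta_a (hβ : DifferentiableOn ℂ β (typeIDomain p q))
    (hb : ∀ Z ∈ typeIDomain p q, ∀ x, nsq (Zᴴ *ᵥ x) + nsq ((β Z)ᴴ *ᵥ x) ≤ nsq x)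
    {u : Fin p → ℂ} {v : Fin q → ℂ} (hu : nsq u = 1) (hv : nsq v = 1)
    {W : Matrix (Fin p) (Fin q) ℂ} (hW : W ∈ typeIDomain p q)
    (h1 : W *ᵥ v = 0) (h2 : star u ᵥ* W = 0) {z : ℂ} (hz : ‖z‖ < 1) :
    star u ᵥ* β (rk u v z + W) = 0 := by
  have hW' : Wᴴ *ᵥ u = 0 := by
    have := congrArg star h2
    rw [star_vecMul_eq, star_star] at this
    simpa using this
  have hn : ∀ z : ℂ, nsq ((rk u v z + W)ᴴ *ᵥ u) = ‖z‖ ^ 2 := by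
    intro z
    have e : (rk u v z + W)ᴴ *ᵥ u = star z • v := by
      rw [conjTranspose_add, add_mulVec, hW', add_zero, rk, conjTranspose_smul, conjTranspose_vecMulVec, star_star,
        smul_mulVec, vecMulVec_mulVec, op_smul_eq_smul, nsq_coe, hu]
      simp
    rw [e, nsq_smul, hv]; simp
  funext j
  have key := disc0 (g := fun z => (star u ᵥ* β (rk u v z + W)) j) ?_ ?_ z hz
  · exact key
  · intro z hz
    have hz' : ‖z‖ < 1 := by simpa using hz
    have hm := rk_add_mem hu hv hz' hW h1 h2
    have hd : DifferentiableAt ℂ (fun z : ℂ => β (rk u v z + W)) z := by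
      have h3 : DifferentiableAt ℂ β (rk u v z + W) := (hβ _ hm).differentiableAt (dom_open.mem_nhds hm)
      exact DifferentiableAt.comp z h3 (rk_diff u v W z)
    have hd' := mdiff_iff.1 hd
    refine DifferentiableAt.differentiableWithinAt ?_
    simp only [vecMul, dotProduct]
    exact DifferentiableAt.fun_sum fun i _ => (hd' i j).const_mul _
  · intro z hz hlim
    refine ⟨id, strictMono_id, ?_⟩
    have hbd : ∀ k, ‖(star u ᵥ* β (rk u v (z k) + W)) j‖ ≤ Real.sqrt (1 - ‖z k‖ ^ 2) := by
      intro k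
      apply Real.le_sqrt_of_sq_le
      refine (nsq_coord _ j).trans ?_
      have := hb _ (rk_add_mem hu hv (hz k) hW h1 h2) u
      rw [hn, hu] at this
      rw [star_vecMul_eq, nsq_star]
      linarith
    have hl : Tendsto (fun k => Real.sqrt (1 - ‖z k‖ ^ 2)) atTop (𝓝 0) := by
      have := ((hlim.pow 2).const_sub 1).sqrt
      simpa using this
    exact squeeze_zero_norm hbd hl

theorem beta_b (hβ : DifferentiableOn ℂ β (typeIDomain p q))
    (hb : ∀ Z ∈ typeIDomain p q, ∀ x, nsq (Zᴴ *ᵥ x) + nsq ((β Z)ᴴ *ᵥ x) ≤ nsq x)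
    {Z : Matrix (Fin p) (Fin q) ℂ} (hZ : Z ∈ typeIDomain p q) : Zᴴ * β Z = 0 := by
  have hM : (Zᴴ * Z).IsHermitian := isHermitian_conjTranspose_mul_self Z
  set U : Matrix (Fin q) (Fin q) ℂ := hM.eigenvectorUnitary.1 with hU
  have hUU : Uᴴ * U = 1 := Unitary.star_mul_self_of_mem hM.eigenvectorUnitary.2
  have hUU' : U * Uᴴ = 1 := mul_eq_one_comm.1 hUU
  obtain ⟨lam, hs⟩ : ∃ lam : Fin q → ℝ, Zᴴ * Z = U * diagonal (fun i => (lam i : ℂ)) * Uᴴ := by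
    have := hM.spectral_theorem
    rw [Unitary.conjStarAlgAut_apply] at this
    exact ⟨_, this⟩
  have key : ∀ i, star (Z *ᵥ (U *ᵥ Pi.single i 1)) ᵥ* β Z = 0 := by
    intro i
    set v : Fin q → ℂ := U *ᵥ Pi.single i 1 with hv
    have hv1 : nsq v = 1 := by
      rw [hv, iso_nsq hUU]
      have := nsq_coe (Pi.single i 1 : Fin q → ℂ)
      have h2 : star (Pi.single i 1 : Fin q → ℂ) ⬝ᵥ Pi.single i 1 = 1 := by simp
      rw [h2] at this
      exact_mod_cast this.symm
    have hev : Zᴴ *ᵥ (Z *ᵥ v) = (lam i : ℂ) • v := by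
      have e : Uᴴ *ᵥ v = Pi.single i 1 := by rw [hv, mulVec_mulVec, hUU, one_mulVec]
      rw [mulVec_mulVec, hs, ← mulVec_mulVec, e, ← mulVec_mulVec, hv, ← mulVec_smul]
      congr 1
      rw [diagonal_mulVec_single]
      ext k; simp [Pi.single_apply]
    by_cases h0 : Z *ᵥ v = 0
    · rw [h0]; simp
    obtain ⟨s, hs0, hs2, hsu⟩ := exists_unit h0
    have hlam : (lam i : ℂ) = (s : ℂ) ^ 2 := by
      have h3 := nsq_coe (Z *ᵥ v)
      rw [star_mulVec_dot, hev, dotProduct_smul, nsq_coe, hv1, ← hs2] at h3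
      simpa using h3
    set u := ((s⁻¹ : ℝ) : ℂ) • (Z *ᵥ v) with hu
    have hsC : (s : ℂ) ≠ 0 := by exact_mod_cast hs0.ne'
    have hZv : Z *ᵥ v = (s : ℂ) • u := by
      rw [hu, smul_smul]; push_cast; rw [mul_inv_cancel₀ hsC, one_smul]
    have hZu : Zᴴ *ᵥ u = (s : ℂ) • v := by
      rw [hu, mulVec_smul, hev, smul_smul, hlam]; push_cast; congr 1; field_simp
    set W := Z - rk u v s with hWd
    have hvv : star v ⬝ᵥ v = 1 := by rw [nsq_coe, hv1]; simp
    have h1 : W *ᵥ v = 0 := by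
      rw [hWd, sub_mulVec, rk_mulVec, hZv, hvv]; simp
    have h2 : star u ᵥ* W = 0 := by
      rw [star_vecMul_eq, hWd, conjTranspose_sub, sub_mulVec, hZu, rk, conjTranspose_smul, conjTranspose_vecMulVec,
        star_star, smul_mulVec, vecMulVec_mulVec, op_smul_eq_smul, nsq_coe, hsu]
      simp
    have hWx : ∀ x, W *ᵥ x = Z *ᵥ (x - (star v ⬝ᵥ x) • v) := by
      intro x
      rw [hWd, sub_mulVec, rk_mulVec, mulVec_sub, mulVec_smul, hZv, smul_smul (star v ⬝ᵥ x) (s : ℂ) u, mul_comm]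
    have hWm : W ∈ typeIDomain p q := by
      rw [mem_dom]
      intro x hx
      rw [hWx]
      have hle : nsq (x - (star v ⬝ᵥ x) • v) ≤ nsq x := by
        have e : nsq x = nsq ((star v ⬝ᵥ x) • v + (x - (star v ⬝ᵥ x) • v)) := by congr 1; abel
        rw [e, nsq_orth]
        · linarith [nsq_nonneg ((star v ⬝ᵥ x) • v)]
        · rw [star_smul, smul_dotProduct, dotProduct_sub, dotProduct_smul, hvv]; simp
      by_cases hx' : x - (star v ⬝ᵥ x) • v = 0
      · rw [hx']; simpa using nsq_pos hx
      · exact (mem_dom.1 hZ _ hx').trans_le hle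
    have hs1 : s < 1 := by
      have hvne : v ≠ 0 := by rintro h; rw [h] at hv1; simp at hv1
      have := mem_dom.1 hZ v hvne
      rw [← hs2, hv1] at this
      nlinarith
    have := beta_a hβ hb hsu hv1 hWm h1 h2 (z := (s : ℂ)) (by
      rw [Complex.norm_real, Real.norm_eq_abs, abs_of_pos hs0]; exact hs1)
    have e : rk u v s + W = Z := by rw [hWd]; abel
    rw [e] at this
    rw [hZv, star_smul, smul_vecMul, this, smul_zero]
  have hfin : (β Z)ᴴ * (Z * U) = 0 := by
    ext a i
    have h3 := key i
    rw [star_vecMul_eq, star_eq_zero] at h3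
    rw [mulVec_mulVec, mulVec_mulVec] at h3
    have := congrFun h3 a
    simpa [Matrix.mul_assoc] using this
  have h4 : (β Z)ᴴ * Z = 0 := by
    have := congrArg (· * Uᴴ) hfin
    simpa [Matrix.mul_assoc, hUU'] using this
  have := congrArg conjTranspose h4
  simpa [conjTranspose_mul] using this

theorem beta_zero (hq : 0 < q) (hβ : DifferentiableOn ℂ β (typeIDomain p q))
    (hb : ∀ Z ∈ typeIDomain p q, ∀ x, nsq (Zᴴ *ᵥ x) + nsq ((β Z)ᴴ *ᵥ x) ≤ nsq x)
    {Z : Matrix (Fin p) (Fin q) ℂ} (hZ : Z ∈ typeIDomain p q) : β Z = 0 := by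
  have key : ∀ W : Matrix (Fin p) (Fin q) ℂ, Wᴴ * β Z = 0 := by
    intro W
    have hc : Continuous (fun t : ℂ => Z + t • W) := by fun_prop
    have hopen : IsOpen ((fun t : ℂ => Z + t • W) ⁻¹' typeIDomain p q) := dom_open.preimage hc
    have h0 : (0 : ℂ) ∈ (fun t : ℂ => Z + t • W) ⁻¹' typeIDomain p q := by
      show Z + (0 : ℂ) • W ∈ typeIDomain p q
      rw [zero_smul, add_zero]; exact hZ
    obtain ⟨ε, hε, hball⟩ := Metric.isOpen_iff.1 hopen 0 h0
    set r := ε / 2 with hr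
    have hr0 : 0 < r := by positivity
    have hcl : Metric.closedBall (0 : ℂ) r ⊆ (fun t : ℂ => Z + t • W) ⁻¹' typeIDomain p q :=
      (Metric.closedBall_subset_ball (by rw [hr]; linarith)).trans hball
    have hd : ∀ t ∈ Metric.closedBall (0 : ℂ) r, DifferentiableAt ℂ (fun t : ℂ => β (Z + t • W)) t := by
      intro t ht
      have hm : Z + t • W ∈ typeIDomain p q := hcl ht
      have h3 : DifferentiableAt ℂ β (Z + t • W) := (hβ _ hm).differentiableAt (dom_open.mem_nhds hm)
      have h4 : DifferentiableAt ℂ (fun t : ℂ => Z + t • W) t := by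
        exact (DifferentiableAt.fun_smul differentiableAt_id (differentiableAt_const W)).const_add Z
      exact DifferentiableAt.comp t h3 h4
    ext i j
    have hH : ∀ (A : Matrix (Fin q) (Fin p) ℂ), ∀ t ∈ Metric.closedBall (0 : ℂ) r,
        DifferentiableAt ℂ (fun t : ℂ => (A * β (Z + t • W)) i j) t := by
      intro A t ht
      exact mdiff_iff.1 (mdiff_mul (differentiableAt_const A) (hd t ht)) i j
    have hdiff : ∀ t ∈ Metric.closedBall (0 : ℂ) r, DifferentiableAt ℂ
        (fun t : ℂ => t * (Zᴴ * β (Z + t • W)) i j + (r : ℂ) ^ 2 * (Wᴴ * β (Z + t • W)) i j) t := by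
      intro t ht
      exact (differentiableAt_id.mul (hH _ t ht)).add ((hH _ t ht).const_mul _)
    have hcb : closure (Metric.ball (0 : ℂ) r) = Metric.closedBall 0 r := closure_ball _ hr0.ne'
    have hDC : DiffContOnCl ℂ
        (fun t : ℂ => t * (Zᴴ * β (Z + t • W)) i j + (r : ℂ) ^ 2 * (Wᴴ * β (Z + t • W)) i j) (Metric.ball 0 r) := by
      refine DifferentiableOn.diffContOnCl ?_
      rw [hcb]
      exact fun t ht => (hdiff t ht).differentiableWithinAt
    have := Complex.eqOn_closure_of_eqOn_frontier (Metric.isBounded_ball (x := (0 : ℂ)) (r := r)) hDC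
      (diffContOnCl_const (c := (0 : ℂ))) (by
        rw [frontier_ball _ hr0.ne']
        intro t ht
        have hn : ‖t‖ = r := by simpa using ht
        have hm : Z + t • W ∈ typeIDomain p q := hcl (Metric.sphere_subset_closedBall ht)
        have hbb := congrFun (congrFun (beta_b hβ hb hm) i) j
        rw [conjTranspose_add, conjTranspose_smul, Matrix.add_mul, Matrix.smul_mul] at hbb
        have hbb' : (Zᴴ * β (Z + t • W)) i j + star t * (Wᴴ * β (Z + t • W)) i j = 0 := hbb
        have ht2 : t * star t = (r : ℂ) ^ 2 := by
          rw [← hn]; exact Complex.mul_conj' t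
        show t * (Zᴴ * β (Z + t • W)) i j + (r : ℂ) ^ 2 * (Wᴴ * β (Z + t • W)) i j = 0
        rw [← ht2]
        linear_combination t * hbb') (subset_closure (Metric.mem_ball_self hr0))
    have h5 : (0 : ℂ) * (Zᴴ * β (Z + (0 : ℂ) • W)) i j + (r : ℂ) ^ 2 * (Wᴴ * β (Z + (0 : ℂ) • W)) i j = 0 := this
    rw [zero_mul, zero_add, zero_smul, add_zero] at h5
    have hrC : (r : ℂ) ^ 2 ≠ 0 := by
      have : (r : ℂ) ≠ 0 := by exact_mod_cast hr0.ne'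
      exact pow_ne_zero 2 this
    exact (mul_eq_zero.1 h5).resolve_left hrC
  ext i j
  have := congrFun (congrFun (key (Matrix.single i ⟨0, hq⟩ 1)) ⟨0, hq⟩) j
  simpa [conjTranspose_single] using this

end P24


section P25

theorem colU {p m p' : ℕ} (hp : p + m = p') {c1 : Matrix (Fin p') (Fin p) ℂ} {c2 : Matrix (Fin p') (Fin m) ℂ}
    (h1 : c1ᴴ * c1 = 1) (h2 : c2ᴴ * c2 = 1) (h12 : c1ᴴ * c2 = 0) (h21 : c2ᴴ * c1 = 0) :
    ((fromCols c1 c2).submatrix id (finSumFinEquiv.trans (finCongr hp)).symm)ᴴ *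
      (fromCols c1 c2).submatrix id (finSumFinEquiv.trans (finCongr hp)).symm = 1 := by
  rw [conjTranspose_submatrix]
  rw [← Matrix.submatrix_mul _ _ _ id _ Function.bijective_id]
  rw [conjTranspose_fromCols_eq_fromRows_conjTranspose, fromRows_mul_fromCols, h1, h2, h12, h21, fromBlocks_one, submatrix_one_equiv]

theorem diag_mul {p q m n p' q' : ℕ} (hp : p + m = p') (hq : q + n = q')
    (c1 : Matrix (Fin p') (Fin p) ℂ) (c2 : Matrix (Fin p') (Fin m) ℂ)
    (k1 : Matrix (Fin q') (Fin q) ℂ) (k2 : Matrix (Fin q') (Fin n) ℂ) (Z : Matrix (Fin p) (Fin q) ℂ)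
    (W : Matrix (Fin m) (Fin n) ℂ) :
    (fromCols c1 c2).submatrix id (finSumFinEquiv.trans (finCongr hp)).symm * diagBlock hp hq Z W *
      ((fromCols k1 k2).submatrix id (finSumFinEquiv.trans (finCongr hq)).symm)ᴴ = c1 * Z * k1ᴴ + c2 * W * k2ᴴ := by
  have e : diagBlock hp hq Z W = (fromBlocks Z 0 0 W).submatrix (finSumFinEquiv.trans (finCongr hp)).symm
    (finSumFinEquiv.trans (finCongr hq)).symm := rfl
  rw [e, conjTranspose_submatrix, submatrix_mul_equiv, submatrix_mul_equiv, submatrix_id_id,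
    conjTranspose_fromCols_eq_fromRows_conjTranspose, fromCols_mul_fromBlocks, fromCols_mul_fromRows]
  simp

theorem block_thm {p q p' q' : ℕ} (hq : 0 < q) {G : Matrix (Fin p) (Fin q) ℂ → Matrix (Fin p') (Fin q') ℂ}
    (hG : DifferentiableOn ℂ G (typeIDomain p q)) (hm : Set.MapsTo G (typeIDomain p q) (typeIDomain p' q'))
    {κ : Matrix (Fin q') (Fin q) ℂ} {c1 : Matrix (Fin p') (Fin p) ℂ} (hκ : κᴴ * κ = 1) (hc1 : c1ᴴ * c1 = 1)
    (hGκ : ∀ Z ∈ typeIDomain p q, G Z * κ = c1 * Z) :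
    ∃ (hpp : p + (p' - p) = p') (hqq : q + (q' - q) = q')
      (U : Matrix (Fin p') (Fin q') ℂ → Matrix (Fin p') (Fin q') ℂ)
      (h : Matrix (Fin p) (Fin q) ℂ → Matrix (Fin (p' - p)) (Fin (q' - q)) ℂ),
      IsAutOf U ∧ DifferentiableOn ℂ h (typeIDomain p q) ∧
      Set.MapsTo h (typeIDomain p q) (typeIDomain (p' - p) (q' - q)) ∧
      ∀ Z ∈ typeIDomain p q, G Z = U (diagBlock hpp hqq Z (h Z)) := by
  obtain ⟨m, hpm, c2, hc2, hc12, hc21, hcc⟩ := iso_compl hc1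
  obtain ⟨n, hqn, κ2, hκ2, hκ12, hκ21, hκκ⟩ := iso_compl hκ
  obtain rfl : m = p' - p := by omega
  obtain rfl : n = q' - q := by omega
  have hGd : ∀ Z ∈ typeIDomain p q, DifferentiableAt ℂ G Z := fun Z hZ =>
    (hG Z hZ).differentiableAt (dom_open.mem_nhds hZ)
  have hβd : DifferentiableOn ℂ (fun Z => c1ᴴ * G Z * κ2) (typeIDomain p q) := fun Z hZ =>
    (mdiff_mul (mdiff_mul (differentiableAt_const _) (hGd Z hZ)) (differentiableAt_const _)).differentiableWithinAt
  have hhd : DifferentiableOn ℂ (fun Z => c2ᴴ * G Z * κ2) (typeIDomain p q) := fun Z hZ =>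
    (mdiff_mul (mdiff_mul (differentiableAt_const _) (hGd Z hZ)) (differentiableAt_const _)).differentiableWithinAt
  have hb : ∀ Z ∈ typeIDomain p q, ∀ x, nsq (Zᴴ *ᵥ x) + nsq ((c1ᴴ * G Z * κ2)ᴴ *ᵥ x) ≤ nsq x := by
    intro Z hZ x
    obtain ⟨y, hy⟩ : ∃ y, y = (G Z)ᴴ *ᵥ (c1 *ᵥ x) := ⟨_, rfl⟩
    have h1 : nsq y ≤ nsq x := by
      rw [hy, ← iso_nsq hc1 x]
      exact conj_contr (dom_le (hm hZ)) _
    have h2 : κᴴ *ᵥ y = Zᴴ *ᵥ x := by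
      have e := congrArg conjTranspose (hGκ Z hZ)
      rw [conjTranspose_mul, conjTranspose_mul] at e
      rw [hy, mulVec_mulVec, mulVec_mulVec, e, Matrix.mul_assoc, hc1, Matrix.mul_one]
    have h3 : κ2ᴴ *ᵥ y = (c1ᴴ * G Z * κ2)ᴴ *ᵥ x := by
      rw [hy, mulVec_mulVec, mulVec_mulVec, conjTranspose_mul, conjTranspose_mul, conjTranspose_conjTranspose,
        Matrix.mul_assoc]
    have h4 : y = κ *ᵥ (κᴴ *ᵥ y) + κ2 *ᵥ (κ2ᴴ *ᵥ y) := by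
      rw [mulVec_mulVec, mulVec_mulVec, ← add_mulVec, hκκ, one_mulVec]
    have h5 : nsq y = nsq (κᴴ *ᵥ y) + nsq (κ2ᴴ *ᵥ y) := by
      conv_lhs => rw [h4]
      rw [nsq_orth, iso_nsq hκ, iso_nsq hκ2]
      rw [star_mulVec_dot, mulVec_mulVec, hκ12, zero_mulVec, dotProduct_zero]
    rw [← h2, ← h3, ← h5]
    exact h1
  have hβ0 : ∀ Z ∈ typeIDomain p q, c1ᴴ * G Z * κ2 = 0 := fun Z hZ =>
    beta_zero (β := fun Z => c1ᴴ * G Z * κ2) hq hβd hb hZ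
  have hdec : ∀ Z ∈ typeIDomain p q, G Z = c1 * Z * κᴴ + c2 * (c2ᴴ * G Z * κ2) * κ2ᴴ := by
    intro Z hZ
    have e1 : G Z * κ2 = c2 * (c2ᴴ * G Z * κ2) := by
      calc G Z * κ2 = (c1 * c1ᴴ + c2 * c2ᴴ) * (G Z * κ2) := by rw [hcc, Matrix.one_mul]
        _ = c1 * (c1ᴴ * G Z * κ2) + c2 * (c2ᴴ * G Z * κ2) := by
          rw [Matrix.add_mul]; simp only [Matrix.mul_assoc]
        _ = _ := by rw [hβ0 Z hZ, Matrix.mul_zero, zero_add]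
    calc G Z = G Z * (κ * κᴴ + κ2 * κ2ᴴ) := by rw [hκκ, Matrix.mul_one]
      _ = (G Z * κ) * κᴴ + (G Z * κ2) * κ2ᴴ := by rw [Matrix.mul_add]; simp only [Matrix.mul_assoc]
      _ = _ := by rw [hGκ Z hZ, ← e1]
  set C := (fromCols c1 c2).submatrix id (finSumFinEquiv.trans (finCongr hpm)).symm with hC
  set V := (fromCols κ κ2).submatrix id (finSumFinEquiv.trans (finCongr hqn)).symm with hV
  have hCC : Cᴴ * C = 1 := colU hpm hc1 hc2 hc12 hc21
  have hVV : Vᴴ * V = 1 := colU hqn hκ hκ2 hκ12 hκ21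
  have hju : JU C 0 0 V := by
    apply JU.of_three
    · rw [hCC]; simp
    · rw [hVV]; simp
    · simp
  have hVinv : V⁻¹ = Vᴴ := Matrix.inv_eq_left_inv hVV
  refine ⟨hpm, hqn, mob C 0 0 V, fun Z => c2ᴴ * G Z * κ2, hju.aut, hhd, ?_, ?_⟩
  · intro Z hZ
    exact mul_iso_mem hκ2 (isoH_mul_mem hc2 (hm hZ))
  · intro Z hZ
    rw [mob, add_zero, Matrix.zero_mul, zero_add, hVinv, hC, hV, diag_mul]
    exact hdec Z hZ

theorem main_thm (p q p' q' : ℕ) (h0p : 0 < p) (h2q : 2 ≤ q) (hq' : q' < min (2 * q - 1) p)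
    (f : Matrix (Fin p) (Fin q) ℂ → Matrix (Fin p') (Fin q') ℂ)
    (hf : DifferentiableOn ℂ f (typeIDomain p q))
    (hfp : ProperOn f (typeIDomain p q) (typeIDomain p' q')) :
    ∃ (hpp : p + (p' - p) = p') (hqq : q + (q' - q) = q')
      (Φ : Matrix (Fin p') (Fin q') ℂ → Matrix (Fin p') (Fin q') ℂ)
      (ψ : Matrix (Fin p) (Fin q) ℂ → Matrix (Fin p) (Fin q) ℂ)
      (h : Matrix (Fin p) (Fin q) ℂ → Matrix (Fin (p' - p)) (Fin (q' - q)) ℂ),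
      IsAutOf Φ ∧ IsAutOf ψ ∧ DifferentiableOn ℂ h (typeIDomain p q) ∧
      Set.MapsTo h (typeIDomain p q) (typeIDomain (p' - p) (q' - q)) ∧
      ∀ Z ∈ typeIDomain p q, f Z = Φ (diagBlock hpp hqq (ψ Z) (h (ψ Z))) := by
  have h0 : (0 : Matrix (Fin p) (Fin q) ℂ) ∈ typeIDomain p q := zero_mem_dom
  obtain ⟨a0, b0, c0, d0, hJ0, hJe⟩ := JU.exists_of_mem (hfp.1 h0)
  obtain ⟨Φ1, hΦ1, hΦ1l, hΦ1r⟩ := hJ0.aut.symm'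
  have hf1 : ProperOn (Φ1 ∘ f) (typeIDomain p q) (typeIDomain p' q') := proper_left hΦ1 hfp
  have hd1 : DifferentiableOn ℂ (Φ1 ∘ f) (typeIDomain p q) := hΦ1.2.1.comp hf hfp.1
  have hf10 : Φ1 (f 0) = 0 := by rw [← hJe]; exact hΦ1l 0 zero_mem_dom
  let S : Submodule ℂ (Fin q' → ℂ) :=
    { carrier := {k | ∀ Z ∈ typeIDomain p q, Φ1 (f Z) *ᵥ k = 0}
      add_mem' := fun {x y} hx hy Z hZ => by rw [mulVec_add, hx Z hZ, hy Z hZ, add_zero]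
      zero_mem' := fun Z _ => mulVec_zero _
      smul_mem' := fun c x hx Z hZ => by rw [mulVec_smul, hx Z hZ, smul_zero] }
  have hSm : ∀ k, k ∈ S ↔ ∀ Z ∈ typeIDomain p q, Φ1 (f Z) *ᵥ k = 0 := fun k => Iff.rfl
  obtain ⟨n, J, hJ, hJS⟩ := exists_ker_iso S
  obtain ⟨n', hnn, -⟩ := iso_compl hJ
  have hfJ : ∀ Z ∈ typeIDomain p q, (Φ1 ∘ f) Z = (Φ1 ∘ f) Z * J * Jᴴ := by
    intro Z hZ
    refine Matrix.ext_of_mulVec_single fun i => ?_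
    have hx : Pi.single i 1 - J *ᵥ (Jᴴ *ᵥ Pi.single i 1) ∈ S := by
      rw [hJS, mulVec_sub, mulVec_mulVec, hJ, one_mulVec, sub_self]
    have := (hSm _).1 hx Z hZ
    rw [mulVec_sub, sub_eq_zero] at this
    show Φ1 (f Z) *ᵥ _ = (Φ1 (f Z) * J * Jᴴ) *ᵥ _
    rw [this, mulVec_mulVec, mulVec_mulVec, Matrix.mul_assoc]
  have hf2 := proper_red hf1 hJ hfJ
  have hd2 : DifferentiableOn ℂ (fun Z => (Φ1 ∘ f) Z * J) (typeIDomain p q) := fun Z hZ =>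
    (mdiff_mul ((hd1 Z hZ).differentiableAt (dom_open.mem_nhds hZ)) (differentiableAt_const _)).differentiableWithinAt
  have hK : ∀ k, (∀ Z ∈ typeIDomain p q, ∀ Z' ∈ typeIDomain p q,
      (fun Z => (Φ1 ∘ f) Z * J) Z *ᵥ k = (fun Z => (Φ1 ∘ f) Z * J) Z' *ᵥ k) → k = 0 := by
    intro k hk
    have hx : J *ᵥ k ∈ S := by
      rw [hSm]
      intro Z hZ
      have e : (Φ1 (f Z) * J) *ᵥ k = (Φ1 (f 0) * J) *ᵥ k := hk Z hZ 0 h0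
      rw [mulVec_mulVec, e, hf10, Matrix.zero_mul, zero_mulVec]
    rw [hJS, mulVec_mulVec, hJ, one_mulVec] at hx
    exact hx
  obtain ⟨a, b, c, d, A, B, C, E, κ1, c1, hab, hAB, hκ, hc, hn⟩ :=
    norm_thm hd2 hf2 h0p h2q (by omega) (by omega) hK
  obtain ⟨B', C', E', hext, hexte⟩ := hAB.ext hJ
  have hψ0 := hab.aut
  set ψ0 := mob a b c d with hψ0d
  set Φ2 := mob A B' C' E' with hΦ2d
  have hΦ2 : IsAutOf Φ2 := hext.aut
  have hGeq : ∀ Z ∈ typeIDomain p q, (Φ2 ∘ Φ1 ∘ f ∘ ψ0) Z =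
      mob A B C E ((Φ1 ∘ f) (ψ0 Z) * J) * Jᴴ := by
    intro Z hZ
    have hz := hψ0.1 hZ
    rw [← hexte _ (hf2.1 hz)]
    show Φ2 ((Φ1 ∘ f) (ψ0 Z)) = _
    rw [← hfJ _ hz]
  have hΦ21 : IsAutOf (Φ2 ∘ Φ1) := hΦ2.comp hΦ1
  have hGP : ProperOn ((Φ2 ∘ Φ1) ∘ (f ∘ ψ0)) (typeIDomain p q) (typeIDomain p' q') :=
    proper_left hΦ21 (proper_right hψ0 hfp)
  have hGD : DifferentiableOn ℂ ((Φ2 ∘ Φ1) ∘ (f ∘ ψ0)) (typeIDomain p q) :=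
    hΦ21.2.1.comp (hf.comp hψ0.2.1 hψ0.1) (hfp.1.comp hψ0.1)
  have hJκ : (J * κ1)ᴴ * (J * κ1) = 1 := by
    rw [conjTranspose_mul, Matrix.mul_assoc, ← Matrix.mul_assoc Jᴴ, hJ, Matrix.one_mul, hκ]
  obtain ⟨hpp, hqq, U, h, hU, hhd, hhm, hfin⟩ := block_thm (by omega) hGD hGP.1 hJκ hc (by
    intro Z hZ
    have e := hGeq Z hZ
    have e' : ((Φ2 ∘ Φ1) ∘ (f ∘ ψ0)) Z = (Φ2 ∘ Φ1 ∘ f ∘ ψ0) Z := rfl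
    rw [e', e, Matrix.mul_assoc, ← Matrix.mul_assoc Jᴴ, hJ, Matrix.one_mul]
    exact hn Z hZ)
  obtain ⟨Ψ21, hΨ, hΨl, hΨr⟩ := hΦ21.symm'
  obtain ⟨ψ, hψ, hψl, hψr⟩ := hψ0.symm'
  refine ⟨hpp, hqq, Ψ21 ∘ U, ψ, h, hΨ.comp hU, hψ, hhd, hhm, fun Z hZ => ?_⟩
  have e := hfin (ψ Z) (hψ.1 hZ)
  show f Z = Ψ21 (U _)
  rw [← e]
  show f Z = Ψ21 ((Φ2 ∘ Φ1) (f (ψ0 (ψ Z))))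
  rw [hψr Z hZ, hΨl _ (hfp.1 hZ)]

end P25

/-- **Main Theorem.** A proper holomorphic map `f : D^I_{p,q} → D^I_{p',q'}` with
`p ≥ q ≥ 2` and `q' < min {2q-1, p}` satisfies `p' ≥ p`, `q' ≥ q`, and is of diagonal type:
`f = Φ ∘ G_h ∘ ψ` on `D^I_{p,q}` for automorphisms `Φ`, `ψ` and a holomorphic
`h : D^I_{p,q} → D^I_{p'-p,q'-q}`. -/
theorem stmt_0 (p q p' q' : ℕ) (h0p : 0 < p) (h0q : 0 < q) (h0p' : 0 < p') (h0q' : 0 < q')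
    (hqp : q ≤ p) (h2q : 2 ≤ q) (hq' : q' < min (2 * q - 1) p)
    (f : Matrix (Fin p) (Fin q) ℂ → Matrix (Fin p') (Fin q') ℂ)
    (hf : DifferentiableOn ℂ f (typeIDomain p q))
    (hfp : ProperOn f (typeIDomain p q) (typeIDomain p' q')) :
    p ≤ p' ∧ q ≤ q' ∧
    ∃ (hpp : p + (p' - p) = p') (hqq : q + (q' - q) = q')
      (Φ : Matrix (Fin p') (Fin q') ℂ → Matrix (Fin p') (Fin q') ℂ)
      (ψ : Matrix (Fin p) (Fin q) ℂ → Matrix (Fin p) (Fin q) ℂ)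
      (h : Matrix (Fin p) (Fin q) ℂ → Matrix (Fin (p' - p)) (Fin (q' - q)) ℂ),
      IsAutOf Φ ∧ IsAutOf ψ ∧
      DifferentiableOn ℂ h (typeIDomain p q) ∧
      Set.MapsTo h (typeIDomain p q) (typeIDomain (p' - p) (q' - q)) ∧
      ∀ Z ∈ typeIDomain p q, f Z = Φ (diagBlock hpp hqq (ψ Z) (h (ψ Z))) := by
  obtain ⟨hpp, hqq, h⟩ := main_thm p q p' q' h0p h2q hq' f hf hfp
  exact ⟨by omega, by omega, hpp, hqq, h⟩
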